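/- Let n ≥ 5 and Ā = A[B_n]/Z(A[B_n]). Then Ā is Hopfian and co-Hopfian: every surjective group endomorphism of Ā is injective, and every injective group endomorphism of Ā is surjective. -/

import Mathlib

/-- The defining relators of the Artin group of type `Bₙ`, as elements of the free
group on `n` generators (0-indexed: generator `i` corresponds to `r_{i+1}`). -/
def BnRels (n : ℕ) : Set (FreeGroup (Fin n)) :=
  {w | (∃ i j : Fin n, (i : ℕ) + 1 = (j : ℕ) ∧ (j : ℕ) + 1 < n ∧
          w = FreeGroup.of i * FreeGroup.of j * FreeGroup.of i *
              (FreeGroup.of j * FreeGroup.of i * FreeGroup.of j)⁻¹) ∨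
       (∃ i j : Fin n, (i : ℕ) + 2 = n ∧ (j : ℕ) + 1 = n ∧
          w = FreeGroup.of i * FreeGroup.of j * FreeGroup.of i * FreeGroup.of j *
              (FreeGroup.of j * FreeGroup.of i * FreeGroup.of j * FreeGroup.of i)⁻¹) ∨
       (∃ i j : Fin n, (i : ℕ) + 2 ≤ (j : ℕ) ∧
          w = FreeGroup.of i * FreeGroup.of j * (FreeGroup.of j * FreeGroup.of i)⁻¹)}

/-- The Artin group `A[Bₙ]` of type `Bₙ`. -/
abbrev ArtinB (n : ℕ) := PresentedGroup (BnRels n)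

/-- The standard generator `r_i` (1-indexed, `1 ≤ i ≤ n`). -/
def rB (n i : ℕ) : ArtinB n :=
  if h : i - 1 < n then PresentedGroup.of ⟨i - 1, h⟩ else 1

/-- `ρ_B = r_1 r_2 ⋯ r_n`. -/
def ρB (n : ℕ) : ArtinB n := ((List.range n).map fun i => rB n (i + 1)).prod

/-- `Δ_B = ρ_B ^ n`, the generator of the center. -/
def ΔB (n : ℕ) : ArtinB n := ρB n ^ n

/-- `t_i` for `i` read modulo `n`: `t_i = r_i` for `1 ≤ i ≤ n-1`,
and `t_0 = ρ_B r_{n-1} ρ_B⁻¹`. -/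
def tB (n i : ℕ) : ArtinB n :=
  if i % n = 0 then ρB n * rB n (n - 1) * (ρB n)⁻¹ else rB n (i % n)

/-- `Δ_Y = (t_1⋯t_{n-1})(t_1⋯t_{n-2})⋯(t_1t_2)t_1`, the Garside element of the
parabolic subgroup of type `A_{n-1}`. -/
def ΔY (n : ℕ) : ArtinB n :=
  ((List.range (n - 1)).map fun k =>
    ((List.range (n - 1 - k)).map fun i => rB n (i + 1)).prod).prod

/-- `ρ_0 = t_1 t_2 ⋯ t_{n-1}`. -/
def ρ₀B (n : ℕ) : ArtinB n := ((List.range (n - 1)).map fun i => rB n (i + 1)).prod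

/-- `ρ_1 = t_1⁻¹ t_2⁻¹ ⋯ t_{n-1}⁻¹`. -/
def ρ₁B (n : ℕ) : ArtinB n := ((List.range (n - 1)).map fun i => (rB n (i + 1))⁻¹).prod

/-- `ρ_k` for `k ∈ {0,1}`. -/
def ρkB (n k : ℕ) : ArtinB n := if k = 0 then ρ₀B n else ρ₁B n

/-- `v_k = ρ_k t_{n-1} ρ_k⁻¹` for `k ∈ {0,1}`. -/
def vB (n k : ℕ) : ArtinB n := ρkB n k * rB n (n - 1) * (ρkB n k)⁻¹

/-- `δ = r_{n-1} r_{n-2} ⋯ r_2 r_1² r_2 ⋯ r_{n-2} r_{n-1}`. -/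
def δB (n : ℕ) : ArtinB n :=
  ((List.range (n - 2)).map fun i => rB n (n - 1 - i)).prod * rB n 1 ^ 2 *
  ((List.range (n - 2)).map fun i => rB n (i + 2)).prod

/-- The quotient `Ā = A[Bₙ]/Z(A[Bₙ])`. -/
abbrev AbarB (n : ℕ) := ArtinB n ⧸ Subgroup.center (ArtinB n)

/-- The canonical projection `π : A[Bₙ] → Ā`. -/
def πB (n : ℕ) : ArtinB n →* AbarB n := QuotientGroup.mk' (Subgroup.center (ArtinB n))

/-- `t̄_i = π(t_i)`. -/
def tbar (n i : ℕ) : AbarB n := πB n (tB n i)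

/-- `ρ̄_B = π(ρ_B)`. -/
def ρbar (n : ℕ) : AbarB n := πB n (ρB n)

/-- The composition `conj_x ∘ φ` of an endomorphism with an inner automorphism. -/
def conjComp {G : Type*} [Group G] (x : G) (φ : G →* G) : G →* G :=
  (MulAut.conj x).toMonoidHom.comp φ

/-- Type (1): there are commuting `g, h` with `φ(t_i) = g` for all `0 ≤ i ≤ n-1`
and `φ(ρ_B) = h`. -/
def IsType1 (n : ℕ) (φ : ArtinB n →* ArtinB n) : Prop :=
  ∃ g h : ArtinB n, g * h = h * g ∧ (∀ i < n, φ (tB n i) = g) ∧ φ (ρB n) = h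

/-- Type (2a) with parameters `ε ∈ {1,-1}`, `p q : ℤ`. -/
def IsType2a (n : ℕ) (ε p q : ℤ) (φ : ArtinB n →* ArtinB n) : Prop :=
  (ε = 1 ∨ ε = -1) ∧ (∀ i < n, φ (tB n i) = tB n i ^ ε * ΔB n ^ p) ∧
    φ (ρB n) = ρB n * ΔB n ^ q

/-- Type (2b) with parameters `ε ∈ {1,-1}`, `p q : ℤ`. -/
def IsType2b (n : ℕ) (ε p q : ℤ) (φ : ArtinB n →* ArtinB n) : Prop :=
  (ε = 1 ∨ ε = -1) ∧ (∀ i < n, φ (tB n i) = tB n (n - i) ^ ε * ΔB n ^ p) ∧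
    φ (ρB n) = (ρB n)⁻¹ * ΔB n ^ q

/-- Type (3) with parameters `ε ∈ {1,-1}`, `k ∈ {0,1}`, `p q r s : ℤ`. -/
def IsType3 (n : ℕ) (ε : ℤ) (k : ℕ) (p q r s : ℤ) (φ : ArtinB n →* ArtinB n) : Prop :=
  (ε = 1 ∨ ε = -1) ∧ (k = 0 ∨ k = 1) ∧
    (∀ i, 1 ≤ i → i ≤ n - 1 → φ (tB n i) = tB n i ^ ε * ΔY n ^ (2 * p) * ΔB n ^ q) ∧
    φ (tB n 0) = vB n k ^ ε * ΔY n ^ (2 * p) * ΔB n ^ q ∧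
    φ (ρB n) = ρkB n k * ΔY n ^ (2 * r) * ΔB n ^ s

namespace BraidB

section Basic

variable {G H : Type*} [Group G] [Group H]

/-- `s 0, …, s (k-2)` satisfy the braid relations on `k` strands. -/
structure IsBraid (k : ℕ) (s : ℕ → G) : Prop where
  braid : ∀ i, i + 2 < k → s i * s (i + 1) * s i = s (i + 1) * s i * s (i + 1)
  comm : ∀ i j, i + 1 < j → j + 1 < k → s i * s j = s j * s i

theorem IsBraid.mono {k l : ℕ} {s : ℕ → G} (h : IsBraid k s) (hl : l ≤ k) : IsBraid l s :=
  ⟨fun i hi => h.braid i (by omega), fun i j hi hj => h.comm i j hi (by omega)⟩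

theorem IsBraid.map {k : ℕ} {s : ℕ → G} (h : IsBraid k s) (f : G →* H) :
    IsBraid k (fun i => f (s i)) :=
  ⟨fun i hi => by simp only [← map_mul, h.braid i hi],
    fun i j hi hj => by simp only [← map_mul, h.comm i j hi hj]⟩

theorem IsBraid.inv {k : ℕ} {s : ℕ → G} (h : IsBraid k s) : IsBraid k (fun i => (s i)⁻¹) := by
  refine ⟨fun i hi => ?_, fun i j hi hj => ?_⟩
  · have := congrArg (·⁻¹) (h.braid i hi)
    simpa [mul_assoc] using this
  · have := congrArg (·⁻¹) (h.comm i j hi hj)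
    simpa using this.symm

/-- Relators of the braid group on `k` strands. Generators beyond the range are trivial. -/
def brRels (k : ℕ) : Set (FreeGroup ℕ) :=
  {w | (∃ i, i + 2 < k ∧ w = FreeGroup.of i * FreeGroup.of (i + 1) * FreeGroup.of i *
          (FreeGroup.of (i + 1) * FreeGroup.of i * FreeGroup.of (i + 1))⁻¹) ∨
       (∃ i j, i + 1 < j ∧ j + 1 < k ∧
          w = FreeGroup.of i * FreeGroup.of j * (FreeGroup.of j * FreeGroup.of i)⁻¹) ∨
       (∃ i, k ≤ i + 1 ∧ w = FreeGroup.of i)}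

/-- The braid group on `k` strands. -/
def Br (k : ℕ) : Type := PresentedGroup (brRels k)

noncomputable instance (k : ℕ) : Group (Br k) :=
  inferInstanceAs (Group (PresentedGroup (brRels k)))

/-- The standard generator crossing strands `i` and `i+1`. -/
def Br.σ (k i : ℕ) : Br k := PresentedGroup.of (rels := brRels k) i

theorem Br.isBraid_σ (k : ℕ) : IsBraid k (Br.σ k) := by
  refine ⟨fun i hi => ?_, fun i j hi hj => ?_⟩
  · exact mul_inv_eq_one.mp (PresentedGroup.one_of_mem (rels := brRels k) (Or.inl ⟨i, hi, rfl⟩))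
  · exact mul_inv_eq_one.mp
      (PresentedGroup.one_of_mem (rels := brRels k) (Or.inr (Or.inl ⟨i, j, hi, hj, rfl⟩)))

theorem Br.σ_eq_one {k i : ℕ} (h : k ≤ i + 1) : Br.σ k i = 1 :=
  PresentedGroup.one_of_mem (rels := brRels k) (Or.inr (Or.inr ⟨i, h, rfl⟩))

/-- The homomorphism from the braid group determined by a braid tuple. -/
noncomputable def Br.lift {k : ℕ} (s : ℕ → G) (h : IsBraid k s) : Br k →* G :=
  PresentedGroup.toGroup (rels := brRels k) (f := fun i => if i + 1 < k then s i else 1) (by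
    rintro r (⟨i, hi, rfl⟩ | ⟨i, j, hi, hj, rfl⟩ | ⟨i, hi, rfl⟩)
    · have h1 : i + 1 < k := by omega
      have h2 : i + 1 + 1 < k := by omega
      simp only [map_mul, map_inv, FreeGroup.lift_apply_of, h1, h2, if_true]
      rw [h.braid i hi]; group
    · have h1 : i + 1 < k := by omega
      simp only [map_mul, map_inv, FreeGroup.lift_apply_of, h1, hj, if_true]
      rw [h.comm i j hi hj]; group
    · simp [hi])

@[simp] theorem Br.lift_σ {k : ℕ} (s : ℕ → G) (h : IsBraid k s) {i : ℕ} (hi : i + 1 < k) :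
    Br.lift s h (Br.σ k i) = s i := by
  unfold Br.lift Br.σ
  erw [PresentedGroup.toGroup.of]
  simp [hi]

theorem Br.hom_ext {k : ℕ} {f g : Br k →* G}
    (h : ∀ i, i + 1 < k → f (Br.σ k i) = g (Br.σ k i)) : f = g := by
  refine PresentedGroup.ext (rels := brRels k) fun i => ?_
  by_cases hi : i + 1 < k
  · exact h i hi
  · have : Br.σ k i = 1 := Br.σ_eq_one (by omega)
    change f (Br.σ k i) = g (Br.σ k i)
    rw [this, map_one, map_one]

theorem Br.closure_σ (k : ℕ) : Subgroup.closure {b | ∃ i, i + 1 < k ∧ Br.σ k i = b} = ⊤ := by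
  rw [eq_top_iff]
  intro b _
  have : b ∈ Subgroup.closure (Set.range (PresentedGroup.of (rels := brRels k))) := by
    have := PresentedGroup.closure_range_of (brRels k)
    rw [this]; exact Subgroup.mem_top (G := PresentedGroup (brRels k)) b
  refine (Subgroup.closure_le (G := PresentedGroup (brRels k)) _ |>.2 ?_) this
  rintro _ ⟨i, rfl⟩
  by_cases hi : i + 1 < k
  · exact Subgroup.subset_closure ⟨i, hi, rfl⟩
  · change Br.σ k i ∈ Subgroup.closure {b | ∃ i, i + 1 < k ∧ Br.σ k i = b}
    rw [Br.σ_eq_one (by omega)]; exact one_mem _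

@[elab_as_elim]
theorem Br.induction {k : ℕ} {p : Br k → Prop} (b : Br k) (one : p 1)
    (mul : ∀ x y, p x → p y → p (x * y)) (inv : ∀ x, p x → p x⁻¹)
    (gen : ∀ i, i + 1 < k → p (Br.σ k i)) : p b := by
  have hb : b ∈ Subgroup.closure {b | ∃ i, i + 1 < k ∧ Br.σ k i = b} := by
    rw [Br.closure_σ]; trivial
  induction hb using Subgroup.closure_induction with
  | mem x hx => obtain ⟨i, hi, rfl⟩ := hx; exact gen i hi
  | one => exact one
  | mul x y _ _ hx hy => exact mul x y hx hy
  | inv x _ hx => exact inv x hx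

/-- A subset closed under right multiplication by generators and their inverses is everything. -/
theorem Br.induction_right {k : ℕ} {p : Br k → Prop} (b : Br k) (one : p 1)
    (mul : ∀ x i, i + 1 < k → p x → p (x * Br.σ k i))
    (mul_inv : ∀ x i, i + 1 < k → p x → p (x * (Br.σ k i)⁻¹)) : p b := by
  have hb : b ∈ Subgroup.closure {b | ∃ i, i + 1 < k ∧ Br.σ k i = b} := by
    rw [Br.closure_σ]; trivial
  induction hb using Subgroup.closure_induction_right with
  | one => exact one
  | mul_right x _ y hy hx => obtain ⟨i, hi, rfl⟩ := hy; exact mul x i hi hx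
  | mul_inv_cancel x _ y hy hx => obtain ⟨i, hi, rfl⟩ := hy; exact mul_inv x i hi hx

/-- The inclusion on the first `k` strands. -/
noncomputable def Br.incl {k l : ℕ} (h : k ≤ l) : Br k →* Br l :=
  Br.lift (Br.σ l) ((Br.isBraid_σ l).mono h)

@[simp] theorem Br.incl_σ {k l : ℕ} (h : k ≤ l) {i : ℕ} (hi : i + 1 < k) :
    Br.incl h (Br.σ k i) = Br.σ l i := Br.lift_σ _ _ hi

theorem Br.incl_incl {k l m : ℕ} (h : k ≤ l) (h' : l ≤ m) (b : Br k) :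
    Br.incl h' (Br.incl h b) = Br.incl (h.trans h') b := by
  have : (Br.incl h').comp (Br.incl h) = Br.incl (h.trans h') :=
    Br.hom_ext fun i hi => by
      simp [Br.incl_σ h hi, Br.incl_σ h' (i := i) (by omega), Br.incl_σ (h.trans h') hi]
  exact DFunLike.congr_fun this b

/-- The permutation of strands underlying a braid. -/
noncomputable def Br.perm (k : ℕ) : Br k →* Equiv.Perm ℕ :=
  Br.lift (fun i => Equiv.swap i (i + 1)) (by
    refine ⟨fun i _ => ?_, fun i j hi _ => ?_⟩
    · ext x
      simp only [Equiv.Perm.mul_apply, Equiv.swap_apply_def]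
      split_ifs <;> omega
    · ext x
      simp only [Equiv.Perm.mul_apply, Equiv.swap_apply_def]
      split_ifs <;> omega)

@[simp] theorem Br.perm_σ {k i : ℕ} (hi : i + 1 < k) :
    Br.perm k (Br.σ k i) = Equiv.swap i (i + 1) := Br.lift_σ _ _ hi

theorem Br.perm_incl {k l : ℕ} (h : k ≤ l) (b : Br k) :
    Br.perm l (Br.incl h b) = Br.perm k b := by
  have : (Br.perm l).comp (Br.incl h) = Br.perm k :=
    Br.hom_ext fun i hi => by
      simp [Br.incl_σ h hi, Br.perm_σ (k := l) (i := i) (by omega), Br.perm_σ hi]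
  exact DFunLike.congr_fun this b

theorem Br.perm_apply_of_le {k : ℕ} (b : Br k) {j : ℕ} (hj : k ≤ j) : Br.perm k b j = j := by
  induction b using Br.induction with
  | one => simp
  | mul x y hx hy => simp [hx, hy]
  | inv x hx => rw [map_inv, Equiv.Perm.inv_eq_iff_eq, hx]
  | gen i hi =>
    rw [Br.perm_σ hi, Equiv.swap_apply_of_ne_of_ne] <;> omega

theorem Br.perm_apply_lt {k : ℕ} (b : Br k) {j : ℕ} (hj : j < k) : Br.perm k b j < k := by
  by_contra h
  have := Br.perm_apply_of_le b (not_lt.mp h)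
  have := (Br.perm k b).injective this
  omega

/-- The free group on `k` letters. -/
abbrev F (k : ℕ) := FreeGroup (Fin k)

/-- The `i`-th generator, trivial beyond the range. -/
def X (k i : ℕ) : F k := if h : i < k then FreeGroup.of ⟨i, h⟩ else 1

theorem X_of_lt {k i : ℕ} (h : i < k) : X k i = FreeGroup.of ⟨i, h⟩ := dif_pos h

theorem X_eq_one {k i : ℕ} (h : k ≤ i) : X k i = 1 := dif_neg (by omega)

theorem of_eq_X {k : ℕ} (i : Fin k) : FreeGroup.of i = X k i := (X_of_lt i.2).symm

/-- The homomorphism from the free group determined by a sequence. -/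
def F.lift {k : ℕ} (f : ℕ → G) : F k →* G := FreeGroup.lift fun i => f i

@[simp] theorem F.lift_X {k : ℕ} (f : ℕ → G) {i : ℕ} (h : i < k) : F.lift f (X k i) = f i := by
  simp [F.lift, X_of_lt h]

theorem F.hom_ext {k : ℕ} {f g : F k →* G} (h : ∀ i < k, f (X k i) = g (X k i)) : f = g :=
  FreeGroup.ext_hom _ _ fun i => by rw [of_eq_X]; exact h i i.2

@[elab_as_elim]
theorem F.induction {k : ℕ} {p : F k → Prop} (w : F k) (one : p 1)
    (mul : ∀ x y, p x → p y → p (x * y)) (inv : ∀ x, p x → p x⁻¹)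
    (gen : ∀ i < k, p (X k i)) : p w := by
  induction w using FreeGroup.induction_on with
  | C1 => exact one
  | of i => rw [of_eq_X]; exact gen i i.2
  | inv_of i _ => rw [of_eq_X]; exact inv _ (gen i i.2)
  | mul x y hx hy => exact mul x y hx hy

end Basic

end BraidB

namespace BraidB

section Action

variable {G H : Type*} [Group G] [Group H]

/-- The Artin automorphism `X_{i+1} ↦ X_i`, `X_i ↦ X_i⁻¹ X_{i+1} X_i`. -/
def artinHom (k i : ℕ) : F k →* F k :=
  F.lift fun j => if j = i + 1 then X k i else
    if j = i then (X k i)⁻¹ * X k (i + 1) * X k i else X k j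

/-- The inverse Artin automorphism. -/
def artinInv (k i : ℕ) : F k →* F k :=
  F.lift fun j => if j = i then X k (i + 1) else
    if j = i + 1 then X k (i + 1) * X k i * (X k (i + 1))⁻¹ else X k j

section
variable {k i : ℕ}

theorem artinHom_succ (hi : i + 1 < k) : artinHom k i (X k (i + 1)) = X k i := by
  simp [artinHom, F.lift_X _ hi]

theorem artinHom_self (hi : i + 1 < k) : artinHom k i (X k i) = (X k i)⁻¹ * X k (i + 1) * X k i := by
  simp [artinHom, F.lift_X _ (show i < k by omega)]

theorem artinHom_of_ne {k i j : ℕ} (h1 : j ≠ i) (h2 : j ≠ i + 1) :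
    artinHom k i (X k j) = X k j := by
  by_cases hj : j < k
  · simp [artinHom, F.lift_X _ hj, h1, h2]
  · simp [X_eq_one (not_lt.mp hj)]

theorem artinInv_succ (hi : i + 1 < k) : artinInv k i (X k (i + 1)) = X k (i + 1) * X k i * (X k (i + 1))⁻¹ := by
  simp [artinInv, F.lift_X _ hi]

theorem artinInv_self (hi : i + 1 < k) : artinInv k i (X k i) = X k (i + 1) := by
  simp [artinInv, F.lift_X _ (show i < k by omega)]

theorem artinInv_of_ne {k i j : ℕ} (h1 : j ≠ i) (h2 : j ≠ i + 1) :
    artinInv k i (X k j) = X k j := by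
  by_cases hj : j < k
  · simp [artinInv, F.lift_X _ hj, h1, h2]
  · simp [X_eq_one (not_lt.mp hj)]

theorem artinHom_comp_inv (hi : i + 1 < k) : (artinHom k i).comp (artinInv k i) = MonoidHom.id _ := by
  refine F.hom_ext fun j hj => ?_
  rcases eq_or_ne j i with rfl | h1
  · simp [artinInv_self hi, artinHom_succ hi]
  rcases eq_or_ne j (i + 1) with rfl | h2
  · simp [artinInv_succ hi, artinHom_succ hi, artinHom_self hi, mul_assoc]
  · simp [artinInv_of_ne h1 h2, artinHom_of_ne h1 h2]

theorem artinInv_comp_hom (hi : i + 1 < k) : (artinInv k i).comp (artinHom k i) = MonoidHom.id _ := by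
  refine F.hom_ext fun j hj => ?_
  rcases eq_or_ne j i with rfl | h1
  · simp [artinInv_self hi, artinInv_succ hi, artinHom_self hi, mul_assoc]
  rcases eq_or_ne j (i + 1) with rfl | h2
  · simp [artinInv_self hi, artinHom_succ hi]
  · simp [artinInv_of_ne h1 h2, artinHom_of_ne h1 h2]

end

/-- The Artin automorphism as an element of the automorphism group. -/
def artinAut (k i : ℕ) : MulAut (F k) :=
  if hi : i + 1 < k then
    (artinHom k i).toMulEquiv (artinInv k i) (artinInv_comp_hom hi) (artinHom_comp_inv hi)
  else 1

theorem artinAut_apply {k i : ℕ} (hi : i + 1 < k) (w : F k) :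
    artinAut k i w = artinHom k i w := by
  simp [artinAut, hi]

theorem mulAut_ext {k : ℕ} {f g : MulAut (F k)} (h : ∀ i < k, f (X k i) = g (X k i)) : f = g := by
  have : f.toMonoidHom = g.toMonoidHom := F.hom_ext h
  exact MulEquiv.toMonoidHom_injective this

theorem isBraid_artinAut (k : ℕ) : IsBraid k (artinAut k) := by
  refine ⟨fun i hi => mulAut_ext fun l hl => ?_, fun i j hi hj => mulAut_ext fun l hl => ?_⟩
  · have h1 : i + 1 < k := by omega
    have h2 : i + 1 + 1 < k := hi
    simp only [MulAut.mul_apply, artinAut_apply h1, artinAut_apply h2]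
    have e1 := artinHom_of_ne (k := k) (i := i + 1) (j := i) (by omega) (by omega)
    have e2 := artinHom_of_ne (k := k) (i := i) (j := i + 1 + 1) (by omega) (by omega)
    rcases eq_or_ne l i with rfl | a1
    · simp [artinHom_self h1, artinHom_succ h1, artinHom_self h2, e1, e2, mul_assoc]
    rcases eq_or_ne l (i + 1) with rfl | a2
    · simp [artinHom_self h1, artinHom_succ h1, artinHom_self h2, artinHom_succ h2, e1, e2, mul_assoc]
    rcases eq_or_ne l (i + 1 + 1) with rfl | a3
    · simp [artinHom_succ h1, artinHom_succ h2, e1, e2]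
    · simp [artinHom_of_ne a1 a2, artinHom_of_ne a2 a3]
  · have h1 : i + 1 < k := by omega
    simp only [MulAut.mul_apply, artinAut_apply h1, artinAut_apply hj]
    have e1 := artinHom_of_ne (k := k) (i := j) (j := i) (by omega) (by omega)
    have e2 := artinHom_of_ne (k := k) (i := j) (j := i + 1) (by omega) (by omega)
    have e3 := artinHom_of_ne (k := k) (i := i) (j := j) (by omega) (by omega)
    have e4 := artinHom_of_ne (k := k) (i := i) (j := j + 1) (by omega) (by omega)
    rcases eq_or_ne l i with rfl | a1
    · simp [artinHom_self h1, e1, e2]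
    rcases eq_or_ne l (i + 1) with rfl | a2
    · simp [artinHom_succ h1, e1, e2]
    rcases eq_or_ne l j with rfl | a3
    · simp [artinHom_self hj, e3, e4]
    rcases eq_or_ne l (j + 1) with rfl | a4
    · simp [artinHom_succ hj, e3, e4]
    · simp [artinHom_of_ne a1 a2, artinHom_of_ne a3 a4]

/-- The Artin action of the braid group on the free group. -/
noncomputable def act (k : ℕ) : Br k →* MulAut (F k) := Br.lift (artinAut k) (isBraid_artinAut k)

theorem act_σ {k i : ℕ} (hi : i + 1 < k) (w : F k) : act k (Br.σ k i) w = artinHom k i w := by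
  rw [act, Br.lift_σ _ _ hi, artinAut_apply hi]

section
variable {k i : ℕ}

theorem act_σ_inv (hi : i + 1 < k) (w : F k) : (act k (Br.σ k i))⁻¹ w = artinInv k i w := by
  rw [MulAut.inv_apply, MulEquiv.symm_apply_eq, act_σ hi]
  exact (DFunLike.congr_fun (artinHom_comp_inv hi) w).symm

theorem act_σ_succ (hi : i + 1 < k) : act k (Br.σ k i) (X k (i + 1)) = X k i := by
  rw [act_σ hi, artinHom_succ hi]

theorem act_σ_self (hi : i + 1 < k) : act k (Br.σ k i) (X k i) = (X k i)⁻¹ * X k (i + 1) * X k i := by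
  rw [act_σ hi, artinHom_self hi]

theorem act_σ_of_ne (hi : i + 1 < k) {j : ℕ} (h1 : j ≠ i) (h2 : j ≠ i + 1) :
    act k (Br.σ k i) (X k j) = X k j := by
  rw [act_σ hi, artinHom_of_ne h1 h2]

end

/-- The action carries generators to conjugates of generators, according to the permutation. -/
theorem act_X_conj (k : ℕ) (b : Br k) (j : ℕ) :
    ∃ u : F k, act k b (X k j) = u * X k (Br.perm k b j) * u⁻¹ := by
  induction b using Br.induction_right generalizing j with
  | one => exact ⟨1, by simp⟩
  | mul b i hi hb =>
    rw [map_mul, map_mul, MulAut.mul_apply, Equiv.Perm.mul_apply, Br.perm_σ hi]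
    rcases eq_or_ne j i with rfl | h1
    · obtain ⟨u, hu⟩ := hb (j + 1)
      rw [act_σ_self hi, Equiv.swap_apply_left]
      exact ⟨(act k b (X k j))⁻¹ * u, by simp [hu, mul_assoc]⟩
    rcases eq_or_ne j (i + 1) with rfl | h2
    · rw [act_σ_succ hi, Equiv.swap_apply_right]; exact hb i
    · rw [act_σ_of_ne hi h1 h2, Equiv.swap_apply_of_ne_of_ne h1 h2]; exact hb j
  | mul_inv b i hi hb =>
    rw [map_mul, map_mul, MulAut.mul_apply, Equiv.Perm.mul_apply, map_inv, act_σ_inv hi, map_inv,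
      Br.perm_σ hi, Equiv.swap_inv]
    rcases eq_or_ne j i with rfl | h1
    · rw [artinInv_self hi, Equiv.swap_apply_left]; exact hb (j + 1)
    rcases eq_or_ne j (i + 1) with rfl | h2
    · obtain ⟨u, hu⟩ := hb i
      rw [artinInv_succ hi, Equiv.swap_apply_right]
      exact ⟨(act k b (X k (i + 1))) * u, by simp [hu, mul_assoc]⟩
    · rw [artinInv_of_ne h1 h2, Equiv.swap_apply_of_ne_of_ne h1 h2]; exact hb j

/-- The descending product `X_{m-1} ⋯ X_0`. -/
def zp (k : ℕ) : ℕ → F k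
  | 0 => 1
  | m + 1 => X k m * zp k m

/-- The boundary element `X_{k-1} ⋯ X_0`. -/
def z (k : ℕ) : F k := zp k k

theorem artin_zp {k i : ℕ} (hi : i + 1 < k) (m : ℕ) (hm : m ≠ i + 1) :
    act k (Br.σ k i) (zp k m) = zp k m := by
  induction m using Nat.strong_induction_on with
  | _ m ih =>
    match m with
    | 0 => simp [zp]
    | m + 1 =>
      rcases eq_or_ne m (i + 1) with rfl | h
      · have := ih i (by omega) (by omega)
        simp [zp, this, act_σ_self hi, act_σ_succ hi, mul_assoc]
      · have h1 := ih m (by omega) h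
        simp only [zp, map_mul, h1]
        rw [act_σ_of_ne hi (by omega) h]

@[simp] theorem act_z (k : ℕ) (b : Br k) : act k b (z k) = z k := by
  induction b using Br.induction with
  | one => simp
  | mul x y hx hy => simp [hx, hy]
  | inv x hx => rw [map_inv, MulAut.inv_apply, MulEquiv.symm_apply_eq, hx]
  | gen i hi => exact artin_zp hi k (by omega)

end Action

section Semidirect

variable {G H : Type*} [Group G] [Group H]

/-- The annular braid group on `k` strands. -/
abbrev E (k : ℕ) := F k ⋊[act k] Br k

/-- The inclusion of the free group. -/
noncomputable abbrev xE (k : ℕ) : F k →* E k := SemidirectProduct.inl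
/-- The inclusion of the braid group. -/
noncomputable abbrev bE (k : ℕ) : Br k →* E k := SemidirectProduct.inr

theorem xE_act (k : ℕ) (b : Br k) (w : F k) :
    xE k (act k b w) = bE k b * xE k w * (bE k b)⁻¹ := by
  rw [← map_inv]; exact SemidirectProduct.inl_aut b w

theorem E.eq_mul {k : ℕ} (e : E k) : e = xE k e.left * bE k e.right :=
  (SemidirectProduct.inl_left_mul_inr_right e).symm

/-- The elements `A_{k-1-d}` obtained from `r` by successive conjugation. -/
def chain (s : ℕ → G) (r : G) (k : ℕ) : ℕ → G
  | 0 => r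
  | d + 1 => s (k - 2 - d) * chain s r k d * (s (k - 2 - d))⁻¹

/-- Relations needed for a homomorphism out of the annular braid group. -/
structure IsAnnular (k : ℕ) (s : ℕ → G) (r : G) : Prop where
  isBraid : IsBraid k s
  comm : ∀ i, i + 2 < k → s i * r = r * s i
  quad : ∀ i, i + 2 = k → s i * r * s i * r = r * s i * r * s i

theorem IsAnnular.map {k : ℕ} {s : ℕ → G} {r : G} (h : IsAnnular k s r) (f : G →* H) :
    IsAnnular k (fun i => f (s i)) (f r) :=
  ⟨h.isBraid.map f, fun i hi => by simp only [← map_mul, h.comm i hi],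
    fun i hi => by simp only [← map_mul, h.quad i hi]⟩

/-- The image of the generator `X_j`. -/
def annX (k : ℕ) (s : ℕ → G) (r : G) (j : ℕ) : G := chain s r k (k - 1 - j)

section
variable {k : ℕ} {s : ℕ → G} {r : G}

theorem annX_top : annX k s r (k - 1) = r := by simp [annX, chain]

theorem annX_succ {i : ℕ} (hi : i + 1 < k) :
    annX k s r i = s i * annX k s r (i + 1) * (s i)⁻¹ := by
  unfold annX
  obtain ⟨d, hd⟩ : ∃ d, k - 1 - (i + 1) = d := ⟨_, rfl⟩
  have h1 : k - 1 - i = d + 1 := by omega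
  have h2 : k - 2 - d = i := by omega
  rw [hd, h1, chain, h2]

/-- Downward induction along strands. -/
theorem down_induction {p : ℕ → Prop} {k : ℕ} (top : p (k - 1))
    (step : ∀ i, i + 1 < k → p (i + 1) → p i) : ∀ i < k, p i := by
  suffices h : ∀ d i, i + 1 + d = k → p i from fun i hi => h (k - (i + 1)) i (by omega)
  intro d
  induction d with
  | zero => intro i hi; rwa [show i = k - 1 by omega]
  | succ d ih => exact fun i hi => step i (by omega) (ih (i + 1) (by omega))

theorem annX_comm_of_lt (h : IsAnnular k s r) {i j : ℕ} (hj : j < k) (hij : i + 1 < j) :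
    s i * annX k s r j = annX k s r j * s i := by
  revert hij
  refine down_induction (p := fun j => i + 1 < j → s i * annX k s r j = annX k s r j * s i)
    (k := k) ?_ ?_ j hj
  · intro hij; rw [annX_top]; exact h.comm i (by omega)
  · intro j hj ih hij
    have c := h.isBraid.comm i j hij hj
    have c' : Commute (s i) (s j) := c
    rw [annX_succ hj]
    exact ((c'.mul_right (show Commute _ _ from ih (by omega))).mul_right c'.inv_right).eq

theorem annX_comm_of_gt (h : IsAnnular k s r) {i j : ℕ} (hi : i + 1 < k) (hij : j < i) :
    s i * annX k s r j = annX k s r j * s i := by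
  obtain ⟨d, rfl⟩ : ∃ d, i = j + 1 + d := ⟨i - (j + 1), by omega⟩
  clear hij
  induction d generalizing j with
  | zero =>
    have hb := h.isBraid.braid j (by omega)
    have hc := annX_comm_of_lt h (i := j) (j := j + 1 + 1) (by omega) (by omega)
    rw [annX_succ (i := j) (by omega), annX_succ (i := j + 1) (by omega)]
    simp only [add_zero] at *
    have e : s (j + 1) * (s j * s (j + 1)) = (s j * s (j + 1)) * s j := by
      rw [← mul_assoc, ← hb]
    have e2 : (s (j+1))⁻¹ * (s j)⁻¹ * s (j + 1) = s j * (s (j+1))⁻¹ * (s j)⁻¹ := by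
      rw [mul_assoc, inv_mul_eq_iff_eq_mul, inv_mul_eq_iff_eq_mul]
      simp only [← mul_assoc]
      rw [hb]; group
    calc _ = (s (j + 1) * (s j * s (j + 1))) * annX k s r (j + 1 + 1) * (s (j+1))⁻¹ * (s j)⁻¹ := by
          group
      _ = (s j * s (j + 1)) * (s j * annX k s r (j + 1 + 1)) * (s (j+1))⁻¹ * (s j)⁻¹ := by
          rw [e]; group
      _ = (s j * s (j + 1)) * annX k s r (j + 1 + 1) * (s j * (s (j+1))⁻¹ * (s j)⁻¹) := by
          rw [hc]; group
      _ = _ := by rw [← e2]; group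
  | succ d ih =>
    have ih := ih (j := j + 1) (by omega)
    rw [annX_succ (i := j) (by omega)]
    have c : Commute (s (j + 1 + (d + 1))) (s j) :=
      (h.isBraid.comm j (j + 1 + (d + 1)) (by omega) hi).symm
    have e : j + 1 + 1 + d = j + 1 + (d + 1) := by omega
    rw [e] at ih
    exact ((c.mul_right (show Commute _ _ from ih)).mul_right c.inv_right).eq

theorem annX_pair (h : IsAnnular k s r) {i : ℕ} (hi : i + 1 < k) :
    s i * (annX k s r (i + 1) * annX k s r i) = (annX k s r (i + 1) * annX k s r i) * s i := by
  revert hi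
  by_cases hk : i < k
  swap
  · intro hi; omega
  refine down_induction (p := fun i => i + 1 < k →
    s i * (annX k s r (i + 1) * annX k s r i) = (annX k s r (i + 1) * annX k s r i) * s i)
    (k := k) (fun hi => by omega) ?_ i hk
  intro i hi ih _
  by_cases h2 : i + 2 < k
  · have ih : Commute _ _ := ih h2
    have hb := h.isBraid.braid i h2
    have e1 : (s (i + 1) * s i) * s (i + 1) * (s (i + 1) * s i)⁻¹ = s i := by
      rw [mul_inv_eq_iff_eq_mul, ← hb]; group
    have e2 : (s (i + 1) * s i) * annX k s r (i + 1) * (s (i + 1) * s i)⁻¹ = annX k s r i := by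
      calc _ = s (i + 1) * (s i * annX k s r (i + 1) * (s i)⁻¹) * (s (i + 1))⁻¹ := by group
        _ = _ := by
          rw [← annX_succ hi, annX_comm_of_gt h (i := i + 1) h2 (by omega)]; group
    have e3 : (s (i + 1) * s i) * annX k s r (i + 1 + 1) * (s (i + 1) * s i)⁻¹
        = annX k s r (i + 1) := by
      calc _ = s (i + 1) * (s i * annX k s r (i + 1 + 1)) * (s i)⁻¹ * (s (i + 1))⁻¹ := by group
        _ = _ := by
          rw [annX_comm_of_lt h (by omega) (by omega), annX_succ (i := i + 1) h2]; group
    have := ih.map (MulAut.conj (s (i + 1) * s i)).toMonoidHom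
    simp only [MulEquiv.coe_toMonoidHom, MulAut.conj_apply] at this
    have e4 : s (i + 1) * s i * (annX k s r (i + 1 + 1) * annX k s r (i + 1)) *
        (s (i + 1) * s i)⁻¹ = annX k s r (i + 1) * annX k s r i := by
      rw [← e2, ← e3]; group
    rw [e1, e4] at this
    exact this.eq
  · have hk2 : i + 2 = k := by omega
    have hq := h.quad i hk2
    have e : annX k s r (i + 1) = r := by
      have : i + 1 = k - 1 := by omega
      rw [this, annX_top]
    rw [annX_succ hi, e]
    calc _ = (s i * r * s i * r) * (s i)⁻¹ := by group
      _ = _ := by rw [hq]; group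

theorem annX_self (h : IsAnnular k s r) {i : ℕ} (hi : i + 1 < k) :
    s i * annX k s r i * (s i)⁻¹ = (annX k s r i)⁻¹ * annX k s r (i + 1) * annX k s r i := by
  have h1 := annX_pair h hi
  have h2 := annX_succ (s := s) (r := r) hi
  have h3 : s i * annX k s r (i + 1) = annX k s r i * s i := by rw [h2]; group
  rw [mul_inv_eq_iff_eq_mul, mul_assoc, mul_assoc, ← mul_assoc (annX k s r (i + 1)), ← h1,
    ← mul_assoc (s i), h3]
  group

/-- The homomorphism from the annular braid group with `σ_i ↦ s i` and `X_{k-1} ↦ r`. -/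
noncomputable def E.lift (h : IsAnnular k s r) : E k →* G :=
  SemidirectProduct.lift (F.lift (annX k s r)) (Br.lift s h.isBraid) (by
    intro b
    induction b using Br.induction with
    | one => ext; simp
    | mul x y hx hy =>
      refine MonoidHom.ext fun w => ?_
      have a := DFunLike.congr_fun hy w
      have b := DFunLike.congr_fun hx (act k y w)
      simp only [MonoidHom.comp_apply, MulEquiv.coe_toMonoidHom, MulAut.conj_apply, map_mul,
        MulAut.mul_apply] at a b ⊢
      rw [b, a]; group
    | inv x hx =>
      refine MonoidHom.ext fun w => ?_
      have a := DFunLike.congr_fun hx ((act k x)⁻¹ w)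
      simp only [MonoidHom.comp_apply, MulEquiv.coe_toMonoidHom, MulAut.conj_apply, map_inv,
        MulAut.apply_inv_self, MulAut.conj_inv_apply] at a ⊢
      rw [a]; simp [mul_assoc]
    | gen i hi =>
      refine F.hom_ext fun j hj => ?_
      have h0 : i < k := by omega
      simp only [MonoidHom.comp_apply, MulEquiv.coe_toMonoidHom, MulAut.conj_apply,
        Br.lift_σ _ _ hi]
      rcases eq_or_ne j i with rfl | h1
      · rw [act_σ_self hi]; simp [F.lift_X _ hi, F.lift_X _ hj, annX_self h hi]
      rcases eq_or_ne j (i + 1) with rfl | h2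
      · rw [act_σ_succ hi, F.lift_X _ h0, F.lift_X _ hj, annX_succ hi]
      · rw [act_σ_of_ne hi h1 h2, F.lift_X _ hj, eq_mul_inv_iff_mul_eq]
        rcases lt_or_gt_of_ne h1 with h3 | h3
        · exact (annX_comm_of_gt h hi h3).symm
        · exact (annX_comm_of_lt h hj (by omega)).symm)

@[simp] theorem E.lift_bE (h : IsAnnular k s r) (b : Br k) : E.lift h (bE k b) = Br.lift s h.isBraid b :=
  SemidirectProduct.lift_inr ..

theorem E.lift_σ (h : IsAnnular k s r) {i : ℕ} (hi : i + 1 < k) : E.lift h (bE k (Br.σ k i)) = s i := by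
  rw [E.lift_bE, Br.lift_σ _ _ hi]

theorem E.lift_X (h : IsAnnular k s r) {j : ℕ} (hj : j < k) : E.lift h (xE k (X k j)) = annX k s r j := by
  rw [E.lift, SemidirectProduct.lift_inl, F.lift_X _ hj]

theorem E.lift_X_top (h : IsAnnular k s r) (hk : 0 < k) : E.lift h (xE k (X k (k - 1))) = r := by
  rw [E.lift_X h (by omega), annX_top]

end

theorem E.bE_conj_X {k i : ℕ} (hi : i + 1 < k) :
    xE k (X k i) = bE k (Br.σ k i) * xE k (X k (i + 1)) * (bE k (Br.σ k i))⁻¹ := by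
  rw [← xE_act, act_σ_succ hi]

theorem E.hom_ext {k : ℕ} {f g : E k →* G}
    (hσ : ∀ i, i + 1 < k → f (bE k (Br.σ k i)) = g (bE k (Br.σ k i)))
    (hX : 0 < k → f (xE k (X k (k - 1))) = g (xE k (X k (k - 1)))) : f = g := by
  refine SemidirectProduct.hom_ext (F.hom_ext ?_) (Br.hom_ext hσ)
  intro i hi
  have hk : 0 < k := by omega
  revert i
  refine down_induction (hX hk) fun i hi ih => ?_
  simp only [MonoidHom.comp_apply] at ih ⊢
  rw [E.bE_conj_X hi, map_mul, map_mul, map_mul, map_mul, map_inv, map_inv, hσ i hi, ih]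

theorem E.isAnnular (k : ℕ) :
    IsAnnular k (fun i => bE k (Br.σ k i)) (xE k (X k (k - 1))) := by
  refine ⟨(Br.isBraid_σ k).map _, fun i hi => ?_, fun i hi => ?_⟩
  · rw [← mul_inv_eq_iff_eq_mul, ← xE_act, act_σ_of_ne] <;> omega
  · have hi1 : i + 1 < k := by omega
    have e : k - 1 = i + 1 := by omega
    rw [e]
    have h1 := E.bE_conj_X hi1
    have h2 : xE k ((X k i)⁻¹ * X k (i + 1) * X k i) =
      bE k (Br.σ k i) * xE k (X k i) * (bE k (Br.σ k i))⁻¹ := by rw [← xE_act, act_σ_self hi1]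
    simp only [map_mul, map_inv] at h2
    generalize bE k (Br.σ k i) = s at *
    generalize xE k (X k i) = a at *
    generalize xE k (X k (i+1)) = r at *
    subst h1
    have h3 : (s * r * s⁻¹) * (s * (s * r * s⁻¹) * s⁻¹) = r * (s * r * s⁻¹) := by
      rw [← h2]; group
    calc s * r * s * r = ((s * r * s⁻¹) * (s * (s * r * s⁻¹) * s⁻¹)) * s * s := by
          simp [mul_assoc]
      _ = _ := by rw [h3]; simp [mul_assoc]

end Semidirect

end BraidB

namespace BraidB

section FreeGroups

variable {α : Type*}

theorem commute_of_zpow {G : Type*} [Group G] [IsMulTorsionFree G] {a b : G} {m : ℤ} (hm : m ≠ 0)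
    (h : Commute (a ^ m) b) : Commute a b := by
  have h1 : (b * a * b⁻¹) ^ m = a ^ m := by
    rw [conj_zpow, ← h.eq]; group
  have := zpow_left_injective hm h1
  exact (mul_inv_eq_iff_eq_mul.mp this).symm

theorem FreeGroup.of_commute {x y : α} (h : Commute (FreeGroup.of x) (FreeGroup.of y)) : x = y := by
  classical
  have := congrArg FreeGroup.toWord h.eq
  by_contra hxy
  rw [FreeGroup.toWord_mul, FreeGroup.toWord_mul] at this
  simp [FreeGroup.toWord_of, FreeGroup.reduce.cons] at this
  exact hxy this.1

theorem FreeGroup.exists_common_root {a b : FreeGroup α} (h : Commute a b) :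
    ∃ c : FreeGroup α, ∃ m n : ℤ, a = c ^ m ∧ b = c ^ n := by
  let K : Subgroup (FreeGroup α) := Subgroup.closure {a, b}
  have hcomm : ∀ x y : K, x * y = y * x := by
    have : IsMulCommutative K := by
      refine Subgroup.isMulCommutative_closure ?_
      rintro x (rfl | rfl) y (rfl | rfl)
      · rfl
      · exact h.eq
      · exact h.eq.symm
      · rfl
    exact fun x y => this.is_comm.comm x y
  have hfree : IsFreeGroup K := inferInstance
  let e := IsFreeGroup.toFreeGroup K
  have hsub : Subsingleton (IsFreeGroup.Generators K) := by
    refine ⟨fun x y => FreeGroup.of_commute ?_⟩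
    have := congrArg e (hcomm (e.symm (FreeGroup.of x)) (e.symm (FreeGroup.of y)))
    simp only [map_mul, MulEquiv.apply_symm_apply] at this
    exact this
  have hcyc : ∃ c : FreeGroup (IsFreeGroup.Generators K), ∀ w, ∃ m : ℤ, c ^ m = w := by
    rcases isEmpty_or_nonempty (IsFreeGroup.Generators K) with hE | ⟨⟨x⟩⟩
    · exact ⟨1, fun w => ⟨0, Subsingleton.elim _ _⟩⟩
    · have : Unique (IsFreeGroup.Generators K) := ⟨⟨x⟩, fun y => Subsingleton.elim _ _⟩
      obtain ⟨c, hc⟩ := (inferInstance : IsCyclic (FreeGroup (IsFreeGroup.Generators K)))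
      exact ⟨c, fun w => Subgroup.mem_zpowers_iff.mp (hc w)⟩
  obtain ⟨c, hc⟩ := hcyc
  obtain ⟨m, hm⟩ := hc (e ⟨a, Subgroup.subset_closure (by simp)⟩)
  obtain ⟨n, hn⟩ := hc (e ⟨b, Subgroup.subset_closure (by simp)⟩)
  refine ⟨(e.symm c : K), m, n, ?_, ?_⟩
  · have := congrArg (fun t => ((e.symm t : K) : FreeGroup α)) hm
    simpa using this.symm
  · have := congrArg (fun t => ((e.symm t : K) : FreeGroup α)) hn
    simpa using this.symm

theorem FreeGroup.commute_trans {a b c : FreeGroup α} (ha : a ≠ 1) (hb : Commute a b)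
    (hc : Commute a c) : Commute b c := by
  obtain ⟨d, m, n, rfl, rfl⟩ := FreeGroup.exists_common_root hb
  have hm : m ≠ 0 := by rintro rfl; simp at ha
  exact (commute_of_zpow hm hc).zpow_left n

/-- An element with a homomorphism to `ℤ` of value `1` generates its centralizer. -/
theorem FreeGroup.centralizer_of_hom {t w : FreeGroup α} (ε : FreeGroup α →* Multiplicative ℤ)
    (ht : ε t = Multiplicative.ofAdd 1) {m : ℤ} (hm : m ≠ 0) (h : Commute w (t ^ m)) :
    ∃ n : ℤ, w = t ^ n := by
  have h1 : Commute t w := commute_of_zpow hm h.symm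
  obtain ⟨c, p, q, rfl, rfl⟩ := FreeGroup.exists_common_root h1
  have h2 : p * Multiplicative.toAdd (ε c) = 1 := by
    have := congrArg Multiplicative.toAdd ht
    simpa [map_zpow, toAdd_zpow] using this
  rcases Int.isUnit_iff.mp (IsUnit.of_mul_eq_one _ h2) with rfl | rfl
  · exact ⟨q, by simp⟩
  · exact ⟨-q, by simp⟩

/-- A group all of whose abelian quotients are trivial maps trivially to free groups. -/
theorem FreeGroup.hom_eq_one_of_perfect {P : Type*} [Group P]
    (hP : ∀ f : P →* Multiplicative ℤ, f = 1) (f : P →* FreeGroup α) : f = 1 := by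
  have hfree : IsFreeGroup f.range := inferInstance
  let e := IsFreeGroup.toFreeGroup f.range
  rcases isEmpty_or_nonempty (IsFreeGroup.Generators f.range) with hE | ⟨⟨x⟩⟩
  · ext p
    have : f.rangeRestrict p = 1 := e.injective (Subsingleton.elim _ _)
    simpa using congrArg (fun t : f.range => (t : FreeGroup α)) this
  · exfalso
    let g : FreeGroup (IsFreeGroup.Generators f.range) →* Multiplicative ℤ :=
      FreeGroup.lift fun _ => Multiplicative.ofAdd 1
    have h := hP ((g.comp e.toMonoidHom).comp f.rangeRestrict)
    obtain ⟨p, hp⟩ := f.rangeRestrict_surjective (e.symm (FreeGroup.of x))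
    have := DFunLike.congr_fun h p
    simp only [MonoidHom.comp_apply, hp, MonoidHom.one_apply] at this
    simp [g] at this

/-- The retraction killing the letters outside a finite set. -/
noncomputable def FreeGroup.retr (T : Set α) : FreeGroup α →* FreeGroup α :=
  open Classical in FreeGroup.lift fun x => if x ∈ T then FreeGroup.of x else 1

theorem FreeGroup.retr_mono {T T' : Set α} (h : T ⊆ T') {w : FreeGroup α}
    (hw : FreeGroup.retr T w = w) : FreeGroup.retr T' w = w := by
  have : (FreeGroup.retr T').comp (FreeGroup.retr T) = FreeGroup.retr T := by
    refine FreeGroup.ext_hom _ _ fun x => ?_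
    by_cases hx : x ∈ T
    · simp [FreeGroup.retr, hx, h hx]
    · simp [FreeGroup.retr, hx]
  rw [← hw]; exact DFunLike.congr_fun this w

theorem FreeGroup.exists_retr (w : FreeGroup α) : ∃ T : Finset α, FreeGroup.retr (T : Set α) w = w := by
  classical
  induction w using FreeGroup.induction_on with
  | C1 => exact ⟨∅, by simp⟩
  | of x => exact ⟨{x}, by simp [FreeGroup.retr]⟩
  | inv_of x _ => exact ⟨{x}, by simp [FreeGroup.retr]⟩
  | mul x y hx hy =>
    obtain ⟨S, hS⟩ := hx
    obtain ⟨T, hT⟩ := hy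
    refine ⟨S ∪ T, ?_⟩
    rw [map_mul, FreeGroup.retr_mono (by simp) hS, FreeGroup.retr_mono (by simp) hT]

/-- If only one letter survives, the image is cyclic. -/
theorem FreeGroup.hom_single {G : Type*} [Group G] (f : FreeGroup α →* G) (x₀ : α)
    (h : ∀ x, x ≠ x₀ → f (FreeGroup.of x) = 1) (w : FreeGroup α) :
    ∃ n : ℤ, f w = f (FreeGroup.of x₀) ^ n := by
  induction w using FreeGroup.induction_on with
  | C1 => exact ⟨0, by simp⟩
  | of x =>
    rcases eq_or_ne x x₀ with rfl | hx
    · exact ⟨1, by simp⟩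
    · exact ⟨0, by simp [h x hx]⟩
  | inv_of x _ =>
    rcases eq_or_ne x x₀ with rfl | hx
    · exact ⟨-1, by simp⟩
    · exact ⟨0, by simp [h x hx]⟩
  | mul x y hx hy =>
    obtain ⟨m, hm⟩ := hx
    obtain ⟨n, hn⟩ := hy
    exact ⟨m + n, by rw [map_mul, hm, hn, zpow_add]⟩

/-- A fixed element of an endomorphism conjugating letters along a map moving all of its
letters away, except possibly one, is conjugate to a power of that letter. -/
theorem FreeGroup.fixed_of_moved {A : FreeGroup α →* FreeGroup α} {π : α → α}
    (hA : ∀ x, ∃ u, A (FreeGroup.of x) = u * FreeGroup.of (π x) * u⁻¹) {w : FreeGroup α}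
    (hw : A w = w) {T : Set α} (hT : FreeGroup.retr T w = w) (x₀ : α)
    (hx₀ : π x₀ = x₀) (hπ : ∀ x ∈ T, x ≠ x₀ → π x ∉ T) :
    ∃ (u : FreeGroup α) (n : ℤ), w = u * FreeGroup.of x₀ ^ n * u⁻¹ := by
  classical
  let f := (FreeGroup.retr T).comp (A.comp (FreeGroup.retr T))
  have hf : f w = w := by simp [f, hT, hw]
  have hk : ∀ x, x ≠ x₀ → f (FreeGroup.of x) = 1 := by
    intro x hx
    by_cases hxT : x ∈ T
    · obtain ⟨u, hu⟩ := hA x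
      have h1 : FreeGroup.retr T (FreeGroup.of x) = FreeGroup.of x := by simp [FreeGroup.retr, hxT]
      have h2 : FreeGroup.retr T (FreeGroup.of (π x)) = 1 := by
        simp [FreeGroup.retr, hπ x hxT hx]
      simp [f, h1, hu, h2]
    · have h1 : FreeGroup.retr T (FreeGroup.of x) = 1 := by simp [FreeGroup.retr, hxT]
      simp [f, h1]
  obtain ⟨n, hn⟩ := FreeGroup.hom_single f x₀ hk w
  rw [hf] at hn
  by_cases hxT : x₀ ∈ T
  · obtain ⟨u, hu⟩ := hA x₀
    have h1 : FreeGroup.retr T (FreeGroup.of x₀) = FreeGroup.of x₀ := by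
      simp [FreeGroup.retr, hxT]
    have h2 : f (FreeGroup.of x₀) = FreeGroup.retr T u * FreeGroup.of x₀ *
        (FreeGroup.retr T u)⁻¹ := by simp [f, h1, hu, hx₀]
    exact ⟨FreeGroup.retr T u, n, by rw [hn, h2, conj_zpow]⟩
  · have h1 : FreeGroup.retr T (FreeGroup.of x₀) = 1 := by simp [FreeGroup.retr, hxT]
    have h2 : f (FreeGroup.of x₀) = 1 := by simp [f, h1]
    exact ⟨1, 0, by rw [hn, h2]; simp⟩

theorem FreeGroup.fixed_of_all_moved {A : FreeGroup α →* FreeGroup α} {π : α → α}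
    (hA : ∀ x, ∃ u, A (FreeGroup.of x) = u * FreeGroup.of (π x) * u⁻¹) {w : FreeGroup α}
    (hw : A w = w) {T : Set α} (hT : FreeGroup.retr T w = w) (hπ : ∀ x ∈ T, π x ∉ T) :
    w = 1 := by
  classical
  have hf : (FreeGroup.retr T).comp (A.comp (FreeGroup.retr T)) = 1 := by
    refine FreeGroup.ext_hom _ _ fun x => ?_
    by_cases hxT : x ∈ T
    · obtain ⟨u, hu⟩ := hA x
      simp [FreeGroup.retr, hxT, hu, hπ x hxT]
    · simp [FreeGroup.retr, hxT]
  have := DFunLike.congr_fun hf w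
  simpa [hT, hw] using this

/-- Letters acting by partial translations on a finite set. -/
theorem exists_perm_translate {G : Type*} [Group G] (B : Finset G) (g : G) :
    ∃ p : Equiv.Perm B, ∀ (x : B) (hx : g * x ∈ B), p x = ⟨g * x, hx⟩ := by
  classical
  let e : {x : B // g * x ∈ B} ≃ {x : B // g⁻¹ * x ∈ B} :=
    { toFun := fun x => ⟨⟨g * x.1, x.2⟩, by simp⟩
      invFun := fun x => ⟨⟨g⁻¹ * x.1, x.2⟩, by simp⟩
      left_inv := fun x => by ext; simp
      right_inv := fun x => by ext; simp }
  refine ⟨e.extendSubtype, fun x hx => ?_⟩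
  rw [Equiv.extendSubtype_apply_of_mem e x hx]
  rfl

instance FreeGroup.residuallyFinite : Group.ResiduallyFinite (FreeGroup α) := by
  classical
  refine Group.residuallyFinite_of_forall_exists_finite_monoidHom fun w hw => ?_
  let B : Finset (FreeGroup α) := (w.toWord.tails.map FreeGroup.mk).toFinset
  choose p hp using fun x : α => exists_perm_translate B (FreeGroup.of x)
  refine ⟨Equiv.Perm B, inferInstance, inferInstance, FreeGroup.lift p, fun h => hw ?_⟩
  have key : ∀ L : List (α × Bool), L <:+ w.toWord → ∃ (h1 : (1 : FreeGroup α) ∈ B)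
      (h2 : FreeGroup.mk L ∈ B), FreeGroup.lift p (FreeGroup.mk L) ⟨1, h1⟩ = ⟨FreeGroup.mk L, h2⟩ := by
    intro L
    have hmem : ∀ L : List (α × Bool), L <:+ w.toWord → FreeGroup.mk L ∈ B := by
      intro L hL
      simp only [B, List.mem_toFinset, List.mem_map, List.mem_tails]
      exact ⟨L, hL, rfl⟩
    induction L with
    | nil =>
      intro hL
      have := hmem [] hL
      refine ⟨this, this, ?_⟩
      have e : (FreeGroup.mk [] : FreeGroup α) = 1 := rfl
      simp [e]
    | cons a L ih =>
      intro hL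
      have hL' : L <:+ w.toWord := (List.suffix_cons a L).trans hL
      obtain ⟨h1, h2, h3⟩ := ih hL'
      refine ⟨h1, hmem _ hL, ?_⟩
      obtain ⟨x, b⟩ := a
      cases b with
      | true =>
        have e : FreeGroup.mk ((x, true) :: L) = FreeGroup.of x * FreeGroup.mk L := rfl
        have h4 := hmem _ hL
        rw [e] at h4
        simp only [e, map_mul, Equiv.Perm.mul_apply, h3, FreeGroup.lift_apply_of]
        exact hp x _ h4
      | false =>
        have e : FreeGroup.mk ((x, false) :: L) = (FreeGroup.of x)⁻¹ * FreeGroup.mk L := rfl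
        have h4 := hmem _ hL
        rw [e] at h4
        simp only [e, map_mul, map_inv, Equiv.Perm.mul_apply, h3, FreeGroup.lift_apply_of]
        rw [Equiv.Perm.inv_eq_iff_eq, hp x ⟨_, h4⟩ (by simpa using h2)]
        simp
  obtain ⟨h1, h2, h3⟩ := key w.toWord (List.suffix_refl _)
  have h4 := congrArg Subtype.val h3
  simp only [FreeGroup.mk_toWord] at h4
  rw [h] at h4
  exact h4.symm

end FreeGroups

end BraidB

namespace BraidB

section Iota

@[elab_as_elim]
theorem E.induction {k : ℕ} {p : E k → Prop} (e : E k) (one : p 1)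
    (mul : ∀ x y, p x → p y → p (x * y)) (inv : ∀ x, p x → p x⁻¹)
    (gen : ∀ i, i + 1 < k → p (bE k (Br.σ k i)))
    (top : 0 < k → p (xE k (X k (k - 1)))) : p e := by
  rw [E.eq_mul e]
  refine mul _ _ ?_ ?_
  · refine F.induction e.left (by simpa using one) (fun x y hx hy => ?_) (fun x hx => ?_) ?_
    · rw [map_mul]; exact mul _ _ hx hy
    · rw [map_inv]; exact inv _ hx
    · intro i hi
      refine down_induction (p := fun i => p (xE k (X k i))) (top (by omega)) (fun i hi ih => ?_) i hi
      rw [E.bE_conj_X hi]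
      exact mul _ _ (mul _ _ (gen i hi) ih) (inv _ (gen i hi))
  · refine Br.induction e.right (by simpa using one) (fun x y hx hy => ?_) (fun x hx => ?_) ?_
    · rw [map_mul]; exact mul _ _ hx hy
    · rw [map_inv]; exact inv _ hx
    · exact gen

theorem isAnnular_sq (k : ℕ) :
    IsAnnular k (Br.σ (k + 1)) (Br.σ (k + 1) (k - 1) ^ 2) := by
  refine ⟨(Br.isBraid_σ _).mono (by omega), fun i hi => ?_, fun i hi => ?_⟩
  · have : Commute (Br.σ (k + 1) i) (Br.σ (k + 1) (k - 1)) :=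
      (Br.isBraid_σ (k + 1)).comm i (k - 1) (by omega) (by omega)
    exact (this.pow_right 2).eq
  · have e : k - 1 = i + 1 := by omega
    have := (Br.isBraid_σ (k + 1)).braid i (by omega)
    rw [e]
    generalize Br.σ (k + 1) i = s at *
    generalize Br.σ (k + 1) (i + 1) = r at *
    have h1 : r * (s * r ^ 2 * s) = (s * r ^ 2 * s) * r := by
      calc r * (s * r ^ 2 * s) = (r * s * r) * (r * s) := by simp only [pow_two, mul_assoc]
        _ = (s * r) * (s * r * s) := by rw [← this]; simp only [mul_assoc]
        _ = _ := by rw [this]; simp only [pow_two, mul_assoc]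
    have h2 : Commute r (s * r ^ 2 * s) := h1
    have h3 := (h2.pow_left 2).eq
    rw [← h3]; simp only [mul_assoc]

/-- The annular braid group as the subgroup of braids fixing the last strand. -/
noncomputable def iota (k : ℕ) : E k →* Br (k + 1) := E.lift (isAnnular_sq k)

theorem iota_σ {k i : ℕ} (hi : i + 1 < k) : iota k (bE k (Br.σ k i)) = Br.σ (k + 1) i :=
  E.lift_σ _ hi

theorem iota_top {k : ℕ} (hk : 0 < k) :
    iota k (xE k (X k (k - 1))) = Br.σ (k + 1) (k - 1) ^ 2 := E.lift_X_top _ hk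

theorem iota_bE {k : ℕ} (b : Br k) : iota k (bE k b) = Br.incl (Nat.le_succ k) b := by
  have : (iota k).comp (bE k) = Br.incl (Nat.le_succ k) :=
    Br.hom_ext fun i hi => by
      rw [MonoidHom.comp_apply, iota_σ hi, Br.incl_σ _ hi]
  exact DFunLike.congr_fun this b

/-- Forget the last letter. -/
def kill (k : ℕ) : F (k + 1) →* F k := F.lift (X k)

theorem kill_X (k i : ℕ) : kill k (X (k + 1) i) = X k i := by
  by_cases hi : i < k + 1
  · exact F.lift_X _ hi
  · rw [X_eq_one (by omega), X_eq_one (by omega), map_one]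

/-- The inclusion of free groups. -/
def up (k : ℕ) : F k →* F (k + 1) := F.lift (X (k + 1))

theorem up_X {k i : ℕ} (hi : i < k) : up k (X k i) = X (k + 1) i := F.lift_X _ hi

theorem kill_up (k : ℕ) (w : F k) : kill k (up k w) = w := by
  have : (kill k).comp (up k) = MonoidHom.id _ :=
    F.hom_ext fun i hi => by simp [up_X hi, kill_X]
  exact DFunLike.congr_fun this w

theorem kill_act_incl {k : ℕ} (b : Br k) (v : F (k + 1)) :
    kill k (act (k + 1) (Br.incl (Nat.le_succ k) b) v) = act k b (kill k v) := by
  induction b using Br.induction generalizing v with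
  | one => simp
  | mul x y hx hy => simp only [map_mul, MulAut.mul_apply, hx, hy]
  | inv x hx =>
    have := hx ((act (k + 1) (Br.incl (Nat.le_succ k) x))⁻¹ v)
    rw [map_inv, map_inv, map_inv]
    rw [MulAut.apply_inv_self] at this
    rw [this, MulAut.inv_apply_self]
  | gen i hi =>
    have hi' : i + 1 < k + 1 := by omega
    have : (kill k).comp (act (k + 1) (Br.σ (k + 1) i)).toMonoidHom =
        (act k (Br.σ k i)).toMonoidHom.comp (kill k) := by
      refine F.hom_ext fun j hj => ?_
      simp only [MonoidHom.comp_apply, MulEquiv.coe_toMonoidHom]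
      rcases eq_or_ne j i with rfl | h1
      · simp [act_σ_self hi, act_σ_self hi', kill_X]
      rcases eq_or_ne j (i + 1) with rfl | h2
      · simp [act_σ_succ hi, act_σ_succ hi', kill_X]
      · rw [act_σ_of_ne hi' h1 h2, kill_X, act_σ_of_ne hi h1 h2]
    rw [Br.incl_σ _ hi]
    exact DFunLike.congr_fun this v

theorem iota_act_aux {k : ℕ} (e : E k) :
    (∀ v, kill k (act (k + 1) (iota k e) v) = act k e.right (kill k v)) ∧
    ∃ g, act (k + 1) (iota k e) (X (k + 1) k) = g⁻¹ * X (k + 1) k * g ∧ kill k g = e.left := by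
  induction e using E.induction with
  | one => exact ⟨by simp, 1, by simp⟩
  | mul x y hx hy =>
    obtain ⟨hx1, g, hx2, hx3⟩ := hx
    obtain ⟨hy1, g', hy2, hy3⟩ := hy
    refine ⟨fun v => ?_, g * act (k + 1) (iota k x) g', ?_, ?_⟩
    · simp only [map_mul, MulAut.mul_apply, hx1, hy1, SemidirectProduct.mul_right]
    · simp only [map_mul, MulAut.mul_apply, hy2, map_inv, hx2]; group
    · simp [hx1, hx3, hy3]
  | inv x hx =>
    obtain ⟨hx1, g, hx2, hx3⟩ := hx
    have key : ∀ v, kill k ((act (k + 1) (iota k x))⁻¹ v) = (act k x.right)⁻¹ (kill k v) := by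
      intro v
      have := hx1 ((act (k + 1) (iota k x))⁻¹ v)
      rw [MulAut.apply_inv_self] at this
      rw [this, MulAut.inv_apply_self]
    refine ⟨fun v => ?_, ((act (k + 1) (iota k x))⁻¹ g)⁻¹, ?_, ?_⟩
    · simp only [map_inv, SemidirectProduct.inv_right, key]
    · have := congrArg (fun t => (act (k + 1) (iota k x))⁻¹ t) hx2
      simp only [MulAut.inv_apply_self, map_mul, map_inv] at this ⊢
      nth_rewrite 2 [this]
      group
    · rw [map_inv, key, hx3]; simp
  | gen i hi =>
    refine ⟨fun v => ?_, 1, ?_, by simp⟩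
    · rw [iota_bE, kill_act_incl]; rfl
    · rw [iota_σ hi, act_σ_of_ne (by omega) (by omega) (by omega)]; simp
  | top hk =>
    rw [iota_top hk]
    obtain ⟨m, rfl⟩ : ∃ m, k = m + 1 := ⟨k - 1, by omega⟩
    have hi : m + 1 < m + 1 + 1 := by omega
    simp only [Nat.add_sub_cancel]
    refine ⟨fun v => ?_, X _ m, ?_, by simp [kill_X]⟩
    · have : (kill (m + 1)).comp (act (m + 1 + 1) (Br.σ (m + 1 + 1) m ^ 2)).toMonoidHom =
        (kill (m + 1)) := by
        refine F.hom_ext fun j hj => ?_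
        simp only [MonoidHom.comp_apply, MulEquiv.coe_toMonoidHom, pow_two, map_mul,
          MulAut.mul_apply]
        rcases eq_or_ne j m with rfl | h1
        · simp [act_σ_self hi, act_σ_succ hi, kill_X, X_eq_one]
        rcases eq_or_ne j (m + 1) with rfl | h2
        · simp [act_σ_self hi, act_σ_succ hi, kill_X, X_eq_one]
        · simp [act_σ_of_ne hi h1 h2]
      simpa using DFunLike.congr_fun this v
    · simp only [pow_two, map_mul, MulAut.mul_apply]
      rw [act_σ_succ hi, act_σ_self hi]

theorem kill_act_iota {k : ℕ} (e : E k) (v : F (k + 1)) :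
    kill k (act (k + 1) (iota k e) v) = act k e.right (kill k v) := (iota_act_aux e).1 v

/-- Coset representatives `σ_{k-1} ⋯ σ_{k-d}`. -/
noncomputable def cr (k : ℕ) : ℕ → Br (k + 1)
  | 0 => 1
  | d + 1 => cr k d * Br.σ (k + 1) (k - 1 - d)

theorem cr_comm {k d j : ℕ} (h : j + 1 + d < k) :
    Commute (cr k d) (Br.σ (k + 1) j) := by
  induction d with
  | zero => exact Commute.one_left _
  | succ d ih =>
    have : Commute (Br.σ (k + 1) j) (Br.σ (k + 1) (k - 1 - d)) :=
      (Br.isBraid_σ (k + 1)).comm _ _ (by omega) (by omega)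
    exact (ih (by omega)).mul_left this.symm

theorem cr_shift {k d j : ℕ} (hd : d ≤ k) (h : k < j + 1 + d) (hj : j + 1 < k) :
    cr k d * Br.σ (k + 1) (j + 1) = Br.σ (k + 1) j * cr k d := by
  induction d with
  | zero => omega
  | succ d ih =>
    rcases lt_or_ge k (j + 1 + d) with h1 | h1
    · have : Commute (Br.σ (k + 1) (k - 1 - d)) (Br.σ (k + 1) (j + 1)) :=
        (Br.isBraid_σ (k + 1)).comm _ _ (by omega) (by omega)
      rw [cr, mul_assoc, this.eq, ← mul_assoc, ih (by omega) h1, mul_assoc]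
    · obtain ⟨d, rfl⟩ : ∃ d', d = d' + 1 := ⟨d - 1, by omega⟩
      have e1 : k - 1 - (d + 1) = j := by omega
      have e2 : k - 1 - d = j + 1 := by omega
      have hb := (Br.isBraid_σ (k + 1)).braid j (by omega)
      have hc := cr_comm (k := k) (d := d) (j := j) (by omega)
      simp only [cr, e1, e2]
      calc cr k d * Br.σ (k + 1) (j + 1) * Br.σ (k + 1) j * Br.σ (k + 1) (j + 1)
          = cr k d * (Br.σ (k + 1) (j + 1) * Br.σ (k + 1) j * Br.σ (k + 1) (j + 1)) := by
            simp only [mul_assoc]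
        _ = (cr k d * Br.σ (k + 1) j) * (Br.σ (k + 1) (j + 1) * Br.σ (k + 1) j) := by
            rw [← hb]; simp only [mul_assoc]
        _ = _ := by rw [hc.eq]; simp only [mul_assoc]

theorem cr_sq_mem {k d : ℕ} (hd : d < k) :
    cr k d * Br.σ (k + 1) (k - 1 - d) ^ 2 * (cr k d)⁻¹ ∈ (iota k).range := by
  induction d with
  | zero => exact ⟨xE k (X k (k - 1)), by rw [iota_top (by omega)]; simp [cr]⟩
  | succ d ih =>
    obtain ⟨j, hj⟩ : ∃ j, k - 1 - (d + 1) = j := ⟨_, rfl⟩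
    have e2 : k - 1 - d = j + 1 := by omega
    have hb := (Br.isBraid_σ (k + 1)).braid j (by omega)
    have hc := (cr_comm (k := k) (d := d) (j := j) (by omega)).eq
    have hmem := ih (by omega)
    have hs : Br.σ (k + 1) j ∈ (iota k).range := ⟨_, iota_σ (k := k) (i := j) (by omega)⟩
    simp only [cr, e2, hj] at *
    have : cr k d * Br.σ (k + 1) (j + 1) * Br.σ (k + 1) j ^ 2 * (cr k d * Br.σ (k + 1) (j + 1))⁻¹
        = (Br.σ (k + 1) j)⁻¹ * (cr k d * Br.σ (k + 1) (j + 1) ^ 2 * (cr k d)⁻¹) *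
          Br.σ (k + 1) j := by
      generalize Br.σ (k + 1) j = s at *
      generalize Br.σ (k + 1) (j + 1) = r at *
      have h1 : r * s * r⁻¹ = s⁻¹ * r * s := by
        rw [mul_inv_eq_iff_eq_mul, mul_assoc, mul_assoc, eq_inv_mul_iff_mul_eq, ← mul_assoc,
          ← mul_assoc, hb]
      have h2 : r * s ^ 2 * r⁻¹ = s⁻¹ * r ^ 2 * s := by
        calc r * s ^ 2 * r⁻¹ = (r * s * r⁻¹) * (r * s * r⁻¹) := by simp [pow_two, mul_assoc]
          _ = _ := by rw [h1]; simp [pow_two, mul_assoc]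
      have h3 : cr k d * s⁻¹ = s⁻¹ * cr k d := by
        rw [eq_inv_mul_iff_mul_eq, ← mul_assoc, ← hc, mul_inv_cancel_right]
      calc _ = cr k d * (r * s ^ 2 * r⁻¹) * (cr k d)⁻¹ := by simp [mul_assoc]
        _ = (cr k d * s⁻¹) * r ^ 2 * (s * (cr k d)⁻¹) := by rw [h2]; simp only [mul_assoc]
        _ = s⁻¹ * cr k d * r ^ 2 * (cr k d * s⁻¹)⁻¹ := by
            rw [mul_inv_rev, inv_inv, h3]
        _ = _ := by rw [h3, mul_inv_rev, inv_inv, ← mul_assoc]; simp only [mul_assoc]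
    rw [this]
    exact mul_mem (mul_mem (inv_mem hs) hmem) hs

theorem exists_iota_mul_cr {k : ℕ} (b : Br (k + 1)) :
    ∃ e d, d ≤ k ∧ b = iota k e * cr k d := by
  have step : ∀ d j, d ≤ k → j < k →
      ∃ h ∈ (iota k).range, ∃ d', d' ≤ k ∧ cr k d * Br.σ (k + 1) j = h * cr k d' := by
    intro d j hd hj
    have hs : ∀ j, j + 1 < k → Br.σ (k + 1) j ∈ (iota k).range := fun j hj => ⟨_, iota_σ hj⟩
    rcases lt_trichotomy (j + 1 + d) k with h | h | h
    · exact ⟨_, hs j (by omega), d, hd, (cr_comm h).eq⟩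
    · exact ⟨1, one_mem _, d + 1, by omega, by rw [cr, one_mul]; congr 2; omega⟩
    · rcases eq_or_ne (j + d) k with h1 | h1
      · obtain ⟨d, rfl⟩ : ∃ d', d = d' + 1 := ⟨d - 1, by omega⟩
        refine ⟨_, cr_sq_mem (k := k) (d := d) (by omega), d, by omega, ?_⟩
        rw [cr, show k - 1 - d = j by omega]; simp [pow_two, mul_assoc]
      · obtain ⟨j, rfl⟩ : ∃ j', j = j' + 1 := ⟨j - 1, by omega⟩
        exact ⟨_, hs j (by omega), d, hd, cr_shift hd (by omega) hj⟩
  have step' : ∀ d j, d ≤ k → j < k →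
      ∃ h ∈ (iota k).range, ∃ d', d' ≤ k ∧ cr k d * (Br.σ (k + 1) j)⁻¹ = h * cr k d' := by
    intro d j hd hj
    have hs : ∀ j, j + 1 < k → Br.σ (k + 1) j ∈ (iota k).range := fun j hj => ⟨_, iota_σ hj⟩
    rcases lt_trichotomy (j + 1 + d) k with h | h | h
    · exact ⟨_, inv_mem (hs j (by omega)), d, hd, (cr_comm h).inv_right.eq⟩
    · have hm := cr_sq_mem (k := k) (d := d) (by omega)
      refine ⟨_, inv_mem hm, d + 1, by omega, ?_⟩
      rw [cr, show k - 1 - d = j by omega]; simp [pow_two, mul_assoc]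
    · rcases eq_or_ne (j + d) k with h1 | h1
      · obtain ⟨d, rfl⟩ : ∃ d', d = d' + 1 := ⟨d - 1, by omega⟩
        refine ⟨1, one_mem _, d, by omega, ?_⟩
        rw [cr, show k - 1 - d = j by omega]; simp
      · obtain ⟨j, rfl⟩ : ∃ j', j = j' + 1 := ⟨j - 1, by omega⟩
        refine ⟨_, inv_mem (hs j (by omega)), d, hd, ?_⟩
        have := cr_shift hd (by omega) hj
        rw [mul_inv_eq_iff_eq_mul, mul_assoc, this]; simp
  suffices h : ∃ h ∈ (iota k).range, ∃ d, d ≤ k ∧ b = h * cr k d by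
    obtain ⟨_, ⟨e, rfl⟩, d, hd, hb⟩ := h
    exact ⟨e, d, hd, hb⟩
  induction b using Br.induction_right with
  | one => exact ⟨1, one_mem _, 0, by omega, by simp [cr]⟩
  | mul x i hi hx =>
    obtain ⟨h, hh, d, hd, rfl⟩ := hx
    obtain ⟨h', hh', d', hd', e⟩ := step d i hd (by omega)
    exact ⟨h * h', mul_mem hh hh', d', hd', by rw [mul_assoc, e, mul_assoc]⟩
  | mul_inv x i hi hx =>
    obtain ⟨h, hh, d, hd, rfl⟩ := hx
    obtain ⟨h', hh', d', hd', e⟩ := step' d i hd (by omega)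
    exact ⟨h * h', mul_mem hh hh', d', hd', by rw [mul_assoc, e, mul_assoc]⟩

theorem perm_iota {k : ℕ} (e : E k) : Br.perm (k + 1) (iota k e) = Br.perm k e.right := by
  have : (Br.perm (k + 1)).comp (iota k) = (Br.perm k).comp SemidirectProduct.rightHom := by
    refine E.hom_ext (fun i hi => ?_) (fun hk => ?_)
    · simp [iota_σ hi, Br.perm_σ hi, Br.perm_σ (k := k + 1) (i := i) (by omega)]
    · have : k - 1 + 1 < k + 1 := by omega
      rw [MonoidHom.comp_apply, MonoidHom.comp_apply, iota_top hk, map_pow, Br.perm_σ this,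
        SemidirectProduct.rightHom_inl, map_one, pow_two, Equiv.swap_mul_self]
  exact DFunLike.congr_fun this e

theorem perm_cr {k d : ℕ} (hd : d ≤ k) : Br.perm (k + 1) (cr k d) (k - d) = k := by
  induction d with
  | zero => simp [cr]
  | succ d ih =>
    have h : k - 1 - d + 1 < k + 1 := by omega
    rw [cr, map_mul, Equiv.Perm.mul_apply, Br.perm_σ h,
      show k - (d + 1) = k - 1 - d by omega, Equiv.swap_apply_left,
      show k - 1 - d + 1 = k - d by omega, ih (by omega)]

theorem mem_range_iota {k : ℕ} {b : Br (k + 1)} (h : Br.perm (k + 1) b k = k) :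
    ∃ e, iota k e = b := by
  obtain ⟨e, d, hd, rfl⟩ := exists_iota_mul_cr b
  rw [map_mul, Equiv.Perm.mul_apply, perm_iota] at h
  have h1 : Br.perm k e.right k = k := Br.perm_apply_of_le _ le_rfl
  have h2 := (Br.perm k e.right).injective (h.trans h1.symm)
  have h3 := (Br.perm (k + 1) (cr k d)).injective (h2.trans (perm_cr hd).symm)
  have : d = 0 := by omega
  subst this
  exact ⟨e, by simp [cr]⟩

/-- Exponent count of the `i`-th letter. -/
def expo (k i : ℕ) : F k →* Multiplicative ℤ :=
  F.lift fun j => if j = i then Multiplicative.ofAdd 1 else 1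

theorem expo_X_self {k i : ℕ} (h : i < k) : expo k i (X k i) = Multiplicative.ofAdd 1 := by
  simp [expo, h]

theorem expo_X_ne {k i j : ℕ} (h : j ≠ i) : expo k i (X k j) = 1 := by
  by_cases hj : j < k
  · simp [expo, hj, h]
  · rw [X_eq_one (by omega), map_one]

theorem X_conj_eq {k i j : ℕ} (hi : i < k) {u : F k} (h : X k i = u * X k j * u⁻¹) : i = j := by
  by_contra hne
  have := congrArg (expo k i) h
  rw [map_mul, map_mul, map_inv, expo_X_self hi, expo_X_ne (Ne.symm hne), mul_one,
    mul_inv_cancel] at this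
  exact absurd this (by decide)

theorem commute_X_zpow {k i : ℕ} (hi : i < k) {w : F k} {m : ℤ} (hm : m ≠ 0)
    (h : Commute w (X k i ^ m)) : ∃ n : ℤ, w = X k i ^ n :=
  FreeGroup.centralizer_of_hom (expo k i) (expo_X_self hi) hm h

theorem kill_eq_one_of_commute {k : ℕ} {g : F (k + 1)} (h : Commute g (X (k + 1) k)) :
    kill k g = 1 := by
  obtain ⟨n, rfl⟩ := commute_X_zpow (k := k + 1) (i := k) (m := 1) (by omega) one_ne_zero (by simpa using h)
  rw [map_zpow, kill_X, X_eq_one le_rfl, one_zpow]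

theorem act_injective (k : ℕ) : Function.Injective (act k) := by
  rw [injective_iff_map_eq_one]
  induction k with
  | zero =>
    intro b _
    induction b using Br.induction with
    | one => rfl
    | mul x y hx hy =>
      rw [hx (MulEquiv.ext fun v => Subsingleton.elim _ _),
        hy (MulEquiv.ext fun v => Subsingleton.elim _ _), one_mul]
    | inv x hx => rw [hx (MulEquiv.ext fun v => Subsingleton.elim _ _), inv_one]
    | gen i hi => omega
  | succ k ih =>
    intro c hc
    have hperm : Br.perm (k + 1) c k = k := by
      obtain ⟨u, hu⟩ := act_X_conj (k + 1) c k
      rw [hc, MulAut.one_apply] at hu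
      exact (X_conj_eq (by omega) hu).symm
    obtain ⟨e, rfl⟩ := mem_range_iota hperm
    obtain ⟨h1, g, h2, h3⟩ := iota_act_aux e
    rw [hc] at h1 h2
    simp only [MulAut.one_apply] at h1 h2
    have h4 : Commute g (X (k + 1) k) := by
      rw [mul_assoc, eq_inv_mul_iff_mul_eq] at h2; exact h2
    have hr : e.right = 1 := ih _ (MulEquiv.ext fun v => by
      rw [← kill_up k v, ← h1, MulAut.one_apply])
    have hl : e.left = 1 := by rw [← h3, kill_eq_one_of_commute h4]
    have : e = 1 := SemidirectProduct.ext hl hr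
    rw [this, map_one]

theorem iota_injective (k : ℕ) : Function.Injective (iota k) := by
  rw [injective_iff_map_eq_one]
  intro e hc
  obtain ⟨h1, g, h2, h3⟩ := iota_act_aux e
  rw [hc, map_one] at h1 h2
  simp only [MulAut.one_apply] at h1 h2
  have h4 : Commute g (X (k + 1) k) := by
    rw [mul_assoc, eq_inv_mul_iff_mul_eq] at h2; exact h2
  have hr : e.right = 1 := act_injective k (MulEquiv.ext fun v => by
    rw [← kill_up k v, ← h1, map_one, MulAut.one_apply])
  have hl : e.left = 1 := by rw [← h3, kill_eq_one_of_commute h4]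
  exact SemidirectProduct.ext hl hr

end Iota

end BraidB

namespace BraidB

section Centre

variable {G H : Type*} [Group G] [Group H]

/-- The descending product `a_{m-1} ⋯ a_0`. -/
def pseq (a : ℕ → G) : ℕ → G
  | 0 => 1
  | m + 1 => a m * pseq a m

theorem pseq_congr {a b : ℕ → G} {m : ℕ} (h : ∀ j < m, a j = b j) : pseq a m = pseq b m := by
  induction m with
  | zero => rfl
  | succ m ih => rw [pseq, pseq, h m (by omega), ih fun j hj => h j (by omega)]

theorem zp_eq_pseq (k m : ℕ) : zp k m = pseq (X k) m := by
  induction m with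
  | zero => rfl
  | succ m ih => rw [zp, pseq, ih]

theorem map_pseq (f : G →* H) (a : ℕ → G) (m : ℕ) : f (pseq a m) = pseq (fun j => f (a j)) m := by
  induction m with
  | zero => simp [pseq]
  | succ m ih => simp [pseq, ih]

theorem pseq_shift {R : MulAut G} {a : ℕ → G} (h : ∀ j, R (a j) = (a 0)⁻¹ * a (j + 1) * a 0)
    (m : ℕ) : R (pseq a m) = (a 0)⁻¹ * pseq a (m + 1) := by
  induction m with
  | zero => simp [pseq]
  | succ m ih => rw [pseq, map_mul, h, ih, pseq, pseq, pseq]; simp [mul_assoc]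

theorem pow_apply_of_shift {R : MulAut G} {a b : ℕ → G}
    (h : ∀ j, R (a j) = (a 0)⁻¹ * a (j + 1) * a 0)
    (h' : ∀ j, R (b j) = (a 0)⁻¹ * b (j + 1) * a 0) (m j : ℕ) :
    (R ^ m) (b j) = (pseq a m)⁻¹ * b (j + m) * pseq a m := by
  induction m generalizing j with
  | zero => simp [pseq]
  | succ m ih =>
    rw [pow_succ', MulAut.mul_apply, ih, map_mul, map_mul, map_inv, pseq_shift h, h', ← add_assoc]
    group

/-- The product `σ_0 ⋯ σ_{m-1}`. -/
noncomputable def rho (k : ℕ) : ℕ → Br k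
  | 0 => 1
  | m + 1 => rho k m * Br.σ k m

theorem act_rho {k m : ℕ} (hm : m < k) :
    (∀ i < m, act k (rho k m) (X k i) = (X k 0)⁻¹ * X k (i + 1) * X k 0) ∧
    act k (rho k m) (X k m) = X k 0 ∧ ∀ j, m < j → act k (rho k m) (X k j) = X k j := by
  induction m with
  | zero => simp [rho]
  | succ m ih =>
    obtain ⟨h1, h2, h3⟩ := ih (by omega)
    refine ⟨fun i hi => ?_, ?_, fun j hj => ?_⟩
    · rw [rho, map_mul, MulAut.mul_apply]
      rcases eq_or_ne i m with rfl | hne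
      · rw [act_σ_self hm, map_mul, map_mul, map_inv, h2, h3 _ (by omega)]
      · rw [act_σ_of_ne hm hne (by omega), h1 i (by omega)]
    · rw [rho, map_mul, MulAut.mul_apply, act_σ_succ hm, h2]
    · rw [rho, map_mul, MulAut.mul_apply, act_σ_of_ne hm (by omega) (by omega), h3 j (by omega)]

/-- The full twist. -/
noncomputable def Z (k : ℕ) : Br k := rho k (k - 1) ^ k

theorem act_rho_mod {k : ℕ} (hk : 0 < k) (j : ℕ) : act k (rho k (k - 1)) (X k (j % k)) =
    (X k (0 % k))⁻¹ * X k ((j + 1) % k) * X k (0 % k) := by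
  obtain ⟨h1, h2, -⟩ := act_rho (k := k) (m := k - 1) (by omega)
  have hj := Nat.mod_lt j hk
  rw [Nat.zero_mod]
  rcases eq_or_ne (j % k) (k - 1) with h | h
  · have : (j + 1) % k = 0 := by
      rw [Nat.add_mod, h]; rcases eq_or_ne k 1 with rfl | h1
      · rfl
      · rw [Nat.mod_eq_of_lt (a := 1) (by omega), Nat.sub_add_cancel (by omega), Nat.mod_self]
    rw [h, this, h2]; simp
  · have : (j + 1) % k = j % k + 1 := by
      rw [Nat.add_mod, Nat.mod_eq_of_lt (a := 1) (by omega), Nat.mod_eq_of_lt (by omega)]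
    rw [this, h1 _ (by omega)]

theorem pseq_mod (k : ℕ) : pseq (fun j => X k (j % k)) k = z k := by
  rw [z, zp_eq_pseq]
  exact pseq_congr fun j hj => by rw [Nat.mod_eq_of_lt hj]

theorem act_Z (k : ℕ) (w : F k) : act k (Z k) w = (z k)⁻¹ * w * z k := by
  have : act k (Z k) = (MulAut.conj (z k))⁻¹ := mulAut_ext fun i hi => by
    have hk : 0 < k := by omega
    have := pow_apply_of_shift (R := act k (rho k (k - 1))) (act_rho_mod hk) (act_rho_mod hk) k i
    rw [Z, map_pow, MulAut.conj_inv_apply]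
    simpa [pseq_mod, Nat.mod_eq_of_lt hi] using this
  rw [this, MulAut.conj_inv_apply]

theorem Z_comm (k : ℕ) (b : Br k) : Commute b (Z k) := by
  refine act_injective k (MulEquiv.ext fun w => ?_)
  simp only [map_mul, MulAut.mul_apply, act_Z, map_inv, act_z]

theorem xE_rho_pow {k : ℕ} (hk : 0 < k) (m : ℕ) :
    (xE k (X k 0) * bE k (rho k (k - 1))) ^ m =
      xE k (pseq (fun j => X k (j % k)) m) * bE k (rho k (k - 1)) ^ m := by
  have h := pseq_shift (R := act k (rho k (k - 1))) (act_rho_mod hk)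
  induction m with
  | zero => simp [pseq]
  | succ m ih =>
    have e : pseq (fun j => X k (j % k)) (m + 1) =
        X k 0 * act k (rho k (k - 1)) (pseq (fun j => X k (j % k)) m) := by
      rw [h, Nat.zero_mod]; simp
    rw [pow_succ', ih, e, map_mul, xE_act]; group

/-- The generator of the centre of the annular braid group. -/
noncomputable def zZ (k : ℕ) : E k := xE k (z k) * bE k (Z k)

theorem zZ_eq_pow {k : ℕ} (hk : 0 < k) :
    zZ k = (bE k (rho k (k - 1)) * xE k (X k (k - 1))) ^ k := by
  have : bE k (rho k (k - 1)) * xE k (X k (k - 1)) =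
      xE k (X k 0) * bE k (rho k (k - 1)) := by
    rw [← (act_rho (k := k) (m := k - 1) (by omega)).2.1, xE_act]; simp
  rw [this, xE_rho_pow hk, pseq_mod, zZ, Z, map_pow]

theorem incl_rho {k l m : ℕ} (h : k ≤ l) (hm : m < k) : Br.incl h (rho k m) = rho l m := by
  induction m with
  | zero => simp [rho]
  | succ m ih => rw [rho, map_mul, ih (by omega), Br.incl_σ _ hm, rho]

theorem iota_zZ {k : ℕ} (hk : 0 < k) : iota k (zZ k) = Z (k + 1) := by
  obtain ⟨m, rfl⟩ : ∃ m, k = m + 1 := ⟨k - 1, by omega⟩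
  have hi : m + 1 < m + 2 := by omega
  set R := act (m + 2) (rho (m + 2) (m + 1) * Br.σ (m + 2) m)
  obtain ⟨h1, h2, -⟩ := act_rho (k := m + 2) (m := m + 1) (by omega)
  have hx : ∀ i < m, R (X _ i) = (X _ 0)⁻¹ * X _ (i + 1) * X _ 0 := fun i hi' => by
    rw [show R = act _ _ from rfl, map_mul, MulAut.mul_apply, act_σ_of_ne hi (by omega) (by omega),
      h1 i (by omega)]
  have hl : R (X _ (m + 1)) = (X _ 0)⁻¹ * X _ (m + 1) * X _ 0 := by
    rw [show R = act _ _ from rfl, map_mul, MulAut.mul_apply, act_σ_succ hi, h1 m (by omega)]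
  have hm : R (X _ m) = (X _ 0)⁻¹ * ((X _ (m + 1))⁻¹ * X _ 0 * X _ (m + 1)) * X _ 0 := by
    rw [show R = act _ _ from rfl, map_mul, MulAut.mul_apply, act_σ_self hi, map_mul, map_mul,
      map_inv, h1 m (by omega), h2]; group
  set a : ℕ → F (m + 2) := fun j => (X _ (m + 1) ^ (j / (m + 1)))⁻¹ * X _ (j % (m + 1)) *
    X _ (m + 1) ^ (j / (m + 1))
  have a0 : a 0 = X _ 0 := by simp [a]
  have ha : ∀ j, R (a j) = (a 0)⁻¹ * a (j + 1) * a 0 := fun j => by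
    have hp : R (X _ (m + 1) ^ (j / (m + 1))) = (X _ 0)⁻¹ * X _ (m + 1) ^ (j / (m + 1)) * X _ 0 := by
      rw [map_pow, hl]
      have := conj_pow (a := (X (m + 2) 0)⁻¹) (b := X (m + 2) (m + 1)) (i := j / (m + 1))
      simpa using this
    rw [a0]
    have hj := Nat.mod_lt j (show 0 < m + 1 by omega)
    have hd := Nat.div_add_mod j (m + 1)
    simp only [a, map_mul, map_inv, hp]
    rcases eq_or_ne (j % (m + 1)) m with h | h
    · have e : j + 1 = (m + 1) * (j / (m + 1) + 1) := by rw [h] at hd; rw [mul_add]; omega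
      have e1 : (j + 1) % (m + 1) = 0 := by rw [e, Nat.mul_mod_right]
      have e2 : (j + 1) / (m + 1) = j / (m + 1) + 1 := by
        rw [e, Nat.mul_div_cancel_left _ (by omega)]
      rw [h, e1, e2, hm, pow_succ']; group
    · have e : j + 1 = (j % (m + 1) + 1) + (m + 1) * (j / (m + 1)) := by omega
      have e1 : (j + 1) % (m + 1) = j % (m + 1) + 1 := by
        rw [e, Nat.add_mul_mod_self_left, Nat.mod_eq_of_lt (by omega)]
      have e2 : (j + 1) / (m + 1) = j / (m + 1) := by
        rw [e, Nat.add_mul_div_left _ _ (by omega), Nat.div_eq_of_lt (by omega), zero_add]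
      rw [e1, e2, hx _ (by omega)]; group
  have hps : pseq a (m + 1) = zp (m + 2) (m + 1) := by
    rw [zp_eq_pseq]
    exact pseq_congr fun j hj => by
      simp [a, Nat.mod_eq_of_lt hj, Nat.div_eq_of_lt hj]
  have hz : z (m + 2) = X _ (m + 1) * zp (m + 2) (m + 1) := rfl
  have e : iota (m + 1) (zZ (m + 1)) = (rho (m + 2) (m + 1) * Br.σ (m + 2) m) ^ (m + 1) := by
    rw [zZ_eq_pow hk, map_pow, map_mul, iota_bE, iota_top hk]
    simp only [Nat.add_sub_cancel]
    rw [incl_rho _ (by omega), rho, pow_two, mul_assoc]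
  refine act_injective _ (mulAut_ext fun i hi => ?_)
  rw [act_Z, e, map_pow, hz]
  change (R ^ (m + 1)) _ = _
  rcases eq_or_ne i (m + 1) with rfl | hne
  · rw [pow_apply_of_shift (b := fun _ => X (m + 2) (m + 1)) ha
      (fun j => by rw [a0]; exact hl) (m + 1) 0, hps]
    group
  · have := pow_apply_of_shift ha ha (m + 1) i
    have hi' : i < m + 1 := by omega
    have e1 : a i = X _ i := by simp [a, Nat.mod_eq_of_lt hi', Nat.div_eq_of_lt hi']
    have e2 : a (i + (m + 1)) = (X _ (m + 1))⁻¹ * X _ i * X _ (m + 1) := by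
      simp [a, Nat.mod_eq_of_lt hi', Nat.div_eq_of_lt hi']
    rw [e1, e2, hps] at this
    rw [this]; group

/-- The action of the annular braid group on its free normal subgroup. -/
noncomputable def full (k : ℕ) : E k →* MulAut (F k) :=
  SemidirectProduct.lift MulAut.conj (act k) fun b => by
    ext w v
    simp

theorem full_apply {k : ℕ} (e : E k) (w : F k) :
    full k e w = e.left * act k e.right w * e.left⁻¹ := by
  conv_lhs => rw [E.eq_mul e]
  rw [map_mul, full, SemidirectProduct.lift_inl, SemidirectProduct.lift_inr]
  simp

theorem xE_full {k : ℕ} (e : E k) (w : F k) : xE k (full k e w) = e * xE k w * e⁻¹ := by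
  rw [full_apply, map_mul, map_mul, xE_act, map_inv]
  conv_rhs => rw [E.eq_mul e]
  group

theorem expo_zero_z {k : ℕ} (hk : 0 < k) : expo k 0 (z k) = Multiplicative.ofAdd 1 := by
  obtain ⟨m, rfl⟩ : ∃ m, k = m + 1 := ⟨k - 1, by omega⟩
  rw [z]
  suffices h : ∀ l, expo (m + 1) 0 (zp (m + 1) (l + 1)) = Multiplicative.ofAdd 1 from h m
  intro l
  induction l with
  | zero => simp [zp, expo_X_self]
  | succ l ih => rw [zp, map_mul, ih, expo_X_ne (by omega), one_mul]

theorem commute_z {k : ℕ} {w : F k} {m : ℤ} (hm : m ≠ 0) (h : Commute w (z k ^ m)) :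
    ∃ j : ℤ, w = z k ^ j := by
  rcases Nat.eq_zero_or_pos k with rfl | hk
  · exact ⟨0, Subsingleton.elim _ _⟩
  · exact FreeGroup.centralizer_of_hom (expo k 0) (expo_zero_z hk) hm h

theorem zZ_zpow (k : ℕ) (j : ℤ) : zZ k ^ j = xE k (z k ^ j) * bE k (Z k ^ j) := by
  have : Commute (xE k (z k)) (bE k (Z k)) := by
    have h := xE_act k (Z k) (z k)
    rw [act_z, eq_mul_inv_iff_mul_eq] at h
    exact h
  rw [zZ, this.mul_zpow, map_zpow, map_zpow]

theorem full_zZ (k : ℕ) : full k (zZ k) = 1 := by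
  ext w
  rw [full_apply]
  simp [zZ, act_Z, mul_assoc]

theorem full_eq_one {k : ℕ} {e : E k} (h : full k e = 1) : ∃ j : ℤ, e = zZ k ^ j := by
  have hz := DFunLike.congr_fun h (z k)
  rw [full_apply, act_z, MulAut.one_apply, mul_inv_eq_iff_eq_mul] at hz
  obtain ⟨j, hj⟩ := commute_z (k := k) (w := e.left) (m := 1) one_ne_zero (by rw [zpow_one]; exact hz)
  have h1 : full k (zZ k ^ j) = 1 := by rw [map_zpow, full_zZ, one_zpow]
  have h2 : (zZ k ^ j).left = e.left := by
    rw [zZ_zpow, SemidirectProduct.mul_left, hj]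
    simp only [SemidirectProduct.left_inl, SemidirectProduct.right_inl,
      SemidirectProduct.left_inr, map_one, mul_one]
  refine ⟨j, SemidirectProduct.ext h2.symm (act_injective k <| MulEquiv.ext fun w => ?_)⟩
  have := DFunLike.congr_fun (h.trans h1.symm) w
  rw [full_apply, full_apply, h2] at this
  exact mul_left_cancel (mul_right_cancel this)

theorem commute_zZ (k : ℕ) (e : E k) : Commute e (zZ k) := by
  have h1 : ∀ w, Commute (xE k w) (zZ k) := fun w => by
    have := xE_full (zZ k) w
    rw [full_zZ, MulAut.one_apply, eq_mul_inv_iff_mul_eq] at this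
    exact this
  have h2 : ∀ b, Commute (bE k b) (zZ k) := fun b => by
    have h := xE_act k b (z k)
    rw [act_z, eq_mul_inv_iff_mul_eq] at h
    have h' : Commute (bE k b) (xE k (z k)) := h.symm
    exact h'.mul_right ((Z_comm k b).map (bE k))
  rw [E.eq_mul e]
  exact (h1 _).mul_left (h2 _)

theorem mem_center_E {k : ℕ} {e : E k} (h : ∀ w : F k, Commute e (xE k w)) : ∃ j : ℤ, e = zZ k ^ j := by
  refine full_eq_one (MulEquiv.ext fun w => SemidirectProduct.inl_injective (φ := act k) ?_)
  have := xE_full e w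
  rw [(h w).eq, mul_inv_cancel_right] at this
  exact this

theorem center_E (k : ℕ) : Subgroup.center (E k) = Subgroup.zpowers (zZ k) := by
  ext e
  rw [Subgroup.mem_center_iff, Subgroup.mem_zpowers_iff]
  constructor
  · intro h
    obtain ⟨j, hj⟩ := mem_center_E (e := e) fun w => (h _).symm
    exact ⟨j, hj.symm⟩
  · rintro ⟨j, rfl⟩ g
    exact ((commute_zZ k g).zpow_right j).eq

theorem center_Br {k : ℕ} (hk : 3 ≤ k) {c : Br k} (h : ∀ b : Br k, Commute b c) : ∃ j : ℤ, c = Z k ^ j := by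
  obtain ⟨k, rfl⟩ : ∃ m, k = m + 3 := ⟨k - 3, by omega⟩
  have key : ∀ i, i + 1 < k + 3 → ∀ l, Br.perm (k + 3) c (Equiv.swap i (i + 1) l) =
      Equiv.swap i (i + 1) (Br.perm (k + 3) c l) := fun i hi l => by
    have := congrArg (fun b => Br.perm (k + 3) b l) (h (Br.σ _ i)).eq
    simp only [map_mul, Equiv.Perm.mul_apply, Br.perm_σ hi] at this
    exact this.symm
  have hp : Br.perm (k + 3) c (k + 2) = k + 2 := by
    have h1 := key k (by omega) (k + 2)
    rw [Equiv.swap_apply_of_ne_of_ne (by omega) (by omega)] at h1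
    have h2 := key (k + 1) (by omega) (k + 2)
    rw [Equiv.swap_apply_right] at h2
    by_contra hne
    have h3 : Br.perm (k + 3) c (k + 2) = k + 1 := by
      by_contra hne2
      rw [Equiv.swap_apply_of_ne_of_ne hne2 hne] at h2
      exact absurd ((Br.perm (k + 3) c).injective h2) (by omega)
    rw [h3, Equiv.swap_apply_right] at h1
    omega
  obtain ⟨e, rfl⟩ := mem_range_iota hp
  obtain ⟨j, rfl⟩ := mem_center_E (e := e) fun w => iota_injective _ (by
      rw [map_mul, map_mul]; exact (h _).symm.eq)
  exact ⟨j, by rw [map_zpow, iota_zZ (by omega)]⟩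

theorem iota_X_swap {k : ℕ} : ∀ j < k, iota (k + 1) (xE (k + 1) (X (k + 1) j)) =
    (Br.σ (k + 2) k)⁻¹ * Br.incl (Nat.le_succ _) (iota k (xE k (X k j))) * Br.σ (k + 2) k := by
  rcases Nat.eq_zero_or_pos k with rfl | hk
  · intro j hj; omega
  obtain ⟨m, rfl⟩ : ∃ m, k = m + 1 := ⟨k - 1, by omega⟩
  refine down_induction ?_ fun j hj ih => ?_
  · have hb := (Br.isBraid_σ (m + 3)).braid m (by omega)
    rw [iota_top hk]
    simp only [Nat.add_sub_cancel]
    rw [E.bE_conj_X (show m + 1 < m + 2 by omega), map_mul, map_mul, map_inv,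
      iota_σ (show m + 1 < m + 2 by omega), map_pow, Br.incl_σ _ (by omega)]
    have := iota_top (k := m + 2) (by omega)
    simp only [Nat.add_one_sub_one] at this
    rw [this]
    generalize Br.σ (m + 3) m = s at *
    generalize Br.σ (m + 3) (m + 1) = r at *
    have h1 : s * r * s⁻¹ = r⁻¹ * s * r := by
      rw [mul_inv_eq_iff_eq_mul, mul_assoc, mul_assoc, eq_inv_mul_iff_mul_eq, ← mul_assoc,
        ← mul_assoc, hb]
    calc s * r ^ 2 * s⁻¹ = (s * r * s⁻¹) ^ 2 := by simp [pow_two, mul_assoc]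
      _ = _ := by rw [h1]; simp [pow_two, mul_assoc]
  · have hc : Commute (Br.σ (m + 3) j) (Br.σ (m + 3) (m + 1)) :=
      (Br.isBraid_σ (m + 3)).comm _ _ (by omega) (by omega)
    rw [E.bE_conj_X (show j + 1 < m + 2 by omega), map_mul, map_mul, map_inv,
      iota_σ (show j + 1 < m + 2 by omega), ih, E.bE_conj_X hj]
    simp only [map_mul, map_inv]
    rw [iota_σ hj, Br.incl_σ _ (by omega)]
    have h1 := hc.inv_right.eq
    have h2 := hc.symm.inv_right.eq
    simp only [← mul_assoc]
    rw [h1]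
    simp only [mul_assoc]
    rw [← h2]

end Centre

end BraidB

namespace BraidB

section Quotients

variable {G : Type*} [Group G]

instance (k : ℕ) : (Subgroup.zpowers (Z k)).Normal :=
  ⟨fun x hx g => by
    obtain ⟨j, rfl⟩ := Subgroup.mem_zpowers_iff.mp hx
    rw [((Z_comm k g).zpow_right j).eq, mul_inv_cancel_right]; exact hx⟩

instance (k : ℕ) : (Subgroup.zpowers (zZ k)).Normal :=
  ⟨fun x hx g => by
    obtain ⟨j, rfl⟩ := Subgroup.mem_zpowers_iff.mp hx
    rw [((commute_zZ k g).zpow_right j).eq, mul_inv_cancel_right]; exact hx⟩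

/-- The braid group modulo the full twist. -/
def M (k : ℕ) : Type := Br k ⧸ Subgroup.zpowers (Z k)

/-- The annular braid group modulo its centre. -/
def A (k : ℕ) : Type := E k ⧸ Subgroup.zpowers (zZ k)

noncomputable instance (k : ℕ) : Group (M k) := inferInstanceAs (Group (Br k ⧸ Subgroup.zpowers (Z k)))
noncomputable instance (k : ℕ) : Group (A k) := inferInstanceAs (Group (E k ⧸ Subgroup.zpowers (zZ k)))

/-- The quotient map onto `M k`. -/
noncomputable def mq (k : ℕ) : Br k →* M k := QuotientGroup.mk' (Subgroup.zpowers (Z k))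

/-- The quotient map onto `A k`. -/
noncomputable def aq (k : ℕ) : E k →* A k := QuotientGroup.mk' (Subgroup.zpowers (zZ k))

theorem mq_surjective (k : ℕ) : Function.Surjective (mq k) := QuotientGroup.mk'_surjective _
theorem aq_surjective (k : ℕ) : Function.Surjective (aq k) := QuotientGroup.mk'_surjective _

theorem mq_eq_one {k : ℕ} {b : Br k} : mq k b = 1 ↔ ∃ j : ℤ, b = Z k ^ j := by
  refine (QuotientGroup.eq_one_iff (N := Subgroup.zpowers (Z k)) b).trans ?_
  rw [Subgroup.mem_zpowers_iff]
  exact exists_congr fun j => eq_comm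

theorem aq_eq_one {k : ℕ} {e : E k} : aq k e = 1 ↔ ∃ j : ℤ, e = zZ k ^ j := by
  refine (QuotientGroup.eq_one_iff (N := Subgroup.zpowers (zZ k)) e).trans ?_
  rw [Subgroup.mem_zpowers_iff]
  exact exists_congr fun j => eq_comm

@[simp] theorem mq_Z (k : ℕ) : mq k (Z k) = 1 := mq_eq_one.mpr ⟨1, (zpow_one _).symm⟩
@[simp] theorem aq_zZ (k : ℕ) : aq k (zZ k) = 1 := aq_eq_one.mpr ⟨1, (zpow_one _).symm⟩

/-- Homomorphisms out of `M k`. -/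
noncomputable def M.lift {k : ℕ} (f : Br k →* G) (h : f (Z k) = 1) : M k →* G :=
  QuotientGroup.lift (Subgroup.zpowers (Z k)) f fun x hx => by
    obtain ⟨j, rfl⟩ := Subgroup.mem_zpowers_iff.mp hx
    rw [MonoidHom.mem_ker, map_zpow, h, one_zpow]

@[simp] theorem M.lift_mq {k : ℕ} (f : Br k →* G) (h : f (Z k) = 1) (b : Br k) :
    M.lift f h (mq k b) = f b := rfl

/-- Homomorphisms out of `A k`. -/
noncomputable def A.lift {k : ℕ} (f : E k →* G) (h : f (zZ k) = 1) : A k →* G :=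
  QuotientGroup.lift (Subgroup.zpowers (zZ k)) f fun x hx => by
    obtain ⟨j, rfl⟩ := Subgroup.mem_zpowers_iff.mp hx
    rw [MonoidHom.mem_ker, map_zpow, h, one_zpow]

@[simp] theorem A.lift_aq {k : ℕ} (f : E k →* G) (h : f (zZ k) = 1) (e : E k) :
    A.lift f h (aq k e) = f e := rfl

/-- The free normal subgroup of `A k`. -/
noncomputable def xA (k : ℕ) : F k →* A k := (aq k).comp (xE k)
/-- The image of the braid group in `A k`. -/
noncomputable def bA (k : ℕ) : Br k →* A k := (aq k).comp (bE k)

@[simp] theorem aq_xE {k : ℕ} (w : F k) : aq k (xE k w) = xA k w := rfl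
@[simp] theorem aq_bE {k : ℕ} (b : Br k) : aq k (bE k b) = bA k b := rfl

theorem bA_Z (k : ℕ) : bA k (Z k) = (xA k (z k))⁻¹ := by
  have := aq_zZ k
  rw [zZ, map_mul] at this
  exact (inv_eq_of_mul_eq_one_right this).symm

theorem A.exists_mul {k : ℕ} (a : A k) : ∃ w b, a = xA k w * bA k b := by
  obtain ⟨e, rfl⟩ := aq_surjective k a
  exact ⟨e.left, e.right, by rw [← aq_xE, ← aq_bE, ← map_mul, ← E.eq_mul]⟩

theorem A.hom_ext {k : ℕ} {f g : A k →* G}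
    (hσ : ∀ i, i + 1 < k → f (bA k (Br.σ k i)) = g (bA k (Br.σ k i)))
    (hX : 0 < k → f (xA k (X k (k - 1))) = g (xA k (X k (k - 1)))) : f = g := by
  have : f.comp (aq k) = g.comp (aq k) := E.hom_ext hσ hX
  refine MonoidHom.ext fun a => ?_
  obtain ⟨e, rfl⟩ := aq_surjective k a
  exact DFunLike.congr_fun this e

theorem M.hom_ext {k : ℕ} {f g : M k →* G}
    (hσ : ∀ i, i + 1 < k → f (mq k (Br.σ k i)) = g (mq k (Br.σ k i))) : f = g := by
  have : f.comp (mq k) = g.comp (mq k) := Br.hom_ext hσ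
  refine MonoidHom.ext fun a => ?_
  obtain ⟨e, rfl⟩ := mq_surjective k a
  exact DFunLike.congr_fun this e

/-- The faithful action of `A k` on the free group. -/
noncomputable def A.aut (k : ℕ) : A k →* MulAut (F k) := A.lift (full k) (full_zZ k)

theorem A.aut_injective (k : ℕ) : Function.Injective (A.aut k) := by
  rw [injective_iff_map_eq_one]
  intro a ha
  obtain ⟨e, rfl⟩ := aq_surjective k a
  exact aq_eq_one.mpr (full_eq_one ha)

theorem A.aut_bA {k : ℕ} (b : Br k) (w : F k) : A.aut k (bA k b) w = act k b w := by
  rw [← aq_bE, A.aut, A.lift_aq, full_apply]; simp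

theorem A.aut_xA {k : ℕ} (v w : F k) : A.aut k (xA k v) w = v * w * v⁻¹ := by
  rw [← aq_xE, A.aut, A.lift_aq, full_apply]; simp

theorem xA_aut {k : ℕ} (a : A k) (w : F k) : xA k (A.aut k a w) = a * xA k w * a⁻¹ := by
  obtain ⟨e, rfl⟩ := aq_surjective k a
  rw [A.aut, A.lift_aq, ← aq_xE, xE_full]; simp

theorem xA_act {k : ℕ} (b : Br k) (w : F k) :
    xA k (act k b w) = bA k b * xA k w * (bA k b)⁻¹ := by rw [← A.aut_bA, xA_aut]

theorem F.center_trivial {k : ℕ} (hk : 2 ≤ k) {w : F k} (h : ∀ v : F k, Commute w v) : w = 1 := by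
  obtain ⟨m, hm⟩ := commute_X_zpow (k := k) (w := w) (i := 0) (m := 1) (by omega) one_ne_zero
    (by rw [zpow_one]; exact h _)
  obtain ⟨n, hn⟩ := commute_X_zpow (k := k) (w := w) (i := 1) (m := 1) (by omega) one_ne_zero
    (by rw [zpow_one]; exact h _)
  have := congrArg (expo k 0) (hm.symm.trans hn)
  rw [map_zpow, map_zpow, expo_X_self (by omega), expo_X_ne (by omega), one_zpow,
    ← ofAdd_zsmul, ofAdd_eq_one] at this
  have : m = 0 := by simpa using this
  rw [hm, this, zpow_zero]

theorem A.eq_one_of_commute {k : ℕ} {a : A k}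
    (h : ∀ w : F k, Commute a (xA k w)) (hx : Function.Injective (xA k)) : a = 1 := by
  refine A.aut_injective k (MulEquiv.ext fun w => hx ?_)
  rw [xA_aut, (h w).eq, map_one, MulAut.one_apply, mul_inv_cancel_right]

theorem xA_injective {k : ℕ} (hk : 2 ≤ k) : Function.Injective (xA k) := by
  rw [injective_iff_map_eq_one]
  intro w hw
  refine F.center_trivial hk fun v => ?_
  have := A.aut_xA w v
  rw [hw, map_one, MulAut.one_apply, eq_mul_inv_iff_mul_eq] at this
  exact this.symm

/-- The projection forgetting the core. -/
noncomputable def pr (k : ℕ) : A k →* M k :=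
  A.lift ((mq k).comp SemidirectProduct.rightHom) (by simp [zZ])

@[simp] theorem pr_xA {k : ℕ} (w : F k) : pr k (xA k w) = 1 := by
  rw [← aq_xE, pr, A.lift_aq]; simp

@[simp] theorem pr_bA {k : ℕ} (b : Br k) : pr k (bA k b) = mq k b := by
  rw [← aq_bE, pr, A.lift_aq]; simp

theorem exists_xA {k : ℕ} {a : A k} (h : pr k a = 1) : ∃ w, a = xA k w := by
  obtain ⟨w, b, rfl⟩ := A.exists_mul a
  rw [map_mul, pr_xA, one_mul, pr_bA, mq_eq_one] at h
  obtain ⟨j, rfl⟩ := h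
  exact ⟨w * (z k)⁻¹ ^ j, by rw [map_zpow, bA_Z, map_mul, map_zpow, map_inv]⟩

/-- The inclusion of `A k` into `M (k + 1)`. -/
noncomputable def aM (k : ℕ) : A k →* M (k + 1) :=
  A.lift ((mq (k + 1)).comp (iota k)) (by
    rcases Nat.eq_zero_or_pos k with rfl | hk
    · have : zZ 0 = 1 := by
        simp [zZ, Z, rho, z, zp]
      rw [this, map_one]
    · rw [MonoidHom.comp_apply, iota_zZ hk, mq_Z])

@[simp] theorem aM_aq {k : ℕ} (e : E k) : aM k (aq k e) = mq (k + 1) (iota k e) := rfl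

theorem aM_bA {k : ℕ} (b : Br k) : aM k (bA k b) = mq (k + 1) (Br.incl (Nat.le_succ k) b) := by
  rw [← aq_bE, aM_aq, iota_bE]

theorem aM_σ {k i : ℕ} (hi : i + 1 < k) : aM k (bA k (Br.σ k i)) = mq (k + 1) (Br.σ (k + 1) i) := by
  rw [aM_bA, Br.incl_σ _ hi]

theorem aM_top {k : ℕ} (hk : 0 < k) :
    aM k (xA k (X k (k - 1))) = mq (k + 1) (Br.σ (k + 1) (k - 1)) ^ 2 := by
  rw [← aq_xE, aM_aq, iota_top hk, map_pow]

theorem aM_injective {k : ℕ} (hk : 0 < k) : Function.Injective (aM k) := by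
  rw [injective_iff_map_eq_one]
  intro a ha
  obtain ⟨e, rfl⟩ := aq_surjective k a
  rw [aM_aq, mq_eq_one] at ha
  obtain ⟨j, hj⟩ := ha
  rw [← iota_zZ hk, ← map_zpow] at hj
  exact aq_eq_one.mpr ⟨j, iota_injective k hj⟩

theorem perm_Z (k : ℕ) : Br.perm k (Z k) = 1 := by
  ext j
  rcases lt_or_ge j k with hj | hj
  · obtain ⟨u, hu⟩ := act_X_conj k (Z k) j
    rw [act_Z] at hu
    refine (X_conj_eq hj (u := z k * u) ?_).symm
    calc X k j = z k * ((z k)⁻¹ * X k j * z k) * (z k)⁻¹ := by group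
      _ = _ := by rw [hu]; group
  · exact Br.perm_apply_of_le _ hj

/-- The permutation of strands. -/
noncomputable def permM (k : ℕ) : M k →* Equiv.Perm ℕ := M.lift (Br.perm k) (perm_Z k)

@[simp] theorem permM_mq {k : ℕ} (b : Br k) : permM k (mq k b) = Br.perm k b := rfl

theorem permM_aM {k : ℕ} (a : A k) : permM (k + 1) (aM k a) = permM k (pr k a) := by
  obtain ⟨w, b, rfl⟩ := A.exists_mul a
  rw [← aq_xE, ← aq_bE, ← map_mul, aM_aq, permM_mq, perm_iota, map_mul, aq_xE, aq_bE, map_mul,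
    pr_xA, pr_bA, one_mul, permM_mq]
  simp

theorem exists_aM {k : ℕ} {m : M (k + 1)} (h : permM (k + 1) m k = k) : ∃ a, aM k a = m := by
  obtain ⟨b, rfl⟩ := mq_surjective _ m
  obtain ⟨e, rfl⟩ := mem_range_iota h
  exact ⟨aq k e, rfl⟩

theorem permM_apply_of_le {k j : ℕ} (m : M k) (hj : k ≤ j) : permM k m j = j := by
  obtain ⟨b, rfl⟩ := mq_surjective _ m
  exact Br.perm_apply_of_le b hj

/-- An endomorphism of `M (k + 1)` compatible with permutations restricts to `A k`. -/
theorem exists_restrict {k : ℕ} (hk : 0 < k) {f : G →* M (k + 1)}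
    (hf : ∀ g, permM (k + 1) (f g) k = k) : ∃ f' : G →* A k, ∀ g, aM k (f' g) = f g := by
  have h : ∀ g, ∃ a, aM k a = f g := fun g => exists_aM (hf g)
  choose f' hf' using h
  refine ⟨MonoidHom.mk' f' fun a b => aM_injective hk ?_, hf'⟩
  rw [map_mul, hf', hf', hf', map_mul]

end Quotients

section Core

theorem iota_z_swap (m : ℕ) : iota (m + 2) (xE (m + 2) (z (m + 2))) =
    Br.σ (m + 3) (m + 1) * Br.incl (Nat.le_succ _) (iota (m + 1) (xE (m + 1) (z (m + 1)))) *
      Br.σ (m + 3) (m + 1) := by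
  have h : iota (m + 2) (xE (m + 2) (zp (m + 2) (m + 1))) =
      (Br.σ (m + 3) (m + 1))⁻¹ * Br.incl (Nat.le_succ _) (iota (m + 1) (xE (m + 1) (z (m + 1)))) *
      Br.σ (m + 3) (m + 1) := by
    rw [z]
    suffices h : ∀ l ≤ m + 1, iota (m + 2) (xE (m + 2) (zp (m + 2) l)) =
      (Br.σ (m + 3) (m + 1))⁻¹ *
        Br.incl (Nat.le_succ _) (iota (m + 1) (xE (m + 1) (zp (m + 1) l))) *
      Br.σ (m + 3) (m + 1) from h _ le_rfl
    intro l hl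
    induction l with
    | zero => simp [zp]
    | succ l ih =>
      rw [zp, zp, map_mul, map_mul, map_mul, map_mul, map_mul, ih (by omega),
        iota_X_swap l (by omega)]
      group
  have ht := iota_top (k := m + 2) (by omega)
  simp only [Nat.add_one_sub_one] at ht
  rw [z, zp, map_mul, map_mul, h, ht]
  group

theorem isAnnular_core (k : ℕ) :
    IsAnnular k (Br.σ k) (Br.incl (Nat.sub_le k 1) (Z (k - 1))) := by
  refine ⟨Br.isBraid_σ k, fun i hi => ?_, fun i hi => ?_⟩
  · rw [← Br.incl_σ (Nat.sub_le k 1) (show i + 1 < k - 1 by omega), ← map_mul, ← map_mul,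
      (Z_comm _ _).eq]
  · subst hi
    rcases Nat.eq_zero_or_pos i with rfl | hi
    · have : Z (0 + 2 - 1) = 1 := by simp [Z, rho]
      rw [this]; simp
    obtain ⟨m, rfl⟩ : ∃ m, i = m + 1 := ⟨i - 1, by omega⟩
    have hle : m + 2 ≤ m + 3 := by omega
    have hle1 : m + 1 ≤ m + 2 := by omega
    change Br.σ (m + 3) (m + 1) * Br.incl hle (Z (m + 2)) * Br.σ (m + 3) (m + 1) *
      Br.incl hle (Z (m + 2)) = Br.incl hle (Z (m + 2)) * Br.σ (m + 3) (m + 1) *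
      Br.incl hle (Z (m + 2)) * Br.σ (m + 3) (m + 1)
    have e1 := iota_zZ (k := m + 2) (by omega)
    have e2 := iota_zZ (k := m + 1) (by omega)
    rw [zZ, map_mul, iota_bE] at e1 e2
    have e3 := iota_z_swap m
    have hc : Commute (Br.σ (m + 3) (m + 1)) (Br.incl hle (Br.incl hle1 (Z (m + 1)))) := by
      rw [Br.incl_incl]
      have h' : ∀ b : Br (m + 1), Commute (Br.σ (m + 3) (m + 1))
          (Br.incl (by omega : m + 1 ≤ m + 3) b) := fun b => by
        induction b using Br.induction with
        | one => rw [map_one]; exact Commute.one_right _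
        | mul x y hx hy => rw [map_mul]; exact hx.mul_right hy
        | inv x hx => rw [map_inv]; exact hx.inv_right
        | gen j hj =>
          rw [Br.incl_σ _ hj]
          exact ((Br.isBraid_σ (m + 3)).comm _ _ (by omega) (by omega) : Commute _ _).symm
      exact h' _
    have e4 : Br.σ (m + 3) (m + 1) * Br.incl hle (Z (m + 2)) * Br.σ (m + 3) (m + 1) =
        iota (m + 2) (xE (m + 2) (z (m + 2))) * Br.incl hle (Br.incl hle1 (Z (m + 1))) := by
      rw [e3, ← e2, map_mul]
      simp only [mul_assoc]
      rw [hc.eq]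
    have h1 : Commute (Br.incl hle (Z (m + 2))) (iota (m + 2) (xE (m + 2) (z (m + 2)))) := by
      have h2 : iota (m + 2) (xE (m + 2) (z (m + 2))) =
        Z (m + 3) * (Br.incl hle (Z (m + 2)))⁻¹ := by rw [← e1]; group
      rw [h2]
      exact (Z_comm _ _).mul_right (Commute.refl _).inv_right
    have h2 : Commute (Br.incl hle (Z (m + 2))) (Br.incl hle (Br.incl hle1 (Z (m + 1)))) :=
      ((Z_comm _ _).symm).map _
    have h3 := (h1.mul_right h2)
    rw [← e4] at h3
    rw [← h3.eq]; simp only [mul_assoc]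

/-- Forgetting the last free strand, keeping the core. -/
noncomputable def prI (k : ℕ) : E k →* Br k := E.lift (isAnnular_core k)

@[simp] theorem prI_bE {k : ℕ} (b : Br k) : prI k (bE k b) = b := by
  have : (prI k).comp (bE k) = MonoidHom.id _ := Br.hom_ext fun i hi => E.lift_σ (isAnnular_core k) hi
  exact DFunLike.congr_fun this b

theorem prI_top {k : ℕ} (hk : 0 < k) :
    prI k (xE k (X k (k - 1))) = Br.incl (Nat.sub_le k 1) (Z (k - 1)) := E.lift_X_top _ hk

theorem perm_prI {k : ℕ} (e : E k) : Br.perm k (prI k e) = Br.perm k e.right := by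
  have : (Br.perm k).comp (prI k) = (Br.perm k).comp SemidirectProduct.rightHom := by
    refine E.hom_ext (fun i hi => ?_) (fun hk => ?_)
    · simp
    · rw [MonoidHom.comp_apply, prI_top hk, Br.perm_incl, perm_Z]; simp
  exact DFunLike.congr_fun this e

theorem mq_prI_zZ (k : ℕ) : mq k (prI k (zZ k)) = 1 := by
  rcases lt_or_ge k 3 with hk | hk
  · have h : (prI k).comp (xE k) = 1 := by
      refine F.hom_ext ?_
      rcases Nat.eq_zero_or_pos k with rfl | hk0
      · intro i hi; omega
      refine down_induction ?_ fun i hi ih => ?_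
      · have : Z (k - 1) = 1 := by
          obtain h | h : k - 1 = 0 ∨ k - 1 = 1 := by omega
          all_goals rw [h]; simp [Z, rho]
        rw [MonoidHom.comp_apply, prI_top hk0, this, map_one, MonoidHom.one_apply]
      · simp only [MonoidHom.comp_apply] at ih ⊢
        rw [E.bE_conj_X hi, map_mul, map_mul, ih, map_inv]; simp
    have h' := DFunLike.congr_fun h (z k)
    rw [MonoidHom.comp_apply] at h'
    rw [zZ, map_mul, h']; simp
  · refine mq_eq_one.mpr (center_Br hk fun b => ?_)
    have := (commute_zZ k (bE k b)).map (prI k)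
    rwa [prI_bE] at this

/-- The map induced by `prI` on the quotients by the centre. -/
noncomputable def piA (k : ℕ) : A k →* M k := A.lift ((mq k).comp (prI k)) (mq_prI_zZ k)

@[simp] theorem piA_aq {k : ℕ} (e : E k) : piA k (aq k e) = mq k (prI k e) := rfl

@[simp] theorem piA_bA {k : ℕ} (b : Br k) : piA k (bA k b) = mq k b := by
  rw [← aq_bE, piA_aq, prI_bE]

theorem piA_top {k : ℕ} (hk : 0 < k) :
    piA k (xA k (X k (k - 1))) = mq k (Br.incl (Nat.sub_le k 1) (Z (k - 1))) := by
  rw [← aq_xE, piA_aq, prI_top hk]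

theorem piA_z (k : ℕ) : piA k (xA k (z k)) = 1 := by
  have h := piA_bA (Z k)
  rw [bA_Z, mq_Z, map_inv, inv_eq_one] at h
  exact h

theorem permM_piA {k : ℕ} (a : A k) : permM k (piA k a) = permM k (pr k a) := by
  obtain ⟨e, rfl⟩ := aq_surjective k a
  rw [piA_aq, permM_mq, perm_prI]; rfl

end Core

section Mirror

/-- The mirror automorphism of the braid group. -/
noncomputable def mirBr (k : ℕ) : Br k →* Br k := Br.lift _ (Br.isBraid_σ k).inv

theorem mirBr_σ {k i : ℕ} (hi : i + 1 < k) : mirBr k (Br.σ k i) = (Br.σ k i)⁻¹ := Br.lift_σ _ _ hi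

theorem mirBr_mirBr {k : ℕ} (b : Br k) : mirBr k (mirBr k b) = b := by
  have : (mirBr k).comp (mirBr k) = MonoidHom.id _ :=
    Br.hom_ext fun i hi => by simp [mirBr_σ hi]
  exact DFunLike.congr_fun this b

theorem IsAnnular.inv {G : Type*} [Group G] {k : ℕ} {s : ℕ → G} {r : G} (h : IsAnnular k s r) :
    IsAnnular k (fun i => (s i)⁻¹) r⁻¹ := by
  refine ⟨h.isBraid.inv, fun i hi => ?_, fun i hi => ?_⟩
  · have := congrArg (·⁻¹) (h.comm i hi).symm
    simpa using this
  · have := congrArg (·⁻¹) (h.quad i hi).symm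
    simpa [mul_assoc] using this

/-- The mirror automorphism of the annular braid group. -/
noncomputable def mirE (k : ℕ) : E k →* E k := E.lift (E.isAnnular k).inv

theorem mirE_σ {k i : ℕ} (hi : i + 1 < k) :
    mirE k (bE k (Br.σ k i)) = (bE k (Br.σ k i))⁻¹ := E.lift_σ _ hi

theorem mirE_top {k : ℕ} (hk : 0 < k) :
    mirE k (xE k (X k (k - 1))) = (xE k (X k (k - 1)))⁻¹ := E.lift_X_top _ hk

theorem mirE_mirE {k : ℕ} (e : E k) : mirE k (mirE k e) = e := by
  have : (mirE k).comp (mirE k) = MonoidHom.id _ :=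
    E.hom_ext (fun i hi => by simp [mirE_σ hi]) fun hk => by simp [mirE_top hk]
  exact DFunLike.congr_fun this e

theorem aq_mirE_zZ (k : ℕ) : aq k (mirE k (zZ k)) = 1 := by
  rw [aq_eq_one]
  refine mem_center_E fun w => ?_
  have := (commute_zZ k (mirE k (xE k w))).map (mirE k)
  rw [mirE_mirE] at this
  exact this.symm

/-- The mirror automorphism of `A k`. -/
noncomputable def mirA (k : ℕ) : A k →* A k := A.lift ((aq k).comp (mirE k)) (aq_mirE_zZ k)

theorem mirA_mirA {k : ℕ} (a : A k) : mirA k (mirA k a) = a := by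
  obtain ⟨e, rfl⟩ := aq_surjective k a
  change aq k (mirE k (mirE k e)) = aq k e
  rw [mirE_mirE]

theorem mirA_σ {k i : ℕ} (hi : i + 1 < k) :
    mirA k (bA k (Br.σ k i)) = (bA k (Br.σ k i))⁻¹ := by
  change aq k (mirE k (bE k (Br.σ k i))) = _
  rw [mirE_σ hi, map_inv]; rfl

theorem mirA_top {k : ℕ} (hk : 0 < k) :
    mirA k (xA k (X k (k - 1))) = (xA k (X k (k - 1)))⁻¹ := by
  change aq k (mirE k (xE k (X k (k - 1)))) = _
  rw [mirE_top hk, map_inv]; rfl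

theorem mq_mirBr_Z (k : ℕ) : mq k (mirBr k (Z k)) = 1 := by
  rcases Nat.eq_zero_or_pos k with rfl | hk
  · simp [Z]
  obtain ⟨m, rfl⟩ : ∃ m, k = m + 1 := ⟨k - 1, by omega⟩
  rcases Nat.eq_zero_or_pos m with rfl | hm
  · simp [Z, rho]
  have h : (mirBr (m + 1)).comp (iota m) = (iota m).comp (mirE m) := by
    refine E.hom_ext (fun i hi => ?_) fun _ => ?_
    · rw [MonoidHom.comp_apply, MonoidHom.comp_apply, mirE_σ hi, iota_σ hi, map_inv, iota_σ hi,
        mirBr_σ (by omega)]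
    · rw [MonoidHom.comp_apply, MonoidHom.comp_apply, mirE_top hm, iota_top hm, map_inv,
        iota_top hm, map_pow, mirBr_σ (by omega), inv_pow]
  have := DFunLike.congr_fun h (zZ m)
  rw [MonoidHom.comp_apply, iota_zZ hm] at this
  rw [this, MonoidHom.comp_apply, ← aM_aq, aq_mirE_zZ, map_one]

/-- The mirror automorphism of `M k`. -/
noncomputable def mirM (k : ℕ) : M k →* M k := M.lift ((mq k).comp (mirBr k)) (mq_mirBr_Z k)

theorem mirM_mq {k : ℕ} (b : Br k) : mirM k (mq k b) = mq k (mirBr k b) := rfl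

theorem pr_mirA {k : ℕ} (a : A k) : pr k (mirA k a) = mirM k (pr k a) := by
  have : (pr k).comp (mirA k) = (mirM k).comp (pr k) := by
    refine A.hom_ext (fun i hi => ?_) fun hk => ?_
    · rw [MonoidHom.comp_apply, MonoidHom.comp_apply, mirA_σ hi, map_inv, pr_bA, mirM_mq,
        mirBr_σ hi, map_inv]
    · rw [MonoidHom.comp_apply, MonoidHom.comp_apply, mirA_top hk, map_inv, pr_xA]; simp
  exact DFunLike.congr_fun this a

theorem aM_mirA {k : ℕ} (a : A k) : aM k (mirA k a) = mirM (k + 1) (aM k a) := by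
  have : (aM k).comp (mirA k) = (mirM (k + 1)).comp (aM k) := by
    refine A.hom_ext (fun i hi => ?_) fun hk => ?_
    · rw [MonoidHom.comp_apply, MonoidHom.comp_apply, mirA_σ hi, map_inv, aM_σ hi, mirM_mq,
        mirBr_σ (by omega), map_inv]
    · rw [MonoidHom.comp_apply, MonoidHom.comp_apply, mirA_top hk, map_inv, aM_top hk, map_pow,
        mirM_mq, mirBr_σ (by omega), map_inv, inv_pow]
  exact DFunLike.congr_fun this a

theorem permM_mirM {k : ℕ} (m : M k) : permM k (mirM k m) = permM k m := by
  have : (permM k).comp (mirM k) = permM k := M.hom_ext fun i hi => by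
    rw [MonoidHom.comp_apply, mirM_mq, mirBr_σ hi, permM_mq, permM_mq, map_inv, Br.perm_σ hi,
      Equiv.swap_inv]
  exact DFunLike.congr_fun this m

end Mirror

end BraidB

namespace BraidB

section Hopfian

theorem exists_finite_hom_ne.{u} {F : Type u} [Group F] [Group.ResiduallyFinite F] {v w : F} (h : v ≠ w) :
    ∃ (Q : Type u) (_ : Group Q) (_ : Finite Q) (f : F →* Q), f v ≠ f w := by
  obtain ⟨H, hH⟩ := Group.exists_finiteIndexNormalSubgroup_notMem (v * w⁻¹)
    (fun hc => h (mul_inv_eq_one.mp hc))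
  refine ⟨F ⧸ H.toSubgroup, inferInstance, inferInstance, QuotientGroup.mk' H.toSubgroup,
    fun hc => hH ?_⟩
  have := (QuotientGroup.eq_one_iff (N := H.toSubgroup) (v * w⁻¹)).mp (by
    rw [QuotientGroup.mk_mul, QuotientGroup.mk_inv, mul_inv_eq_one]; exact hc)
  exact this

theorem finite_hom_free {k : ℕ} (Q : Type*) [Group Q] [Finite Q] : Finite (F k →* Q) :=
  Finite.of_injective (fun f (i : Fin k) => f (X k i)) fun _ _ h =>
    F.hom_ext fun i hi => congrFun h ⟨i, hi⟩

theorem finite_hom_A {k : ℕ} (Q : Type*) [Group Q] [Finite Q] : Finite (A k →* Q) :=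
  Finite.of_injective (fun f => (fun i : Fin k => f (bA k (Br.σ k i)), f (xA k (X k (k - 1)))))
    fun f g h => A.hom_ext (fun i hi => congrFun (congrArg Prod.fst h) ⟨i, by omega⟩)
      fun _ => congrArg Prod.snd h

/-- Precomposition with the automorphism by which `a` acts. -/
noncomputable def homAct (k : ℕ) (Q : Type*) [Group Q] : A k →* Equiv.Perm (F k →* Q) where
  toFun a :=
    { toFun := fun f => f.comp (A.aut k a⁻¹).toMonoidHom
      invFun := fun f => f.comp (A.aut k a).toMonoidHom
      left_inv := fun f => by ext; simp
      right_inv := fun f => by ext; simp }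
  map_one' := by ext; simp
  map_mul' a b := by ext; simp

theorem A.exists_finite_hom {k : ℕ} {a : A k} (ha : a ≠ 1) :
    ∃ (Q : Type) (_ : Group Q) (_ : Finite Q) (f : A k →* Q), f a ≠ 1 := by
  have h : A.aut k a⁻¹ ≠ 1 := fun h => ha (by
    rw [← map_one (A.aut k)] at h; exact inv_eq_one.mp (A.aut_injective k h))
  obtain ⟨w, hw⟩ : ∃ w, A.aut k a⁻¹ w ≠ w := by
    by_contra! hc; exact h (MulEquiv.ext hc)
  obtain ⟨Q, _, _, f, hf⟩ := exists_finite_hom_ne hw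
  have := finite_hom_free (k := k) Q
  exact ⟨_, inferInstance, inferInstance, homAct k Q, fun h1 => hf (DFunLike.congr_fun
    (DFunLike.congr_fun h1 f) w)⟩

theorem A.hopfian {k : ℕ} {φ : A k →* A k} (hφ : Function.Surjective φ) :
    Function.Injective φ := by
  rw [injective_iff_map_eq_one]
  intro a ha
  by_contra hne
  obtain ⟨Q, _, _, f, hf⟩ := A.exists_finite_hom hne
  have := finite_hom_A (k := k) Q
  have hs := Finite.surjective_of_injective (f := fun g : A k →* Q => g.comp φ) fun g g' h =>
    MonoidHom.ext fun b => by
      obtain ⟨c, rfl⟩ := hφ b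
      exact DFunLike.congr_fun h c
  obtain ⟨g, rfl⟩ := hs f
  exact hf (by rw [MonoidHom.comp_apply, ha, map_one])

end Hopfian

section Presentation

/-- The standard generators of the Artin group, extended by `1`. -/
noncomputable def rGen (n i : ℕ) : ArtinB n := if h : i < n then PresentedGroup.of ⟨i, h⟩ else 1

theorem of_eq_rGen {n : ℕ} (i : Fin n) : PresentedGroup.of (rels := BnRels n) i = rGen n i := by
  simp [rGen]

theorem rGen_eq {n i : ℕ} (h : i < n) :
    rGen n i = PresentedGroup.mk (BnRels n) (FreeGroup.of ⟨i, h⟩) := dif_pos h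

theorem rGen_isAnnular (n : ℕ) : IsAnnular n (rGen n) (rGen n (n - 1)) := by
  have hc : ∀ i j, i + 1 < j → j < n → rGen n i * rGen n j = rGen n j * rGen n i := by
    intro i j hij hj
    have : PresentedGroup.mk (BnRels n) _ = 1 := PresentedGroup.one_of_mem
      (Or.inr (Or.inr ⟨⟨i, by omega⟩, ⟨j, hj⟩, hij, rfl⟩))
    rw [map_mul, map_inv, mul_inv_eq_one, map_mul, map_mul] at this
    rwa [rGen_eq (show i < n by omega), rGen_eq hj]
  refine ⟨⟨fun i hi => ?_, fun i j hij hj => hc i j hij (by omega)⟩,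
    fun i hi => hc _ _ (by omega) (by omega), fun i hi => ?_⟩
  · have : PresentedGroup.mk (BnRels n) _ = 1 := PresentedGroup.one_of_mem
      (Or.inl ⟨⟨i, by omega⟩, ⟨i + 1, by omega⟩, rfl, hi, rfl⟩)
    rw [map_mul, map_inv, mul_inv_eq_one] at this
    simp only [map_mul] at this
    rwa [rGen_eq (show i < n by omega), rGen_eq (show i + 1 < n by omega)]
  · have : PresentedGroup.mk (BnRels n) _ = 1 := PresentedGroup.one_of_mem
      (Or.inr (Or.inl ⟨⟨i, by omega⟩, ⟨n - 1, by omega⟩, hi, show n - 1 + 1 = n by omega, rfl⟩))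
    rw [map_mul, map_inv, mul_inv_eq_one] at this
    simp only [map_mul] at this
    rwa [rGen_eq (show i < n by omega), rGen_eq (show n - 1 < n by omega)]

/-- The generator of the annular braid group corresponding to `rGen`. -/
noncomputable def eGen (n i : ℕ) : E n :=
  if i + 1 < n then bE n (Br.σ n i) else xE n (X n (n - 1))

theorem eGen_rel (n : ℕ) : ∀ r ∈ BnRels n, FreeGroup.lift (fun i : Fin n => eGen n i) r = 1 := by
  have hA := E.isAnnular n
  rintro r (⟨⟨i, hi⟩, ⟨j, hj⟩, h1, h2, rfl⟩ | ⟨⟨i, hi⟩, ⟨j, hj⟩, h1, h2, rfl⟩ |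
    ⟨⟨i, hi⟩, ⟨j, hj⟩, h1, rfl⟩)
  · obtain rfl : i + 1 = j := h1
    have h2 : i + 1 + 1 < n := h2
    simp only [map_mul, map_inv, FreeGroup.lift_apply_of, mul_inv_eq_one, eGen]
    rw [if_pos (by omega), if_pos (by omega)]
    exact hA.isBraid.braid i h2
  · have h1 : i + 2 = n := h1
    have h2 : j + 1 = n := h2
    simp only [map_mul, map_inv, FreeGroup.lift_apply_of, mul_inv_eq_one, eGen]
    rw [if_pos (by omega), if_neg (by omega)]
    exact hA.quad i h1
  · have h1 : i + 2 ≤ j := h1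
    simp only [map_mul, map_inv, FreeGroup.lift_apply_of, mul_inv_eq_one, eGen]
    rw [if_pos (by omega)]
    split_ifs with h
    · exact hA.isBraid.comm i j h1 h
    · exact hA.comm i (by omega)

/-- The Artin group of type `B` is the annular braid group. -/
noncomputable def artinEquiv {n : ℕ} (hn : 0 < n) : ArtinB n ≃* E n :=
  MonoidHom.toMulEquiv (PresentedGroup.toGroup (eGen_rel n)) (E.lift (rGen_isAnnular n))
    (by
      refine PresentedGroup.ext fun i => ?_
      rw [MonoidHom.comp_apply, PresentedGroup.toGroup.of, MonoidHom.id_apply, of_eq_rGen, eGen]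
      split_ifs with h
      · exact E.lift_σ _ h
      · rw [E.lift_X_top _ hn]; congr 1; omega)
    (by
      refine E.hom_ext (fun i hi => ?_) fun _ => ?_
      · rw [MonoidHom.comp_apply, E.lift_σ _ hi, MonoidHom.id_apply, ← of_eq_rGen ⟨i, by omega⟩,
          PresentedGroup.toGroup.of, eGen, if_pos hi]
      · rw [MonoidHom.comp_apply, E.lift_X_top _ hn, MonoidHom.id_apply,
          ← of_eq_rGen ⟨n - 1, by omega⟩, PresentedGroup.toGroup.of, eGen,
          if_neg (show ¬ (n - 1 + 1 < n) by omega)])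

/-- The central quotient of the Artin group of type `B`. -/
noncomputable def abarEquiv {n : ℕ} (hn : 0 < n) : AbarB n ≃* A n :=
  QuotientGroup.congr (Subgroup.center (ArtinB n)) (Subgroup.zpowers (zZ n)) (artinEquiv hn) (by
    rw [← center_E]
    ext x
    simp only [Subgroup.mem_map, Subgroup.mem_center_iff]
    constructor
    · rintro ⟨y, hy, rfl⟩ g
      obtain ⟨h, rfl⟩ := (artinEquiv hn).surjective g
      have := congrArg (artinEquiv hn) (hy h)
      rw [map_mul, map_mul] at this
      exact this
    · intro hx
      refine ⟨(artinEquiv hn).symm x, fun g => (artinEquiv hn).injective ?_, by simp⟩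
      simpa using hx (artinEquiv hn g))

theorem hopfian_coHopfian_of {n : ℕ} (hn : 0 < n)
    (h : ∀ φ : A n →* A n, Function.Injective φ → Function.Surjective φ) :
    (∀ φ : AbarB n →* AbarB n, Function.Surjective φ → Function.Injective φ) ∧
    (∀ φ : AbarB n →* AbarB n, Function.Injective φ → Function.Surjective φ) := by
  let e := abarEquiv hn
  let t : (AbarB n →* AbarB n) → (A n →* A n) := fun φ =>
    (e.toMonoidHom.comp φ).comp e.symm.toMonoidHom
  have ht : ∀ φ, ⇑(t φ) = e ∘ φ ∘ e.symm := fun φ => rfl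
  refine ⟨fun φ hφ => ?_, fun φ hφ => ?_⟩
  · have := A.hopfian (φ := t φ) (by
      rw [ht]; exact e.surjective.comp (hφ.comp e.symm.surjective))
    rw [ht, EquivLike.comp_injective] at this
    exact (EquivLike.injective_comp e.symm φ).mp this
  · have := h (t φ) (by
      rw [ht]; exact e.injective.comp (hφ.comp e.symm.injective))
    rw [ht, EquivLike.comp_surjective] at this
    exact (EquivLike.surjective_comp e.symm φ).mp this

end Presentation

end BraidB

namespace BraidB

section BraidTuples

variable {G : Type*} [Group G] {k : ℕ} {s : ℕ → G}

theorem eq_of_commute_of_braid {a b : G} (hb : a * b * a = b * a * b) (hc : Commute a b) :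
    a = b := by
  rw [hc.eq, mul_assoc, mul_assoc] at hb
  exact mul_left_cancel (mul_left_cancel hb)

theorem IsBraid.eq_succ (h : IsBraid k s) {i : ℕ} (hi : i + 3 < k) :
    s i = s (i + 1) ↔ s (i + 1) = s (i + 2) := by
  have hc : Commute (s i) (s (i + 2)) := h.comm _ _ (by omega) (by omega)
  refine ⟨fun e => ?_, fun e => ?_⟩
  · exact eq_of_commute_of_braid (h.braid (i + 1) hi) (e ▸ hc)
  · exact eq_of_commute_of_braid (h.braid i (by omega)) (e ▸ hc)

theorem IsBraid.eq_succ_iff (h : IsBraid k s) {i : ℕ} (hi : i + 2 < k) :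
    s i = s (i + 1) ↔ s 0 = s 1 := by
  induction i with
  | zero => exact Iff.rfl
  | succ i ih => exact (h.eq_succ (by omega)).symm.trans (ih (by omega))

theorem IsBraid.eq_zero (h : IsBraid k s) (h01 : s 0 = s 1) {i : ℕ} (hi : i + 1 < k) :
    s i = s 0 := by
  induction i with
  | zero => rfl
  | succ i ih => rw [← (h.eq_succ_iff (by omega)).mpr h01]; exact ih (by omega)

theorem IsBraid.isConj (h : IsBraid k s) {i : ℕ} (hi : i + 1 < k) : IsConj (s 0) (s i) := by
  induction i with
  | zero => rfl
  | succ i ih =>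
    refine (ih (by omega)).trans (isConj_iff.mpr ⟨s i * s (i + 1), ?_⟩)
    rw [h.braid i hi]; group

theorem IsBraid.eq_of_commute (h : IsBraid k s) (hk : 5 ≤ k)
    (hc : Commute (s 0 * (s 3)⁻¹) (s 1 * (s 3)⁻¹)) : s 0 = s 1 := by
  have h0 : Commute (s 0) (s 3) := h.comm _ _ (by omega) (by omega)
  have h1 : Commute (s 1) (s 3) := h.comm _ _ (by omega) (by omega)
  refine eq_of_commute_of_braid (h.braid 0 (by omega)) ?_
  have e0 : s 0 = (s 0 * (s 3)⁻¹) * s 3 := by group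
  have e1 : s 1 = (s 1 * (s 3)⁻¹) * s 3 := by group
  have c0 : Commute (s 0 * (s 3)⁻¹) (s 3) := h0.mul_left (Commute.refl _).inv_left
  have c1 : Commute (s 1 * (s 3)⁻¹) (s 3) := h1.mul_left (Commute.refl _).inv_left
  have := (hc.mul_left c1.symm).mul_right (c0.mul_left (Commute.refl _))
  rwa [← e0, ← e1] at this

theorem IsBraid.zero_ne_two (h : IsBraid k s) (hk : 5 ≤ k) (hs : s 0 ≠ s 1) : s 2 ≠ s 3 :=
  fun e => hs ((h.eq_succ_iff (i := 2) (by omega)).mp e)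

end BraidTuples

section Orbits

/-- The permutation of the cycles of `a` induced by an element of its centralizer. -/
noncomputable def cycleHom {S : Type} (a : Equiv.Perm S) :
    Subgroup.centralizer {a} →* Equiv.Perm (Quotient (Equiv.Perm.SameCycle.setoid a)) where
  toFun g := Quotient.congr g.1 fun p q => by
    have hg : a * g.1 = g.1 * a := (Subgroup.mem_centralizer_singleton_iff.mp g.2).symm
    have hc : ∀ i : ℤ, a ^ i * g.1 = g.1 * a ^ i := fun i =>
      ((show Commute a g.1 from hg).zpow_left i).eq
    refine exists_congr fun i => ?_
    have := DFunLike.congr_fun (hc i) p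
    simp only [Equiv.Perm.mul_apply] at this
    rw [this, g.1.apply_eq_iff_eq]
  map_one' := by ext x; induction x using Quotient.inductionOn; rfl
  map_mul' g h := by ext x; induction x using Quotient.inductionOn; rfl

theorem cycleHom_eq_one {S : Type} {a : Equiv.Perm S} {g : Subgroup.centralizer {a}}
    (hg : cycleHom a g = 1) (p : S) : ∃ i : ℤ, (a ^ i) (g.1 p) = p := by
  have := DFunLike.congr_fun hg (Quotient.mk _ p)
  exact Quotient.exact this

theorem cycleHom_ker_comm {S : Type} {a : Equiv.Perm S} {g h : Subgroup.centralizer {a}}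
    (hg : cycleHom a g = 1) (hh : cycleHom a h = 1) : Commute g h := by
  have hcg : ∀ i : ℤ, Commute (a ^ i) g.1 := fun i =>
    (show Commute g.1 a from Subgroup.mem_centralizer_singleton_iff.mp g.2).symm.zpow_left i
  have hch : ∀ i : ℤ, Commute (a ^ i) h.1 := fun i =>
    (show Commute h.1 a from Subgroup.mem_centralizer_singleton_iff.mp h.2).symm.zpow_left i
  refine Subtype.ext (Equiv.ext fun p => ?_)
  obtain ⟨i, hi⟩ := cycleHom_eq_one hg p
  obtain ⟨j, hj⟩ := cycleHom_eq_one hh p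
  have hi' : g.1 p = (a ^ (-i)) p := by
    conv_rhs => rw [← hi]
    rw [← Equiv.Perm.mul_apply, ← zpow_add]; simp
  have hj' : h.1 p = (a ^ (-j)) p := by
    conv_rhs => rw [← hj]
    rw [← Equiv.Perm.mul_apply, ← zpow_add]; simp
  change g.1 (h.1 p) = h.1 (g.1 p)
  have e1 := DFunLike.congr_fun (hcg (-j)).eq p
  have e2 := DFunLike.congr_fun (hch (-i)).eq p
  simp only [Equiv.Perm.mul_apply] at e1 e2
  rw [hj', ← e1, hi', ← e2, hj', ← Equiv.Perm.mul_apply, ← Equiv.Perm.mul_apply, ← zpow_add,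
    ← zpow_add, add_comm]

theorem two_mul_card_cycles_le {S : Type} [Finite S] {a : Equiv.Perm S} (ha : ∀ p, a p ≠ p) :
    2 * Nat.card (Quotient (Equiv.Perm.SameCycle.setoid a)) ≤ Nat.card S := by
  rw [← Nat.card_eq_two_iff.mpr ⟨false, true, by decide, by ext x; cases x <;> simp⟩,
    ← Nat.card_prod]
  refine Nat.card_le_card_of_injective
    (fun x : Bool × _ => if x.1 then x.2.out else a x.2.out) ?_
  have hq : ∀ x : Quotient (Equiv.Perm.SameCycle.setoid a),
      (Quotient.mk (Equiv.Perm.SameCycle.setoid a) (a x.out)) = x := fun x => by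
    conv_rhs => rw [← Quotient.out_eq x]
    exact Quotient.sound ⟨-1, by simp⟩
  have hq' := Quotient.out_eq (s := Equiv.Perm.SameCycle.setoid a)
  rintro ⟨b, x⟩ ⟨c, y⟩ h
  have hxy : x = y := by
    have := congrArg (Quotient.mk (Equiv.Perm.SameCycle.setoid a)) h
    cases b <;> cases c <;> simpa [hq, hq'] using this
  subst hxy
  cases b <;> cases c <;> simp at h ⊢
  · exact ha _ h
  · exact ha _ h.symm

end Orbits

section SmallPerm

theorem perm_eq_one_of_card_le_three {R : Type} [Fintype R] (hR : Fintype.card R ≤ 3)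
    {a b c : Equiv.Perm R} (hab : Commute a b) (hac : Commute a c) (hbc : ¬ Commute b c) :
    a = 1 := by
  obtain ⟨e⟩ : Nonempty (R ↪ Fin 3) := Function.Embedding.nonempty_of_card_le (by simpa using hR)
  have hinj := Equiv.Perm.viaEmbeddingHom_injective e
  have key : ∀ a b c : Equiv.Perm (Fin 3), a * b = b * a → a * c = c * a → b * c ≠ c * b → a = 1 := by
    decide
  refine hinj ((key _ _ _ (hab.map _).eq (hac.map _).eq fun h => hbc (hinj ?_)).trans
    (map_one _).symm)
  rw [map_mul, map_mul]; exact h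

theorem perm_commute_of_card_le_three {R : Type} [Fintype R] (hR : Fintype.card R ≤ 3)
    {b c : Equiv.Perm R} (hb : b ^ 3 = 1) (hc : c ^ 3 = 1) : Commute b c := by
  obtain ⟨e⟩ : Nonempty (R ↪ Fin 3) := Function.Embedding.nonempty_of_card_le (by simpa using hR)
  have hinj := Equiv.Perm.viaEmbeddingHom_injective e
  have key : ∀ b c : Equiv.Perm (Fin 3), b ^ 3 = 1 → c ^ 3 = 1 → b * c = c * b := by
    decide
  refine hinj ?_
  rw [map_mul, map_mul]
  exact key _ _ (by rw [← map_pow, hb, map_one]) (by rw [← map_pow, hc, map_one])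

theorem perm_commute_of_card_le_two {R : Type} [Fintype R] (hR : Fintype.card R ≤ 2)
    (b c : Equiv.Perm R) : Commute b c := by
  obtain ⟨e⟩ : Nonempty (R ↪ Fin 2) := Function.Embedding.nonempty_of_card_le (by simpa using hR)
  have hinj := Equiv.Perm.viaEmbeddingHom_injective e
  have key : ∀ b c : Equiv.Perm (Fin 2), b * c = c * b := by decide
  refine hinj ?_
  rw [map_mul, map_mul]
  exact key _ _

variable {α : Type} {a b c : Equiv.Perm α}

theorem sameCycle_apply_iff (hab : Commute a b) {p x : α} :
    a.SameCycle (b p) (b x) ↔ a.SameCycle p x := by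
  have := Equiv.Perm.sameCycle_conj (f := a) (g := b) (x := b p) (y := b x)
  rw [← hab.eq, mul_inv_cancel_right] at this
  simpa using this

variable [Fintype α]

theorem sameCycle_of_card_le_six (hα : Fintype.card α ≤ 6) (hab : Commute a b) (hconj : IsConj a b)
    {p : α} (hp : a (a p) ≠ p) : a.SameCycle p (b p) := by
  by_contra hn
  have hne : a p ≠ p := fun h => hp (by rw [h, h])
  have hbb : ∀ x y : α, a.SameCycle p x → a.SameCycle p y → x ≠ b y := fun x y hx hy h => by
    have h2 := (sameCycle_apply_iff hab).mpr hy
    rw [← h] at h2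
    exact hn (hx.trans h2.symm)
  have s1 : a.SameCycle p (a p) := ⟨1, by simp⟩
  have s2 : a.SameCycle p (a (a p)) := ⟨2, by simp [zpow_ofNat, pow_two]⟩
  have s0 : a.SameCycle p p := Equiv.Perm.SameCycle.refl _ _
  have hnd : [p, a p, a (a p), b p, b (a p), b (a (a p))].Nodup := by
    simp [hbb p p s0 s0, hbb p _ s0 s1, hbb p _ s0 s2, hbb _ p s1 s0, hbb _ _ s1 s1, hbb _ _ s1 s2,
      hbb _ p s2 s0, hbb _ _ s2 s1, hbb _ _ s2 s2, hne.symm, Ne.symm hp]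
  have hmem : ∀ x, x ∈ [p, a p, a (a p), b p, b (a p), b (a (a p))] := fun x => by
    by_contra hx
    have := (List.nodup_cons.mpr ⟨hx, hnd⟩).length_le_card
    simp at this
    omega
  have hb2 : a.SameCycle p (b (b p)) := by
    have h := hmem (b (b p))
    simp only [List.mem_cons, List.not_mem_nil, or_false] at h
    have h' : ∀ y, a.SameCycle p y → b (b p) ≠ b y := fun y hy h => by
      rw [b.apply_eq_iff_eq] at h
      exact hn (h ▸ hy)
    rcases h with h | h | h | h | h | h
    · rw [h]
    · rw [h]; exact s1
    · rw [h]; exact s2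
    · exact absurd h (h' _ s0)
    · exact absurd h (h' _ s1)
    · exact absurd h (h' _ s2)
  have ha3 : a (a (a p)) = p := by
    have h := hmem (a (a (a p)))
    have s3 : a.SameCycle p (a (a (a p))) := ⟨3, by simp [zpow_ofNat, pow_succ]⟩
    simpa [hbb _ _ s3 s0, hbb _ _ s3 s1, hbb _ _ s3 s2, hne, hp] using h
  have hab' : ∀ x, a (b x) = b (a x) := fun x => DFunLike.congr_fun hab.eq x
  have h3 : a ^ 3 = 1 := by
    ext x
    have h := hmem x
    simp only [List.mem_cons, List.not_mem_nil, or_false] at h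
    simp only [pow_succ, pow_zero, one_mul, Equiv.Perm.mul_apply, Equiv.Perm.one_apply]
    rcases h with rfl | rfl | rfl | rfl | rfl | rfl <;> simp [hab', ha3]
  have hb3 : b ^ 3 = 1 := by
    obtain ⟨g, rfl⟩ := isConj_iff.mp hconj
    rw [conj_pow, h3]; simp
  have h4 := DFunLike.congr_fun hb3 p
  simp only [pow_succ, pow_zero, one_mul, Equiv.Perm.mul_apply, Equiv.Perm.one_apply] at h4
  exact hbb p (b (b p)) s0 hb2 h4.symm

theorem sq_eq_one_of_card_le_six (hα : Fintype.card α ≤ 6) (hab : Commute a b) (hac : Commute a c)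
    (hb : IsConj a b) (hc : IsConj a c) (hbr : b * c * b = c * b * c) (hne : b ≠ c) :
    a ^ 2 = 1 := by
  classical
  by_contra h
  obtain ⟨p, hp⟩ : ∃ p, a (a p) ≠ p := by
    by_contra! hc
    exact h (Equiv.ext fun p => by simpa [pow_two] using hc p)
  have hne' : a p ≠ p := fun h => hp (by rw [h, h])
  have sb := sameCycle_of_card_le_six hα hab hb hp
  have sc := sameCycle_of_card_le_six hα hac hc hp
  have ncomm : ¬ Commute b c := fun h => hne (eq_of_commute_of_braid hbr h)
  have sbx : ∀ x, ¬ a.SameCycle p (b x) ↔ ¬ a.SameCycle p x := fun x => not_congr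
    ⟨fun h => (sameCycle_apply_iff hab).mp (sb.symm.trans h),
      fun h => sb.trans ((sameCycle_apply_iff hab).mpr h)⟩
  have scx : ∀ x, ¬ a.SameCycle p (c x) ↔ ¬ a.SameCycle p x := fun x => not_congr
    ⟨fun h => (sameCycle_apply_iff hac).mp (sc.symm.trans h),
      fun h => sc.trans ((sameCycle_apply_iff hac).mpr h)⟩
  have sax : ∀ x, ¬ a.SameCycle p (a x) ↔ ¬ a.SameCycle p x := fun x =>
    not_congr Equiv.Perm.sameCycle_apply_right
  let R := {x // ¬ a.SameCycle p x}
  let bR : Equiv.Perm R := b.subtypePerm sbx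
  let cR : Equiv.Perm R := c.subtypePerm scx
  let aR : Equiv.Perm R := a.subtypePerm sax
  have hO : ∀ x, a.SameCycle p x → b (c x) = c (b x) := by
    rintro x ⟨j, rfl⟩
    obtain ⟨i, hi⟩ := sb
    obtain ⟨l, hl⟩ := sc
    have e1 : ∀ j : ℤ, b ((a ^ j) p) = (a ^ (i + j)) p := fun j => by
      have := DFunLike.congr_fun (hab.zpow_left j).eq p
      simp only [Equiv.Perm.mul_apply] at this
      rw [← this, ← hi, ← Equiv.Perm.mul_apply, ← zpow_add, add_comm]
    have e2 : ∀ j : ℤ, c ((a ^ j) p) = (a ^ (l + j)) p := fun j => by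
      have := DFunLike.congr_fun (hac.zpow_left j).eq p
      simp only [Equiv.Perm.mul_apply] at this
      rw [← this, ← hl, ← Equiv.Perm.mul_apply, ← zpow_add, add_comm]
    rw [e1, e2, e1, e2, add_left_comm]
  have ncR : ¬ Commute bR cR := fun h => ncomm (Equiv.ext fun x => by
    by_cases hx : a.SameCycle p x
    · exact hO x hx
    · exact congrArg Subtype.val (DFunLike.congr_fun h.eq ⟨x, hx⟩))
  have hnd : [p, a p, a (a p)].Nodup := by simp [hne'.symm, Ne.symm hp]
  let O := {x // a.SameCycle p x}
  have s1 : a.SameCycle p (a p) := ⟨1, by simp⟩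
  have s2 : a.SameCycle p (a (a p)) := ⟨2, by simp [zpow_ofNat, pow_two]⟩
  have s0 : a.SameCycle p p := Equiv.Perm.SameCycle.refl _ _
  have hsum : Fintype.card O + Fintype.card R = Fintype.card α := by
    rw [← Fintype.card_sum]
    exact Fintype.card_congr (Equiv.sumCompl _)
  have hndO : [(⟨p, s0⟩ : O), ⟨_, s1⟩, ⟨_, s2⟩].Nodup := by simp [hne'.symm, Ne.symm hp]
  have hO3 : 3 ≤ Fintype.card O := by simpa using hndO.length_le_card
  have hR3 : Fintype.card R ≤ 3 := by omega
  have hR2 : 2 < Fintype.card R := by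
    by_contra hlt
    exact ncR (perm_commute_of_card_le_two (by omega) _ _)
  have haR : aR = 1 := perm_eq_one_of_card_le_three hR3
    (show Commute aR bR from Equiv.ext fun x => Subtype.ext (DFunLike.congr_fun hab.eq x.1))
    (show Commute aR cR from Equiv.ext fun x => Subtype.ext (DFunLike.congr_fun hac.eq x.1)) ncR
  have ha3 : a (a (a p)) = p := by
    have s3 : a.SameCycle p (a (a (a p))) := ⟨3, by simp [zpow_ofNat, pow_succ]⟩
    by_contra h3
    have hnd4 : [(⟨_, s3⟩ : O), ⟨p, s0⟩, ⟨_, s1⟩, ⟨_, s2⟩].Nodup := by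
      simp [hne', hne'.symm, Ne.symm hp, hp, h3]
    have : 4 ≤ Fintype.card O := by simpa using hnd4.length_le_card
    omega
  have h3 : a ^ 3 = 1 := by
    ext x
    by_cases hx : a.SameCycle p x
    · obtain ⟨j, rfl⟩ := hx
      have hp3 : (a ^ 3) p = p := by simpa [pow_succ] using ha3
      rw [← Equiv.Perm.mul_apply, ← ((Commute.refl a).pow_left 3 |>.zpow_right j).eq.symm]
      simp [Equiv.Perm.mul_apply, hp3]
    · have e1 : ∀ y (hy : ¬ a.SameCycle p y), a y = y := fun y hy =>
        congrArg Subtype.val (DFunLike.congr_fun haR (⟨y, hy⟩ : R))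
      simp [pow_succ, e1 x hx]
  have hcube : ∀ g : Equiv.Perm α, IsConj a g → g ^ 3 = 1 := fun g hg => by
    obtain ⟨u, rfl⟩ := isConj_iff.mp hg
    rw [conj_pow, h3]; simp
  refine ncR (perm_commute_of_card_le_three hR3 ?_ ?_)
  · rw [Equiv.Perm.subtypePerm_pow]
    exact Equiv.ext fun x => Subtype.ext (DFunLike.congr_fun (hcube b hb) x.1)
  · rw [Equiv.Perm.subtypePerm_pow]
    exact Equiv.ext fun x => Subtype.ext (DFunLike.congr_fun (hcube c hc) x.1)

end SmallPerm

end BraidB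

namespace BraidB

section Centralizer

theorem IsBraid.exists_centralizer {G : Type*} [Group G] {k : ℕ} {s : ℕ → G} (h : IsBraid k s) {a : G}
    (ha : s 0 = a) :
    ∃ y : ℕ → Subgroup.centralizer {a}, IsBraid (k - 2) y ∧ ∀ i, i + 3 < k → (y i).1 = s (i + 2) := by
  classical
  subst ha
  have hm : ∀ i, i + 3 < k → s (i + 2) ∈ Subgroup.centralizer {s 0} := fun i hi =>
    Subgroup.mem_centralizer_singleton_iff.mpr (h.comm 0 (i + 2) (by omega) (by omega)).symm
  refine ⟨fun i => if hi : i + 3 < k then ⟨s (i + 2), hm i hi⟩ else 1, ⟨fun i hi => ?_,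
    fun i j hi hj => ?_⟩, fun i hi => by simp [hi]⟩
  · rw [dif_pos (by omega), dif_pos (by omega)]
    exact Subtype.ext (h.braid (i + 2) (by omega))
  · rw [dif_pos (by omega), dif_pos (by omega)]
    exact Subtype.ext (h.comm (i + 2) (j + 2) (by omega) (by omega))

/-- Restriction of a group of permutations to an invariant subset. -/
def restrictHom {S : Type} (H : Subgroup (Equiv.Perm S)) (p : S → Prop)
    (hp : ∀ g ∈ H, ∀ x, p (g x) ↔ p x) : H →* Equiv.Perm {x // p x} where
  toFun g := g.1.subtypePerm (hp g.1 g.2)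
  map_one' := rfl
  map_mul' _ _ := rfl

theorem apply_eq_iff_of_mem_centralizer {S : Type} {a g : Equiv.Perm S}
    (hg : g ∈ Subgroup.centralizer {a}) (x : S) : a (g x) = g x ↔ a x = x := by
  have h := DFunLike.congr_fun (Subgroup.mem_centralizer_singleton_iff.mp hg) x
  simp only [Equiv.Perm.mul_apply] at h
  rw [← h, g.apply_eq_iff_eq]

end Centralizer

section Sym

theorem IsBraid.eq_of_no_fixed {k : ℕ} (hk : 5 ≤ k)
    (hT : ∀ (S : Type) [Finite S] (t : ℕ → Equiv.Perm S), IsBraid k t → t 0 ≠ t 1 → k ≤ Nat.card S)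
    {S : Type} [Finite S] {a : Equiv.Perm S} (ha : ∀ p, a p ≠ p) (hS : Nat.card S ≤ k + 2)
    {t : ℕ → Subgroup.centralizer {a}} (ht : IsBraid k t) : t 0 = t 1 := by
  have hc := ht.map (cycleHom a)
  have h01 : cycleHom a (t 0) = cycleHom a (t 1) := by
    by_contra hne
    have h1 := hT _ _ hc hne
    have h2 := two_mul_card_cycles_le ha
    omega
  have h03 : cycleHom a (t 3) = cycleHom a (t 0) := hc.eq_zero h01 (by omega)
  refine ht.eq_of_commute hk (cycleHom_ker_comm (a := a) ?_ ?_)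
  · rw [map_mul, map_inv, h03, mul_inv_cancel]
  · rw [map_mul, map_inv, h03, h01, mul_inv_cancel]

theorem IsBraid.sq_eq_one_step {k : ℕ} (hk : 5 ≤ k)
    (hT : ∀ (S : Type) [Finite S] (t : ℕ → Equiv.Perm S), IsBraid k t → t 0 ≠ t 1 → k ≤ Nat.card S)
    {S : Type} [Finite S] (hS : Nat.card S ≤ k + 2) {s : ℕ → Equiv.Perm S}
    (hs : IsBraid (k + 2) s) (hne : s 0 ≠ s 1) : s 0 ^ 2 = 1 := by
  classical
  obtain ⟨a, ha⟩ : ∃ a, s 0 = a := ⟨_, rfl⟩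
  obtain ⟨y, hy, hys⟩ := hs.exists_centralizer ha
  rw [Nat.add_sub_cancel] at hy
  let fF := restrictHom (Subgroup.centralizer {a}) (fun x => a x = x)
    fun g hg x => apply_eq_iff_of_mem_centralizer hg x
  let fS := restrictHom (Subgroup.centralizer {a}) (fun x => a x ≠ x)
    fun g hg x => not_congr (apply_eq_iff_of_mem_centralizer hg x)
  let a' : Equiv.Perm {x // a x ≠ x} := fS ⟨a, Subgroup.mem_centralizer_singleton_iff.mpr rfl⟩
  have ha' : ∀ p, a' p ≠ p := fun p hp => p.2 (congrArg Subtype.val hp)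
  have hmem : ∀ g, fS g ∈ Subgroup.centralizer {a'} := fun g => by
    refine Subgroup.mem_centralizer_singleton_iff.mpr ?_
    rw [← map_mul, ← map_mul]
    exact congrArg _ (Subtype.ext (Subgroup.mem_centralizer_singleton_iff.mp g.2))
  have hcard : Nat.card {x // a x = x} + Nat.card {x // a x ≠ x} = Nat.card S := by
    rw [← Nat.card_sum]
    exact Nat.card_congr (Equiv.sumCompl _)
  have hS01 : fS (y 0) = fS (y 1) := congrArg Subtype.val
    (IsBraid.eq_of_no_fixed hk hT ha' (by omega) (hy.map (fS.codRestrict _ hmem)))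
  have hF01 : fF (y 0) ≠ fF (y 1) := fun hF => by
    refine hs.zero_ne_two (by omega) hne ?_
    rw [← hys 0 (by omega), ← hys 1 (by omega)]
    refine Equiv.ext fun x => ?_
    by_cases hx : a x = x
    · exact congrArg Subtype.val (DFunLike.congr_fun hF (⟨x, hx⟩ : {x // a x = x}))
    · exact congrArg Subtype.val (DFunLike.congr_fun hS01 (⟨x, hx⟩ : {x // a x ≠ x}))
  have hF := hT _ _ (hy.map fF) hF01
  rw [ha]
  refine Equiv.ext fun p => ?_
  by_contra hp
  have hp2 : a (a p) ≠ p := by simpa [pow_two] using hp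
  have hp1 : a p ≠ p := fun h => hp2 (by rw [h, h])
  have := Fintype.ofFinite S
  have hnd : [(⟨p, hp1⟩ : {x // a x ≠ x}), ⟨a p, fun h => hp1 (a.injective h)⟩,
      ⟨a (a p), fun h => hp1 (a.injective (a.injective h))⟩].Nodup := by
    simp [hp1.symm, Ne.symm hp2]
  have h3 : 3 ≤ Fintype.card {x // a x ≠ x} := by simpa using hnd.length_le_card
  rw [← Nat.card_eq_fintype_card] at h3
  omega

/-- The permutation of the strands, as a permutation of `Fin k`. -/
noncomputable def permF (k : ℕ) : Br k →* Equiv.Perm (Fin k) where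
  toFun b :=
    { toFun := fun j => ⟨Br.perm k b j, Br.perm_apply_lt b j.2⟩
      invFun := fun j => ⟨Br.perm k b⁻¹ j, Br.perm_apply_lt b⁻¹ j.2⟩
      left_inv := fun j => by simp
      right_inv := fun j => by simp }
  map_one' := by ext; simp
  map_mul' _ _ := by ext; simp

@[simp] theorem permF_apply {k : ℕ} (b : Br k) (j : Fin k) : (permF k b j : ℕ) = Br.perm k b j := rfl

theorem perm_eq_one_iff {k : ℕ} {b : Br k} : Br.perm k b = 1 ↔ permF k b = 1 := by
  constructor
  · intro h; ext j; simp [h]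
  · intro h; ext j
    rcases lt_or_ge j k with hj | hj
    · exact congrArg Fin.val (DFunLike.congr_fun h ⟨j, hj⟩)
    · exact Br.perm_apply_of_le b hj

theorem permF_σ {k i : ℕ} (hi : i + 1 < k) :
    permF k (Br.σ k i) = Equiv.swap ⟨i, by omega⟩ ⟨i + 1, hi⟩ := by
  ext j
  rw [permF_apply, Br.perm_σ hi, Equiv.swap_apply_def, Equiv.swap_apply_def]
  simp only [Fin.ext_iff]
  split_ifs <;> rfl

theorem permF_surjective (k : ℕ) : Function.Surjective (permF k) := by
  rcases k with _ | m
  · exact fun p => ⟨1, Subsingleton.elim _ _⟩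
  rw [← MonoidHom.range_eq_top, eq_top_iff]
  have h := Equiv.Perm.mclosure_swap_castSucc_succ m
  intro p _
  have hp : p ∈ Submonoid.closure (Set.range fun i : Fin m => Equiv.swap i.castSucc i.succ) :=
    h ▸ Submonoid.mem_top p
  refine (Submonoid.closure_le (S := (permF (m + 1)).range.toSubmonoid)).mpr ?_ hp
  rintro _ ⟨i, rfl⟩
  exact ⟨Br.σ (m + 1) i, permF_σ (by omega)⟩

theorem eq_one_of_perm_eq_one {G : Type*} [Group G] {k : ℕ} {f : Br k →* G}
    (hf : ∀ i, i + 1 < k → f (Br.σ k i) ^ 2 = 1) {b : Br k} (hb : Br.perm k b = 1) : f b = 1 := by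
  induction k with
  | zero =>
    have : f = 1 := Br.hom_ext fun i hi => by omega
    rw [this, MonoidHom.one_apply]
  | succ k ih =>
    obtain ⟨e, rfl⟩ := mem_range_iota (b := b) (by rw [hb]; rfl)
    have hx : ((f.comp (iota k)).comp (xE k)) = 1 := F.hom_ext fun i hi => by
      refine down_induction (k := k) (p := fun i => ((f.comp (iota k)).comp (xE k)) (X k i) = 1)
        ?_ (fun j hj h => ?_) i hi
      · rw [MonoidHom.comp_apply, MonoidHom.comp_apply, iota_top (by omega), map_pow]
        exact hf _ (by omega)
      · simp only [MonoidHom.comp_apply] at h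
        rw [MonoidHom.comp_apply, MonoidHom.comp_apply, E.bE_conj_X hj, map_mul, map_mul, map_mul,
          map_mul, h, mul_one, ← map_mul, ← map_mul, mul_inv_cancel, map_one, map_one]
    have h2 : (f.comp (Br.incl (Nat.le_succ k))) e.right = 1 := by
      refine ih (fun i hi => ?_) ?_
      · rw [MonoidHom.comp_apply, Br.incl_σ _ hi]; exact hf i (by omega)
      · rw [← perm_iota, hb]
    rw [E.eq_mul e, map_mul, map_mul, iota_bE]
    have h1 := DFunLike.congr_fun hx e.left
    simp only [MonoidHom.comp_apply, MonoidHom.one_apply] at h1 h2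
    rw [h1, h2, mul_one]

theorem perm_hom_injective {G : Type*} [Group G] {k : ℕ} (hk : 5 ≤ k) (f : Equiv.Perm (Fin k) →* G)
    {x y : Equiv.Perm (Fin k)} (hxy : ¬ Commute (f x) (f y)) : Function.Injective f := by
  rw [← MonoidHom.ker_eq_bot_iff]
  by_contra hne
  have h5 : 5 ≤ Nat.card (Fin k) := by simpa using hk
  have hA := Equiv.Perm.alternatingGroup_le_of_normal h5 ((Subgroup.nontrivial_iff_ne_bot _).mpr hne)
  have hc := hA (alternatingGroup.commutator_perm_le
    (Subgroup.commutator_mem_commutator (Subgroup.mem_top x) (Subgroup.mem_top y)))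
  rw [MonoidHom.mem_ker, map_commutatorElement, commutatorElement_eq_one_iff_commute] at hc
  exact hxy hc

theorem exists_perm_factor {G : Type*} [Group G] {k : ℕ} (hk : 5 ≤ k) {f : Br k →* G}
    (hf : f (Br.σ k 0) ^ 2 = 1) (hne : f (Br.σ k 0) ≠ f (Br.σ k 1)) :
    ∃ α : Equiv.Perm (Fin k) →* G, Function.Injective α ∧ ∀ b, f b = α (permF k b) := by
  have hb := (Br.isBraid_σ k).map f
  have hsq : ∀ i, i + 1 < k → f (Br.σ k i) ^ 2 = 1 := fun i hi => by
    obtain ⟨g, hg⟩ := isConj_iff.mp (hb.isConj hi)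
    rw [← hg, conj_pow, hf]; simp
  have hker : (permF k).ker ≤ f.ker := fun b h =>
    eq_one_of_perm_eq_one hsq (perm_eq_one_iff.mpr h)
  let α := (permF k).liftOfSurjective (permF_surjective k) ⟨f, hker⟩
  have hα : ∀ b, α (permF k b) = f b := fun b =>
    MonoidHom.liftOfRightInverse_comp_apply _ _ _ ⟨f, hker⟩ b
  refine ⟨α, perm_hom_injective hk α (x := permF k (Br.σ k 0)) (y := permF k (Br.σ k 1)) ?_,
    fun b => (hα b).symm⟩
  rw [hα, hα]
  exact fun hc => hne (eq_of_commute_of_braid (hb.braid 0 (by omega)) hc)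

theorem IsBraid.le_card_of_sq {k : ℕ} (hk : 5 ≤ k) {S : Type} [Finite S] {s : ℕ → Equiv.Perm S}
    (hs : IsBraid k s) (hne : s 0 ≠ s 1) (hsq : Nat.card S ≤ k → s 0 ^ 2 = 1) : k ≤ Nat.card S := by
  classical
  by_contra! hlt
  have := Fintype.ofFinite S
  have e0 := Br.lift_σ s hs (show 0 + 1 < k by omega)
  have e1 := Br.lift_σ s hs (show 1 + 1 < k by omega)
  obtain ⟨α, hα, -⟩ := exists_perm_factor hk (f := Br.lift s hs) (by rw [e0]; exact hsq hlt.le)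
    (by rw [e0, e1]; exact hne)
  have h := Nat.card_le_card_of_injective _ hα
  rw [Nat.card_perm, Nat.card_perm, Nat.card_fin] at h
  have h2 := Nat.factorial_le (show Nat.card S ≤ k - 1 by omega)
  have h3 := Nat.factorial_lt_of_lt (show 0 < k - 1 by omega) (show k - 1 < k by omega)
  omega

theorem IsBraid.sq_eq_one {k : ℕ} (hk : 5 ≤ k) {S : Type} [Finite S] {s : ℕ → Equiv.Perm S}
    (hs : IsBraid k s) (hne : s 0 ≠ s 1) (hS : Nat.card S ≤ k) : s 0 ^ 2 = 1 := by
  induction k using Nat.strong_induction_on generalizing S s with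
  | _ k ih =>
    rcases lt_or_ge k 7 with h7 | h7
    · have := Fintype.ofFinite S
      exact sq_eq_one_of_card_le_six (b := s 2) (c := s 3) (by rw [← Nat.card_eq_fintype_card]; omega)
        (hs.comm 0 2 (by omega) (by omega)) (hs.comm 0 3 (by omega) (by omega))
        (hs.isConj (by omega)) (hs.isConj (by omega)) (hs.braid 2 (by omega)) (hs.zero_ne_two hk hne)
    · obtain ⟨m, rfl⟩ : ∃ m, k = m + 2 := ⟨k - 2, by omega⟩
      exact IsBraid.sq_eq_one_step (by omega) (fun S _ t ht hn =>
        ht.le_card_of_sq (by omega) hn fun h => ih m (by omega) (by omega) ht hn h) hS hs hne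

end Sym

end BraidB

namespace BraidB

theorem A.one_eq_one (a : A 1) : a = 1 := by
  have hb : ∀ b : Br 1, b = 1 := fun b => DFunLike.congr_fun
    (show MonoidHom.id (Br 1) = 1 from Br.hom_ext fun i hi => by omega) b
  refine DFunLike.congr_fun (show MonoidHom.id (A 1) = 1 from
    A.hom_ext (fun i hi => by omega) fun _ => ?_) a
  have h := bA_Z 1
  rw [hb (Z 1), map_one] at h
  have hz : z 1 = X 1 0 := by simp [z, zp]
  rw [hz] at h
  exact inv_injective (h.symm.trans inv_one.symm)

theorem M.two_eq_one {m : M 2} (h : permM 2 m = 1) : m = 1 := by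
  obtain ⟨a, rfl⟩ := exists_aM (k := 1) (m := m) (by rw [h]; rfl)
  rw [A.one_eq_one a, map_one]

section Perfect

variable {P : Type*} [Group P]

theorem exists_lift_xA {k : ℕ} (hk : 2 ≤ k) {f : P →* A k} (hf : ∀ p, pr k (f p) = 1) :
    ∃ g : P →* F k, ∀ p, xA k (g p) = f p := by
  choose g hg using fun p => exists_xA (hf p)
  have hinj := xA_injective hk
  exact ⟨⟨⟨g, hinj (by rw [← hg, map_one, map_one])⟩, fun p q => hinj (by
    rw [map_mul, ← hg, ← hg]
    simp only
    rw [← hg, map_mul])⟩, fun p => (hg p).symm⟩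

theorem A.hom_eq_one_of_perfect (hP : ∀ f : P →* Multiplicative ℤ, f = 1) {k : ℕ} (hk : 2 ≤ k)
    {f : P →* A k} (hf : ∀ p, pr k (f p) = 1) (p : P) : f p = 1 := by
  obtain ⟨g, hg⟩ := exists_lift_xA hk hf
  rw [← hg, FreeGroup.hom_eq_one_of_perfect hP g, MonoidHom.one_apply, map_one]

theorem M.hom_eq_one_of_perfect (hP : ∀ f : P →* Multiplicative ℤ, f = 1) {k : ℕ} (hk : 2 ≤ k)
    {f : P →* M k} (hf : ∀ p, permM k (f p) = 1) (p : P) : f p = 1 := by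
  induction k, hk using Nat.le_induction generalizing p with
  | base => exact M.two_eq_one (hf p)
  | succ k hk ih =>
    obtain ⟨g, hg⟩ := exists_restrict (k := k) (by omega) (f := f) fun p => by rw [hf]; rfl
    have h1 : ∀ p, pr k (g p) = 1 := fun p => ih (f := (pr k).comp g) (fun p => by
      rw [MonoidHom.comp_apply, ← permM_aM, hg, hf]) p
    rw [← hg, A.hom_eq_one_of_perfect hP hk h1, map_one]

theorem Br.hom_commute {G : Type*} [Group G] {k : ℕ} {f : Br k →* G}
    (h : f (Br.σ k 0) = f (Br.σ k 1)) (x y : Br k) : Commute (f x) (f y) := by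
  have hz : ∀ x, f x ∈ Subgroup.zpowers (f (Br.σ k 0)) := fun x => by
    induction x using Br.induction with
    | one => rw [map_one]; exact one_mem _
    | mul x y hx hy => rw [map_mul]; exact mul_mem hx hy
    | inv x hx => rw [map_inv]; exact inv_mem hx
    | gen i hi =>
      rw [((Br.isBraid_σ k).map f).eq_zero h hi]
      exact Subgroup.mem_zpowers _
  obtain ⟨i, hi⟩ := Subgroup.mem_zpowers_iff.mp (hz x)
  obtain ⟨j, hj⟩ := Subgroup.mem_zpowers_iff.mp (hz y)
  rw [← hi, ← hj]
  exact Commute.zpow_zpow_self _ _ _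

theorem Br.mul_inv_mem_commutator {k i j : ℕ} (hk : 3 ≤ k) (hi : i + 1 < k) (hj : j + 1 < k) :
    Br.σ k i * (Br.σ k j)⁻¹ ∈ commutator (Br k) := by
  rw [← Abelianization.ker_of, MonoidHom.mem_ker, map_mul, map_inv, mul_inv_eq_one]
  have hb := (Br.isBraid_σ k).map (Abelianization.of (G := Br k))
  have h01 := eq_of_commute_of_braid (hb.braid 0 (by omega)) (mul_comm _ _)
  exact (hb.eq_zero h01 hi).trans (hb.eq_zero h01 hj).symm

/-- The commutator subgroup of the braid group on at least five strands is perfect. -/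
theorem Br.commutator_perfect {k : ℕ} (hk : 5 ≤ k) :
    ∀ f : commutator (Br k) →* Multiplicative ℤ, f = 1 := by
  set D := commutator (Br k)
  set q := QuotientGroup.mk' ⁅D, D⁆
  have hq : ∀ x ∈ D, ∀ y ∈ D, Commute (q x) (q y) := fun x hx y hy => by
    rw [← commutatorElement_eq_one_iff_commute, ← map_commutatorElement]
    exact (QuotientGroup.eq_one_iff _).mpr (Subgroup.commutator_mem_commutator hx hy)
  have hb := (Br.isBraid_σ k).map q
  have hD : ∀ i j, i + 1 < k → j + 1 < k → Br.σ k i * (Br.σ k j)⁻¹ ∈ D := fun i j hi hj =>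
    Br.mul_inv_mem_commutator (by omega) hi hj
  have h01 : q (Br.σ k 0) = q (Br.σ k 1) := hb.eq_of_commute hk (by
    rw [← map_inv, ← map_mul, ← map_mul]
    exact hq _ (hD _ _ (by omega) (by omega)) _ (hD _ _ (by omega) (by omega)))
  have hle : D ≤ ⁅D, D⁆ := Subgroup.commutator_le.mpr fun x _ y _ => by
    rw [← (QuotientGroup.eq_one_iff _)]
    change q _ = 1
    rw [map_commutatorElement, commutatorElement_eq_one_iff_commute]
    exact Br.hom_commute h01 x y
  refine fun f => MonoidHom.ext fun ⟨d, hd⟩ => ?_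
  have hd' : d ∈ (commutator D).map D.subtype := by
    rw [commutator_def, Subgroup.map_commutator, ← MonoidHom.range_eq_map, D.range_subtype]
    exact hle hd
  obtain ⟨d', hd', rfl⟩ := hd'
  exact Abelianization.commutator_subset_ker f hd'

end Perfect

section Outer

/-- The strand permutation of an element of `A k`, as a permutation of `Fin k`. -/
noncomputable def permA (k : ℕ) : A k →* Equiv.Perm (Fin k) :=
  (M.lift (permF k) (perm_eq_one_iff.mp (perm_Z k))).comp (pr k)

@[simp] theorem permA_bA {k : ℕ} (b : Br k) : permA k (bA k b) = permF k b := rfl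

@[simp] theorem permA_xA {k : ℕ} (w : F k) : permA k (xA k w) = 1 := by
  rw [permA, MonoidHom.comp_apply, pr_xA, map_one]

theorem permA_eq_one {k : ℕ} {a : A k} : permA k a = 1 ↔ permM k (pr k a) = 1 := by
  obtain ⟨w, b, rfl⟩ := A.exists_mul a
  rw [map_mul, permA_xA, one_mul, permA_bA, map_mul, pr_xA, one_mul, pr_bA, permM_mq,
    perm_eq_one_iff]

theorem permA_eq_iff {k : ℕ} {a b : A k} :
    permA k a = permA k b ↔ permM k (pr k a) = permM k (pr k b) := by
  rw [← inv_mul_eq_one, ← map_inv, ← map_mul, permA_eq_one, map_mul, map_inv, map_mul, map_inv,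
    inv_mul_eq_one]

theorem bA_σ_ne {k : ℕ} (hk : 3 ≤ k) : bA k (Br.σ k 0) ≠ bA k (Br.σ k 1) := fun h => by
  have h1 := congrArg (fun a => permM k (pr k a) 0) h
  simp only [pr_bA, permM_mq] at h1
  rw [Br.perm_σ (by omega), Br.perm_σ (by omega)] at h1
  simp [Equiv.swap_apply_def] at h1

theorem permA_comp_ne {k : ℕ} (hk : 5 ≤ k) {φ : A k →* A k} (hφ : Function.Injective φ) :
    permA k (φ (bA k (Br.σ k 0))) ≠ permA k (φ (bA k (Br.σ k 1))) := fun h => by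
  have hP := fun f => Br.commutator_perfect hk f
  let f : commutator (Br k) →* A k := (φ.comp (bA k)).comp (commutator (Br k)).subtype
  have hf : ∀ d, permM k (pr k (f d)) = 1 := fun d => by
    rw [← permA_eq_one]
    have hle : commutator (Br k) ≤ ((permA k).comp (φ.comp (bA k))).ker :=
      Subgroup.commutator_le.mpr fun x _ y _ => by
        rw [MonoidHom.mem_ker, map_commutatorElement, commutatorElement_eq_one_iff_commute]
        exact Br.hom_commute h x y
    exact hle d.2
  have h1 := A.hom_eq_one_of_perfect hP (by omega)
    (M.hom_eq_one_of_perfect hP (by omega) (f := (pr k).comp f) hf)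
  refine bA_σ_ne (by omega) (hφ ?_)
  rw [← mul_inv_eq_one, ← map_inv, ← map_inv, ← map_mul, ← map_mul]
  exact h1 ⟨_, Br.mul_inv_mem_commutator (by omega) (by omega) (by omega)⟩

theorem perm_eq_one_of_commute_swap {k : ℕ} (hk : 4 ≤ k) {g : Equiv.Perm (Fin k)}
    (hg : ∀ i (hi : i + 2 < k), Commute g (Equiv.swap ⟨i, by omega⟩ ⟨i + 1, by omega⟩)) : g = 1 := by
  have key : ∀ i (hi : i + 2 < k), ((g ⟨i, by omega⟩ : ℕ) = i ∨ (g ⟨i, by omega⟩ : ℕ) = i + 1) ∧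
      ((g ⟨i + 1, by omega⟩ : ℕ) = i ∨ (g ⟨i + 1, by omega⟩ : ℕ) = i + 1) := fun i hi => by
    have h := (hg i hi).eq
    rw [Equiv.mul_swap_eq_swap_mul, mul_left_inj] at h
    have h1 := congrArg Fin.val (DFunLike.congr_fun h (g ⟨i, by omega⟩))
    have h2 := congrArg Fin.val (DFunLike.congr_fun h (g ⟨i + 1, by omega⟩))
    rw [Equiv.swap_apply_left, Equiv.swap_apply_def] at h1
    rw [Equiv.swap_apply_right, Equiv.swap_apply_def] at h2
    have hne : (g ⟨i, by omega⟩ : ℕ) ≠ g ⟨i + 1, by omega⟩ := fun h => by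
      have := congrArg Fin.val (g.injective (Fin.ext h))
      simp at this
    constructor
    · split_ifs at h1 with h3 h4
      · exact Or.inl (congrArg Fin.val h3)
      · exact Or.inr (congrArg Fin.val h4)
      · exact absurd h1.symm hne
    · split_ifs at h2 with h3 h4
      · exact Or.inl (congrArg Fin.val h3)
      · exact Or.inr (congrArg Fin.val h4)
      · exact absurd h2 hne
  have hmid : ∀ j (hj : 1 ≤ j) (hj' : j + 2 < k), (g ⟨j, by omega⟩ : ℕ) = j := fun j hj hj' => by
    have h1 := (key j hj').1
    have h2 := (key (j - 1) (by omega)).2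
    simp only [Nat.sub_add_cancel hj] at h2
    omega
  have hinj : ∀ i j (hi : i < k) (hj : j < k), (g ⟨i, hi⟩ : ℕ) = g ⟨j, hj⟩ → i = j :=
    fun i j hi hj h => congrArg Fin.val (g.injective (Fin.ext h))
  have hlow : ∀ j (hj' : j + 1 < k), (g ⟨j, by omega⟩ : ℕ) = j := fun j hj' => by
    rcases Nat.eq_zero_or_pos j with rfl | hj
    · have h1 := (key 0 (by omega)).1
      have h2 := hmid 1 le_rfl (by omega)
      have h3 := hinj 0 1 (by omega) (by omega)
      omega
    rcases lt_or_ge (j + 2) k with h | h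
    · exact hmid j hj h
    · have h2 := (key (j - 1) (by omega)).2
      simp only [Nat.sub_add_cancel hj] at h2
      have h3 := hmid (j - 1) (by omega) (by omega)
      have h4 := hinj j (j - 1) (by omega) (by omega)
      omega
  ext ⟨j, hj⟩
  rcases lt_or_ge (j + 1) k with h | h
  · exact hlow j h
  · by_contra hne
    have hlt := (g ⟨j, hj⟩).2
    simp only [Equiv.Perm.one_apply] at hne
    have h5 := hlow (g ⟨j, hj⟩) (by omega)
    exact hne (hinj _ _ _ hj h5)

theorem exists_permA_factor {k : ℕ} (hk : 5 ≤ k) {φ : A k →* A k} (hφ : Function.Injective φ) :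
    ∃ α : MulAut (Equiv.Perm (Fin k)), ∀ a, permA k (φ a) = α (permA k a) := by
  let f : Br k →* Equiv.Perm (Fin k) := (permA k).comp (φ.comp (bA k))
  have hb := (Br.isBraid_σ k).map f
  have hne := permA_comp_ne hk hφ
  obtain ⟨α, hα, hf⟩ := exists_perm_factor hk (f := f) (hb.sq_eq_one hk hne (by simp)) hne
  refine ⟨MulEquiv.ofBijective α (Finite.injective_iff_bijective.mp hα), ?_⟩
  suffices h : (permA k).comp φ = α.comp (permA k) from DFunLike.congr_fun h
  refine A.hom_ext (fun i hi => hf _) fun hk0 => ?_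
  obtain ⟨g, hg⟩ := (Finite.injective_iff_bijective.mp hα).2 (permA k (φ (xA k (X k (k - 1)))))
  have hg1 : g = 1 := perm_eq_one_of_commute_swap (by omega) fun i hi => hα ?_
  · rw [MonoidHom.comp_apply, MonoidHom.comp_apply, permA_xA, map_one, ← hg, hg1, map_one]
  rw [← permF_σ (by omega), map_mul, map_mul, hg, ← hf]
  have hc := (E.isAnnular k).comm i hi
  have := congrArg (fun e => permA k (φ (aq k e))) hc
  simp only [map_mul] at this
  exact this.symm

/-- Some positive power of an injective endomorphism preserves strand permutations. -/
theorem exists_pow_perm {k : ℕ} (hk : 5 ≤ k) {φ : A k →* A k} (hφ : Function.Injective φ) :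
    ∃ m > 0, ∀ a, permM k (pr k (φ^[m] a)) = permM k (pr k a) := by
  obtain ⟨α, hα⟩ := exists_permA_factor hk hφ
  have : Finite (MulAut (Equiv.Perm (Fin k))) := DFunLike.finite _
  refine ⟨orderOf α, orderOf_pos α, fun a => ?_⟩
  rw [← permA_eq_iff]
  have h : ∀ m : ℕ, permA k (φ^[m] a) = (α ^ m) (permA k a) := fun m => by
    induction m with
    | zero => rfl
    | succ m ih => rw [Function.iterate_succ_apply', hα, ih, pow_succ', MulAut.mul_apply]
  rw [h, pow_orderOf_eq_one, MulAut.one_apply]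

end Outer

end BraidB

namespace BraidB

open Matrix (SpecialLinearGroup)

/-- The group `SL₂(ℤ)`. -/
abbrev SL2 := SpecialLinearGroup (Fin 2) ℤ

namespace SL2

/-- The upper unipotent generator. -/
def U : SL2 := ⟨!![1, 1; 0, 1], by simp⟩
/-- The lower unipotent generator. -/
def L : SL2 := ⟨!![1, 0; -1, 1], by simp⟩

theorem mul_00 (x y : SL2) : (x * y) 0 0 = x 0 0 * y 0 0 + x 0 1 * y 1 0 := by
  simp [Matrix.mul_apply, Fin.sum_univ_two]
theorem mul_01 (x y : SL2) : (x * y) 0 1 = x 0 0 * y 0 1 + x 0 1 * y 1 1 := by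
  simp [Matrix.mul_apply, Fin.sum_univ_two]
theorem mul_10 (x y : SL2) : (x * y) 1 0 = x 1 0 * y 0 0 + x 1 1 * y 1 0 := by
  simp [Matrix.mul_apply, Fin.sum_univ_two]
theorem mul_11 (x y : SL2) : (x * y) 1 1 = x 1 0 * y 0 1 + x 1 1 * y 1 1 := by
  simp [Matrix.mul_apply, Fin.sum_univ_two]

theorem inv_00 (x : SL2) : x⁻¹ 0 0 = x 1 1 := by simp [Matrix.adjugate_fin_two]
theorem inv_01 (x : SL2) : x⁻¹ 0 1 = -x 0 1 := by simp [Matrix.adjugate_fin_two]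
theorem inv_10 (x : SL2) : x⁻¹ 1 0 = -x 1 0 := by simp [Matrix.adjugate_fin_two]
theorem inv_11 (x : SL2) : x⁻¹ 1 1 = x 0 0 := by simp [Matrix.adjugate_fin_two]

theorem det (x : SL2) : x 0 0 * x 1 1 - x 0 1 * x 1 0 = 1 := by
  rw [← Matrix.det_fin_two]; exact x.2

theorem ext_iff' {x y : SL2} :
    x = y ↔ x 0 0 = y 0 0 ∧ x 0 1 = y 0 1 ∧ x 1 0 = y 1 0 ∧ x 1 1 = y 1 1 := by
  refine ⟨fun h => by simp [h], fun ⟨h1, h2, h3, h4⟩ => ?_⟩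
  ext i j
  fin_cases i <;> fin_cases j <;> assumption

theorem neg_apply (x : SL2) (i j : Fin 2) : (-x) i j = -x i j := by simp

theorem U_00 : U 0 0 = 1 := rfl
theorem U_01 : U 0 1 = 1 := rfl
theorem U_10 : U 1 0 = 0 := rfl
theorem U_11 : U 1 1 = 1 := rfl
theorem L_00 : L 0 0 = 1 := rfl
theorem L_01 : L 0 1 = 0 := rfl
theorem L_10 : L 1 0 = -1 := rfl
theorem L_11 : L 1 1 = 1 := rfl

/-- The trace. -/
def tr (x : SL2) : ℤ := x 0 0 + x 1 1

theorem tr_neg (x : SL2) : tr (-x) = -tr x := by simp only [tr, neg_apply]; ring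
theorem tr_mul_comm (x y : SL2) : tr (x * y) = tr (y * x) := by
  simp only [tr, mul_00, mul_11]; ring
theorem tr_conj (x y : SL2) : tr (y * x * y⁻¹) = tr x := by
  rw [tr_mul_comm, inv_mul_cancel_left]

theorem braid_UL : U * L * U = L * U * L := by
  simp [ext_iff', mul_00, mul_01, mul_10, mul_11, U_00, U_01, U_10, U_11, L_00, L_01, L_10, L_11]

end SL2

open SL2

theorem isBraid_UL : IsBraid 3 (fun i => if i = 0 then U else L) where
  braid i hi := by
    obtain rfl : i = 0 := by omega
    exact braid_UL
  comm i j h1 h2 := by omega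

/-- The reduced Burau representation at `t = -1`. -/
noncomputable def R : Br 3 →* SL2 := Br.lift _ isBraid_UL

theorem R_zero : R (Br.σ 3 0) = U := Br.lift_σ _ isBraid_UL (by omega)
theorem R_one : R (Br.σ 3 1) = L := Br.lift_σ _ isBraid_UL (by omega)

theorem R_Z : R (Z 3) = -1 := by
  have : R (Z 3) = (U * L) ^ 3 := by
    simp [Z, rho, R_zero, R_one]
  rw [this]
  simp [pow_succ, ext_iff', mul_00, mul_01, mul_10, mul_11, U_00, U_01, U_10, U_11, L_00, L_01,
    L_10, L_11]

theorem R_eq_of_mq {b c : Br 3} (h : mq 3 b = mq 3 c) : R b = R c ∨ R b = -R c := by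
  have h1 : mq 3 (b * c⁻¹) = 1 := by rw [map_mul, map_inv, h, mul_inv_cancel]
  obtain ⟨j, hj⟩ := mq_eq_one.mp h1
  have h2 : R b = (-1) ^ j * R c := by
    rw [← R_Z, ← map_zpow, ← hj, map_mul, map_inv, inv_mul_cancel_right]
  rcases Int.even_or_odd j with h | h
  · left; rw [h2, h.neg_one_zpow, one_mul]
  · right; rw [h2, h.neg_one_zpow, neg_one_mul]

section Parity

/-- The representation `R` modulo two. -/
noncomputable def R2 : Br 3 →* SpecialLinearGroup (Fin 2) (ZMod 2) :=
  (SpecialLinearGroup.map (Int.castRingHom (ZMod 2))).comp R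

theorem R2_apply (b : Br 3) (i j : Fin 2) : R2 b i j = ((R b i j : ℤ) : ZMod 2) := rfl

theorem R2_eq {b c : Br 3} (h : Br.perm 3 b = Br.perm 3 c) : R2 b = R2 c := by
  rw [← mul_inv_eq_one, ← map_inv, ← map_mul]
  refine eq_one_of_perm_eq_one (f := R2) (fun i hi => ?_) (by rw [map_mul, map_inv, h, mul_inv_cancel])
  have h : ∀ x : SL2, (∀ i j, ((x i j : ℤ) : ZMod 2) = (1 : SL2) i j) →
      SpecialLinearGroup.map (Int.castRingHom (ZMod 2)) x = 1 := fun x hx => by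
    rw [← map_one (SpecialLinearGroup.map (Int.castRingHom (ZMod 2)))]
    ext i j
    exact hx i j
  rw [R2, MonoidHom.comp_apply, ← map_pow]
  obtain rfl | rfl : i = 0 ∨ i = 1 := by omega
  · rw [R_zero]
    refine h _ ?_
    decide
  · rw [R_one]
    refine h _ ?_
    decide

theorem R_parity {b c : Br 3} (h : Br.perm 3 b = Br.perm 3 c) (i j : Fin 2) :
    ∃ m, R b i j = R c i j + 2 * m := by
  have h1 := congrArg (fun x => x i j) (R2_eq h)
  simp only [R2_apply] at h1
  rw [ZMod.intCast_eq_intCast_iff, Int.modEq_iff_dvd] at h1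
  obtain ⟨m, hm⟩ := h1
  exact ⟨-m, by push_cast at hm; linarith⟩

/-- The nonzero vectors modulo two, indexed by strands. -/
def vec2 (j : ℕ) : Fin 2 → ZMod 2 := if j = 0 then ![0, 1] else if j = 1 then ![1, 1] else ![1, 0]

/-- Matrices modulo two acting on vectors. -/
def actVec (x : SpecialLinearGroup (Fin 2) (ZMod 2)) (v : Fin 2 → ZMod 2) : Fin 2 → ZMod 2 :=
  Matrix.mulVec (x : Matrix (Fin 2) (Fin 2) (ZMod 2)) v

theorem actVec_mul (x y : SpecialLinearGroup (Fin 2) (ZMod 2)) (v : Fin 2 → ZMod 2) :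
    actVec (x * y) v = actVec x (actVec y v) :=
  (Matrix.mulVec_mulVec v (x : Matrix (Fin 2) (Fin 2) (ZMod 2)) y).symm

theorem actVec_one (v : Fin 2 → ZMod 2) : actVec 1 v = v := Matrix.one_mulVec v

theorem actVec_R2 (b : Br 3) : ∀ j < 3, actVec (R2 b) (vec2 j) = vec2 (Br.perm 3 b j) := by
  refine Br.induction b ?_ ?_ ?_ ?_
  · intro j _; simp [actVec_one]
  · intro x y hx hy j hj
    rw [map_mul, map_mul, actVec_mul, hy j hj, hx _ (Br.perm_apply_lt _ hj), Equiv.Perm.mul_apply]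
  · intro x hx j hj
    have h := hx _ (Br.perm_apply_lt x⁻¹ hj)
    rw [← Equiv.Perm.mul_apply, ← map_mul, mul_inv_cancel, map_one, Equiv.Perm.one_apply] at h
    rw [← h, ← actVec_mul, ← map_mul, inv_mul_cancel, map_one, actVec_one]
  · intro i hi j hj
    rw [Br.perm_σ hi, R2, MonoidHom.comp_apply]
    obtain rfl | rfl : i = 0 ∨ i = 1 := by omega
    · rw [R_zero]
      interval_cases j <;> decide
    · rw [R_one]
      interval_cases j <;> decide

theorem vec2_injective {i j : ℕ} (hi : i < 3) (hj : j < 3) (h : vec2 i = vec2 j) : i = j := by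
  interval_cases i <;> interval_cases j <;> first | rfl | (exfalso; revert h; decide)

theorem perm_eq_one_of_R {b : Br 3} (h : R b = 1 ∨ R b = -1) : Br.perm 3 b = 1 := by
  have h2 : R2 b = 1 := by
    ext i j
    rw [R2_apply]
    obtain h | h := h <;> rw [h] <;> fin_cases i <;> fin_cases j <;> decide
  ext j
  by_cases hj : j < 3
  · have h1 := actVec_R2 b j hj
    rw [h2, actVec_one] at h1
    exact (vec2_injective hj (Br.perm_apply_lt b hj) h1).symm
  · rw [Br.perm_apply_of_le b (by omega)]; rfl

end Parity

section Sanov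

open scoped Pointwise in
theorem sanov : Function.Injective (FreeGroup.lift ![U * L ^ 2 * U⁻¹, L ^ 2]) := by
  let a : Fin 2 → SL2 := ![U * L ^ 2 * U⁻¹, L ^ 2]
  let P : Fin 2 → Set SL2 := ![{g | (g 0 0 - g 1 0) * (2 * g 0 0 - g 1 0) < 0},
    {g | g 0 0 * g 1 0 < 0}]
  let Q : Fin 2 → Set SL2 := ![{g | 0 ≤ (g 0 0 - g 1 0) * g 1 0},
    {g | 0 ≤ g 0 0 * (g 1 0 - 2 * g 0 0)}]
  have e00 : ∀ g : SL2, (a 0 * g) 0 0 = -g 0 0 + 2 * g 1 0 := fun g => by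
    rw [mul_00, show a 0 0 0 = -1 from rfl, show a 0 0 1 = 2 from rfl]; ring
  have e01 : ∀ g : SL2, (a 0 * g) 1 0 = -2 * g 0 0 + 3 * g 1 0 := fun g => by
    rw [mul_10, show a 0 1 0 = -2 from rfl, show a 0 1 1 = 3 from rfl]
  have e10 : ∀ g : SL2, (a 1 * g) 0 0 = g 0 0 := fun g => by
    rw [mul_00, show a 1 0 0 = 1 from rfl, show a 1 0 1 = 0 from rfl]; ring
  have e11 : ∀ g : SL2, (a 1 * g) 1 0 = -2 * g 0 0 + g 1 0 := fun g => by
    rw [mul_10, show a 1 1 0 = -2 from rfl, show a 1 1 1 = 1 from rfl]; ring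
  have f00 : ∀ g : SL2, ((a 0)⁻¹ * g) 0 0 = 3 * g 0 0 - 2 * g 1 0 := fun g => by
    rw [mul_00, show (a 0)⁻¹ 0 0 = 3 from rfl, show (a 0)⁻¹ 0 1 = -2 from rfl]; ring
  have f01 : ∀ g : SL2, ((a 0)⁻¹ * g) 1 0 = 2 * g 0 0 - g 1 0 := fun g => by
    rw [mul_10, show (a 0)⁻¹ 1 0 = 2 from rfl, show (a 0)⁻¹ 1 1 = -1 from rfl]; ring
  have f10 : ∀ g : SL2, ((a 1)⁻¹ * g) 0 0 = g 0 0 := fun g => by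
    rw [mul_00, show (a 1)⁻¹ 0 0 = 1 from rfl, show (a 1)⁻¹ 0 1 = 0 from rfl]; ring
  have f11 : ∀ g : SL2, ((a 1)⁻¹ * g) 1 0 = 2 * g 0 0 + g 1 0 := fun g => by
    rw [mul_10, show (a 1)⁻¹ 1 0 = 2 from rfl, show (a 1)⁻¹ 1 1 = 1 from rfl]; ring
  have hne : ∀ g : SL2, ¬ (g 0 0 = 0 ∧ g 1 0 = 0) := fun g ⟨h1, h2⟩ => by
    have := det g
    rw [h1, h2] at this
    simp at this
  have key : ∀ g : SL2, ¬ (g ∈ P 0 ∧ g ∈ P 1) ∧ ¬ (g ∈ Q 0 ∧ g ∈ Q 1) ∧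
      ∀ i j, ¬ (g ∈ P i ∧ g ∈ Q j) := by
    intro g
    have h0 := hne g
    generalize hx : g 0 0 = x at h0
    generalize hy : g 1 0 = y at h0
    have p0 : g ∈ P 0 ↔ (x - y) * (2 * x - y) < 0 := by rw [← hx, ← hy]; rfl
    have p1 : g ∈ P 1 ↔ x * y < 0 := by rw [← hx, ← hy]; rfl
    have q0 : g ∈ Q 0 ↔ 0 ≤ (x - y) * y := by rw [← hx, ← hy]; rfl
    have q1 : g ∈ Q 1 ↔ 0 ≤ x * (y - 2 * x) := by rw [← hx, ← hy]; rfl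
    refine ⟨?_, ?_, ?_⟩
    · rw [p0, p1]; rintro ⟨h1, h2⟩; nlinarith [sq_nonneg x, sq_nonneg y]
    · rw [q0, q1]; rintro ⟨h1, h2⟩
      have h3 : x ^ 2 + (x - y) ^ 2 ≤ 0 := by nlinarith
      have h4 : x = 0 := by nlinarith [sq_nonneg (x - y), sq_nonneg x]
      have h5 : x - y = 0 := by nlinarith [sq_nonneg (x - y), sq_nonneg x]
      exact h0 ⟨h4, by omega⟩
    · intro i j
      fin_cases i <;> fin_cases j <;> simp only [Fin.zero_eta, Fin.mk_one, Fin.isValue] <;>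
        simp only [p0, p1, q0, q1] <;> rintro ⟨h1, h2⟩
      · nlinarith [sq_nonneg (x - y)]
      · nlinarith [sq_nonneg (y - 2 * x)]
      · nlinarith [sq_nonneg y]
      · nlinarith [sq_nonneg x]
  refine FreeGroup.injective_lift_of_ping_pong a P Q ?_ ?_ ?_ ?_ ?_ ?_
  · intro i
    fin_cases i
    · exact ⟨⟨!![2, 1; 3, 2], by simp⟩, by show ((2 : ℤ) - 3) * (2 * 2 - 3) < 0; norm_num⟩
    · exact ⟨L, by show (1 : ℤ) * (-1) < 0; norm_num⟩
  · intro i j hij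
    refine Set.disjoint_left.mpr fun g h1 h2 => ?_
    fin_cases i <;> fin_cases j
    · exact hij rfl
    · exact (key g).1 ⟨h1, h2⟩
    · exact (key g).1 ⟨h2, h1⟩
    · exact hij rfl
  · intro i j hij
    refine Set.disjoint_left.mpr fun g h1 h2 => ?_
    fin_cases i <;> fin_cases j
    · exact hij rfl
    · exact (key g).2.1 ⟨h1, h2⟩
    · exact (key g).2.1 ⟨h2, h1⟩
    · exact hij rfl
  · exact fun i j => Set.disjoint_left.mpr fun g h1 h2 => (key g).2.2 i j ⟨h1, h2⟩
  · intro i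
    rintro _ ⟨g, hg, rfl⟩
    fin_cases i
    · have hg' : ¬ 0 ≤ (g 0 0 - g 1 0) * g 1 0 := hg
      show ((a 0 * g) 0 0 - (a 0 * g) 1 0) * (2 * (a 0 * g) 0 0 - (a 0 * g) 1 0) < 0
      rw [e00, e01]
      nlinarith
    · have hg' : ¬ 0 ≤ g 0 0 * (g 1 0 - 2 * g 0 0) := hg
      show (a 1 * g) 0 0 * (a 1 * g) 1 0 < 0
      rw [e10, e11]
      nlinarith
  · intro i
    rintro _ ⟨g, hg, rfl⟩
    fin_cases i
    · have hg' : ¬ (g 0 0 - g 1 0) * (2 * g 0 0 - g 1 0) < 0 := hg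
      show 0 ≤ (((a 0)⁻¹ * g) 0 0 - ((a 0)⁻¹ * g) 1 0) * ((a 0)⁻¹ * g) 1 0
      rw [f00, f01]
      nlinarith
    · have hg' : ¬ g 0 0 * g 1 0 < 0 := hg
      show 0 ≤ ((a 1)⁻¹ * g) 0 0 * (((a 1)⁻¹ * g) 1 0 - 2 * ((a 1)⁻¹ * g) 0 0)
      rw [f10, f11]
      nlinarith

end Sanov

theorem M.exists_pure_three {m : M 3} (h : permM 3 m = 1) : ∃ w, m = aM 2 (xA 2 w) := by
  obtain ⟨a, rfl⟩ := exists_aM (k := 2) (m := m) (by rw [h]; rfl)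
  obtain ⟨w, rfl⟩ := exists_xA (M.two_eq_one (m := pr 2 a) (by rw [← permM_aM, h]))
  exact ⟨w, rfl⟩

theorem R_faithful {b c : Br 3} (h : R b = R c ∨ R b = -R c) : mq 3 b = mq 3 c := by
  have h1 : R (b * c⁻¹) = 1 ∨ R (b * c⁻¹) = -1 := by
    rw [map_mul, map_inv]
    rcases h with h | h <;> rw [h] <;> simp
  have h2 := perm_eq_one_of_R h1
  rw [← mul_inv_eq_one, ← map_inv, ← map_mul]
  obtain ⟨d, hd⟩ : ∃ d, b * c⁻¹ = d := ⟨_, rfl⟩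
  rw [hd] at h1 h2 ⊢
  obtain ⟨w, ha⟩ := M.exists_pure_three (m := mq 3 d) (by rw [permM_mq, h2])
  have h4 : ∀ v : F 2, R (iota 2 (xE 2 v)) = FreeGroup.lift ![U * L ^ 2 * U⁻¹, L ^ 2] v := by
    suffices h : (R.comp (iota 2)).comp (xE 2) = FreeGroup.lift ![U * L ^ 2 * U⁻¹, L ^ 2] from
      DFunLike.congr_fun h
    have e1 : R (iota 2 (xE 2 (X 2 1))) = L ^ 2 := by
      have h := congrArg R (iota_top (k := 2) (by omega))
      rw [map_pow] at h
      exact h.trans (congrArg (· ^ 2) R_one)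
    refine F.hom_ext fun i hi => ?_
    obtain rfl | rfl : i = 0 ∨ i = 1 := by omega
    · rw [MonoidHom.comp_apply, MonoidHom.comp_apply, E.bE_conj_X (by omega), map_mul, map_mul,
        map_mul, map_mul, map_inv, map_inv, iota_bE, Br.incl_σ _ (by omega), e1, R_zero,
        X_of_lt (by omega), FreeGroup.lift_apply_of]
      rfl
    · rw [MonoidHom.comp_apply, MonoidHom.comp_apply, e1, X_of_lt (by omega),
        FreeGroup.lift_apply_of]
      rfl
  have h5 : R (iota 2 (xE 2 w)) = 1 ∨ R (iota 2 (xE 2 w)) = -1 := by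
    have h6 : mq 3 (iota 2 (xE 2 w)) = mq 3 d := by rw [ha, ← aq_xE, aM_aq]
    rcases R_eq_of_mq h6 with h | h <;> rcases h1 with h1 | h1 <;> rw [h, h1] <;> simp
  have h7 : w ^ 2 = 1 := by
    refine sanov ?_
    rw [← h4, map_one, map_pow, map_pow, map_pow]
    rcases h5 with h | h <;> rw [h] <;> simp
  have h8 : w = 1 := (pow_eq_one_iff_left two_ne_zero).mp h7
  rw [ha, h8, map_one, map_one]

namespace SL2

theorem tr_eq_zero_of_anticommute {x y : SL2} (h : x * y = -(y * x)) : tr x = 0 := by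
  have h1 : x = -(y * x * y⁻¹) := by rw [← neg_mul, ← h, mul_inv_cancel_right]
  have h2 := congrArg tr h1
  rw [tr_neg, tr_conj] at h2
  omega

theorem tr_eq_of_braid {x y : SL2} (h : x * y * x = y * x * y ∨ x * y * x = -(y * x * y)) :
    tr y = tr x ∨ tr y = -tr x := by
  have h0 : tr ((x * y) * x * (x * y)⁻¹) = tr x := tr_conj _ _
  rcases h with h | h
  · rw [h, mul_assoc y, mul_inv_cancel_right] at h0
    exact Or.inl h0
  · rw [h, mul_assoc y, ← neg_mul, mul_inv_cancel_right, tr_neg] at h0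
    exact Or.inr (by omega)

theorem not_braid_of_sq_commute {x y : SL2} (h : x * y * x = y * x * y ∨ x * y * x = -(y * x * y))
    (hx : ∀ i j, ∃ m, x i j = U i j + 2 * m) (hy : ∀ i j, ∃ m, y i j = L i j + 2 * m)
    (hc : x ^ 2 * y ^ 2 = y ^ 2 * x ^ 2 ∨ x ^ 2 * y ^ 2 = -(y ^ 2 * x ^ 2)) : False := by
  have htr := tr_eq_of_braid h
  have hsq : ∀ x : SL2, tr (x ^ 2) = tr x ^ 2 - 2 := fun x => by
    have := det x
    simp only [tr, pow_two, mul_00, mul_11]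
    linear_combination -2 * this
  obtain ⟨a', ha⟩ := hx 0 0
  obtain ⟨b', hb⟩ := hx 0 1
  obtain ⟨c', hc'⟩ := hx 1 0
  obtain ⟨d', hd⟩ := hx 1 1
  obtain ⟨p', hp⟩ := hy 0 0
  obtain ⟨q', hq⟩ := hy 0 1
  obtain ⟨r', hr⟩ := hy 1 0
  obtain ⟨s', hs⟩ := hy 1 1
  rw [U_00] at ha
  rw [U_01] at hb
  rw [U_10] at hc'
  rw [U_11] at hd
  rw [L_00] at hp
  rw [L_01] at hq
  rw [L_10] at hr
  rw [L_11] at hs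
  have dx := det x
  have dy := det y
  rcases hc with hc | hc
  · have h00 := congrArg (fun m : SL2 => m 0 0) hc
    have ht : tr x * tr y = 0 := by
      simp only [pow_two, mul_00, mul_01, mul_10] at h00
      have h1 : tr x * tr y * (x 0 1 * y 1 0 - y 0 1 * x 1 0) = 0 := by
        simp only [tr]
        linear_combination h00
      refine (mul_eq_zero.mp h1).resolve_right fun h2 => ?_
      rw [hb, hr, hq, hc'] at h2
      have : (2 : ℤ) ∣ 1 := ⟨r' - b' + 2 * b' * r' - 2 * q' * c', by linear_combination -h2⟩
      omega
    have htx : tr x = 0 := by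
      rcases htr with e | e <;> simpa [e] using ht
    have hty : tr y = 0 := by rcases htr with e | e <;> simp [e, htx]
    have e1 : x 1 1 = -x 0 0 := by unfold tr at htx; omega
    have e2 : y 1 1 = -y 0 0 := by unfold tr at hty; omega
    rw [e1] at dx
    rw [e2] at dy
    obtain ⟨ε, hε, h⟩ : ∃ ε : ℤ, (ε = 1 ∨ ε = -1) ∧
        (x * y * x) 1 0 = ε * (y * x * y) 1 0 := by
      rcases h with h | h
      · exact ⟨1, Or.inl rfl, by rw [h, one_mul]⟩
      · exact ⟨-1, Or.inr rfl, by rw [h, neg_apply]; ring⟩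
    simp only [mul_10, mul_11, e1, e2] at h
    generalize x 0 0 = a at *
    generalize x 0 1 = b at *
    generalize x 1 0 = c at *
    generalize y 0 0 = p at *
    generalize y 0 1 = q at *
    generalize y 1 0 = r at *
    obtain ⟨τ, hτ⟩ : ∃ τ, τ = 2 * a * p + b * r + c * q := ⟨_, rfl⟩
    have h1 : (τ - ε) * (c - ε * r) = 0 := by
      have : ε ^ 2 = 1 := by rcases hε with e | e <;> rw [e] <;> norm_num
      rw [hτ]
      linear_combination h + r * this + (ε * c) * dy - r * dx
    have h2 : τ = ε := by
      rcases mul_eq_zero.mp h1 with h | h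
      · omega
      · rcases hε with e | e <;> rw [e] at h <;> omega
    have h3 : b * c = -(1 + a ^ 2) := by linear_combination -dx
    have h4 : q * r = -(1 + p ^ 2) := by linear_combination -dy
    have h5 : (b * r + c * q) ^ 2 ≥ 4 * (1 + a ^ 2) * (1 + p ^ 2) := by
      have : 4 * (1 + a ^ 2) * (1 + p ^ 2) = 4 * (b * r) * (c * q) := by
        linear_combination 4 * (1 + p ^ 2) * h3 - 4 * b * c * h4
      rw [this]
      nlinarith [sq_nonneg (b * r - c * q)]
    have h6 : b * r + c * q = ε - 2 * a * p := by linarith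
    rw [h6] at h5
    rcases hε with rfl | rfl
    · nlinarith [sq_nonneg (a + p), sq_nonneg (a - p)]
    · nlinarith [sq_nonneg (a + p), sq_nonneg (a - p)]
  · have h1 := tr_eq_zero_of_anticommute hc
    rw [hsq] at h1
    have h2 : tr x < 2 := by nlinarith
    have h3 : -2 < tr x := by nlinarith
    generalize tr x = t at *
    interval_cases t <;> omega

end SL2

/-- Under a homomorphism `Br 3 → M 3` over the symmetric group, the images of the squares of the
two generators do not commute. -/
theorem not_commute_sq {h : Br 3 →* M 3} (hp : ∀ b, permM 3 (h b) = Br.perm 3 b) :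
    ¬ Commute (h (Br.σ 3 0 ^ 2)) (h (Br.σ 3 1 ^ 2)) := by
  intro hc
  obtain ⟨b, hb⟩ := mq_surjective 3 (h (Br.σ 3 0))
  obtain ⟨c, hc'⟩ := mq_surjective 3 (h (Br.σ 3 1))
  have hbr := (Br.isBraid_σ 3).braid 0 (by omega)
  refine not_braid_of_sq_commute (x := R b) (y := R c) ?_ ?_ ?_ ?_
  · have h1 : mq 3 (b * c * b) = mq 3 (c * b * c) := by
      simp only [map_mul, hb, hc']
      simp only [← map_mul]
      exact congrArg h hbr
    simpa only [map_mul] using R_eq_of_mq h1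
  · rw [← R_zero]
    exact fun i j => R_parity (by rw [← permM_mq, hb, hp]) i j
  · rw [← R_one]
    exact fun i j => R_parity (by rw [← permM_mq, hc', hp]) i j
  · have h1 : mq 3 (b ^ 2 * c ^ 2) = mq 3 (c ^ 2 * b ^ 2) := by
      simp only [map_mul, map_pow, hb, hc'] at hc ⊢
      exact hc
    simpa only [map_mul, map_pow] using R_eq_of_mq h1

theorem perm_eq_one_of_commute {k : ℕ} (hk : 3 ≤ k) {π : Equiv.Perm ℕ} (hπ : ∀ j, k ≤ j → π j = j)
    (h : ∀ i, i + 1 < k → Commute π (Equiv.swap i (i + 1))) : π = 1 := by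
  have h1 : ∀ i, i + 1 < k → ∀ j, π (Equiv.swap i (i + 1) j) = Equiv.swap i (i + 1) (π j) :=
    fun i hi j => DFunLike.congr_fun (h i hi) j
  have h2 : ∀ i, i + 1 < k → (π i = i ∨ π i = i + 1) ∧ (π (i + 1) = i ∨ π (i + 1) = i + 1) := by
    intro i hi
    have h3 := h1 i hi i
    rw [Equiv.swap_apply_left] at h3
    have h4 : π (i + 1) ≠ π i := fun h => by have := π.injective h; omega
    rcases eq_or_ne (π i) i with e | e
    · rw [e, Equiv.swap_apply_left] at h3; omega
    rcases eq_or_ne (π i) (i + 1) with e' | e'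
    · rw [e', Equiv.swap_apply_right] at h3; omega
    · rw [Equiv.swap_apply_of_ne_of_ne e e'] at h3; exact absurd h3 h4
  have h5 : ∀ i, i + 2 < k → π (i + 1) = i + 1 := fun i hi => by
    have := (h2 i (by omega)).2
    have := (h2 (i + 1) (by omega)).1
    omega
  ext j
  rw [Equiv.Perm.one_apply]
  by_cases hj : k ≤ j
  · exact hπ j hj
  rcases Nat.eq_zero_or_pos j with rfl | hj0
  · have := (h2 0 (by omega)).1
    have h6 := h5 0 (by omega)
    have h7 : π 0 ≠ π 1 := fun h => by have := π.injective h; omega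
    simp only [zero_add] at *
    omega
  obtain ⟨i, rfl⟩ : ∃ i, j = i + 1 := ⟨j - 1, by omega⟩
  by_cases hi : i + 2 < k
  · exact h5 i hi
  · have := (h2 i (by omega)).2
    obtain ⟨l, rfl⟩ : ∃ l, i = l + 1 := ⟨i - 1, by omega⟩
    have h6 := h5 l (by omega)
    have h7 : π (l + 1) ≠ π (l + 1 + 1) := fun h => by have := π.injective h; omega
    omega

/-- The centralizer of the image of a homomorphism over the symmetric group is pure. -/
theorem permM_eq_one_of_commute {k : ℕ} (hk : 3 ≤ k) {h : Br k →* M k}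
    (hp : ∀ b, permM k (h b) = Br.perm k b) {g : M k} (hg : ∀ b, Commute g (h b)) :
    permM k g = 1 := by
  refine perm_eq_one_of_commute hk (fun j hj => permM_apply_of_le g hj) fun i hi => ?_
  have := (hg (Br.σ k i)).map (permM k)
  rwa [hp, Br.perm_σ hi] at this

theorem permM_σ_sq {k : ℕ} {h : Br k →* M k} (hp : ∀ b, permM k (h b) = Br.perm k b) {i : ℕ}
    (hi : i + 1 < k) : permM k (h (Br.σ k i ^ 2)) = 1 := by
  rw [hp, map_pow, Br.perm_σ hi, pow_two, Equiv.swap_mul_self]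

theorem eq_one_of_commute_three {h : Br 3 →* M 3} (hp : ∀ b, permM 3 (h b) = Br.perm 3 b) {g : M 3}
    (hg : ∀ b, Commute g (h b)) : g = 1 := by
  obtain ⟨w, rfl⟩ := M.exists_pure_three (permM_eq_one_of_commute le_rfl hp hg)
  obtain ⟨u, hu⟩ := M.exists_pure_three (permM_σ_sq hp (i := 0) (by omega))
  obtain ⟨v, hv⟩ := M.exists_pure_three (permM_σ_sq hp (i := 1) (by omega))
  have hinj : Function.Injective ((aM 2).comp (xA 2)) :=
    (aM_injective (by omega)).comp (xA_injective le_rfl)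
  have hcomm : ∀ x y : F 2, Commute (aM 2 (xA 2 x)) (aM 2 (xA 2 y)) → Commute x y :=
    fun x y h => hinj (by simpa only [MonoidHom.comp_apply, map_mul] using h.eq)
  by_contra hw
  have hw1 : w ≠ 1 := fun h => hw (by rw [h, map_one, map_one])
  have h1 : Commute w u := hcomm _ _ (hu ▸ hg _)
  have h2 : Commute w v := hcomm _ _ (hv ▸ hg _)
  refine not_commute_sq hp ?_
  rw [hu, hv]
  exact ((FreeGroup.commute_trans hw1 h1 h2).map (xA 2)).map (aM 2)

theorem SL2.U_zpow (j : ℤ) : (U ^ j) 0 0 = 1 ∧ (U ^ j) 0 1 = j ∧ (U ^ j) 1 0 = 0 ∧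
    (U ^ j) 1 1 = 1 := by
  induction j with
  | zero => exact ⟨rfl, rfl, rfl, rfl⟩
  | succ i ih =>
    rw [zpow_add_one, mul_00, mul_01, mul_10, mul_11, ih.1, ih.2.1, ih.2.2.1, ih.2.2.2, U_00, U_01,
      U_10, U_11]
    refine ⟨?_, ?_, ?_, ?_⟩ <;> ring
  | pred i ih =>
    rw [zpow_sub_one, mul_00, mul_01, mul_10, mul_11, inv_00, inv_01, inv_10, inv_11, ih.1, ih.2.1,
      ih.2.2.1, ih.2.2.2, U_00, U_01, U_10, U_11]
    refine ⟨?_, ?_, ?_, ?_⟩ <;> ring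

/-- A homomorphism over the symmetric group sending the square of the first generator to a power
of that square is a conjugate of the quotient map or of its mirror image. -/
theorem exists_conj_mir {h : Br 3 →* M 3} (hp : ∀ b, permM 3 (h b) = Br.perm 3 b) {l : ℤ}
    (hl : l ≠ 0) (hσ : h (Br.σ 3 0 ^ 2) = mq 3 (Br.σ 3 0 ^ (2 * l))) :
    ∃ j : ℤ, (∀ b, h b = mq 3 (Br.σ 3 0 ^ (2 * j) * b * (Br.σ 3 0 ^ (2 * j))⁻¹)) ∨
      (∀ b, h b = mq 3 (Br.σ 3 0 ^ (2 * j) * mirBr 3 b * (Br.σ 3 0 ^ (2 * j))⁻¹)) := by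
  have hlift : ∀ m : M 3, ∀ P : SL2 → Prop, (∀ b, mq 3 b = m → P (R b) ∨ P (-R b)) →
      ∃ b, mq 3 b = m ∧ P (R b) := by
    intro m P hP
    obtain ⟨b, hb⟩ := mq_surjective 3 m
    rcases hP b hb with h | h
    · exact ⟨b, hb, h⟩
    · exact ⟨Z 3 * b, by rw [map_mul, mq_Z, one_mul, hb], by rwa [map_mul, R_Z, neg_one_mul]⟩
  obtain ⟨b, hb, ha, hc, hd⟩ := hlift (h (Br.σ 3 0))
    (fun x => x 0 0 = 1 ∧ x 1 0 = 0 ∧ x 1 1 = 1) (by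
    intro b hb
    have h1 : mq 3 (b ^ 2) = mq 3 (Br.σ 3 0 ^ (2 * l)) := by rw [map_pow, hb, ← map_pow, hσ]
    have h2 : R b * U ^ (2 * l) = U ^ (2 * l) * R b := by
      have h3 := R_eq_of_mq h1
      rw [map_pow, map_zpow, R_zero] at h3
      have h4 : U ^ (2 * l) = R b ^ 2 ∨ U ^ (2 * l) = -R b ^ 2 := by
        rcases h3 with h | h
        · exact Or.inl h.symm
        · exact Or.inr (by rw [h, neg_neg])
      rcases h4 with h | h <;> rw [h]
      · rw [← pow_succ, ← pow_succ']
      · rw [mul_neg, neg_mul, ← pow_succ, ← pow_succ']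
    obtain ⟨e1, e2, e3, e4⟩ := U_zpow (2 * l)
    have h00 := congrArg (fun m : SL2 => m 0 0) h2
    simp only [mul_00, e1, e2, e3] at h00
    have hc : R b 1 0 = 0 := by
      have : (2 * l) * R b 1 0 = 0 := by linarith
      simpa [hl] using this
    have hd := det (R b)
    rw [hc, mul_zero, sub_zero] at hd
    simp only [neg_apply, hc]
    rcases Int.mul_eq_one_iff_eq_one_or_neg_one.mp hd with h | h
    · left; simpa using h
    · right; omega)
  obtain ⟨c, hc', hbr⟩ := hlift (h (Br.σ 3 1)) (fun y => R b * y * R b = y * R b * y) (by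
    intro c hc
    have h1 : mq 3 (b * c * b) = mq 3 (c * b * c) := by
      simp only [map_mul, hb, hc]
      simp only [← map_mul]
      exact congrArg h ((Br.isBraid_σ 3).braid 0 (by omega))
    simpa [neg_eq_iff_eq_neg] using R_eq_of_mq h1)
  have htr : tr (R c) = 2 := by
    have h0 : tr ((R b * R c) * R b * (R b * R c)⁻¹) = tr (R b) := tr_conj _ _
    rw [hbr, mul_assoc (R c), mul_inv_cancel_right] at h0
    rw [h0, tr, ha, hd]; norm_num
  have hpc : Br.perm 3 c = Br.perm 3 (Br.σ 3 1) := by rw [← permM_mq, hc', hp]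
  obtain ⟨p', hp'⟩ := R_parity hpc 0 0
  obtain ⟨r', hr'⟩ := R_parity hpc 1 0
  rw [R_one] at hp' hr'
  rw [L_00] at hp'
  rw [L_10] at hr'
  have h10 := congrArg (fun m : SL2 => m 1 0) hbr
  simp only [mul_10, mul_11, ha, hc, hd] at h10
  have hs : R c 1 1 = 2 - R c 0 0 := by unfold tr at htr; omega
  have hdet := det (R c)
  rw [hs] at h10 hdet
  have h1 : R c 1 0 * (1 + R b 0 1 * R c 1 0) = 0 := by linear_combination -h10
  have h2 : R b 0 1 * R c 1 0 = -1 := by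
    rcases mul_eq_zero.mp h1 with h | h <;> omega
  have h3 : (R b 0 1 = 1 ∧ R c 1 0 = -1) ∨ (R b 0 1 = -1 ∧ R c 1 0 = 1) := by
    have : R b 0 1 * (-R c 1 0) = 1 := by linarith
    rcases Int.mul_eq_one_iff_eq_one_or_neg_one.mp this with h | h <;> omega
  have hconj : ∀ (j : ℤ) (x : Br 3), R (Br.σ 3 0 ^ (2 * j) * x * (Br.σ 3 0 ^ (2 * j))⁻¹) =
      U ^ (2 * j) * R x * (U ^ (2 * j))⁻¹ := fun j x => by
    rw [map_mul, map_mul, map_inv, map_zpow, R_zero]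
  have hhom : ∀ g : Br 3 →* Br 3, R (g (Br.σ 3 0)) = R b → R (g (Br.σ 3 1)) = R c →
      ∀ x, h x = mq 3 (g x) := fun g h1 h2 => by
    suffices e : h = (mq 3).comp g from DFunLike.congr_fun e
    refine Br.hom_ext fun i hi => ?_
    obtain rfl | rfl : i = 0 ∨ i = 1 := by omega
    · rw [MonoidHom.comp_apply, ← hb, R_faithful (Or.inl h1)]
    · rw [MonoidHom.comp_apply, ← hc', R_faithful (Or.inl h2)]
  rcases h3 with ⟨h3, h4⟩ | ⟨h3, h4⟩
  · obtain ⟨e1, e2, e3, e4⟩ := U_zpow (2 * (-p'))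
    refine ⟨-p', Or.inl (hhom (MulAut.conj (Br.σ 3 0 ^ (2 * -p'))).toMonoidHom ?_ ?_)⟩
    · refine (hconj _ _).trans (SL2.ext_iff'.mpr ?_)
      simp only [mul_00, mul_01, mul_10, mul_11, inv_00, inv_01, inv_10, inv_11, e1, e2, e3, e4,
        R_zero, U_00, U_01, U_10, U_11, ha, hc, hd, h3]
      refine ⟨?_, ?_, ?_, ?_⟩ <;> ring
    · refine (hconj _ _).trans (SL2.ext_iff'.mpr ?_)
      simp only [mul_00, mul_01, mul_10, mul_11, inv_00, inv_01, inv_10, inv_11, e1, e2, e3, e4,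
        R_one, L_00, L_01, L_10, L_11, hs, h4]
      rw [h4, hp'] at hdet
      refine ⟨?_, ?_, ?_, ?_⟩ <;> linarith
  · obtain ⟨e1, e2, e3, e4⟩ := U_zpow (2 * p')
    refine ⟨p', Or.inr (hhom
      ((MulAut.conj (Br.σ 3 0 ^ (2 * p'))).toMonoidHom.comp (mirBr 3)) ?_ ?_)⟩
    · refine (hconj p' (mirBr 3 (Br.σ 3 0))).trans (SL2.ext_iff'.mpr ?_)
      simp only [mul_00, mul_01, mul_10, mul_11, inv_00, inv_01, inv_10, inv_11, e1, e2, e3, e4,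
        mirBr_σ (k := 3) (i := 0) (by omega), map_inv, R_zero, U_00, U_01, U_10, U_11, ha, hc, hd,
        h3]
      refine ⟨?_, ?_, ?_, ?_⟩ <;> ring
    · refine (hconj p' (mirBr 3 (Br.σ 3 1))).trans (SL2.ext_iff'.mpr ?_)
      simp only [mul_00, mul_01, mul_10, mul_11, inv_00, inv_01, inv_10, inv_11, e1, e2, e3, e4,
        mirBr_σ (k := 3) (i := 1) (by omega), map_inv, R_one, L_00, L_01, L_10, L_11, hs, h4]
      rw [h4, hp'] at hdet
      refine ⟨?_, ?_, ?_, ?_⟩ <;> linarith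

end BraidB

namespace BraidB

/-- `Forget k m m'`: the element `m` fixes the last strand, and forgetting this strand gives `m'`. -/
def Forget (k : ℕ) (m : M (k + 1)) (m' : M k) : Prop := ∃ a : A k, aM k a = m ∧ pr k a = m'

section Forget

variable {k : ℕ}

theorem Forget.mul {m n : M (k + 1)} {m' n' : M k} (h : Forget k m m') (h' : Forget k n n') :
    Forget k (m * n) (m' * n') := by
  obtain ⟨a, rfl, rfl⟩ := h
  obtain ⟨b, rfl, rfl⟩ := h'
  exact ⟨a * b, map_mul _ _ _, map_mul _ _ _⟩

theorem Forget.inv {m : M (k + 1)} {m' : M k} (h : Forget k m m') : Forget k m⁻¹ m'⁻¹ := by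
  obtain ⟨a, rfl, rfl⟩ := h
  exact ⟨a⁻¹, map_inv _ _, map_inv _ _⟩

theorem Forget.one : Forget k 1 1 := ⟨1, map_one _, map_one _⟩

theorem Forget.unique (hk : 0 < k) {m : M (k + 1)} {m' m'' : M k} (h : Forget k m m')
    (h' : Forget k m m'') : m' = m'' := by
  obtain ⟨a, rfl, rfl⟩ := h
  obtain ⟨b, hb, rfl⟩ := h'
  rw [aM_injective hk hb]

theorem Forget.conj {m n : M (k + 1)} {m' n' : M k} (h : Forget k m m') (h' : Forget k n n') :
    Forget k (m * n * m⁻¹) (m' * n' * m'⁻¹) := (h.mul h').mul h.inv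

theorem Forget.commute (hk : 0 < k) {m n : M (k + 1)} {m' n' : M k} (h : Forget k m m')
    (h' : Forget k n n') (hc : Commute m n) : Commute m' n' :=
  (h.mul h').unique hk (hc.eq ▸ h'.mul h)

theorem Forget.exists {m : M (k + 1)} (h : permM (k + 1) m k = k) : ∃ m', Forget k m m' := by
  obtain ⟨a, rfl⟩ := exists_aM h
  exact ⟨_, a, rfl, rfl⟩

theorem Forget.permM {m : M (k + 1)} {m' : M k} (h : Forget k m m') :
    permM (k + 1) m = permM k m' := by
  obtain ⟨a, rfl, rfl⟩ := h
  exact permM_aM a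

theorem Forget.exists_xA {m : M (k + 1)} (h : Forget k m 1) : ∃ w, m = aM k (xA k w) := by
  obtain ⟨a, rfl, h⟩ := h
  obtain ⟨w, rfl⟩ := BraidB.exists_xA h
  exact ⟨w, rfl⟩

theorem Forget.iota (e : E k) : Forget k (mq (k + 1) (iota k e)) (mq k e.right) :=
  ⟨aq k e, aM_aq e, by
    conv_lhs => rw [E.eq_mul e]
    rw [map_mul, aq_xE, aq_bE, map_mul, pr_xA, pr_bA, one_mul]⟩

theorem Forget.iota_xE (w : F k) : Forget k (mq (k + 1) (BraidB.iota k (xE k w))) 1 := by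
  simpa using Forget.iota (xE k w)

theorem Forget.incl (b : Br k) : Forget k (mq (k + 1) (Br.incl (Nat.le_succ k) b)) (mq k b) := by
  simpa [iota_bE] using Forget.iota (bE k b)

theorem Forget.commute_of {m n p : M (k + 1)} (hk : 2 ≤ k) (hm : Forget k m 1) (hn : Forget k n 1)
    (hp : Forget k p 1) (h1 : m ≠ 1) (h : Commute m n) (h' : Commute m p) : Commute n p := by
  obtain ⟨u, rfl⟩ := hm.exists_xA
  obtain ⟨v, rfl⟩ := hn.exists_xA
  obtain ⟨w, rfl⟩ := hp.exists_xA
  have hinj : Function.Injective ((aM k).comp (xA k)) :=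
    (aM_injective (by omega)).comp (xA_injective hk)
  have hcomm : ∀ x y : F k, Commute (aM k (xA k x)) (aM k (xA k y)) → Commute x y :=
    fun x y h => hinj (by simpa only [MonoidHom.comp_apply, map_mul] using h.eq)
  have hu : u ≠ 1 := fun h => h1 (by rw [h, map_one, map_one])
  exact ((FreeGroup.commute_trans hu (hcomm _ _ h) (hcomm _ _ h')).map (xA k)).map (aM k)

/-- Forgetting the last two strands. -/
def Forget2 (k : ℕ) (m : M (k + 2)) (m' : M k) : Prop := ∃ n, Forget (k + 1) m n ∧ Forget k n m'

theorem Forget2.mul {m n : M (k + 2)} {m' n' : M k} (h : Forget2 k m m') (h' : Forget2 k n n') :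
    Forget2 k (m * n) (m' * n') := by
  obtain ⟨a, h1, h2⟩ := h
  obtain ⟨b, h3, h4⟩ := h'
  exact ⟨a * b, h1.mul h3, h2.mul h4⟩

theorem Forget2.inv {m : M (k + 2)} {m' : M k} (h : Forget2 k m m') : Forget2 k m⁻¹ m'⁻¹ := by
  obtain ⟨a, h1, h2⟩ := h
  exact ⟨a⁻¹, h1.inv, h2.inv⟩

theorem Forget2.unique (hk : 0 < k) {m : M (k + 2)} {m' m'' : M k} (h : Forget2 k m m')
    (h' : Forget2 k m m'') : m' = m'' := by
  obtain ⟨a, h1, h2⟩ := h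
  obtain ⟨b, h3, h4⟩ := h'
  rw [h1.unique (Nat.succ_pos k) h3] at h2
  exact h2.unique hk h4

theorem Forget2.commute (hk : 0 < k) {m n : M (k + 2)} {m' n' : M k} (h : Forget2 k m m')
    (h' : Forget2 k n n') (hc : Commute m n) : Commute m' n' :=
  (h.mul h').unique hk (hc.eq ▸ h'.mul h)

theorem Forget2.exists {m : M (k + 2)} (h : BraidB.permM (k + 2) m (k + 1) = k + 1)
    (h' : BraidB.permM (k + 2) m k = k) : ∃ m', Forget2 k m m' := by
  obtain ⟨n, hn⟩ := Forget.exists h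
  rw [hn.permM] at h'
  obtain ⟨m', hm'⟩ := Forget.exists h'
  exact ⟨m', n, hn, hm'⟩

theorem Forget2.permM {m : M (k + 2)} {m' : M k} (h : Forget2 k m m') :
    BraidB.permM (k + 2) m = BraidB.permM k m' := by
  obtain ⟨a, h1, h2⟩ := h
  rw [h1.permM, h2.permM]

theorem Forget2.conj_σ {m : M (k + 2)} (h : Forget2 k m 1) :
    Forget2 k (mq (k + 2) (Br.σ (k + 2) k) * m * (mq (k + 2) (Br.σ (k + 2) k))⁻¹) 1 := by
  let s := mq (k + 2) (Br.σ (k + 2) k)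
  have hmul : ∀ m n, Forget2 k (s * m * s⁻¹) 1 → Forget2 k (s * n * s⁻¹) 1 →
      Forget2 k (s * (m * n) * s⁻¹) 1 := fun m n h h' => by
    rw [show s * (m * n) * s⁻¹ = s * m * s⁻¹ * (s * n * s⁻¹) by group, ← mul_one (1 : M k)]
    exact h.mul h'
  have hinv : ∀ m, Forget2 k (s * m * s⁻¹) 1 → Forget2 k (s * m⁻¹ * s⁻¹) 1 := fun m h => by
    rw [show s * m⁻¹ * s⁻¹ = (s * m * s⁻¹)⁻¹ by group, ← inv_one (G := M k)]
    exact h.inv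
  have h1 : ∀ u, Forget2 k (mq (k + 2) (iota (k + 1) (xE (k + 1) u))) 1 := fun u =>
    ⟨1, Forget.iota_xE u, Forget.one⟩
  have h2 : ∀ w, Forget2 k (mq (k + 2) (Br.incl (Nat.le_succ _) (iota k (xE k w)))) 1 := fun w =>
    ⟨_, Forget.incl _, Forget.iota_xE w⟩
  have hs : s ^ 2 = mq (k + 2) (iota (k + 1) (xE (k + 1) (X (k + 1) k))) := by
    have := iota_top (Nat.succ_pos k)
    exact (map_pow _ _ _).symm.trans (congrArg (mq (k + 2)) this.symm)
  have hsw : ∀ j < k, mq (k + 2) (iota (k + 1) (xE (k + 1) (X (k + 1) j))) =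
      s⁻¹ * mq (k + 2) (Br.incl (Nat.le_succ _) (iota k (xE k (X k j)))) * s := fun j hj => by
    rw [iota_X_swap j hj, map_mul, map_mul, map_inv]
  have hone : Forget2 k 1 1 := ⟨1, Forget.one, Forget.one⟩
  have h3 : ∀ u, Forget2 k (s * mq (k + 2) (iota (k + 1) (xE (k + 1) u)) * s⁻¹) 1 := fun u => by
    refine F.induction u ?_ ?_ ?_ ?_
    · simpa using hone
    · intro a b ha hb
      simpa only [map_mul] using hmul _ _ ha hb
    · intro a ha
      simpa only [map_inv] using hinv _ ha
    · intro j hj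
      rcases Nat.lt_succ_iff_lt_or_eq.mp hj with hj | rfl
      · rw [hsw j hj]
        simpa [mul_assoc] using h2 (X k j)
      · rw [← hs, show s * s ^ 2 * s⁻¹ = s ^ 2 by group, hs]
        exact h1 _
  have h4 : ∀ w, Forget2 k
      (s * mq (k + 2) (Br.incl (Nat.le_succ _) (iota k (xE k w))) * s⁻¹) 1 := fun w => by
    refine F.induction w ?_ ?_ ?_ ?_
    · simpa using hone
    · intro a b ha hb
      simpa only [map_mul] using hmul _ _ ha hb
    · intro a ha
      simpa only [map_inv] using hinv _ ha
    · intro j hj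
      have hc := hsw j hj
      have := ((h1 (X (k + 1) k)).mul (h1 (X (k + 1) j))).mul (h1 (X (k + 1) k)).inv
      rw [← hs, hc] at this
      convert this using 1
      · group
      · simp
  obtain ⟨n, ⟨a, rfl, rfl⟩, h'⟩ := h
  obtain ⟨w, hw⟩ := h'.exists_xA
  rw [← aq_xE, aM_aq, ← pr_bA, ← mul_inv_eq_one, ← map_inv, ← map_mul] at hw
  obtain ⟨u, hu⟩ := BraidB.exists_xA hw
  rw [mul_inv_eq_iff_eq_mul] at hu
  rw [hu, map_mul, aM_bA, ← aq_xE, aM_aq]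
  exact hmul _ _ (h3 u) (h4 w)

theorem Forget2.conj {m s : M (k + 2)} (h : Forget2 k m 1)
    (h1 : BraidB.permM (k + 2) s (k + 1) = k) (h2 : BraidB.permM (k + 2) s k = k + 1) :
    Forget2 k (s * m * s⁻¹) 1 := by
  obtain ⟨t, ht⟩ : ∃ t, t = (mq (k + 2) (Br.σ (k + 2) k))⁻¹ * s := ⟨_, rfl⟩
  have hp : BraidB.permM (k + 2) t = Equiv.swap k (k + 1) * BraidB.permM (k + 2) s := by
    rw [ht, map_mul, map_inv, permM_mq, Br.perm_σ (by omega), Equiv.swap_inv]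
  obtain ⟨t', ht'⟩ := Forget2.exists (m := t) (by rw [hp, Equiv.Perm.mul_apply, h1]; simp)
    (by rw [hp, Equiv.Perm.mul_apply, h2]; simp)
  have h3 : Forget2 k (t * m * t⁻¹) 1 := by
    rw [← mul_inv_cancel t', ← mul_one t']
    simpa using (ht'.mul h).mul ht'.inv
  have h4 := h3.conj_σ
  rwa [show mq (k + 2) (Br.σ (k + 2) k) * (t * m * t⁻¹) * (mq (k + 2) (Br.σ (k + 2) k))⁻¹ =
    s * m * s⁻¹ by rw [ht]; group] at h4

end Forget

end BraidB

namespace BraidB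

/-- A homomorphism `Br k → M k` that induces the standard permutations. -/
def Over (k : ℕ) (H : Br k →* M k) : Prop := ∀ b, permM k (H b) = Br.perm k b

/-- `H'` is obtained from `H` by restricting to `Br k` and forgetting the last strand. -/
def Down (k : ℕ) (H : Br (k + 1) →* M (k + 1)) (H' : Br k →* M k) : Prop :=
  ∀ b, Forget k (H (Br.incl (Nat.le_succ k) b)) (H' b)

/-- `H` is compatible with forgetting the last strand. -/
def Good (k : ℕ) (H : Br (k + 1) →* M (k + 1)) : Prop :=
  ∀ w, Forget k (H (iota k (xE k w))) 1

section Tower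

variable {k : ℕ} {H : Br (k + 1) →* M (k + 1)} {H' : Br k →* M k}

theorem Over.exists_down (hk : 0 < k) (h : Over (k + 1) H) : ∃ H', Down k H H' := by
  obtain ⟨f, hf⟩ := exists_restrict hk (f := H.comp (Br.incl (Nat.le_succ k))) fun b => by
    rw [MonoidHom.comp_apply, h, Br.perm_incl, Br.perm_apply_of_le _ le_rfl]
  exact ⟨(pr k).comp f, fun b => ⟨f b, hf b, rfl⟩⟩

theorem Over.down (h : Over (k + 1) H) (hd : Down k H H') : Over k H' := fun b => by
  rw [← (hd b).permM, h, Br.perm_incl]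

theorem Down.σ (hd : Down k H H') {i : ℕ} (hi : i + 1 < k) :
    Forget k (H (Br.σ (k + 1) i)) (H' (Br.σ k i)) := by
  simpa [Br.incl_σ _ hi] using hd (Br.σ k i)

theorem Over.not_commute_zero_one (hk : 3 ≤ k) {H : Br k →* M k} (h : Over k H) :
    ¬ Commute (H (Br.σ k 0 ^ 2)) (H (Br.σ k 1 ^ 2)) := by
  induction k, hk using Nat.le_induction with
  | base => exact not_commute_sq h
  | succ k hk ih =>
    obtain ⟨H', hd⟩ := h.exists_down (by omega)
    refine fun hc => ih (h.down hd) ?_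
    have h0 := hd (Br.σ k 0 ^ 2)
    have h1 := hd (Br.σ k 1 ^ 2)
    rw [map_pow, Br.incl_σ _ (by omega)] at h0 h1
    exact h0.commute (by omega) h1 hc

theorem commute_conj_iff {G : Type*} [Group G] {a b : G} (g : G) :
    Commute (g * a * g⁻¹) (g * b * g⁻¹) ↔ Commute a b := by
  constructor
  · intro h
    have := h.map (MulAut.conj g⁻¹)
    simpa [mul_assoc] using this
  · intro h
    simpa using h.map (MulAut.conj g)

theorem braid_conj_sq {G : Type*} [Group G] {x y : G} (e : x * y * x = y * x * y) :
    x * y ^ 2 * x⁻¹ = y⁻¹ * x ^ 2 * y := by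
  rw [mul_inv_eq_iff_eq_mul, mul_assoc, mul_assoc, ← mul_left_cancel_iff (a := y),
    mul_inv_cancel_left]
  calc y * (x * y ^ 2) = (y * x * y) * y := by rw [pow_two]; group
    _ = (x * y * x) * y := by rw [e]
    _ = x * (y * x * y) := by group
    _ = x * (x * y * x) := by rw [e]
    _ = x ^ 2 * (y * x) := by rw [pow_two]; group

theorem Over.not_commute (h : Over (k + 1) H) {i : ℕ} (hi : i + 2 < k + 1) :
    ¬ Commute (H (Br.σ (k + 1) i ^ 2)) (H (Br.σ (k + 1) (i + 1) ^ 2)) := by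
  induction i with
  | zero => exact h.not_commute_zero_one (by omega)
  | succ i ih =>
    have hB := Br.isBraid_σ (k + 1)
    have e0 := hB.braid i (by omega)
    have e1 := hB.braid (i + 1) (by omega)
    have e2 := hB.comm i (i + 2) (by omega) (by omega)
    obtain ⟨a, ha⟩ : ∃ a, a = Br.σ (k + 1) i := ⟨_, rfl⟩
    obtain ⟨b, hb⟩ : ∃ b, b = Br.σ (k + 1) (i + 1) := ⟨_, rfl⟩
    obtain ⟨c, hc⟩ : ∃ c, c = Br.σ (k + 1) (i + 2) := ⟨_, rfl⟩
    rw [← ha, ← hb] at e0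
    rw [show i + 1 + 1 = i + 2 from rfl, ← hb, ← hc] at e1
    rw [← ha, ← hc] at e2
    have ih := ih (by omega)
    rw [show i + 1 + 1 = i + 2 from rfl, ← hb, ← hc]
    rw [← ha, ← hb] at ih
    have hab : a * b * c * a * (a * b * c)⁻¹ = b := by
      rw [mul_inv_eq_iff_eq_mul]
      calc a * b * c * a = a * b * (c * a) := by group
        _ = a * b * (a * c) := by rw [← e2]
        _ = (a * b * a) * c := by group
        _ = b * (a * b * c) := by rw [e0]; group
    have hbc : a * b * c * b * (a * b * c)⁻¹ = c := by
      rw [mul_inv_eq_iff_eq_mul]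
      calc a * b * c * b = a * (b * c * b) := by group
        _ = (a * c) * b * c := by rw [e1]; group
        _ = c * (a * b * c) := by rw [e2]; group
    refine fun hcc => ih ((commute_conj_iff (H (a * b * c))).mp ?_)
    have hsq : ∀ x y : Br (k + 1), a * b * c * x * (a * b * c)⁻¹ = y →
        H (a * b * c) * H (x ^ 2) * (H (a * b * c))⁻¹ = H (y ^ 2) := by
      rintro x _ rfl
      rw [← map_inv, ← map_mul, ← map_mul, conj_pow]
    rwa [hsq _ _ hab, hsq _ _ hbc]

theorem Down.forget_X_iff (hd : Down k H H') {j : ℕ} (hj : j + 1 < k) :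
    Forget k (H (iota k (xE k (X k j)))) 1 ↔ Forget k (H (iota k (xE k (X k (j + 1))))) 1 := by
  have hs := hd.σ hj
  rw [E.bE_conj_X hj, map_mul, map_mul, map_mul, map_mul, map_inv, map_inv, iota_bE,
    Br.incl_σ _ hj]
  constructor
  · intro h
    simpa [mul_assoc] using (hs.inv.mul h).mul hs
  · intro h
    simpa using hs.conj h

theorem Down.good_of_zero (hd : Down k H H') (h : Forget k (H (iota k (xE k (X k 0)))) 1) :
    Good k H := by
  have hX : ∀ j < k, Forget k (H (iota k (xE k (X k j)))) 1 := by
    intro j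
    induction j with
    | zero => exact fun _ => h
    | succ j ih => exact fun hj => (hd.forget_X_iff hj).mp (ih (by omega))
  intro w
  refine F.induction w ?_ ?_ ?_ hX
  · simpa using Forget.one
  · intro a b ha hb
    simpa using ha.mul hb
  · intro a ha
    simpa using ha.inv

theorem Down.good_of_top (hk : 0 < k) (hd : Down k H H')
    (h : Forget k (H (Br.σ (k + 1) (k - 1) ^ 2)) 1) : Good k H := by
  refine hd.good_of_zero (down_induction (k := k)
    (p := fun j => Forget k (H (iota k (xE k (X k j)))) 1) ?_ ?_ 0 hk)
  · rwa [iota_top hk]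
  · intro j hj h
    exact (hd.forget_X_iff hj).mpr h

theorem Good.exists_not_commute (hk : 3 ≤ k) (h : Over (k + 1) H) :
    ¬ Commute (H (iota k (xE k (X k (k - 1))))) (H (iota k (xE k (X k (k - 2))))) := by
  obtain ⟨m, rfl⟩ : ∃ m, k = m + 2 := ⟨k - 2, by omega⟩
  have e := (Br.isBraid_σ (m + 2 + 1)).braid m (by omega)
  have hn := h.not_commute (i := m) (by omega)
  have h1 : iota (m + 2) (xE (m + 2) (X (m + 2) (m + 1))) = Br.σ (m + 2 + 1) (m + 1) ^ 2 :=
    iota_top (by omega)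
  have h2 : iota (m + 2) (xE (m + 2) (X (m + 2) m)) = Br.σ (m + 2 + 1) m *
      Br.σ (m + 2 + 1) (m + 1) ^ 2 * (Br.σ (m + 2 + 1) m)⁻¹ := by
    rw [E.bE_conj_X (by omega), map_mul, map_mul, map_inv, iota_bE, Br.incl_σ _ (by omega), h1]
  rw [show m + 2 - 1 = m + 1 from rfl, show m + 2 - 2 = m from rfl, h1, h2]
  obtain ⟨a, ha⟩ : ∃ a, a = Br.σ (m + 2 + 1) m := ⟨_, rfl⟩
  obtain ⟨b, hb⟩ : ∃ b, b = Br.σ (m + 2 + 1) (m + 1) := ⟨_, rfl⟩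
  rw [← ha, ← hb] at e hn ⊢
  rw [braid_conj_sq e]
  intro hc
  rw [← commute_conj_iff (H b)] at hc
  refine hn ?_
  simpa [mul_assoc, pow_two] using hc.symm

theorem Good.centralizer (hk : 3 ≤ k) (h : Over (k + 1) H) (hg : Good k H) (hd : Down k H H')
    (hH' : ∀ g, (∀ b, Commute g (H' b)) → g = 1) {g : M (k + 1)} (hgc : ∀ b, Commute g (H b)) :
    g = 1 := by
  have hp := permM_eq_one_of_commute (by omega) h hgc
  obtain ⟨g', hg'⟩ := Forget.exists (m := g) (by rw [hp]; rfl)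
  have h1 : g' = 1 := hH' g' fun b => hg'.commute (by omega) (hd b) (hgc _)
  rw [h1] at hg'
  by_contra hne
  exact Good.exists_not_commute hk h
    (Forget.commute_of (by omega) hg' (hg _) (hg _) hne (hgc _) (hgc _))

end Tower

theorem Good.step {k : ℕ} (hk : 3 ≤ k) {H : Br (k + 2) →* M (k + 2)}
    {H' : Br (k + 1) →* M (k + 1)} (h : Over (k + 2) H) (hd : Down (k + 1) H H')
    (hg : Good k H') : Good (k + 1) H := by
  refine hd.good_of_zero ?_
  have hpσ : permM (k + 2) (H (Br.σ (k + 2) k))⁻¹ = Equiv.swap k (k + 1) := by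
    rw [map_inv, h, Br.perm_σ (by omega), Equiv.swap_inv]
  have h2 : Forget2 k (H (iota (k + 1) (xE (k + 1) (X (k + 1) 0)))) 1 := by
    rw [iota_X_swap 0 (by omega), map_mul, map_mul, map_inv]
    have := Forget2.conj (s := (H (Br.σ (k + 2) k))⁻¹) ⟨_, hd _, hg (X k 0)⟩
      (by rw [hpσ]; simp) (by rw [hpσ]; simp)
    simpa using this
  obtain ⟨c, hc, hc'⟩ := h2
  suffices c = 1 by rwa [this] at hc
  by_contra hne
  have hcσ : ∀ i, 1 ≤ i → i + 1 < k + 1 → Commute c (H' (Br.σ (k + 1) i)) := fun i h1 hi => by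
    refine hc.commute (by omega) (hd.σ hi) (Commute.map ?_ H)
    have : Commute (xE (k + 1) (X (k + 1) 0)) (bE (k + 1) (Br.σ (k + 1) i)) := by
      have := xE_act (k + 1) (Br.σ (k + 1) i) (X (k + 1) 0)
      rw [act_σ_of_ne hi (by omega) (by omega), eq_mul_inv_iff_mul_eq] at this
      exact this
    simpa [iota_bE, Br.incl_σ _ hi] using this.map (iota (k + 1))
  have htop : Commute c (H' (iota k (xE k (X k (k - 1))))) := by
    rw [iota_top (by omega), map_pow]
    exact (hcσ (k - 1) (by omega) (by omega)).pow_right 2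
  refine Good.exists_not_commute hk (h.down hd)
    (Forget.commute_of (by omega) hc' (hg _) (hg _) hne htop ?_)
  obtain ⟨m, rfl⟩ : ∃ m, k = m + 2 := ⟨k - 2, by omega⟩
  rw [show m + 2 - 2 = m from rfl, E.bE_conj_X (by omega), map_mul, map_mul, map_mul, map_mul,
    map_inv, map_inv, iota_bE, Br.incl_σ _ (by omega)]
  exact ((hcσ m (by omega) (by omega)).mul_right htop).mul_right
    (hcσ m (by omega) (by omega)).inv_right

theorem M.commute_trans_pure {a b c : M 3} (ha : permM 3 a = 1) (hb : permM 3 b = 1)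
    (hc : permM 3 c = 1) (h1 : a ≠ 1) (h : Commute a b) (h' : Commute a c) : Commute b c := by
  obtain ⟨u, rfl⟩ := M.exists_pure_three ha
  obtain ⟨v, rfl⟩ := M.exists_pure_three hb
  obtain ⟨w, rfl⟩ := M.exists_pure_three hc
  have hF : ∀ w, Forget 2 (aM 2 (xA 2 w)) 1 := fun w => ⟨_, rfl, pr_xA w⟩
  exact Forget.commute_of le_rfl (hF u) (hF v) (hF w) h1 h h'

theorem Good.base {H : Br 5 →* M 5} (h : Over 5 H) {H' : Br 4 →* M 4} (hd : Down 4 H H') :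
    Good 3 H' := by
  obtain ⟨T, hT⟩ := (h.down hd).exists_down (by omega)
  refine hT.good_of_top (by omega) ?_
  have hTo := (h.down hd).down hT
  have hB := Br.isBraid_σ 5
  have e01 := hB.braid 0 (by omega)
  have e12 := hB.braid 1 (by omega)
  have e23 := hB.braid 2 (by omega)
  have c02 := hB.comm 0 2 (by omega) (by omega)
  have c03 := hB.comm 0 3 (by omega) (by omega)
  have c13 := hB.comm 1 3 (by omega) (by omega)
  simp only [Nat.reduceAdd] at e01 e12 e23
  obtain ⟨s0, hs0⟩ : ∃ a, a = Br.σ 5 0 := ⟨_, rfl⟩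
  obtain ⟨s1, hs1⟩ : ∃ a, a = Br.σ 5 1 := ⟨_, rfl⟩
  obtain ⟨s2, hs2⟩ : ∃ a, a = Br.σ 5 2 := ⟨_, rfl⟩
  obtain ⟨s3, hs3⟩ : ∃ a, a = Br.σ 5 3 := ⟨_, rfl⟩
  have hf : ∀ i, i + 1 < 3 → Forget2 3 (H (Br.σ 5 i)) (T (Br.σ 3 i)) := fun i hi =>
    ⟨_, hd.σ (by omega), hT.σ hi⟩
  have hf0 := hf 0 (by omega)
  have hf1 := hf 1 (by omega)
  rw [← hs0] at hf0
  rw [← hs1] at hf1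
  rw [← hs0, ← hs1] at e01
  rw [← hs1, ← hs2] at e12
  rw [← hs2, ← hs3] at e23
  rw [← hs0, ← hs2] at c02
  rw [← hs0, ← hs3] at c03
  rw [← hs1, ← hs3] at c13
  have hp2 : Br.perm 5 (s2 ^ 2) = 1 := by
    rw [hs2, map_pow, Br.perm_σ (by omega), pow_two, Equiv.swap_mul_self]
  have hp3 : Br.perm 5 (s3 ^ 2) = 1 := by
    rw [hs3, map_pow, Br.perm_σ (by omega), pow_two, Equiv.swap_mul_self]
  have hex : ∀ b, Br.perm 5 b = 1 → ∃ m, Forget2 3 (H b) m ∧ permM 3 m = 1 := fun b hb => by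
    have hb' : permM 5 (H b) = 1 := by rw [h, hb]
    obtain ⟨m, hm⟩ := Forget2.exists (k := 3) (m := H b) (by rw [hb']; rfl) (by rw [hb']; rfl)
    exact ⟨m, hm, by rw [← hm.permM, hb']⟩
  obtain ⟨a, ha, hap⟩ := hex (s2 ^ 2) hp2
  obtain ⟨a', ha', hap'⟩ := hex (s3 * s2 ^ 2 * s3⁻¹) (by
    rw [map_mul, map_mul, hp2, mul_one, ← map_mul, mul_inv_cancel, map_one])
  obtain ⟨d, hdd, -⟩ := hex (s3 ^ 2) hp3
  have hd1 : d = 1 := by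
    have hcc : ∀ i, i + 1 < 3 → Commute d (T (Br.σ 3 i)) := fun i hi => by
      refine hdd.commute (by omega) (hf i hi) (Commute.map ?_ H)
      refine (Commute.pow_right ?_ 2).symm
      have : i = 0 ∨ i = 1 := by omega
      rcases this with rfl | rfl
      · rw [← hs0]; exact c03
      · rw [← hs1]; exact c13
    refine eq_one_of_commute_three hTo (g := d) fun b => ?_
    refine Br.induction b ?_ ?_ ?_ fun i hi => hcc i hi
    · rw [map_one]; exact Commute.one_right _
    · intro x y hx hy
      rw [map_mul]; exact hx.mul_right hy
    · intro x hx
      rw [map_inv]; exact hx.inv_right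
  rw [hd1] at hdd
  have h3 : Commute a a' := by
    have hm := (ha.mul ha').mul hdd
    rw [mul_one, ← map_mul, ← map_mul,
      show s2 ^ 2 * (s3 * s2 ^ 2 * s3⁻¹) * s3 ^ 2 = s2 ^ 2 * s3 * s2 ^ 2 * s3 by
        simp only [pow_two]; group] at hm
    have hcomm : Commute s2 (s2 ^ 2 * s3 * s2 ^ 2 * s3) := by
      have : s3 * s2 ^ 2 * s3 * s2 = s2 * s3 * s2 ^ 2 * s3 := by
        calc s3 * s2 ^ 2 * s3 * s2 = s3 * s2 * (s2 * s3 * s2) := by simp only [pow_two]; group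
          _ = (s3 * s2 * s3) * s2 * s3 := by rw [e23]; group
          _ = _ := by rw [← e23]; simp only [pow_two]; group
      show s2 * (s2 ^ 2 * s3 * s2 ^ 2 * s3) = s2 ^ 2 * s3 * s2 ^ 2 * s3 * s2
      calc _ = s2 ^ 2 * (s2 * s3 * s2 ^ 2 * s3) := by simp only [pow_two]; group
        _ = _ := by rw [← this]; simp only [pow_two]; group
    have := ha.commute (by omega) hm ((hcomm.pow_left 2).map H)
    have h4 := (Commute.refl a).inv_right.mul_right this
    rwa [inv_mul_cancel_left] at h4
  have hb := (hf1.mul ha).mul hf1.inv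
  rw [← map_inv, ← map_mul, ← map_mul] at hb
  have hba' : Commute (T (Br.σ 3 1) * a * (T (Br.σ 3 1))⁻¹) a' := by
    refine hb.commute (by omega) ha' (Commute.map ?_ H)
    rw [braid_conj_sq e12, braid_conj_sq e23.symm]
    have := (commute_conj_iff s2⁻¹ (a := s1 ^ 2) (b := s3 ^ 2)).mpr
      (Commute.pow_pow (show Commute s1 s3 from c13) 2 2)
    simpa using this
  have hTa : Commute a (T (Br.σ 3 0) ^ 2) := by
    have : Commute (H (s2 ^ 2)) (H s0) := Commute.map (Commute.pow_left c02.symm 2) H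
    exact (ha.commute (by omega) hf0 this).pow_right 2
  have hT0 : permM 3 (T (Br.σ 3 0) ^ 2) = 1 := by
    rw [← map_pow]; exact permM_σ_sq hTo (by omega)
  have ha1 : a = 1 := by
    by_contra hne
    have hne' : a' ≠ 1 := by
      rintro rfl
      have hps : permM (3 + 2) (H s3)⁻¹ = Equiv.swap 3 4 := by
        rw [map_inv, h, hs3, Br.perm_σ (by omega), Equiv.swap_inv]
      have := ha'.conj (s := (H s3)⁻¹) (by rw [hps]; rfl) (by rw [hps]; rfl)
      rw [← map_inv, ← map_inv, ← map_mul, ← map_mul,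
        show s3⁻¹ * (s3 * s2 ^ 2 * s3⁻¹) * s3⁻¹⁻¹ = s2 ^ 2 by group] at this
      exact hne (ha.unique (by omega) this)
    have k1 := M.commute_trans_pure hap hT0 hap' hne hTa h3
    have hbp : permM 3 (T (Br.σ 3 1) * a * (T (Br.σ 3 1))⁻¹) = 1 := by
      rw [map_mul, map_mul, hap, mul_one, ← map_mul, mul_inv_cancel, map_one]
    have k2 := M.commute_trans_pure hap' hT0 hbp hne' k1.symm hba'.symm
    have hbne : T (Br.σ 3 1) * a * (T (Br.σ 3 1))⁻¹ ≠ 1 := by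
      rwa [Ne, conj_eq_one_iff]
    have k3 := (commute_conj_iff (T (Br.σ 3 1))).mpr hTa
    have hp4 : permM 3 (T (Br.σ 3 1) * T (Br.σ 3 0) ^ 2 * (T (Br.σ 3 1))⁻¹) = 1 := by
      rw [map_mul, map_mul, hT0, mul_one, ← map_mul, mul_inv_cancel, map_one]
    have k4 := M.commute_trans_pure hbp hT0 hp4 hbne k2.symm k3
    have e := congrArg T ((Br.isBraid_σ 3).braid 0 (by omega))
    simp only [map_mul, zero_add] at e
    refine not_commute_sq hTo ?_
    rw [map_pow, map_pow]
    generalize T (Br.σ 3 0) = x at *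
    generalize T (Br.σ 3 1) = y at *
    rw [braid_conj_sq e.symm, ← commute_conj_iff x] at k4
    simpa [mul_assoc, pow_two] using k4
  rw [ha1] at ha
  obtain ⟨n, h1, h2⟩ := ha
  have h5 := hd (Br.σ 4 2 ^ 2)
  rw [map_pow, Br.incl_σ _ (by omega), ← hs2] at h5
  rwa [h1.unique (by omega) h5] at h2

theorem Over.good {k : ℕ} (hk : 4 ≤ k) {H : Br (k + 1) →* M (k + 1)} (h : Over (k + 1) H) :
    Good k H := by
  induction k, hk using Nat.le_induction with
  | base =>
    obtain ⟨H', hd⟩ := h.exists_down (by omega)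
    exact Good.step le_rfl h hd (Good.base h hd)
  | succ k hk ih =>
    obtain ⟨H', hd⟩ := h.exists_down (by omega)
    exact Good.step (by omega) h hd (ih (h.down hd))

theorem Good.centralizer_four {H : Br 4 →* M 4} (h : Over 4 H) (hg : Good 3 H) {g : M 4}
    (hgc : ∀ b, Commute g (H b)) : g = 1 := by
  obtain ⟨H', hd⟩ := h.exists_down (by omega)
  exact hg.centralizer le_rfl h hd (fun g hg => eq_one_of_commute_three (h.down hd) hg) hgc

theorem Over.centralizer {k : ℕ} (hk : 5 ≤ k) {H : Br k →* M k} (h : Over k H) {g : M k}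
    (hgc : ∀ b, Commute g (H b)) : g = 1 := by
  induction k, hk using Nat.le_induction with
  | base =>
    obtain ⟨H', hd⟩ := h.exists_down (k := 4) (by omega)
    exact (h.good (k := 4) le_rfl).centralizer (by omega) h hd
      (fun g hg => (Good.base h hd).centralizer_four (h.down hd) hg) hgc
  | succ k hk ih =>
    obtain ⟨H', hd⟩ := h.exists_down (by omega)
    exact (h.good (by omega)).centralizer (by omega) h hd (fun g hg => ih (h.down hd) hg) hgc

end BraidB

namespace BraidB

open Pointwise in
theorem exists_smul_notMem {B S : Type*} [Group B] [MulAction B S] (T : Finset S)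
    (h : ∀ x ∈ T, ¬ (MulAction.stabilizer B x).FiniteIndex) : ∃ b : B, ∀ x ∈ T, b • x ∉ T := by
  classical
  by_contra! hb
  let g : S × S → B := fun p => if hp : ∃ b : B, b • p.1 = p.2 then hp.choose else 1
  have hcov : ⋃ p ∈ T ×ˢ T, g p • (MulAction.stabilizer B p.1 : Set B) = Set.univ := by
    refine Set.eq_univ_of_forall fun b => ?_
    obtain ⟨x, hx, hbx⟩ := hb b
    refine Set.mem_biUnion (x := (x, b • x)) (by simp [hx, hbx]) ?_
    have hp : ∃ c : B, c • x = b • x := ⟨b, rfl⟩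
    rw [mem_leftCoset_iff, SetLike.mem_coe, MulAction.mem_stabilizer_iff, mul_smul,
      inv_smul_eq_iff]
    simp only [g]
    rw [dif_pos hp, hp.choose_spec]
  obtain ⟨p, hp, hf⟩ := Subgroup.exists_finiteIndex_of_leftCoset_cover hcov
  exact h p.1 (Finset.mem_product.mp hp).1 hf

theorem FreeGroup.eq_of_conj_of {α : Type*} {x y : α} {u v : FreeGroup α}
    (h : u * FreeGroup.of x * u⁻¹ = v * FreeGroup.of y * v⁻¹) : x = y := by
  classical
  by_contra hne
  have := congrArg (FreeGroup.lift fun t : α => if t = x then Multiplicative.ofAdd (1 : ℤ) else 1) h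
  simp [Ne.symm hne] at this

/-- The translation action of a group on the free group on its underlying set. -/
noncomputable def shift (G : Type*) [Group G] : G →* MulAut (FreeGroup G) :=
  MonoidHom.mk' (fun g => FreeGroup.freeGroupCongr (Equiv.mulLeft g)) fun g h => by
    refine MulEquiv.toMonoidHom_injective (FreeGroup.ext_hom _ _ fun x => ?_)
    simp [mul_assoc]

theorem shift_of {G : Type*} [Group G] (g x : G) :
    shift G g (FreeGroup.of x) = FreeGroup.of (g * x) := by
  simp [shift]

/-- The group `P` is the free product of `s G` and the infinite cyclic group generated by `y`, and
`q` kills `y`. -/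
structure IsKer {P G : Type*} [Group P] [Group G] (q : P →* G) (s : G →* P) (y : P) : Prop where
  q_s : ∀ g, q (s g) = g
  q_y : q y = 1
  ext : ∀ f : P →* P, (∀ g, f (s g) = s g) → f y = y → ∀ p, f p = p
  exists_hom : ∃ Θ : P →* FreeGroup G ⋊[shift G] G,
    (∀ g, Θ (s g) = SemidirectProduct.inr g) ∧ Θ y = SemidirectProduct.inl (FreeGroup.of 1)

section IsKer

variable {P G : Type*} [Group P] [Group G] {q : P →* G} {s : G →* P} {y : P}

/-- The basis of the normal closure of `y`. -/
noncomputable def kap (s : G →* P) (y : P) : FreeGroup G →* P :=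
  FreeGroup.lift fun g => s g * y * (s g)⁻¹

theorem kap_of (s : G →* P) (y : P) (g : G) : kap s y (FreeGroup.of g) = s g * y * (s g)⁻¹ := by
  simp [kap]

theorem IsKer.kap_injective (hK : IsKer q s y) : Function.Injective (kap s y) := by
  obtain ⟨Θ, h1, h2⟩ := hK.exists_hom
  have : Θ.comp (kap s y) = SemidirectProduct.inl := FreeGroup.ext_hom _ _ fun g => by
    rw [MonoidHom.comp_apply, kap_of, map_mul, map_mul, map_inv, h1, h2, ← map_inv,
      ← SemidirectProduct.inl_aut, shift_of, mul_one]
  intro a b hab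
  have := congrArg Θ hab
  rw [← MonoidHom.comp_apply, ← MonoidHom.comp_apply, ‹Θ.comp _ = _›] at this
  exact SemidirectProduct.inl_injective this

theorem IsKer.q_kap (hK : IsKer q s y) (v : FreeGroup G) : q (kap s y v) = 1 := by
  have : q.comp (kap s y) = 1 := FreeGroup.ext_hom _ _ fun g => by
    simp [kap_of, hK.q_y]
  exact DFunLike.congr_fun this v

theorem IsKer.exists_mul (hK : IsKer q s y) (p : P) : ∃ v, p = kap s y v * s (q p) := by
  obtain ⟨Θ, h1, h2⟩ := hK.exists_hom
  let Ψ : FreeGroup G ⋊[shift G] G →* P := SemidirectProduct.lift (kap s y) s fun g => by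
    refine FreeGroup.ext_hom _ _ fun x => ?_
    simp [shift_of, kap_of, mul_assoc]
  have h3 := hK.ext (Ψ.comp Θ) (fun g => by simp [Ψ, h1]) (by simp [Ψ, h2, kap_of]) p
  have h4 : (q.comp Ψ) = SemidirectProduct.rightHom := by
    refine SemidirectProduct.hom_ext (MonoidHom.ext fun v => ?_) (MonoidHom.ext fun g => ?_)
    · simp [Ψ, hK.q_kap]
    · simp [Ψ, hK.q_s]
  have h5 : (Θ p).right = q p := by
    rw [← SemidirectProduct.rightHom_eq_right, ← h4, MonoidHom.comp_apply]
    exact congrArg q h3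
  refine ⟨(Θ p).left, ?_⟩
  rw [← h5]
  conv_lhs => rw [← h3, MonoidHom.comp_apply,
    ← SemidirectProduct.inl_left_mul_inr_right (Θ p), map_mul]
  rw [SemidirectProduct.lift_inl, SemidirectProduct.lift_inr]

theorem IsKer.exists_kap (hK : IsKer q s y) {p : P} (hp : q p = 1) : ∃ v, kap s y v = p := by
  obtain ⟨v, hv⟩ := hK.exists_mul p
  exact ⟨v, by rw [hv, hp, map_one, mul_one]⟩

theorem IsKer.exists_conj (hK : IsKer q s y) (p : P) :
    ∃ v, p * y * p⁻¹ = kap s y (v * FreeGroup.of (q p) * v⁻¹) := by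
  obtain ⟨v, hv⟩ := hK.exists_mul p
  refine ⟨v, ?_⟩
  rw [map_mul, map_mul, map_inv, kap_of]
  conv_lhs => rw [hv]
  group

theorem IsKer.q_eq (hK : IsKer q s y) {c d : P} (h : c * y * c⁻¹ = d * y * d⁻¹) : q c = q d := by
  obtain ⟨u, hu⟩ := hK.exists_conj c
  obtain ⟨v, hv⟩ := hK.exists_conj d
  rw [hu, hv] at h
  exact FreeGroup.eq_of_conj_of (hK.kap_injective h)

theorem IsKer.exists_endo (hK : IsKer q s y) (α : P →* P) {c : P} (hc : α y = c * y * c⁻¹) :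
    ∃ A : FreeGroup G →* FreeGroup G, (∀ v, kap s y (A v) = α (kap s y v)) ∧
      ∀ g, ∃ u, A (FreeGroup.of g) = u * FreeGroup.of (q (α (s g) * c)) * u⁻¹ := by
  choose u hu using fun g => hK.exists_conj (α (s g) * c)
  refine ⟨FreeGroup.lift fun g => u g * FreeGroup.of (q (α (s g) * c)) * (u g)⁻¹, fun v => ?_,
    fun g => ⟨u g, by simp⟩⟩
  have : (kap s y).comp (FreeGroup.lift fun g => u g * FreeGroup.of (q (α (s g) * c)) * (u g)⁻¹) =
      α.comp (kap s y) := FreeGroup.ext_hom _ _ fun g => by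
    rw [MonoidHom.comp_apply, FreeGroup.lift_apply_of, ← hu, MonoidHom.comp_apply, kap_of, map_mul,
      map_mul, map_inv, hc]
    group
  exact DFunLike.congr_fun this v

theorem IsKer.q_congr (hK : IsKer q s y) (α : P →* P) {c : P} (hc : α y = c * y * c⁻¹) {p p' : P}
    (h : q p = q p') : q (α p) = q (α p') := by
  obtain ⟨v, hv⟩ := hK.exists_mul p
  obtain ⟨v', hv'⟩ := hK.exists_mul p'
  obtain ⟨A, hA, -⟩ := hK.exists_endo α hc
  rw [hv, hv', h, map_mul α, map_mul α, ← hA, ← hA, map_mul, map_mul, hK.q_kap, hK.q_kap]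

theorem IsKer.exists_conj_zpow (hK : IsKer q s y) {B : Type*} [Group B] (Φ : B →* MulAut P)
    (hy : ∀ b, ∃ c, Φ b y = c * y * c⁻¹)
    (hU : ∀ g, (∀ b, ∃ m > 0, ∀ c, Φ (b ^ m) y = c * y * c⁻¹ →
      q (c⁻¹ * Φ (b ^ m) (s g) * c) = g) → g = 1)
    {w : P} (hw : q w = 1) (hw1 : w ≠ 1) (hfix : ∀ b, Φ b w = w) :
    ∃ (u : P) (n : ℤ), w = u * y ^ n * u⁻¹ := by
  classical
  choose c hc using hy
  have hcong : ∀ b {p p'}, q p = q p' → q (Φ b p) = q (Φ b p') := fun b p p' h =>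
    hK.q_congr (Φ b).toMonoidHom (hc b) h
  have hmul : ∀ b b', q (c (b * b')) = q (Φ b (c b') * c b) := fun b b' => hK.q_eq <| by
    rw [← hc, map_mul, MulAut.mul_apply, hc b', map_mul, map_mul, map_inv, hc b]
    group
  have hone : q (c 1) = 1 := by
    rw [← map_one q]
    exact hK.q_eq (by rw [← hc, map_one]; simp)
  let act : MulAction B G :=
    { smul := fun b g => q (Φ b (s g) * c b)
      one_smul := fun g => by
        show q (Φ 1 (s g) * c 1) = g
        rw [map_mul, hone, map_one, mul_one, MulAut.one_apply, hK.q_s]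
      mul_smul := fun b b' g => by
        show q (Φ (b * b') (s g) * c (b * b')) = q (Φ b (s (q (Φ b' (s g) * c b'))) * c b)
        rw [map_mul q _ (c b), hcong b (hK.q_s (q (Φ b' (s g) * c b'))), map_mul q, hmul, map_mul Φ,
          MulAut.mul_apply, map_mul (Φ b), map_mul, map_mul]
        group }
  have hsmul : ∀ (b : B) (g : G), b • g = q (Φ b (s g) * c b) := fun _ _ => rfl
  obtain ⟨v, rfl⟩ := hK.exists_kap hw
  obtain ⟨T, hT⟩ := FreeGroup.exists_retr v
  have hA : ∀ b : B, ∃ A : FreeGroup G →* FreeGroup G, A v = v ∧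
      ∀ g, ∃ u, A (FreeGroup.of g) = u * FreeGroup.of (b • g) * u⁻¹ := fun b => by
    obtain ⟨A, h1, h2⟩ := hK.exists_endo (Φ b).toMonoidHom (hc b)
    exact ⟨A, hK.kap_injective (by rw [h1]; exact hfix b), h2⟩
  by_cases hg : ∃ g : G, (MulAction.stabilizer B g).FiniteIndex
  · obtain ⟨g₀, hg₀⟩ := hg
    have hinf : ∀ x, x ≠ g₀ → ¬ (MulAction.stabilizer (MulAction.stabilizer B g₀) x).FiniteIndex := by
      intro x hx hfin
      refine hx (inv_mul_eq_one.mp (hU (x⁻¹ * g₀) fun b => ?_))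
      obtain ⟨m₁, hm₁, -, h1⟩ := Subgroup.exists_pow_mem_of_index_ne_zero hg₀.index_ne_zero b
      obtain ⟨m₂, hm₂, -, h2⟩ := Subgroup.exists_pow_mem_of_index_ne_zero hfin.index_ne_zero
        (⟨b ^ m₁, h1⟩ : MulAction.stabilizer B g₀)
      have hx : b ^ (m₁ * m₂) • x = x := by
        rw [pow_mul]
        exact MulAction.mem_stabilizer_iff.mp h2
      have hg : b ^ (m₁ * m₂) • g₀ = g₀ := by
        rw [pow_mul]
        exact MulAction.mem_stabilizer_iff.mp (pow_mem h1 m₂)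
      refine ⟨m₁ * m₂, Nat.mul_pos hm₁ hm₂, fun d hd => ?_⟩
      rw [hc] at hd
      rw [hsmul, map_mul q, hK.q_eq hd] at hx hg
      rw [map_mul q, map_mul q, map_inv q, map_mul s, map_mul (Φ _), map_mul q, map_inv s,
        map_inv (Φ _), map_inv q]
      conv_rhs => rw [← hx, ← hg]
      group
    obtain ⟨⟨b, hb⟩, hbT⟩ := exists_smul_notMem (B := MulAction.stabilizer B g₀) (T.erase g₀)
      fun x hx => hinf x (Finset.ne_of_mem_erase hx)
    obtain ⟨A, h1, h2⟩ := hA b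
    obtain ⟨u, n, hu⟩ := FreeGroup.fixed_of_moved h2 h1 hT g₀ hb fun x hx hne hmem => by
      refine hbT x (Finset.mem_erase.mpr ⟨hne, hx⟩) (Finset.mem_erase.mpr ⟨fun h => hne ?_, hmem⟩)
      exact smul_left_cancel b (h.trans (MulAction.mem_stabilizer_iff.mp hb).symm)
    refine ⟨kap s y u * s g₀, n, ?_⟩
    conv_lhs => rw [hu]
    rw [map_mul, map_mul, map_inv, map_zpow, kap_of, conj_zpow]
    group
  · push Not at hg
    obtain ⟨b, hb⟩ := exists_smul_notMem (B := B) T fun x _ => hg x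
    obtain ⟨A, h1, h2⟩ := hA b
    exact absurd (by rw [FreeGroup.fixed_of_all_moved h2 h1 hT hb, map_one]) hw1

end IsKer

end BraidB

namespace BraidB

variable {r : ℕ}

theorem isKer_of {q : F (r + 1) →* F r} (hq : ∀ j < r, q (X (r + 1) j) = X r j) {y : F (r + 1)}
    (hy : y = X (r + 1) r * (up r (q (X (r + 1) r)))⁻¹) : IsKer q (up r) y := by
  have hs : ∀ g, q (up r g) = g := fun g => by
    have : q.comp (up r) = MonoidHom.id _ := F.hom_ext fun i hi => by simp [up_X hi, hq i hi]
    exact DFunLike.congr_fun this g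
  refine ⟨hs, by rw [hy, map_mul, map_inv, hs, mul_inv_cancel], fun f h1 h2 p => ?_, ?_⟩
  · have : f = MonoidHom.id _ := F.hom_ext fun j hj => by
      rcases Nat.lt_succ_iff_lt_or_eq.mp hj with hj | rfl
      · rw [← up_X hj, h1]; rfl
      · rw [hy, map_mul, map_inv, h1] at h2
        exact mul_right_cancel h2
    rw [this]; rfl
  · let Θ : F (r + 1) →* FreeGroup (F r) ⋊[shift (F r)] F r := F.lift fun j =>
      if j < r then SemidirectProduct.inr (X r j)
      else SemidirectProduct.inl (FreeGroup.of 1) * SemidirectProduct.inr (q (X (r + 1) r))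
    have hΘ : ∀ g, Θ (up r g) = SemidirectProduct.inr g := fun g => by
      have : Θ.comp (up r) = SemidirectProduct.inr := F.hom_ext fun i hi => by
        rw [MonoidHom.comp_apply, up_X hi]
        simp only [Θ]
        rw [F.lift_X _ (by omega), if_pos hi]
      exact DFunLike.congr_fun this g
    refine ⟨Θ, hΘ, ?_⟩
    rw [hy, map_mul, map_inv, hΘ]
    simp only [Θ]
    rw [F.lift_X _ (by omega), if_neg (lt_irrefl _), mul_inv_cancel_right]

theorem isKer_kill (r : ℕ) : IsKer (kill r) (up r) (X (r + 1) r) :=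
  isKer_of (fun j _ => kill_X r j) (by rw [kill_X, X_eq_one le_rfl, map_one, inv_one, mul_one])

/-- The homomorphism killing the product of the generators. -/
def qz (r : ℕ) : F (r + 1) →* F r := F.lift fun j => if j < r then X r j else (z r)⁻¹

theorem qz_X {j : ℕ} (hj : j < r) : qz r (X (r + 1) j) = X r j := by
  rw [qz, F.lift_X _ (by omega), if_pos hj]

theorem qz_top (r : ℕ) : qz r (X (r + 1) r) = (z r)⁻¹ := by
  rw [qz, F.lift_X _ (by omega), if_neg (lt_irrefl _)]

theorem up_z (r : ℕ) : up r (z r) = zp (r + 1) r := by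
  rw [z, zp_eq_pseq, zp_eq_pseq, map_pseq]
  exact pseq_congr fun j hj => up_X hj

theorem z_succ (r : ℕ) : z (r + 1) = X (r + 1) r * up r (z r) := by
  rw [up_z]; rfl

theorem isKer_qz (r : ℕ) : IsKer (qz r) (up r) (z (r + 1)) :=
  isKer_of (fun _ => qz_X) (by rw [qz_top, map_inv, inv_inv, z_succ])

theorem act_incl (b : Br r) : (∀ w, act (r + 1) (Br.incl (Nat.le_succ r) b) (up r w) =
    up r (act r b w)) ∧ act (r + 1) (Br.incl (Nat.le_succ r) b) (X (r + 1) r) = X (r + 1) r := by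
  induction b using Br.induction with
  | one => simp
  | mul x y hx hy => simp [hx, hy]
  | inv x hx =>
    refine ⟨fun w => ?_, ?_⟩
    · rw [map_inv, map_inv, MulAut.inv_apply, MulEquiv.symm_apply_eq, hx.1, map_inv,
        MulAut.apply_inv_self]
    · rw [map_inv, map_inv, MulAut.inv_apply, MulEquiv.symm_apply_eq, hx.2]
  | gen i hi =>
    rw [Br.incl_σ _ hi]
    refine ⟨fun w => ?_, act_σ_of_ne (by omega) (by omega) (by omega)⟩
    have : (act (r + 1) (Br.σ (r + 1) i)).toMonoidHom.comp (up r) =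
        (up r).comp (act r (Br.σ r i)).toMonoidHom := F.hom_ext fun j hj => by
      simp only [MonoidHom.comp_apply, MulEquiv.toMonoidHom_eq_coe, MonoidHom.coe_coe, up_X hj]
      rcases eq_or_ne j i with rfl | h1
      · rw [act_σ_self hi, act_σ_self (by omega)]
        simp [up_X hi, up_X hj]
      rcases eq_or_ne j (i + 1) with rfl | h2
      · rw [act_σ_succ hi, act_σ_succ (by omega), up_X (by omega)]
      · rw [act_σ_of_ne hi h1 h2, act_σ_of_ne (by omega) h1 h2, up_X hj]
    exact DFunLike.congr_fun this w

theorem act_incl_up (b : Br r) (w : F r) :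
    act (r + 1) (Br.incl (Nat.le_succ r) b) (up r w) = up r (act r b w) := (act_incl b).1 w

theorem act_incl_top (b : Br r) :
    act (r + 1) (Br.incl (Nat.le_succ r) b) (X (r + 1) r) = X (r + 1) r := (act_incl b).2

theorem qz_act_Z (m : ℕ) (u : F (r + 1)) :
    qz r (act (r + 1) (Br.incl (Nat.le_succ r) (Z r) ^ m) u) =
      qz r (X (r + 1) r ^ m * u * (X (r + 1) r ^ m)⁻¹) := by
  have h1 : ∀ u, qz r (act (r + 1) (Br.incl (Nat.le_succ r) (Z r)) u) =
      qz r (X (r + 1) r * u * (X (r + 1) r)⁻¹) := fun u => by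
    have : (qz r).comp (act (r + 1) (Br.incl (Nat.le_succ r) (Z r))).toMonoidHom =
        (qz r).comp (MulAut.conj (X (r + 1) r)).toMonoidHom := F.hom_ext fun j hj => by
      simp only [MonoidHom.comp_apply, MulEquiv.toMonoidHom_eq_coe, MonoidHom.coe_coe,
        MulAut.conj_apply]
      rcases Nat.lt_succ_iff_lt_or_eq.mp hj with hj | rfl
      · rw [← up_X hj, act_incl_up, act_Z, map_mul, map_mul, (isKer_qz r).q_s]
        simp [qz_top, qz_X hj, up_X hj, (isKer_qz r).q_s]
      · rw [act_incl_top]; simp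
    exact DFunLike.congr_fun this u
  induction m generalizing u with
  | zero => simp
  | succ m ih =>
    rw [pow_succ, map_mul, MulAut.mul_apply, ih, map_mul, map_mul, h1, map_mul, map_mul, pow_succ]
    simp [mul_assoc]

theorem qz_act_congr_left {b b' : Br (r + 1)} (h : mq (r + 1) b = mq (r + 1) b') (u : F (r + 1)) :
    qz r (act (r + 1) b u) = qz r (act (r + 1) b' u) := by
  rw [← inv_mul_eq_one, ← map_inv, ← map_mul, mq_eq_one] at h
  obtain ⟨j, hj⟩ := h
  have hq : ∀ (j : ℤ) (u : F (r + 1)), qz r (act (r + 1) (Z (r + 1) ^ j) u) = qz r u := by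
    intro j u
    have hz : act (r + 1) (Z (r + 1)) = MulAut.conj (z (r + 1))⁻¹ := by
      ext w; rw [act_Z]; simp
    rw [map_zpow, hz, ← map_zpow, MulAut.conj_apply]
    simp [(isKer_qz r).q_y]
  have hb : b' = Z (r + 1) ^ j * b := by
    rw [← ((Z_comm (r + 1) b).zpow_right j).eq, ← hj, mul_inv_cancel_left]
  rw [hb, map_mul, MulAut.mul_apply, hq]

theorem qz_act_congr (b : Br (r + 1)) {u v : F (r + 1)} (h : qz r u = qz r v) :
    qz r (act (r + 1) b u) = qz r (act (r + 1) b v) :=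
  (isKer_qz r).q_congr (act (r + 1) b).toMonoidHom (c := 1)
    (by rw [one_mul, inv_one, mul_one]; exact act_z _ _) h

theorem qz_act_prI (e : E (r + 1)) : ∀ u : F (r + 1),
    qz r (act (r + 1) (prI (r + 1) e) u) = qz r (full (r + 1) e u) := by
  have hcongr : ∀ e : E (r + 1), ∀ {u v : F (r + 1)}, qz r u = qz r v →
      qz r (full (r + 1) e u) = qz r (full (r + 1) e v) := fun e u v h => by
    rw [full_apply, full_apply, map_mul, map_mul, map_mul, map_mul, qz_act_congr _ h]
  induction e using E.induction with
  | one => simp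
  | mul x y hx hy =>
    intro u
    rw [map_mul, map_mul, map_mul, MulAut.mul_apply, MulAut.mul_apply, hx, hcongr x (hy u)]
  | inv x hx =>
    intro u
    have h := hx ((act (r + 1) (prI (r + 1) x))⁻¹ u)
    rw [MulAut.apply_inv_self] at h
    have := hcongr x⁻¹ h
    rw [map_inv, MulAut.inv_apply_self] at this
    rw [map_inv, map_inv, map_inv, ← this]
  | gen i hi => intro u; rw [prI_bE, full_apply]; simp
  | top hk =>
    intro u
    rw [prI_top hk, full_apply]
    have := qz_act_Z 1 u
    simpa using this

theorem qz_eq_one_of_piA (hr : 2 ≤ r) {w : F (r + 1)} (h : piA (r + 1) (xA (r + 1) w) = 1) :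
    qz r w = 1 := by
  rw [← aq_xE, piA_aq] at h
  refine F.center_trivial hr fun v => ?_
  have h1 := qz_act_prI (xE (r + 1) w) (up r v)
  rw [qz_act_congr_left (b' := 1) (by rw [h, map_one]), full_apply, map_one, MulAut.one_apply,
    (isKer_qz r).q_s] at h1
  simp only [SemidirectProduct.left_inl, xE, SemidirectProduct.right_inl, map_one,
    MulAut.one_apply, map_mul, (isKer_qz r).q_s, map_inv] at h1
  exact (eq_mul_inv_iff_mul_eq.mp h1).symm

theorem eq_one_of_qz_fixed (hr : 2 ≤ r) {g : F r}
    (h : ∀ b : Br (r + 1), ∃ m > 0, qz r (act (r + 1) (b ^ m) (up r g)) = g) : g = 1 := by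
  obtain ⟨m, hm, h1⟩ := h (Br.incl (Nat.le_succ r) (Z r))
  obtain ⟨n, hn, h2⟩ := h (Br.σ (r + 1) (r - 1) * Br.incl (Nat.le_succ r) (Z r) *
    (Br.σ (r + 1) (r - 1))⁻¹)
  rw [qz_act_Z] at h1
  simp only [map_mul, map_pow, qz_top, map_inv, (isKer_qz r).q_s] at h1
  rw [conj_pow, map_mul, map_mul, MulAut.mul_apply, MulAut.mul_apply,
    qz_act_congr _ (qz_act_Z n _)] at h2
  simp only [map_mul, map_pow, map_inv, MulAut.apply_inv_self] at h2
  have hσ : act (r + 1) (Br.σ (r + 1) (r - 1)) (X (r + 1) r) = X (r + 1) (r - 1) := by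
    obtain ⟨r, rfl⟩ : ∃ s, r = s + 1 := ⟨r - 1, by omega⟩
    exact act_σ_succ (by omega)
  rw [hσ] at h2
  simp only [qz_X (show r - 1 < r by omega), (isKer_qz r).q_s] at h2
  have c1 : Commute g (z r ^ (m : ℤ)) := by
    have : Commute ((z r)⁻¹ ^ m) g := mul_inv_eq_iff_eq_mul.mp h1
    rw [inv_pow] at this
    exact_mod_cast Commute.inv_right_iff.mp this.symm
  have c2 : Commute g (X r (r - 1) ^ (n : ℤ)) := by
    have : Commute (X r (r - 1) ^ n) g := mul_inv_eq_iff_eq_mul.mp h2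
    exact_mod_cast this.symm
  obtain ⟨a, ha⟩ := commute_z (by omega) c1
  obtain ⟨b, hb⟩ := commute_X_zpow (by omega) (by omega) c2
  have h3 := congrArg (expo r 0) (ha.symm.trans hb)
  rw [map_zpow, map_zpow, expo_X_ne (by omega), one_zpow] at h3
  have h4 := expo_zero_z (k := r) (by omega)
  rw [h4, ← ofAdd_zsmul] at h3
  have : a = 0 := by simpa using congrArg Multiplicative.toAdd h3
  rw [ha, this, zpow_zero]

theorem A.exists_conj_z (hr : 2 ≤ r) (φ : Br (r + 1) →* A (r + 1))
    (hU : ∀ g : F r, (∀ b, ∃ m > 0, ∀ b', mq (r + 1) b' = pr (r + 1) (φ b) ^ m →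
      qz r (act (r + 1) b' (up r g)) = g) → g = 1) {w : F (r + 1)} (hw : w ≠ 1)
    (hc : ∀ b, Commute (φ b) (xA (r + 1) w)) (hpi : piA (r + 1) (xA (r + 1) w) = 1) :
    ∃ (u : F (r + 1)) (n : ℤ), w = u * z (r + 1) ^ n * u⁻¹ := by
  have haut : ∀ κ b u, A.aut (r + 1) (xA (r + 1) κ * bA (r + 1) b) u =
      κ * act (r + 1) b u * κ⁻¹ := fun κ b u => by
    rw [map_mul, MulAut.mul_apply, A.aut_bA, A.aut_xA]
  refine (isKer_qz r).exists_conj_zpow ((A.aut (r + 1)).comp φ) (fun b => ?_) (fun g hg => ?_)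
    (qz_eq_one_of_piA hr hpi) hw fun b => ?_
  · obtain ⟨κ, b', hb⟩ := A.exists_mul (φ b)
    exact ⟨κ, by rw [MonoidHom.comp_apply, hb, haut, act_z]⟩
  · refine hU g fun b => ?_
    obtain ⟨m, hm, h⟩ := hg b
    refine ⟨m, hm, fun b' hb' => ?_⟩
    obtain ⟨κ, b'', hb⟩ := A.exists_mul (φ (b ^ m))
    have h1 := h κ (by rw [MonoidHom.comp_apply, hb, haut, act_z])
    rw [MonoidHom.comp_apply, hb, haut] at h1
    rw [show κ⁻¹ * (κ * act (r + 1) b'' (up r g) * κ⁻¹) * κ = act (r + 1) b'' (up r g) by group] at h1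
    have h2 : mq (r + 1) b' = mq (r + 1) b'' := by
      rw [hb', ← map_pow, ← map_pow, hb, map_mul, pr_xA, one_mul, pr_bA]
    rw [qz_act_congr_left h2]
    exact h1
  · refine xA_injective (by omega) ?_
    rw [MonoidHom.comp_apply, xA_aut, (hc b).eq, mul_inv_cancel_right]

end BraidB

namespace BraidB

open Multiplicative

variable {k : ℕ}

/-- The exponent sum of a braid. -/
noncomputable def Br.len (k : ℕ) : Br k →* Multiplicative ℤ :=
  Br.lift (fun _ => ofAdd 1) ⟨fun _ _ => rfl, fun _ _ _ _ => rfl⟩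

theorem Br.len_σ {i : ℕ} (hi : i + 1 < k) : Br.len k (Br.σ k i) = ofAdd 1 := Br.lift_σ _ _ hi

theorem Br.len_rho {m : ℕ} (hm : m < k) : Br.len k (rho k m) = ofAdd (m : ℤ) := by
  induction m with
  | zero => simp [rho]
  | succ m ih => rw [rho, map_mul, ih (by omega), Br.len_σ hm, ← ofAdd_add]; simp

theorem Br.len_Z (hk : 0 < k) : Br.len k (Z k) = ofAdd (k * (k - 1) : ℤ) := by
  rw [Z, map_pow, Br.len_rho (by omega), ← ofAdd_nsmul]
  congr 1
  rw [nsmul_eq_mul]; push_cast [Nat.cast_sub (show 1 ≤ k by omega)]; ring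

theorem Br.hom_eq_len {f : Br k →* Multiplicative ℤ} (b : Br k) :
    f b = f (Br.σ k 0) ^ toAdd (Br.len k b) := by
  have : f = (zpowersHom _ (f (Br.σ k 0))).comp (Br.len k) := Br.hom_ext fun i hi => by
    obtain ⟨c, hc⟩ := isConj_iff.mp (((Br.isBraid_σ k).map f).isConj hi)
    rw [mul_right_comm, mul_inv_cancel, one_mul] at hc
    rw [MonoidHom.comp_apply, Br.len_σ hi, ← hc]
    simp [zpowersHom_apply]
  conv_lhs => rw [this]
  simp [zpowersHom_apply]

/-- The total exponent. -/
noncomputable def tot (k : ℕ) : F k →* Multiplicative ℤ := F.lift fun _ => ofAdd 1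

theorem tot_X {i : ℕ} (hi : i < k) : tot k (X k i) = ofAdd 1 := F.lift_X _ hi

theorem tot_act (b : Br k) (w : F k) : tot k (act k b w) = tot k w := by
  have : (tot k).comp (act k b).toMonoidHom = tot k := F.hom_ext fun j hj => by
    obtain ⟨u, hu⟩ := act_X_conj k b j
    have hp := Br.perm_apply_lt b hj
    simp only [MonoidHom.comp_apply, MulEquiv.coe_toMonoidHom]
    rw [hu, map_mul, map_mul, map_inv, mul_right_comm, mul_inv_cancel, one_mul, tot_X hp, tot_X hj]
  exact DFunLike.congr_fun this w

theorem map_zp {f : F k →* Multiplicative ℤ} {c : Multiplicative ℤ} (h : ∀ j < k, f (X k j) = c)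
    {m : ℕ} (hm : m ≤ k) : f (zp k m) = c ^ m := by
  induction m with
  | zero => simp [zp]
  | succ m ih => rw [zp, map_mul, h m (by omega), ih (by omega), pow_succ']

theorem map_z {f : F k →* Multiplicative ℤ} {c : Multiplicative ℤ} (h : ∀ j < k, f (X k j) = c) :
    f (z k) = c ^ k := map_zp h le_rfl

/-- The exponent sum on the annular braid group for which the central element has sum zero. -/
noncomputable def chiE (k : ℕ) : E k →* Multiplicative ℤ :=
  E.lift (s := fun _ => ofAdd 1) (r := ofAdd (1 - k : ℤ))
    ⟨⟨fun _ _ => rfl, fun _ _ _ _ => rfl⟩, fun _ _ => mul_comm _ _, fun _ _ => by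
      simp only [mul_left_comm, mul_comm]⟩

theorem chiE_bE (b : Br k) : chiE k (bE k b) = Br.len k b := E.lift_bE _ _

theorem chiE_xE (w : F k) : chiE k (xE k w) = tot k w ^ (1 - k : ℤ) := by
  have : (chiE k).comp (xE k) = (zpowGroupHom (1 - k : ℤ)).comp (tot k) := F.hom_ext fun j hj => by
    rw [MonoidHom.comp_apply, MonoidHom.comp_apply, tot_X hj]
    refine down_induction (k := k) (p := fun j => chiE k (xE k (X k j)) = _) ?_ ?_ j hj
    · rw [chiE, E.lift_X_top _ (by omega)]
      simp [← ofAdd_zsmul]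
    · intro i hi h
      rw [E.bE_conj_X hi, map_mul, map_mul, map_inv, mul_right_comm, mul_inv_cancel, one_mul, h]
  exact DFunLike.congr_fun this w

theorem chiE_zZ (k : ℕ) : chiE k (zZ k) = 1 := by
  rcases Nat.eq_zero_or_pos k with rfl | hk
  · simp [zZ, z, zp, Z]
  rw [zZ, map_mul, chiE_bE, Br.len_Z hk, chiE_xE, map_z fun j hj => tot_X hj, ← ofAdd_nsmul,
    ← ofAdd_zsmul, ← ofAdd_add, ← ofAdd_zero]
  congr 1
  simp only [nsmul_eq_mul, smul_eq_mul]; ring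

/-- The exponent sum on the annular braid group modulo its centre. -/
noncomputable def chi (k : ℕ) : A k →* Multiplicative ℤ := A.lift (chiE k) (chiE_zZ k)

theorem chi_bA (b : Br k) : chi k (bA k b) = Br.len k b := chiE_bE b

theorem chi_xA (w : F k) : chi k (xA k w) = tot k w ^ (1 - k : ℤ) := chiE_xE w

theorem exists_bA_mul_xA {b : Br k} {a : A k} (h : pr k a = mq k b) :
    ∃ v, a = bA k b * xA k v := by
  obtain ⟨v, hv⟩ := exists_xA (a := (bA k b)⁻¹ * a) (by rw [map_mul, h, map_inv, pr_bA,
    inv_mul_cancel])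
  exact ⟨v, by rw [← hv, mul_inv_cancel_left]⟩

theorem commute_bA_xA_z (b : Br k) (n : ℤ) : Commute (bA k b) (xA k (z k ^ n)) := by
  have : Commute (bA k b) (xA k (z k)) := by
    have := xA_act b (z k)
    rw [act_z] at this
    exact (mul_inv_eq_iff_eq_mul.mp this.symm)
  rw [map_zpow]; exact this.zpow_right n

theorem A.exists_twist (hk : 3 ≤ k) (ψ : Br k →* A k) (h : ∀ b, pr k (ψ b) = mq k b)
    (hp : piA k (ψ (Z k)) = 1) : ∃ (u : F k) (a : ℤ), ∀ b,
      ψ b = xA k u * (bA k b * xA k (z k ^ (a * toAdd (Br.len k b)))) * (xA k u)⁻¹ := by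
  obtain ⟨r, rfl⟩ : ∃ r, k = r + 1 := ⟨k - 1, by omega⟩
  obtain ⟨w, hw⟩ := exists_xA (a := ψ (Z (r + 1))) (by rw [h, mq_Z])
  have hw1 : w ≠ 1 := by
    rintro rfl
    obtain ⟨v, hv⟩ := exists_bA_mul_xA (h (Br.σ (r + 1) 0))
    have h1 := Br.hom_eq_len (f := (chi (r + 1)).comp ψ) (Z (r + 1))
    rw [MonoidHom.comp_apply, MonoidHom.comp_apply, hw, hv, map_one, map_one, map_mul, chi_bA,
      chi_xA, Br.len_σ (by omega), Br.len_Z (by omega)] at h1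
    have h2 := congrArg toAdd h1
    simp only [toAdd_one, toAdd_zpow, toAdd_mul, toAdd_ofAdd, smul_eq_mul] at h2
    push_cast at h2
    have h3 : (1 : ℤ) + (1 - (r + 1)) * toAdd (tot (r + 1) v) = 0 := by
      have : ((r : ℤ) + 1) * (r + 1 - 1) ≠ 0 := by
        exact mul_ne_zero (by omega) (by omega)
      exact (mul_eq_zero.mp h2.symm).resolve_left this
    have : (r : ℤ) ∣ 1 := ⟨toAdd (tot (r + 1) v), by linarith⟩
    have := Int.le_of_dvd one_pos this
    omega
  obtain ⟨u, m, hu⟩ := A.exists_conj_z (by omega) ψ (fun g hg => eq_one_of_qz_fixed (by omega)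
    fun b => by
      obtain ⟨m, hm, h1⟩ := hg b
      exact ⟨m, hm, h1 (b ^ m) (by rw [map_pow, h])⟩) hw1
    (fun b => by rw [← hw]; exact (Z_comm _ b).map ψ) (by rw [← hw, hp])
  have hm : m ≠ 0 := by
    rintro rfl
    exact hw1 (by rw [hu]; simp)
  obtain ⟨ψ', hψ'⟩ : ∃ ψ' : Br (r + 1) →* A (r + 1),
      ∀ b, ψ' b = (xA (r + 1) u)⁻¹ * ψ b * xA (r + 1) u :=
    ⟨(MulAut.conj (xA (r + 1) u)⁻¹).toMonoidHom.comp ψ, fun b => by simp⟩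
  have hZ : ψ' (Z (r + 1)) = xA (r + 1) (z (r + 1) ^ m) := by
    rw [hψ', hw, hu, map_mul, map_mul, map_inv]; group
  have hv : ∀ i, ∃ a : ℤ, i + 1 < r + 1 → ψ' (Br.σ (r + 1) i) =
      bA (r + 1) (Br.σ (r + 1) i) * xA (r + 1) (z (r + 1) ^ a) := fun i => by
    by_cases hi : i + 1 < r + 1
    · obtain ⟨v, hv⟩ := exists_bA_mul_xA (a := ψ' (Br.σ (r + 1) i)) (b := Br.σ (r + 1) i)
        (by rw [hψ', map_mul, map_mul, map_inv, pr_xA, h]; group)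
      have hc : Commute (ψ' (Br.σ (r + 1) i)) (ψ' (Z (r + 1))) := (Z_comm _ _).map ψ'
      rw [hv, hZ] at hc
      have h1 := (commute_bA_xA_z (Br.σ (r + 1) i) m).inv_left.mul_left hc
      rw [inv_mul_cancel_left] at h1
      obtain ⟨a, ha⟩ := commute_z hm (show Commute v (z (r + 1) ^ m) from
        xA_injective (by omega) (by rw [map_mul, map_mul]; exact h1))
      exact ⟨a, fun _ => by rw [hv, ha]⟩
    · exact ⟨0, fun h => absurd h hi⟩
  choose a ha using hv
  have ha0 : ∀ i, i + 1 < r + 1 → a i = a 0 := fun i hi => by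
    have h1 := Br.hom_eq_len (f := (chi (r + 1)).comp ψ') (Br.σ (r + 1) i)
    rw [MonoidHom.comp_apply, MonoidHom.comp_apply, ha i hi, ha 0 (by omega), Br.len_σ hi,
      map_mul, map_mul, chi_bA, chi_bA, Br.len_σ hi, Br.len_σ (by omega), chi_xA, chi_xA,
      map_zpow, map_zpow, map_z fun j hj => tot_X hj] at h1
    have h2 := congrArg toAdd h1
    simp only [toAdd_zpow, toAdd_mul, toAdd_ofAdd, smul_eq_mul, toAdd_pow, nsmul_eq_mul] at h2
    push_cast at h2
    have h3 : ((r : ℤ) * (r + 1)) * (a i - a 0) = 0 := by linarith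
    have : (r : ℤ) * (r + 1) ≠ 0 := by
      exact mul_ne_zero (by omega) (by omega)
    have := (mul_eq_zero.mp h3).resolve_left this
    omega
  let τ : Br (r + 1) →* A (r + 1) := MonoidHom.mk'
    (fun b => bA (r + 1) b * xA (r + 1) (z (r + 1) ^ (a 0 * toAdd (Br.len (r + 1) b))))
    fun b b' => by
      rw [map_mul, map_mul, toAdd_mul, mul_add, zpow_add, map_mul, mul_assoc, mul_assoc,
        ← mul_assoc (xA _ _) (bA _ _), ← (commute_bA_xA_z b' _).eq, mul_assoc]
  have hτ : ψ' = τ := Br.hom_ext fun i hi => by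
    rw [ha i hi, ha0 i hi]
    simp [τ, Br.len_σ hi]
  refine ⟨u, a 0, fun b => ?_⟩
  have := DFunLike.congr_fun hτ b
  rw [hψ'] at this
  change _ = bA (r + 1) b * xA (r + 1) (z (r + 1) ^ (a 0 * toAdd (Br.len (r + 1) b))) at this
  rw [← this]; group

end BraidB

namespace BraidB

open Multiplicative

theorem FreeGroup.retr_of {α : Type*} (T : Set α) {x : α} (hx : x ∈ T) :
    FreeGroup.retr T (FreeGroup.of x) = FreeGroup.of x := by
  simp [FreeGroup.retr, hx]

theorem FreeGroup.retr_of_notMem {α : Type*} (T : Set α) {x : α} (hx : x ∉ T) :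
    FreeGroup.retr T (FreeGroup.of x) = 1 := by
  simp [FreeGroup.retr, hx]

theorem FreeGroup.exists_retr_periodic {α : Type*} (p : Equiv.Perm α) {v : FreeGroup α}
    (hv : FreeGroup.map p v = v) : ∃ T : Finset α, FreeGroup.retr (T : Set α) v = v ∧
      ∀ x ∈ T, ∃ n > 0, (p ^ n) x = x := by
  classical
  have hex : ∃ n, ∃ T : Finset α, T.card = n ∧ FreeGroup.retr (T : Set α) v = v := by
    obtain ⟨T, hT⟩ := FreeGroup.exists_retr v
    exact ⟨_, T, rfl, hT⟩
  obtain ⟨T, hc, hT⟩ := Nat.find_spec hex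
  have hstep : (FreeGroup.map p).comp (FreeGroup.retr (T : Set α)) =
      (FreeGroup.retr (T.map p.toEmbedding : Finset α)).comp (FreeGroup.map p) :=
    FreeGroup.ext_hom _ _ fun x => by
      by_cases hx : x ∈ T
      · simp [FreeGroup.retr, hx]
      · simp [FreeGroup.retr, hx]
  have h1 : FreeGroup.retr (T.map p.toEmbedding : Finset α) v = v := by
    have := DFunLike.congr_fun hstep v
    rwa [MonoidHom.comp_apply, MonoidHom.comp_apply, hT, hv, eq_comm] at this
  have h2 : (FreeGroup.retr (T : Set α)).comp (FreeGroup.retr (T.map p.toEmbedding : Finset α)) =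
      FreeGroup.retr ((T ∩ T.map p.toEmbedding : Finset α) : Set α) :=
    FreeGroup.ext_hom _ _ fun x => by
      by_cases hx : x ∈ T.map p.toEmbedding
      · rw [MonoidHom.comp_apply, FreeGroup.retr_of _ (Finset.mem_coe.mpr hx)]
        by_cases hx' : x ∈ T
        · rw [FreeGroup.retr_of _ (Finset.mem_coe.mpr hx'),
            FreeGroup.retr_of _ (Finset.mem_coe.mpr (Finset.mem_inter.mpr ⟨hx', hx⟩))]
        · rw [FreeGroup.retr_of_notMem _ (by simpa using hx'),
            FreeGroup.retr_of_notMem _ fun h => hx' (Finset.mem_inter.mp (Finset.mem_coe.mp h)).1]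
      · rw [MonoidHom.comp_apply, FreeGroup.retr_of_notMem _ fun h => hx (Finset.mem_coe.mp h),
          FreeGroup.retr_of_notMem _ fun h => hx (Finset.mem_inter.mp (Finset.mem_coe.mp h)).2,
          map_one]
  have h3 : FreeGroup.retr ((T ∩ T.map p.toEmbedding : Finset α) : Set α) v = v := by
    rw [← h2, MonoidHom.comp_apply, h1, hT]
  have h4 := Nat.find_min' hex ⟨_, rfl, h3⟩
  have h5 : T ∩ T.map p.toEmbedding = T :=
    Finset.eq_of_subset_of_card_le Finset.inter_subset_left (by rw [hc]; exact h4)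
  have h6 : T.map p.toEmbedding = T :=
    (Finset.eq_of_subset_of_card_le (Finset.inter_eq_left.mp h5) (by simp)).symm
  have h7 : ∀ x ∈ T, p x ∈ T := fun x hx => by
    rw [← h6]; exact Finset.mem_map_of_mem _ hx
  have h8 : ∀ n : ℕ, ∀ x ∈ T, (p ^ n) x ∈ T := fun n => by
    induction n with
    | zero => simp
    | succ n ih => intro x hx; rw [pow_succ', Equiv.Perm.mul_apply]; exact h7 _ (ih x hx)
  refine ⟨T, hT, fun x hx => ?_⟩
  obtain ⟨m, n, hne, he⟩ :=
    Finite.exists_ne_map_eq_of_infinite fun n : ℕ => (⟨(p ^ n) x, h8 n x hx⟩ : T)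
  have he : (p ^ m) x = (p ^ n) x := congrArg Subtype.val he
  have key : ∀ m n : ℕ, m < n → (p ^ m) x = (p ^ n) x → ∃ n > 0, (p ^ n) x = x :=
    fun m n h e => ⟨n - m, by omega, by
      rw [show n = m + (n - m) by omega, pow_add, Equiv.Perm.mul_apply] at e
      exact ((p ^ m).injective e).symm⟩
  rcases lt_or_gt_of_ne hne with h | h
  · exact key m n h he
  · exact key n m h he.symm

variable {k r : ℕ}

theorem expo_act (b : Br k) {j : ℕ} (hj : j < k) (w : F k) :
    expo k (Br.perm k b j) (act k b w) = expo k j w := by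
  have : (expo k (Br.perm k b j)).comp (act k b).toMonoidHom = expo k j := F.hom_ext fun l hl => by
    obtain ⟨u, hu⟩ := act_X_conj k b l
    rw [MonoidHom.comp_apply, MulEquiv.coe_toMonoidHom, hu, map_mul, map_mul, map_inv,
      mul_right_comm, mul_inv_cancel, one_mul]
    rcases eq_or_ne l j with rfl | h
    · rw [expo_X_self hj, expo_X_self (Br.perm_apply_lt b hj)]
    · rw [expo_X_ne h, expo_X_ne fun h' => h ((Br.perm k b).injective h')]
  exact DFunLike.congr_fun this w

theorem tot_eq_prod (w : F k) : tot k w = ∏ j ∈ Finset.range k, expo k j w := by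
  have : tot k = ∏ j ∈ Finset.range k, expo k j := F.hom_ext fun l hl => by
    rw [tot_X hl, MonoidHom.finsetProd_apply, Finset.prod_eq_single l, expo_X_self hl]
    · exact fun j _ h => expo_X_ne h.symm
    · exact fun h => absurd (Finset.mem_range.mpr hl) h
  rw [this, MonoidHom.finsetProd_apply]

theorem expo_kill {i : ℕ} (hi : i < r) (w : F (r + 1)) :
    expo r i (kill r w) = expo (r + 1) i w := by
  have : (expo r i).comp (kill r) = expo (r + 1) i := F.hom_ext fun l hl => by
    rw [MonoidHom.comp_apply, kill_X]
    rcases eq_or_ne l i with rfl | h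
    · rw [expo_X_self hi, expo_X_self hl]
    · rw [expo_X_ne h, expo_X_ne h]
  exact DFunLike.congr_fun this w

theorem expo_z {i : ℕ} (hi : i < k) : expo k i (z k) = ofAdd 1 := by
  suffices h : ∀ m ≤ k, expo k i (zp k m) = if i < m then ofAdd 1 else 1 by
    rw [z, h k le_rfl, if_pos hi]
  intro m hm
  induction m with
  | zero => simp [zp]
  | succ m ih =>
    rw [zp, map_mul, ih (by omega)]
    rcases eq_or_ne m i with rfl | h
    · rw [expo_X_self hi, if_neg (lt_irrefl _), if_pos (by omega), mul_one]
    · rw [expo_X_ne h, one_mul]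
      by_cases h' : i < m
      · rw [if_pos h', if_pos (by omega)]
      · rw [if_neg h', if_neg (by omega)]

theorem kill_act_σ_sq (hr : 0 < r) (w : F (r + 1)) :
    kill r (act (r + 1) (Br.σ (r + 1) (r - 1)) (act (r + 1) (Br.σ (r + 1) (r - 1)) w)) =
      kill r w := by
  have h := kill_act_iota (xE r (X r (r - 1))) w
  rw [iota_top hr, pow_two, map_mul, MulAut.mul_apply] at h
  rw [h]
  simp [xE]

theorem expo_eq_of_twist (hr : 2 ≤ r) {y : F (r + 1)} {a : ℤ} (ha : a ≠ 0)
    (h : y = z (r + 1) ^ a * act (r + 1) (Br.σ (r + 1) 0 ^ 2) y * (z (r + 1) ^ a)⁻¹) :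
    expo (r + 1) 0 y = expo (r + 1) r y := by
  let p : F (r + 1) →* F 2 := F.lift fun j => if j = 0 then X 2 0 else if j = r then X 2 1 else 1
  have p0 : p (X (r + 1) 0) = X 2 0 := by simp only [p]; rw [F.lift_X _ (by omega), if_pos rfl]
  have pr' : p (X (r + 1) r) = X 2 1 := by
    simp only [p]; rw [F.lift_X _ (by omega), if_neg (by omega), if_pos rfl]
  have pj : ∀ j, j ≠ 0 → j < r → p (X (r + 1) j) = 1 := fun j h0 hj => by
    simp only [p]; rw [F.lift_X _ (by omega), if_neg h0, if_neg (by omega)]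
  have p1 := pj 1 one_ne_zero (by omega)
  have s0 : act (r + 1) (Br.σ (r + 1) 0) (X (r + 1) 0) =
      (X (r + 1) 0)⁻¹ * X (r + 1) 1 * X (r + 1) 0 := act_σ_self (by omega)
  have s1 : act (r + 1) (Br.σ (r + 1) 0) (X (r + 1) 1) = X (r + 1) 0 := act_σ_succ (by omega)
  have hσ : ∀ w, p (act (r + 1) (Br.σ (r + 1) 0 ^ 2) w) = p w := fun w => by
    have : p.comp (act (r + 1) (Br.σ (r + 1) 0 ^ 2)).toMonoidHom = p := F.hom_ext fun j hj => by
      rw [MonoidHom.comp_apply, MulEquiv.coe_toMonoidHom, pow_two, map_mul, MulAut.mul_apply]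
      rcases eq_or_ne j 0 with rfl | h0
      · simp only [s0, s1, map_mul, map_inv, p0, p1]
        group
      · rcases eq_or_ne j 1 with rfl | h1
        · simp only [s0, s1, map_mul, map_inv, p0, p1]
          group
        · rw [act_σ_of_ne (by omega) h0 (by omega), act_σ_of_ne (by omega) h0 (by omega)]
    exact DFunLike.congr_fun this w
  have hz : p (z (r + 1)) = z 2 := by
    have : ∀ m < r, p (zp (r + 1) (m + 1)) = X 2 0 := fun m => by
      induction m with
      | zero => intro _; rw [zp, zp, mul_one, p0]
      | succ m ih => intro hm; rw [zp, map_mul, ih (by omega), pj _ (by omega) hm, one_mul]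
    obtain ⟨s, rfl⟩ : ∃ s, r = s + 1 := ⟨r - 1, by omega⟩
    rw [z, zp, map_mul, pr', this s (by omega)]
    simp [z, zp]
  have h1 := congrArg p h
  rw [map_mul, map_mul, map_inv, map_zpow, hz, hσ, eq_mul_inv_iff_mul_eq] at h1
  obtain ⟨c, hc⟩ := commute_z ha h1
  have e0 : (expo 2 0).comp p = expo (r + 1) 0 := F.hom_ext fun j hj => by
    rw [MonoidHom.comp_apply]
    rcases eq_or_ne j 0 with rfl | h0
    · rw [p0, expo_X_self (by omega), expo_X_self (by omega)]
    · rw [expo_X_ne h0]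
      rcases eq_or_ne j r with rfl | h1
      · rw [pr', expo_X_ne (by omega)]
      · rw [pj j h0 (by omega), map_one]
  have e1 : (expo 2 1).comp p = expo (r + 1) r := F.hom_ext fun j hj => by
    rw [MonoidHom.comp_apply]
    rcases eq_or_ne j r with rfl | h0
    · rw [pr', expo_X_self (by omega), expo_X_self (by omega)]
    · rw [expo_X_ne h0]
      rcases eq_or_ne j 0 with rfl | h1
      · rw [p0, expo_X_ne (by omega)]
      · rw [pj j h1 (by omega), map_one]
  rw [← e0, ← e1, MonoidHom.comp_apply, MonoidHom.comp_apply, hc, map_zpow, map_zpow,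
    expo_z (by omega), expo_z (by omega)]

end BraidB

namespace BraidB

open Multiplicative

variable {k r : ℕ}

theorem tot_of_expo {y : F (r + 1)} (h : ∀ i, i + 1 < r → expo (r + 1) i y = expo (r + 1) (i + 1) y) :
    tot (r + 1) y = expo (r + 1) 0 y ^ r * expo (r + 1) r y := by
  have h0 : ∀ i < r, expo (r + 1) i y = expo (r + 1) 0 y := fun i => by
    induction i with
    | zero => exact fun _ => rfl
    | succ i ih => exact fun hi => by rw [← h i hi, ih (by omega)]
  rw [tot_eq_prod, Finset.prod_range_succ, Finset.prod_congr rfl fun i hi =>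
    h0 i (Finset.mem_range.mp hi), Finset.prod_const, Finset.card_range]

theorem isPeriodic_conj_z {x : F r} {n : ℕ} (hn : 0 < n)
    (h : ((MulAut.conj (z r)⁻¹).toEquiv ^ n : Equiv.Perm (F r)) x = x) : ∃ j : ℤ, x = z r ^ j := by
  have h1 : ∀ n : ℕ, ((MulAut.conj (z r)⁻¹).toEquiv ^ n : Equiv.Perm (F r)) x =
      (z r ^ n)⁻¹ * x * z r ^ n := fun n => by
    induction n with
    | zero => simp
    | succ n ih =>
      rw [pow_succ', Equiv.Perm.mul_apply, ih]
      simp only [MulEquiv.toEquiv_eq_coe, MulEquiv.coe_toEquiv, MulAut.conj_apply, inv_inv]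
      group
  rw [h1, mul_assoc, inv_mul_eq_iff_eq_mul] at h
  exact commute_z (m := n) (by omega) (by rw [zpow_natCast]; exact h)

theorem exists_eq_z_conj (hr : 2 ≤ r) {y : F (r + 1)} (hy1 : y ≠ 1)
    (hZ : act (r + 1) (Br.incl (Nat.le_succ r) (Z r)) y = y) (hk : kill r y = 1) {s : F r}
    (hs : s = kill r (act (r + 1) (Br.σ (r + 1) (r - 1)) y)) (hs0 : expo r 0 s = 1)
    (hb : y = act (r + 1) (Br.σ (r + 1) (r - 1)) y *
      act (r + 1) (Br.σ (r + 1) (r - 1)) (act (r + 1) (Br.σ (r + 1) (r - 1)) y) *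
      (act (r + 1) (Br.σ (r + 1) (r - 1)) y)⁻¹) :
    ∃ j : ℤ, y = z (r + 1) ^ j * X (r + 1) r * (z (r + 1) ^ j)⁻¹ := by
  have hK := isKer_kill r
  obtain ⟨v, hv⟩ := hK.exists_kap hk
  have hmap : FreeGroup.map (MulAut.conj (z r)⁻¹).toEquiv v = v := by
    refine hK.kap_injective ?_
    have : (kap (up r) (X (r + 1) r)).comp (FreeGroup.map (MulAut.conj (z r)⁻¹).toEquiv) =
        (act (r + 1) (Br.incl (Nat.le_succ r) (Z r))).toMonoidHom.comp
          (kap (up r) (X (r + 1) r)) := FreeGroup.ext_hom _ _ fun g => by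
      simp only [MonoidHom.comp_apply, FreeGroup.map.of, kap_of, MulEquiv.coe_toMonoidHom, map_mul,
        map_inv, (act_incl (Z r)).1, (act_incl (Z r)).2, act_Z]
      simp
    have h1 := DFunLike.congr_fun this v
    rw [MonoidHom.comp_apply, MonoidHom.comp_apply, hv, MulEquiv.coe_toMonoidHom, hZ] at h1
    rw [h1, hv]
  obtain ⟨T, hT, hper⟩ := FreeGroup.exists_retr_periodic _ hmap
  have hTz : ∀ x ∈ T, ∃ j : ℤ, x = z r ^ j := fun x hx => by
    obtain ⟨n, hn, h⟩ := hper x hx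
    exact isPeriodic_conj_z hn h
  have e0 : act (r + 1) (Br.σ (r + 1) (r - 1)) (X (r + 1) r) = X (r + 1) (r - 1) := by
    obtain ⟨r, rfl⟩ : ∃ s, r = s + 1 := ⟨r - 1, by omega⟩
    exact act_σ_succ (by omega)
  have e1 : act (r + 1) (Br.σ (r + 1) (r - 1)) (X (r + 1) (r - 1)) =
      (X (r + 1) (r - 1))⁻¹ * X (r + 1) r * X (r + 1) (r - 1) := by
    obtain ⟨r, rfl⟩ : ∃ s, r = s + 1 := ⟨r - 1, by omega⟩
    exact act_σ_self (by omega)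
  have hsq := kill_act_σ_sq (r := r) (by omega)
  generalize hτ : act (r + 1) (Br.σ (r + 1) (r - 1)) = τ at *
  obtain ⟨α, hα⟩ : ∃ α : F (r + 1) →* F (r + 1), ∀ w, α w = τ y * τ (τ w) * (τ y)⁻¹ :=
    ⟨(MulAut.conj (τ y) * τ * τ).toMonoidHom, fun w => by simp⟩
  obtain ⟨A, hA, hA'⟩ := hK.exists_endo α (c := τ y * (X (r + 1) (r - 1))⁻¹)
    (by rw [hα, e0, e1]; group)
  have hAv : A v = v := hK.kap_injective (by rw [hA, hv, hα, ← hb])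
  have hex : ∃ x ∈ T, kill r (α (up r x) * (τ y * (X (r + 1) (r - 1))⁻¹)) ∈ T := by
    by_contra! hcon
    have := FreeGroup.fixed_of_all_moved hA' hAv hT hcon
    rw [this, map_one] at hv
    exact hy1 hv.symm
  obtain ⟨x, hx, hx'⟩ := hex
  obtain ⟨j, rfl⟩ := hTz x hx
  obtain ⟨j', hj'⟩ := hTz _ hx'
  simp only [hα, map_mul, map_inv, hsq, kill_up, kill_X, ← hs] at hj'
  have hj'' : s = z r ^ j' * X r (r - 1) * (z r ^ j)⁻¹ := by rw [← hj']; group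
  have hjj : j' = j := by
    have h1 := congrArg (expo r 0) hj''
    rw [hs0, map_mul, map_mul, map_inv, map_zpow, map_zpow, expo_X_ne (by omega), mul_one,
      expo_z (by omega), ← ofAdd_zsmul, ← ofAdd_zsmul, eq_comm, mul_inv_eq_one] at h1
    simpa using congrArg toAdd h1
  subst hjj
  let ν : F r →* F (r + 1) := F.lift fun i =>
    if i = r - 1 then X (r + 1) r else if i = 0 then (X (r + 1) r)⁻¹ * z (r + 1) else 1
  have νtop : ν (X r (r - 1)) = X (r + 1) r := by
    simp only [ν]; rw [F.lift_X _ (by omega), if_pos rfl]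
  have νzp : ∀ m, m + 1 < r → ν (zp r (m + 1)) = (X (r + 1) r)⁻¹ * z (r + 1) := fun m => by
    induction m with
    | zero =>
      intro hm
      rw [zp, zp, mul_one]
      simp only [ν]
      rw [F.lift_X _ (by omega), if_neg (by omega), if_pos rfl]
    | succ m ih =>
      intro hm
      rw [zp, map_mul, ih (by omega)]
      simp only [ν]
      rw [F.lift_X _ (by omega), if_neg (by omega), if_neg (by omega), one_mul]
  have νz : ν (z r) = z (r + 1) := by
    obtain ⟨q, rfl⟩ : ∃ q, r = q + 2 := ⟨r - 2, by omega⟩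
    rw [z, zp, map_mul, νzp q (by omega)]
    rw [show q + 1 = q + 2 - 1 by omega, νtop, mul_inv_cancel_left]
  have κz : kill r (τ (z (r + 1))) = z r := by
    rw [← hτ, act_z, z_succ, map_mul, kill_X, kill_up, X_eq_one le_rfl, one_mul]
  have κX : kill r (τ (X (r + 1) r)) = X r (r - 1) := by rw [e0, kill_X]
  have hup : up r (z r) = (X (r + 1) r)⁻¹ * z (r + 1) := by rw [z_succ, inv_mul_cancel_left]
  have hΞ : ν (kill r (τ (kap (up r) (X (r + 1) r) (FreeGroup.retr T v)))) =
      kap (up r) (X (r + 1) r) (FreeGroup.retr T v) := by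
    have : ((ν.comp (kill r)).comp τ.toMonoidHom).comp ((kap (up r) (X (r + 1) r)).comp
        (FreeGroup.retr T)) = (kap (up r) (X (r + 1) r)).comp (FreeGroup.retr T) :=
      FreeGroup.ext_hom _ _ fun g => by
        by_cases hg : g ∈ T
        · obtain ⟨i, rfl⟩ := hTz g hg
          simp only [MonoidHom.comp_apply, FreeGroup.retr_of _ (Finset.mem_coe.mpr hg), kap_of,
            map_zpow, map_mul, map_inv, hup, MulEquiv.coe_toMonoidHom, κz, κX, νz, νtop]
        · simp only [MonoidHom.comp_apply,
            FreeGroup.retr_of_notMem _ fun h => hg (Finset.mem_coe.mp h), map_one]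
    exact DFunLike.congr_fun this v
  rw [hT, hv, ← hs, hj'', map_mul, map_mul, map_inv, map_zpow, νz, νtop] at hΞ
  exact ⟨j', hΞ.symm⟩

theorem exists_eq_z_conj_of_equivariant (hr : 2 ≤ r) {f : F (r + 1) →* F (r + 1)}
    (hf : ∀ b w, f (act (r + 1) b w) = act (r + 1) b (f w)) {y : F (r + 1)}
    (hy : f (X (r + 1) r) = y) (ht : tot (r + 1) y = ofAdd 1) :
    ∃ j : ℤ, y = z (r + 1) ^ j * X (r + 1) r * (z (r + 1) ^ j)⁻¹ := by
  have hfix : ∀ b, act (r + 1) b (X (r + 1) r) = X (r + 1) r → act (r + 1) b y = y :=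
    fun b hb => by rw [← hy, ← hf, hb]
  have hZ := hfix _ (act_incl (Z r)).2
  have hexp : ∀ i, i + 1 < r → expo (r + 1) i y = expo (r + 1) (i + 1) y := fun i hi => by
    have h1 := expo_act (Br.σ (r + 1) i) (j := i) (by omega) y
    rw [hfix _ (act_σ_of_ne (by omega) (by omega) (by omega)), Br.perm_σ (by omega),
      Equiv.swap_apply_left] at h1
    exact h1.symm
  rw [tot_of_expo hexp] at ht
  have hkz : act r (Z r) (kill r y) = kill r y := by rw [← kill_act_incl, hZ]
  rw [act_Z, mul_assoc, inv_mul_eq_iff_eq_mul] at hkz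
  obtain ⟨d, hd⟩ := commute_z one_ne_zero (show Commute (kill r y) (z r ^ (1 : ℤ)) by
    rw [zpow_one]; exact hkz)
  have hed : expo (r + 1) 0 y = ofAdd d := by
    rw [← expo_kill (by omega), hd, map_zpow, expo_z (by omega), ← ofAdd_zsmul]; simp
  have e0 : act (r + 1) (Br.σ (r + 1) (r - 1)) (X (r + 1) r) = X (r + 1) (r - 1) := by
    obtain ⟨r, rfl⟩ : ∃ s, r = s + 1 := ⟨r - 1, by omega⟩
    exact act_σ_succ (by omega)
  have e1 : act (r + 1) (Br.σ (r + 1) (r - 1)) (X (r + 1) (r - 1)) =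
      (X (r + 1) (r - 1))⁻¹ * X (r + 1) r * X (r + 1) (r - 1) := by
    obtain ⟨r, rfl⟩ : ∃ s, r = s + 1 := ⟨r - 1, by omega⟩
    exact act_σ_self (by omega)
  obtain ⟨s, hs⟩ : ∃ s, s = kill r (act (r + 1) (Br.σ (r + 1) (r - 1)) y) := ⟨_, rfl⟩
  have hb : y * act (r + 1) (Br.σ (r + 1) (r - 1)) y = act (r + 1) (Br.σ (r + 1) (r - 1)) y *
      act (r + 1) (Br.σ (r + 1) (r - 1)) (act (r + 1) (Br.σ (r + 1) (r - 1)) y) := by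
    rw [← hy, ← hf, ← hf, e0, e1, ← map_mul, ← map_mul]
    congr 1; group
  have hs0 : expo r 0 s = ofAdd d := by
    have h1 := expo_act (Br.σ (r + 1) (r - 1)) (j := 0) (by omega) y
    rcases eq_or_ne r 1 with h | h
    · omega
    rw [Br.perm_σ (by omega), Equiv.swap_apply_of_ne_of_ne (by omega) (by omega)] at h1
    rw [hs, expo_kill (by omega), h1, hed]
  have hs1 : expo r (r - 1) s = expo (r + 1) r y := by
    have h1 := expo_act (Br.σ (r + 1) (r - 1)) (j := r) (by omega) y
    rw [Br.perm_σ (by omega), show r - 1 + 1 = r by omega, Equiv.swap_apply_right] at h1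
    rw [hs, expo_kill (by omega), h1]
  have hcs : Commute s (kill r y) := by
    have h1 := congrArg (kill r) hb
    rw [map_mul, map_mul, kill_act_σ_sq (by omega), ← hs] at h1
    exact h1.symm
  have hd0 : d = 0 := by
    by_contra hne
    rw [hd] at hcs
    obtain ⟨c, rfl⟩ := commute_z hne hcs
    rw [map_zpow, expo_z (by omega)] at hs0 hs1
    rw [← hs1, hs0, hed] at ht
    have h1 := congrArg toAdd ht
    simp only [toAdd_mul, toAdd_pow, toAdd_ofAdd, nsmul_eq_mul] at h1
    have h2 : ((r : ℤ) + 1) ∣ 1 := ⟨d, by linarith⟩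
    have := Int.le_of_dvd one_pos h2
    omega
  subst hd0
  refine exists_eq_z_conj hr ?_ hZ (by rw [hd, zpow_zero]) hs (by rw [hs0, ofAdd_zero])
    (by rw [← hb, mul_inv_cancel_right])
  rintro rfl
  rw [map_one] at ht
  exact absurd (congrArg toAdd ht) (by simp)

theorem twist_trivial (hr : 2 ≤ r) {f : F (r + 1) →* F (r + 1)} {a : ℤ}
    (hf : ∀ b w, f (act (r + 1) b w) = z (r + 1) ^ (a * toAdd (Br.len (r + 1) b)) *
      act (r + 1) b (f w) * (z (r + 1) ^ (a * toAdd (Br.len (r + 1) b)))⁻¹)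
    (hz : f (z (r + 1)) = z (r + 1) ^ (1 - a * ((r + 1) * r))) :
    a = 0 ∧ tot (r + 1) (f (X (r + 1) r)) = ofAdd 1 := by
  have htot : ∀ j < r + 1, tot (r + 1) (f (X (r + 1) j)) = tot (r + 1) (f (X (r + 1) r)) := by
    refine down_induction (k := r + 1)
      (p := fun j => tot (r + 1) (f (X (r + 1) j)) = tot (r + 1) (f (X (r + 1) r))) rfl ?_
    intro i hi h
    rw [← h, ← act_σ_succ hi, hf, map_mul, map_mul, map_inv, mul_right_comm, mul_inv_cancel,
      one_mul, tot_act]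
  have hm : toAdd (tot (r + 1) (f (X (r + 1) r))) = 1 - a * ((r + 1) * r) := by
    have h1 := map_z (f := (tot (r + 1)).comp f) (c := tot (r + 1) (f (X (r + 1) r))) htot
    rw [MonoidHom.comp_apply, hz, map_zpow, map_z fun j hj => tot_X hj] at h1
    have h2 := congrArg toAdd h1
    simp only [toAdd_zpow, toAdd_pow, toAdd_ofAdd, nsmul_eq_mul, smul_eq_mul] at h2
    push_cast at h2
    have : ((r : ℤ) + 1) ≠ 0 := by omega
    exact mul_left_cancel₀ this (by linarith)
  have ha : a = 0 := by
    by_contra hne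
    obtain ⟨y, hy⟩ : ∃ y, y = f (X (r + 1) r) := ⟨_, rfl⟩
    rw [← hy] at hm
    have hfix : ∀ b, act (r + 1) b (X (r + 1) r) = X (r + 1) r →
        y = z (r + 1) ^ (a * toAdd (Br.len (r + 1) b)) * act (r + 1) b y *
          (z (r + 1) ^ (a * toAdd (Br.len (r + 1) b)))⁻¹ := fun b hb => by
      rw [hy, ← hf, hb]
    have hexp : ∀ i, i + 1 < r → expo (r + 1) i y = expo (r + 1) (i + 1) y := fun i hi => by
      have h1 := expo_act (Br.σ (r + 1) i) (j := i) (by omega) y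
      have h2 := congrArg (expo (r + 1) (i + 1))
        (hfix (Br.σ (r + 1) i) (act_σ_of_ne (by omega) (by omega) (by omega)))
      rw [map_mul, map_mul, map_inv, mul_right_comm, mul_inv_cancel, one_mul] at h2
      rw [Br.perm_σ (by omega), Equiv.swap_apply_left] at h1
      rw [h2, h1]
    have hσ : act (r + 1) (Br.σ (r + 1) 0) (X (r + 1) r) = X (r + 1) r :=
      act_σ_of_ne (by omega) (by omega) (by omega)
    have h3 := expo_eq_of_twist hr (a := a * 2) (by omega) (y := y) (by
      have := hfix (Br.σ (r + 1) 0 ^ 2) (by rw [pow_two, map_mul, MulAut.mul_apply, hσ, hσ])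
      rw [map_pow, Br.len_σ (by omega), toAdd_pow, toAdd_ofAdd] at this
      simpa using this)
    rw [tot_of_expo hexp, ← h3] at hm
    simp only [toAdd_mul, toAdd_pow, nsmul_eq_mul] at hm
    have h2 : ((r : ℤ) + 1) ∣ 1 := ⟨toAdd (expo (r + 1) 0 y) + a * r, by linarith⟩
    have := Int.le_of_dvd one_pos h2
    omega
  refine ⟨ha, toAdd.injective ?_⟩
  rw [hm, ha]; simp

theorem A.exists_conj_of_pr (hk : 3 ≤ k) {φ : A k →* A k} (h : ∀ a, pr k (φ a) = pr k a)
    (hp : piA k (φ (bA k (Z k))) = 1) : ∃ c, ∀ a, φ a = c * a * c⁻¹ := by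
  obtain ⟨r, rfl⟩ : ∃ r, k = r + 1 := ⟨k - 1, by omega⟩
  obtain ⟨u, a, hu⟩ := A.exists_twist hk (φ.comp (bA (r + 1)))
    (fun b => by rw [MonoidHom.comp_apply, h, pr_bA]) hp
  obtain ⟨φ', hφ'⟩ : ∃ φ' : A (r + 1) →* A (r + 1),
      ∀ x, φ' x = (xA (r + 1) u)⁻¹ * φ x * xA (r + 1) u :=
    ⟨(MulAut.conj (xA (r + 1) u)⁻¹).toMonoidHom.comp φ, fun b => by simp⟩
  have hβ : ∀ b, φ' (bA (r + 1) b) =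
      bA (r + 1) b * xA (r + 1) (z (r + 1) ^ (a * toAdd (Br.len (r + 1) b))) := fun b => by
    have := hu b
    rw [MonoidHom.comp_apply] at this
    rw [hφ', this]; group
  have hinj : Function.Injective (xA (r + 1)) := xA_injective (by omega)
  obtain ⟨f, hf⟩ := exists_lift_xA (k := r + 1) (by omega) (f := φ'.comp (xA (r + 1))) fun w => by
    rw [MonoidHom.comp_apply, hφ', map_mul, map_mul, map_inv, h, pr_xA, pr_xA]; simp
  replace hf : ∀ w, φ' (xA (r + 1) w) = xA (r + 1) (f w) := fun w => (hf w).symm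
  have hact : ∀ b w, f (act (r + 1) b w) = z (r + 1) ^ (a * toAdd (Br.len (r + 1) b)) *
      act (r + 1) b (f w) * (z (r + 1) ^ (a * toAdd (Br.len (r + 1) b)))⁻¹ := fun b w => hinj (by
    rw [← hf, xA_act, map_mul, map_mul, map_inv, hf, hβ, map_mul, map_mul, map_inv, xA_act,
      (commute_bA_xA_z b _).eq]; group)
  have hz : f (z (r + 1)) = z (r + 1) ^ (1 - a * ((r + 1) * r)) := hinj (by
    have h1 := congrArg φ' (bA_Z (r + 1))
    rw [hβ, map_inv, hf, bA_Z, Br.len_Z (by omega), toAdd_ofAdd, map_zpow, eq_comm,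
      inv_eq_iff_eq_inv] at h1
    rw [h1, map_zpow, mul_inv_rev, inv_inv, ← zpow_neg, ← zpow_add_one]
    congr 1; push_cast; ring)
  obtain ⟨rfl, ht⟩ := twist_trivial (by omega) hact hz
  obtain ⟨j, hj⟩ := exists_eq_z_conj_of_equivariant (by omega) (f := f)
    (fun b w => by simpa using hact b w) rfl ht
  have hfin : φ' = (MulAut.conj (xA (r + 1) (z (r + 1) ^ j))).toMonoidHom := A.hom_ext
    (fun i hi => by
      rw [hβ]
      simp only [zero_mul, zpow_zero, map_one, mul_one, MulEquiv.coe_toMonoidHom,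
        MulAut.conj_apply, ← (commute_bA_xA_z _ j).eq, mul_inv_cancel_right])
    (fun _ => by
      rw [Nat.add_sub_cancel, hf, hj, MulEquiv.coe_toMonoidHom, MulAut.conj_apply, map_mul,
        map_mul, map_inv])
  refine ⟨xA (r + 1) u * xA (r + 1) (z (r + 1) ^ j), fun x => ?_⟩
  have h1 := DFunLike.congr_fun hfin x
  rw [hφ', MulEquiv.coe_toMonoidHom, MulAut.conj_apply] at h1
  have h2 : φ x = xA (r + 1) u * ((xA (r + 1) u)⁻¹ * φ x * xA (r + 1) u) *
      (xA (r + 1) u)⁻¹ := by group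
  rw [h2, h1]
  group

end BraidB

namespace BraidB

variable {k : ℕ}

/-- An endomorphism of `M k` that preserves the permutation of the strands. -/
def OverM (k : ℕ) (e : M k →* M k) : Prop := ∀ m, permM k (e m) = permM k m

theorem OverM.over {e : M k →* M k} (h : OverM k e) : Over k (e.comp (mq k)) := fun b => by
  rw [MonoidHom.comp_apply, h, permM_mq]

theorem OverM.conj {e : M k →* M k} (h : OverM k e) {g : M k} (hg : permM k g = 1) :
    OverM k ((MulAut.conj g).toMonoidHom.comp e) := fun m => by
  rw [MonoidHom.comp_apply, MulEquiv.coe_toMonoidHom, MulAut.conj_apply, map_mul, map_mul, map_inv,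
    hg, h]
  simp

theorem OverM.exists_down (hk : 0 < k) {e : M (k + 1) →* M (k + 1)} (he : OverM (k + 1) e)
    (hg : Good k (e.comp (mq (k + 1)))) : ∃ (φ : A k →* A k) (e' : M k →* M k),
      (∀ a, aM k (φ a) = e (aM k a)) ∧ (∀ a, pr k (φ a) = e' (pr k a)) ∧ OverM k e' ∧
        Down k (e.comp (mq (k + 1))) (e'.comp (mq k)) := by
  obtain ⟨φ, hφ⟩ := exists_restrict hk (f := e.comp (aM k)) fun a => by
    rw [MonoidHom.comp_apply, he, permM_aM, permM_apply_of_le _ le_rfl]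
  replace hφ : ∀ a, aM k (φ a) = e (aM k a) := hφ
  have hx : ∀ w, pr k (φ (xA k w)) = 1 := fun w => by
    have h := hg w
    rw [MonoidHom.comp_apply, ← aM_aq, aq_xE, ← hφ] at h
    exact Forget.unique hk ⟨_, rfl, rfl⟩ h
  have hZ : pr k (φ (bA k (Z k))) = 1 := by
    rw [bA_Z, map_inv, map_inv, hx, inv_one]
  obtain ⟨e', he'⟩ : ∃ e' : M k →* M k, ∀ b, e' (mq k b) = pr k (φ (bA k b)) :=
    ⟨M.lift ((pr k).comp (φ.comp (bA k))) hZ, fun b => M.lift_mq _ _ b⟩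
  have hpr : ∀ a, pr k (φ a) = e' (pr k a) := fun a => by
    obtain ⟨w, b, rfl⟩ := A.exists_mul a
    rw [map_mul, map_mul, hx, one_mul, map_mul, pr_xA, one_mul, pr_bA, he']
  have hd : Down k (e.comp (mq (k + 1))) (e'.comp (mq k)) := fun b => by
    rw [MonoidHom.comp_apply, MonoidHom.comp_apply, ← aM_bA, ← hφ, he']
    exact ⟨_, rfl, rfl⟩
  refine ⟨φ, e', hφ, hpr, fun m => ?_, hd⟩
  obtain ⟨b, rfl⟩ := mq_surjective k m
  have := he.over.down hd b
  rwa [MonoidHom.comp_apply, ← permM_mq] at this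

/-- Conjugation by the last generator maps the kernel of forgetting the last strand to the elements
that become trivial when the last strand but one is forgotten. -/
theorem exists_conj_swap (w : F (k + 1)) : ∃ a : A (k + 1),
    aM (k + 1) a = mq (k + 2) (Br.σ (k + 2) k) * aM (k + 1) (xA (k + 1) w) *
      (mq (k + 2) (Br.σ (k + 2) k))⁻¹ ∧ Forget k (piA (k + 1) a) 1 := by
  refine F.induction w ?_ ?_ ?_ ?_
  · exact ⟨1, by simp, by simpa using Forget.one⟩
  · rintro u v ⟨a, ha, ha'⟩ ⟨b, hb, hb'⟩
    refine ⟨a * b, ?_, by simpa using ha'.mul hb'⟩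
    rw [map_mul, ha, hb, map_mul, map_mul]
    group
  · rintro u ⟨a, ha, ha'⟩
    refine ⟨a⁻¹, ?_, by simpa using ha'.inv⟩
    rw [map_inv, ha, map_inv, map_inv]
    group
  · intro j hj
    rcases Nat.lt_succ_iff_lt_or_eq.mp hj with hj | rfl
    · refine ⟨bA (k + 1) (iota k (xE k (X k j))), ?_, ?_⟩
      · rw [aM_bA, ← aq_xE, aM_aq, iota_X_swap j hj]
        simp [mul_assoc]
      · rw [piA_bA]
        exact Forget.iota_xE _
    · refine ⟨xA (j + 1) (X (j + 1) j), ?_, ?_⟩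
      · have : aM (j + 1) (xA (j + 1) (X (j + 1) j)) = mq (j + 2) (Br.σ (j + 2) j) ^ 2 :=
          aM_top (Nat.succ_pos j)
        rw [this]
        group
      · have : piA (j + 1) (xA (j + 1) (X (j + 1) j)) =
          mq (j + 1) (Br.incl (Nat.le_succ j) (Z j)) := piA_top (Nat.succ_pos j)
        rw [this]
        have h := Forget.incl (Z j)
        rwa [mq_Z] at h

theorem good_piA (hk : 0 < k) {φ : A (k + 1) →* A (k + 1)} {e : M (k + 2) →* M (k + 2)}
    (hφ : ∀ a, aM (k + 1) (φ a) = e (aM (k + 1) a)) (he : OverM (k + 2) e)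
    (hpr : ∀ a, pr (k + 1) (φ a) = pr (k + 1) a)
    (hH : Over (k + 1) ((piA (k + 1)).comp (φ.comp (bA (k + 1))))) :
    Good k ((piA (k + 1)).comp (φ.comp (bA (k + 1)))) := by
  obtain ⟨H', hd⟩ := hH.exists_down hk
  refine hd.good_of_top hk ?_
  obtain ⟨s, hs⟩ : ∃ s, s = mq (k + 2) (Br.σ (k + 2) k) := ⟨_, rfl⟩
  have h1 : aM (k + 1) (bA (k + 1) (Br.σ (k + 1) (k - 1) ^ 2)) =
      s * aM (k + 1) (xA (k + 1) (X (k + 1) (k - 1))) * s⁻¹ := by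
    rw [← iota_top hk, aM_bA, ← aq_xE, aM_aq, iota_X_swap _ (by omega), hs]
    simp [mul_assoc]
  obtain ⟨p, hp⟩ : ∃ p, aM (k + 1) p = s⁻¹ * e s := exists_aM (by
    rw [map_mul, map_inv, he, inv_mul_cancel]; rfl)
  obtain ⟨v, hv⟩ := exists_xA (a := p * φ (xA (k + 1) (X (k + 1) (k - 1))) * p⁻¹) (by
    rw [map_mul, map_mul, hpr, pr_xA, map_inv]; simp)
  obtain ⟨a, ha, ha'⟩ := exists_conj_swap v
  have h2 : φ (bA (k + 1) (Br.σ (k + 1) (k - 1) ^ 2)) = a := aM_injective (by omega) (by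
    rw [hφ, h1, ha, ← hv, map_mul, map_mul, map_mul, map_mul, map_inv, map_inv, ← hφ, ← hs, hp]
    group)
  rw [MonoidHom.comp_apply, MonoidHom.comp_apply, h2]
  exact ha'

theorem eq_conj_of_eq_conj_aM (hk : 2 ≤ k) {e : M (k + 1) →* M (k + 1)} (he : OverM (k + 1) e)
    {g : M (k + 1)} (hg : permM (k + 1) g = 1) (h : ∀ a, e (aM k a) = g * aM k a * g⁻¹) (m) :
    e m = g * m * g⁻¹ := by
  obtain ⟨f, hf⟩ : ∃ f : M (k + 1) →* M (k + 1), ∀ m, f m = g⁻¹ * e m * g :=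
    ⟨(MulAut.conj g⁻¹).toMonoidHom.comp e, fun m => by simp⟩
  have hfa : ∀ a, f (aM k a) = aM k a := fun a => by rw [hf, h]; group
  have hfp : ∀ m, permM (k + 1) (f m) = permM (k + 1) m := fun m => by
    rw [hf, map_mul, map_mul, map_inv, hg, he]; simp
  obtain ⟨t, ht⟩ : ∃ t, t = mq (k + 1) (Br.σ (k + 1) (k - 1)) := ⟨_, rfl⟩
  obtain ⟨a, ha⟩ : ∃ a, aM k a = t⁻¹ * f t := exists_aM (by
    rw [map_mul, map_inv, hfp, inv_mul_cancel]; rfl)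
  have ha1 : a = 1 := A.eq_one_of_commute (fun w => by
    obtain ⟨b, hb⟩ : ∃ b, aM k b = t * aM k (xA k w) * t⁻¹ := exists_aM (by
      rw [map_mul, map_mul, permM_aM, pr_xA, map_one, map_inv]; simp)
    have h1 := hfa b
    rw [hb, map_mul, map_mul, map_inv, hfa] at h1
    refine aM_injective (by omega : 0 < k) ?_
    rw [mul_inv_eq_iff_eq_mul] at h1
    rw [map_mul, map_mul, ha, mul_assoc, h1]
    group) (xA_injective hk)
  have hft : f t = t := by
    rw [ha1, map_one, eq_comm, inv_mul_eq_one] at ha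
    exact ha.symm
  have hid : f = MonoidHom.id _ := M.hom_ext fun i hi => by
    rcases Nat.lt_or_ge (i + 1) k with h | h
    · rw [← Br.incl_σ (Nat.le_succ k) h, ← aM_bA, hfa, MonoidHom.id_apply]
    · obtain rfl : i = k - 1 := by omega
      rw [← ht, hft, MonoidHom.id_apply]
  have := DFunLike.congr_fun hid m
  rw [hf, MonoidHom.id_apply] at this
  conv_rhs => rw [← this]
  group

theorem exists_conj_succ_of_pr (hk : 3 ≤ k) {φ : A k →* A k} {e : M (k + 1) →* M (k + 1)}
    (hφ : ∀ a, aM k (φ a) = e (aM k a)) (he : OverM (k + 1) e) (hpr : ∀ a, pr k (φ a) = pr k a) :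
    ∃ c, permM (k + 1) c = 1 ∧ ∀ m, e m = c * m * c⁻¹ := by
  have hH : Over k ((piA k).comp (φ.comp (bA k))) := fun b => by
    rw [MonoidHom.comp_apply, MonoidHom.comp_apply, permM_piA, hpr, pr_bA, permM_mq]
  have hc : ∀ b, Commute (piA k (φ (bA k (Z k)))) ((piA k).comp (φ.comp (bA k)) b) := fun b =>
    ((Z_comm k b).symm.map (φ.comp (bA k))).map (piA k)
  have hp : piA k (φ (bA k (Z k))) = 1 := by
    rcases Nat.lt_or_ge k 5 with h5 | h5
    · rcases (show k = 3 ∨ k = 4 by omega) with rfl | rfl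
      · exact eq_one_of_commute_three hH hc
      · exact Good.centralizer_four hH (good_piA (by omega) hφ he hpr hH) hc
    · exact hH.centralizer h5 hc
  obtain ⟨c, hc⟩ := A.exists_conj_of_pr hk hpr hp
  have hc1 : permM (k + 1) (aM k c) = 1 := by
    rw [permM_aM]
    refine permM_eq_one_of_commute hk (h := mq k) (permM_mq (k := k)) fun b => ?_
    have h := hpr (bA k b)
    rw [hc, map_mul, map_mul, map_inv, pr_bA, mul_inv_eq_iff_eq_mul] at h
    exact h
  exact ⟨_, hc1, eq_conj_of_eq_conj_aM (by omega) he hc1 fun a => by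
    rw [← hφ, hc, map_mul, map_mul, map_inv]⟩

/-- If the endomorphism induced on `M k` is inner, so is the endomorphism of `M (k + 1)`. -/
theorem exists_conj_succ (hk : 3 ≤ k) {φ : A k →* A k} {e : M (k + 1) →* M (k + 1)}
    (hφ : ∀ a, aM k (φ a) = e (aM k a)) (he : OverM (k + 1) e) {g : M k}
    (hpr : ∀ a, pr k (φ a) = g * pr k a * g⁻¹) :
    ∃ c, permM (k + 1) c = 1 ∧ ∀ m, e m = c * m * c⁻¹ := by
  have hpg : permM k g = 1 := by
    refine perm_eq_one_of_commute hk (fun j hj => permM_apply_of_le g hj) fun i hi => ?_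
    have h1 := hpr (bA k (Br.σ k i))
    rw [pr_bA] at h1
    have h2 := congrArg (permM k) h1
    rw [← permM_aM, hφ, he, permM_aM, pr_bA, map_mul, map_mul, map_inv, permM_mq, Br.perm_σ hi,
      eq_mul_inv_iff_mul_eq] at h2
    exact h2.symm
  obtain ⟨b, rfl⟩ := mq_surjective k g
  have hpb : permM (k + 1) (aM k (bA k b)) = 1 := by rwa [permM_aM, pr_bA]
  obtain ⟨φ', hφ'⟩ : ∃ φ' : A k →* A k, ∀ a, φ' a = (bA k b)⁻¹ * φ a * bA k b :=
    ⟨(MulAut.conj (bA k b)⁻¹).toMonoidHom.comp φ, fun m => by simp⟩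
  obtain ⟨c, hc1, hc⟩ := exists_conj_succ_of_pr hk (φ := φ')
    (e := (MulAut.conj (aM k (bA k b))⁻¹).toMonoidHom.comp e) (fun a => by simp [hφ', hφ])
    (he.conj (by rw [map_inv, hpb, inv_one])) fun a => by
      rw [hφ', map_mul, map_mul, map_inv, hpr, pr_bA]; group
  refine ⟨aM k (bA k b) * c, by rw [map_mul, hpb, hc1, one_mul], fun m => ?_⟩
  have h := hc m
  rw [MonoidHom.comp_apply, MulEquiv.coe_toMonoidHom, MulAut.conj_apply] at h
  have h2 : e m = aM k (bA k b) * ((aM k (bA k b))⁻¹ * e m * (aM k (bA k b))⁻¹⁻¹) *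
      (aM k (bA k b))⁻¹ := by group
  rw [h2, h]
  group

end BraidB

namespace BraidB

open Multiplicative

variable {k r : ℕ}

theorem Br.len_iota_xE (w : F k) : Br.len (k + 1) (iota k (xE k w)) = tot k w ^ 2 := by
  refine F.induction w ?_ ?_ ?_ ?_
  · simp
  · intro u v hu hv
    rw [map_mul, map_mul, map_mul, hu, hv, map_mul, mul_pow]
  · intro u hu
    rw [map_inv, map_inv, map_inv, hu, map_inv, inv_pow]
  · refine down_induction (k := k)
      (p := fun j => Br.len (k + 1) (iota k (xE k (X k j))) = tot k (X k j) ^ 2) ?_ ?_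
    · rcases Nat.eq_zero_or_pos k with rfl | hk
      · rw [X_eq_one (by omega)]; simp
      · rw [iota_top hk, map_pow, Br.len_σ (by omega), tot_X (by omega)]
    · intro j hj h
      rw [E.bE_conj_X hj, map_mul, map_mul, map_mul, map_mul, map_inv, map_inv, mul_right_comm,
        mul_inv_cancel, one_mul, h, tot_X (by omega), tot_X (by omega)]

theorem Z_two : Z 2 = Br.σ 2 0 ^ 2 := by
  simp [Z, rho]

/-- The annular braid whose image is the conjugate of `z` by the last generator. -/
noncomputable def swapA (m : ℕ) : A (m + 2) :=
  bA (m + 2) (iota (m + 1) (xE (m + 1) (z (m + 1)))) * xA (m + 2) (X (m + 2) (m + 1))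

theorem aM_swapA (m : ℕ) : aM (m + 2) (swapA m) =
    (mq (m + 3) (Br.σ (m + 3) (m + 1)))⁻¹ * aM (m + 2) (xA (m + 2) (z (m + 2))) *
      mq (m + 3) (Br.σ (m + 3) (m + 1)) := by
  have ht : aM (m + 2) (xA (m + 2) (X (m + 2) (m + 1))) =
      mq (m + 3) (Br.σ (m + 3) (m + 1)) ^ 2 := aM_top (Nat.succ_pos _)
  rw [swapA, map_mul, ht, aM_bA, ← aq_xE, aM_aq, iota_z_swap, map_mul, map_mul, pow_two]
  simp only [mul_assoc, inv_mul_cancel_left]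

theorem exists_aM_swap (m : ℕ) : ∃ a : A (m + 2),
    aM (m + 2) a = (mq (m + 3) (Br.σ (m + 3) (m + 1)))⁻¹ * aM (m + 2) (xA (m + 2) (z (m + 2))) *
      mq (m + 3) (Br.σ (m + 3) (m + 1)) ∧
    pr (m + 2) a = (mq (m + 2) (Br.incl (Nat.le_succ _) (Z (m + 1))))⁻¹ := by
  refine ⟨swapA m, aM_swapA m, ?_⟩
  · rw [swapA]
    have h := mq_Z (m + 2)
    rw [← iota_zZ (Nat.succ_pos m), zZ, map_mul, iota_bE, map_mul] at h
    rw [map_mul, pr_bA, pr_xA, mul_one]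
    exact eq_inv_of_mul_eq_one_left h

theorem piA_xA_up (w : F (r + 1)) : piA (r + 1) (xA (r + 1) (up r (qz r w))) =
    piA (r + 1) (xA (r + 1) w) := by
  refine F.induction w ?_ ?_ ?_ ?_
  · simp
  · intro u v hu hv
    simp only [map_mul, hu, hv]
  · intro u hu
    simp only [map_inv, hu]
  · intro j hj
    rcases Nat.lt_succ_iff_lt_or_eq.mp hj with hj | rfl
    · rw [qz_X hj, up_X hj]
    · have h := piA_z (j + 1)
      rw [z_succ, map_mul, map_mul] at h
      rw [qz_top, map_inv, map_inv, map_inv]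
      exact (eq_inv_of_mul_eq_one_left h).symm

theorem exists_piA_xA_sq : ∃ w, piA 3 (xA 3 w) = mq 3 (Br.σ 3 1 ^ 2) := by
  have h0 : piA 3 (xA 3 (X 3 2)) = mq 3 (Br.σ 3 0 ^ 2) := by
    have : piA 3 (xA 3 (X 3 2)) = mq 3 (Br.incl (Nat.le_succ 2) (Z 2)) := piA_top (by omega)
    rw [this, Z_two, map_pow, Br.incl_σ _ (by omega)]
  refine ⟨act 3 (Br.σ 3 0 * Br.σ 3 1) (X 3 2), ?_⟩
  rw [xA_act, map_mul, map_mul, h0, map_inv, piA_bA, ← map_mul, ← map_inv, ← map_mul]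
  congr 1
  have e := (Br.isBraid_σ 3).braid 0 (by omega)
  rw [zero_add] at e
  rw [mul_inv_eq_iff_eq_mul]
  obtain ⟨a, ha⟩ : ∃ a, a = Br.σ 3 0 := ⟨_, rfl⟩
  obtain ⟨b, hb⟩ : ∃ b, b = Br.σ 3 1 := ⟨_, rfl⟩
  rw [← ha, ← hb] at e ⊢
  calc a * b * a ^ 2 = (a * b * a) * a := by rw [pow_two]; group
    _ = b * (a * b * a) := by rw [e]; simp only [mul_assoc, e]
    _ = b ^ 2 * (a * b) := by rw [e, pow_two]; group

theorem exists_piA_xA {m : M 3} (h : permM 3 m = 1) : ∃ w, piA 3 (xA 3 w) = m := by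
  obtain ⟨v, rfl⟩ := M.exists_pure_three h
  obtain ⟨y, hy⟩ := exists_piA_xA_sq
  refine F.induction v ?_ ?_ ?_ ?_
  · exact ⟨1, by simp⟩
  · rintro u v ⟨x, hx⟩ ⟨y, hy⟩
    exact ⟨x * y, by simp [hx, hy]⟩
  · rintro u ⟨x, hx⟩
    exact ⟨x⁻¹, by simp [hx]⟩
  · refine down_induction (k := 2) (p := fun j => ∃ w, piA 3 (xA 3 w) = aM 2 (xA 2 (X 2 j))) ?_ ?_
    · exact ⟨y, by rw [hy, aM_top (by omega), map_pow]⟩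
    · rintro j hj ⟨x, hx⟩
      refine ⟨act 3 (Br.σ 3 j) x, ?_⟩
      rw [← aq_xE (k := 2), E.bE_conj_X hj, map_mul, map_mul, map_inv, map_mul, map_mul, map_inv, aq_xE,
        aq_bE, aM_bA, Br.incl_σ _ hj, xA_act, map_mul, map_mul, hx, piA_bA, map_inv, piA_bA]

theorem conj_qz_eq {w : F (r + 1)} {g : F r} :
    qz r (act (r + 1) (prI (r + 1) (xE (r + 1) w)) (up r g)) = qz r w * g * (qz r w)⁻¹ := by
  rw [qz_act_prI, full_apply]
  simp only [SemidirectProduct.left_inl, xE, SemidirectProduct.right_inl, map_one,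
    MulAut.one_apply, map_mul, (isKer_qz r).q_s, map_inv]

theorem eq_one_of_fixed {e : M 3 →* M 3} (he : OverM 3 e) {g : F 2}
    (h : ∀ b : Br 3, ∃ m > 0, ∀ b', mq 3 b' = e (mq 3 b) ^ m → qz 2 (act 3 b' (up 2 g)) = g) :
    g = 1 := by
  by_contra hg
  have hc : ∀ b : Br 3, Br.perm 3 b = 1 →
      ∃ w, piA 3 (xA 3 w) = e (mq 3 b) ∧ Commute g (qz 2 w) := fun b hb => by
    obtain ⟨w, hw⟩ := exists_piA_xA (m := e (mq 3 b)) (by rw [he, permM_mq, hb])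
    obtain ⟨m, hm, h1⟩ := h b
    have h2 := h1 (prI 3 (xE 3 (w ^ m))) (by rw [← piA_aq, aq_xE, map_pow, map_pow, hw])
    rw [conj_qz_eq, map_pow, mul_inv_eq_iff_eq_mul] at h2
    refine ⟨w, hw, (commute_of_zpow (m := m) (by omega) ?_).symm⟩
    rw [zpow_natCast]
    exact h2
  have hs : ∀ i, i + 1 < 3 → Br.perm 3 (Br.σ 3 i ^ 2) = 1 := fun i hi => by
    rw [map_pow, Br.perm_σ hi, pow_two, Equiv.swap_mul_self]
  obtain ⟨w0, h0, hc0⟩ := hc _ (hs 0 (by omega))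
  obtain ⟨w1, h1, hc1⟩ := hc _ (hs 1 (by omega))
  refine not_commute_sq he.over ?_
  rw [MonoidHom.comp_apply, MonoidHom.comp_apply, ← h0, ← h1, ← piA_xA_up w0, ← piA_xA_up w1]
  exact (((FreeGroup.commute_trans hg hc0 hc1).map (up 2)).map (xA 3)).map (piA 3)

theorem apply_bA_Z_ne_one {φ : A 3 →* A 3} {e : M 3 →* M 3} (hpr : ∀ a, pr 3 (φ a) = e (pr 3 a))
    (he : OverM 3 e) : φ (bA 3 (Z 3)) ≠ 1 := by
  intro h
  have h1 := Br.hom_eq_len (f := (chi 3).comp (φ.comp (bA 3))) (Z 3)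
  rw [MonoidHom.comp_apply, MonoidHom.comp_apply, h, map_one, Br.len_Z (by omega), toAdd_ofAdd]
    at h1
  obtain ⟨w, hw⟩ := M.exists_pure_three (m := e (mq 3 (Br.σ 3 0)) * (mq 3 (Br.σ 3 0))⁻¹) (by
    rw [map_mul, he, map_inv, mul_inv_cancel])
  rw [mul_inv_eq_iff_eq_mul, ← aq_xE, aM_aq, ← map_mul, ← pr_bA, ← hpr] at hw
  obtain ⟨v, hv⟩ := exists_bA_mul_xA hw
  rw [MonoidHom.comp_apply, MonoidHom.comp_apply, hv, map_mul, chi_bA, chi_xA, map_mul,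
    Br.len_iota_xE, Br.len_σ (by omega)] at h1
  have h2 := congrArg toAdd h1
  simp only [toAdd_one, toAdd_zpow, toAdd_mul, toAdd_pow, toAdd_ofAdd, smul_eq_mul] at h2
  push_cast at h2
  simp at h2
  omega

end BraidB

namespace BraidB

variable {k : ℕ}

/-- The endomorphism `e` is inner up to the mirror automorphism. -/
def Std (k : ℕ) (e : M k →* M k) : Prop :=
  ∃ g, (∀ m, e m = g * m * g⁻¹) ∨ ∀ m, e m = g * mirM k m * g⁻¹

theorem mirM_mirM (m : M k) : mirM k (mirM k m) = m := by
  obtain ⟨b, rfl⟩ := mq_surjective k m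
  rw [mirM_mq, mirM_mq, mirBr_mirBr]

theorem Std.succ (hk : 3 ≤ k) {φ : A k →* A k} {e : M (k + 1) →* M (k + 1)} {e' : M k →* M k}
    (hφ : ∀ a, aM k (φ a) = e (aM k a)) (he : OverM (k + 1) e)
    (hpr : ∀ a, pr k (φ a) = e' (pr k a)) (h : Std k e') : Std (k + 1) e := by
  obtain ⟨g, h | h⟩ := h
  · obtain ⟨c, -, hc⟩ := exists_conj_succ hk hφ he (g := g) fun a => by rw [hpr, h]
    exact ⟨c, .inl hc⟩
  · obtain ⟨c, -, hc⟩ := exists_conj_succ hk (φ := (mirA k).comp φ)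
      (e := (mirM (k + 1)).comp e) (g := mirM k g)
      (fun a => by rw [MonoidHom.comp_apply, aM_mirA, hφ, MonoidHom.comp_apply])
      (fun m => by rw [MonoidHom.comp_apply, permM_mirM, he])
      (fun a => by rw [MonoidHom.comp_apply, pr_mirA, hpr, h, map_mul, map_mul, map_inv, mirM_mirM])
    refine ⟨mirM (k + 1) c, .inr fun m => ?_⟩
    rw [← map_inv, ← map_mul, ← map_mul, ← hc, MonoidHom.comp_apply, mirM_mirM]

theorem Std.three {φ : A 3 →* A 3} {e : M 4 →* M 4} {e' : M 3 →* M 3}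
    (hφ : ∀ a, aM 3 (φ a) = e (aM 3 a)) (he : OverM 4 e)
    (hpr : ∀ a, pr 3 (φ a) = e' (pr 3 a)) (he' : OverM 3 e') : Std 3 e' := by
  obtain ⟨w, hw⟩ := exists_xA (a := φ (bA 3 (Z 3))) (by rw [hpr, pr_bA, mq_Z, map_one])
  have hcomm : ∀ b, Commute (φ (bA 3 b)) (xA 3 w) := fun b => by
    rw [← hw]
    exact (Z_comm 3 b).map (φ.comp (bA 3))
  have hpi : piA 3 (xA 3 w) = 1 :=
    eq_one_of_commute_three (h := (piA 3).comp (φ.comp (bA 3))) (fun b => by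
      rw [MonoidHom.comp_apply, MonoidHom.comp_apply, permM_piA, hpr, pr_bA, he', permM_mq])
      fun b => (hcomm b).symm.map (piA 3)
  have hne := apply_bA_Z_ne_one hpr he'
  obtain ⟨u, n, hu⟩ := A.exists_conj_z le_rfl (φ.comp (bA 3)) (w := w)
    (fun g hg => eq_one_of_fixed he' fun b => by
      obtain ⟨m, hm, h⟩ := hg b
      refine ⟨m, hm, fun b' hb' => h b' ?_⟩
      rw [hb', MonoidHom.comp_apply, hpr, pr_bA])
    (fun h => hne (by rw [hw, h, map_one])) hcomm hpi
  have hn : n ≠ 0 := by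
    rintro rfl
    exact hne (by rw [hw, hu, zpow_zero, mul_one, mul_inv_cancel, map_one])
  have hz : φ (xA 3 (z 3)) = xA 3 u * xA 3 (z 3 ^ (-n)) * (xA 3 u)⁻¹ := by
    rw [bA_Z, map_inv, inv_eq_iff_eq_inv] at hw
    rw [hw, hu, ← map_inv, ← map_inv, ← map_mul, ← map_mul]
    congr 1
    group
  obtain ⟨a, ha, hpa⟩ := exists_aM_swap 1
  rw [Z_two, map_pow, Br.incl_σ _ (by omega)] at hpa
  obtain ⟨s, hs⟩ : ∃ s, s = mq 4 (Br.σ 4 2) := ⟨_, rfl⟩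
  replace ha : aM 3 a = s⁻¹ * aM 3 (xA 3 (z 3)) * s := hs ▸ ha
  replace hpa : pr 3 a = (mq 3 (Br.σ 3 0 ^ 2))⁻¹ := hpa
  obtain ⟨p, hp⟩ : ∃ p, aM 3 p = e s * s⁻¹ := exists_aM (by
    rw [map_mul, map_inv, he, mul_inv_cancel]; rfl)
  obtain ⟨v, b, hv⟩ := A.exists_mul (p⁻¹ * xA 3 u)
  obtain ⟨c, hc⟩ : ∃ c, aM 3 c = s⁻¹ * aM 3 (xA 3 v) * s := exists_aM (by
    rw [map_mul, map_mul, permM_aM, pr_xA, map_one, map_inv, mul_one, inv_mul_cancel]; rfl)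
  have hpc : permM 3 (pr 3 c) = 1 := by
    rw [← permM_aM, hc, map_mul, map_mul, permM_aM, pr_xA, map_one, map_inv, mul_one,
      inv_mul_cancel]
  have hφa : φ a = c * a ^ (-n) * c⁻¹ := aM_injective (by omega : 0 < 3) (by
    have h1 : p⁻¹ * φ (xA 3 (z 3)) * p = xA 3 v * xA 3 (z 3) ^ (-n) * (xA 3 v)⁻¹ := by
      calc p⁻¹ * φ (xA 3 (z 3)) * p =
          (p⁻¹ * xA 3 u) * xA 3 (z 3 ^ (-n)) * (p⁻¹ * xA 3 u)⁻¹ := by rw [hz]; group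
        _ = xA 3 v * (bA 3 b * xA 3 (z 3 ^ (-n))) * (bA 3 b)⁻¹ * (xA 3 v)⁻¹ := by rw [hv]; group
        _ = xA 3 v * xA 3 (z 3) ^ (-n) * (xA 3 v)⁻¹ := by
          rw [(commute_bA_xA_z b _).eq, map_zpow]; group
    have h2 : e s = aM 3 p * s := by rw [hp, inv_mul_cancel_right]
    calc aM 3 (φ a) = s⁻¹ * aM 3 (p⁻¹ * φ (xA 3 (z 3)) * p) * s := by
          rw [hφ, ha, map_mul e, map_mul e, map_inv e, ← hφ, h2, map_mul (aM 3), map_mul (aM 3),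
            map_inv (aM 3)]
          group
      _ = (s⁻¹ * aM 3 (xA 3 v) * s) * (s⁻¹ * aM 3 (xA 3 (z 3)) * s⁻¹⁻¹) ^ (-n) *
          (s⁻¹ * aM 3 (xA 3 v) * s)⁻¹ := by
          rw [h1, conj_zpow, map_mul, map_mul, map_inv, map_zpow]
          group
      _ = aM 3 (c * a ^ (-n) * c⁻¹) := by
          rw [inv_inv, ← hc, ← ha, map_mul, map_mul, map_inv, map_zpow])
  have hσ : e' (mq 3 (Br.σ 3 0 ^ 2)) =
      pr 3 c * mq 3 (Br.σ 3 0 ^ 2) ^ (-n) * (pr 3 c)⁻¹ := by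
    have h1 := hpr a
    rw [hφa, map_mul, map_mul, map_inv, map_zpow, hpa, map_inv, inv_zpow] at h1
    rw [← inv_inj, ← h1]
    group
  obtain ⟨h, hh⟩ : ∃ h : Br 3 →* M 3, ∀ b, h b = (pr 3 c)⁻¹ * e' (mq 3 b) * pr 3 c :=
    ⟨(MulAut.conj (pr 3 c)⁻¹).toMonoidHom.comp (e'.comp (mq 3)), fun b => by simp⟩
  obtain ⟨j, hj⟩ := exists_conj_mir (h := h) (l := -n)
    (fun b => by rw [hh, map_mul, map_mul, map_inv, hpc, he', permM_mq]; simp)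
    (neg_ne_zero.mpr hn) (by
      rw [hh, hσ, zpow_mul, ← map_zpow]
      norm_cast
      group)
  have he1 : ∀ b, e' (mq 3 b) = pr 3 c * h b * (pr 3 c)⁻¹ := fun b => by rw [hh]; group
  refine ⟨pr 3 c * mq 3 (Br.σ 3 0 ^ (2 * j)), hj.imp (fun hj m => ?_) fun hj m => ?_⟩
  all_goals
    obtain ⟨b, rfl⟩ := mq_surjective 3 m
    rw [he1, hj, map_mul, map_mul, map_inv]
  · group
  · rw [mirM_mq]; group

theorem std {m : ℕ} (hm : 3 ≤ m) {e : M (m + 1) →* M (m + 1)} (he : OverM (m + 1) e)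
    (hg : Good m (e.comp (mq (m + 1)))) : Std (m + 1) e := by
  induction m, hm using Nat.le_induction with
  | base =>
    obtain ⟨φ, e', hφ, hpr, he', -⟩ := he.exists_down (by omega) hg
    exact Std.succ le_rfl hφ he hpr (.three hφ he hpr he')
  | succ m hm ih =>
    obtain ⟨φ, e', hφ, hpr, he', hd⟩ := he.exists_down (by omega) hg
    refine Std.succ (by omega) hφ he hpr (ih he' ?_)
    rcases Nat.lt_or_ge m 4 with h | h
    · obtain rfl : m = 3 := by omega
      exact Good.base he.over hd
    · exact he'.over.good h

end BraidB

namespace BraidB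

open Multiplicative

theorem act_iota_z_top (m : ℕ) : act (m + 2) (iota (m + 1) (xE (m + 1) (z (m + 1)))) (X (m + 2) (m + 1)) =
    (z (m + 2))⁻¹ * X (m + 2) (m + 1) * z (m + 2) := by
  have h := act_Z (m + 2) (X (m + 2) (m + 1))
  rw [← iota_zZ (Nat.succ_pos m), zZ, map_mul, iota_bE, map_mul, MulAut.mul_apply,
    act_incl_top] at h
  exact h

theorem eq_zero_or_of_commute_swapA {m : ℕ} {j : ℤ}
    (h : Commute (swapA m ^ j) (xA (m + 2) (z (m + 2) ^ j * X (m + 2) (m + 1)))) :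
    j = 0 ∨ j = -1 := by
  obtain ⟨x, hx⟩ : ∃ x, x = X (m + 2) (m + 1) := ⟨_, rfl⟩
  obtain ⟨t, ht⟩ : ∃ t, t = z (m + 2) := ⟨_, rfl⟩
  obtain ⟨b, hb⟩ : ∃ b, b = iota (m + 1) (xE (m + 1) (z (m + 1))) := ⟨_, rfl⟩
  have hbx := act_iota_z_top m
  have hbt := act_z (m + 2) b
  have hs : swapA m = bA (m + 2) b * xA (m + 2) x := by rw [hb, hx]; rfl
  rw [← hb, ← hx, ← ht] at hbx
  rw [← ht] at hbt
  rw [← hx, ← ht] at h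
  obtain ⟨β, hβ⟩ : ∃ β, swapA m = xA (m + 2) (t⁻¹ * x) * β :=
    ⟨(xA (m + 2) (t⁻¹ * x))⁻¹ * swapA m, by group⟩
  have hconj : ∀ w, act (m + 2) b (x * w * x⁻¹) = t⁻¹ * x * w * (t⁻¹ * x)⁻¹ →
      Commute β (xA (m + 2) w) := fun w hw => by
    have h1 := xA_act b (x * w * x⁻¹)
    have h2 : bA (m + 2) b = xA (m + 2) (t⁻¹ * x) * β * (xA (m + 2) x)⁻¹ := by rw [← hβ, hs]; group
    rw [hw, h2] at h1
    simp only [map_mul, map_inv] at h1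
    have h3 : β * xA (m + 2) w * β⁻¹ = xA (m + 2) w := by
      refine mul_left_cancel (a := (xA (m + 2) t)⁻¹ * xA (m + 2) x)
        (mul_right_cancel (b := ((xA (m + 2) t)⁻¹ * xA (m + 2) x)⁻¹) ?_)
      rw [h1]; group
    exact mul_inv_eq_iff_eq_mul.mp h3
  have hcx : Commute β (xA (m + 2) x) := hconj x (by
    rw [mul_inv_cancel_right, hbx]; group)
  have hct : Commute β (xA (m + 2) t) := hconj t (by
    rw [map_mul, map_mul, map_inv, hbx, hbt]; group)
  have hcj : Commute β (xA (m + 2) (t ^ j * x)) := by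
    rw [map_mul, map_zpow]
    exact (hct.zpow_right j).mul_right hcx
  have hcc : Commute β (xA (m + 2) (t⁻¹ * x)) := by
    rw [map_mul, map_inv]
    exact hct.inv_right.mul_right hcx
  by_contra hj
  rw [not_or] at hj
  rw [hβ, (hcc.symm).mul_zpow, ← map_zpow] at h
  have h1 : Commute (xA (m + 2) ((t⁻¹ * x) ^ j)) (xA (m + 2) (t ^ j * x)) := by
    have := h.mul_left (hcj.zpow_left j).inv_left
    rwa [mul_inv_cancel_right] at this
  have h2 : Commute ((t⁻¹ * x) ^ j) (t ^ j * x) := xA_injective (by omega) (by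
    rw [map_mul, map_mul _ (t ^ j * x), h1.eq])
  have h3 : Commute (t ^ j * x) (t⁻¹ * x) := (commute_of_zpow hj.1 h2).symm
  have h4 : Commute (t⁻¹ * x) (t ^ (j + 1)) := by
    have := h3.symm.mul_right (Commute.refl (t⁻¹ * x)).inv_right
    have e : t ^ j * x * (t⁻¹ * x)⁻¹ = t ^ (j + 1) := by group
    rwa [e] at this
  rw [ht] at h4
  obtain ⟨i, hi⟩ := commute_z (by omega) h4
  have e1 := congrArg (expo (m + 2) (m + 1)) hi
  have e2 := congrArg (expo (m + 2) 0) hi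
  rw [map_mul, map_inv, map_zpow, expo_z (by omega), hx, expo_X_self (by omega)] at e1
  rw [map_mul, map_inv, map_zpow, expo_z (by omega), hx, expo_X_ne (by omega)] at e2
  rw [← e1] at e2
  simp at e2

variable {k : ℕ}

theorem mq_eq_one_of_commute (hk : 4 ≤ k) {g : M k} (h : ∀ b, Commute g (mq k b)) : g = 1 := by
  have ho : Over k (mq k) := fun b => permM_mq b
  rcases Nat.lt_or_ge 4 k with h5 | h4
  · exact ho.centralizer h5 h
  · obtain rfl : k = 4 := by omega
    exact Good.centralizer_four ho (fun w => Forget.iota_xE w) h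

theorem perm_apply_of_commute (hk : 2 ≤ k) {π : Equiv.Perm ℕ} (hπ : ∀ j, k + 1 ≤ j → π j = j)
    (h : ∀ i, i + 1 < k → Commute π (Equiv.swap i (i + 1))) : π k = k := by
  by_contra hne
  have hlt : π k < k := by
    by_contra hge
    have := hπ (π k) (by omega)
    exact hne (π.injective this)
  have h1 : ∀ i, i + 1 < k → Equiv.swap i (i + 1) (π k) = π k := fun i hi => by
    have := DFunLike.congr_fun (h i hi) k
    rw [Equiv.Perm.mul_apply, Equiv.Perm.mul_apply,
      Equiv.swap_apply_of_ne_of_ne (by omega) (by omega)] at this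
    exact this.symm
  by_cases hj : π k + 1 < k
  · have := h1 _ hj
    rw [Equiv.swap_apply_left] at this
    omega
  · obtain ⟨i, hi⟩ : ∃ i, π k = i + 1 := ⟨π k - 1, by omega⟩
    have := h1 i (by omega)
    rw [hi, Equiv.swap_apply_right] at this
    omega

theorem exists_xA_z_of_commute (hk : 4 ≤ k) {v : M (k + 1)}
    (h : ∀ i, i + 1 < k → Commute v (mq (k + 1) (Br.σ (k + 1) i))) :
    ∃ j : ℤ, v = aM k (xA k (z k ^ j)) := by
  obtain ⟨a, rfl⟩ := exists_aM (perm_apply_of_commute (by omega) (π := permM (k + 1) v)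
    (fun j hj => permM_apply_of_le v hj) fun i hi => by
      have := (h i hi).map (permM (k + 1))
      rwa [permM_mq, Br.perm_σ (by omega)] at this)
  have ha : ∀ b, Commute a (bA k b) := by
    have : (MulAut.conj a).toMonoidHom.comp (bA k) = bA k := Br.hom_ext fun i hi => by
      refine aM_injective (by omega) ?_
      have h1 := (h i hi).eq
      simp only [MonoidHom.comp_apply, MulEquiv.coe_toMonoidHom, MulAut.conj_apply, map_mul,
        map_inv, aM_bA, Br.incl_σ _ hi]
      rw [h1, mul_inv_cancel_right]
    intro b
    have h1 := DFunLike.congr_fun this b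
    simp only [MonoidHom.comp_apply, MulEquiv.coe_toMonoidHom, MulAut.conj_apply] at h1
    exact mul_inv_eq_iff_eq_mul.mp h1
  obtain ⟨w, rfl⟩ := exists_xA (mq_eq_one_of_commute hk fun b => by
    have := (ha b).map (pr k)
    rwa [pr_bA] at this)
  have hw : Commute w (z k ^ (-1 : ℤ)) := xA_injective (by omega) (by
    rw [zpow_neg_one, map_mul, map_mul _ _ w, map_inv, ← bA_Z]
    exact (ha _).eq)
  obtain ⟨j, rfl⟩ := commute_z (by omega) hw
  exact ⟨j, rfl⟩

theorem top_image {m : ℕ} (hm : 2 ≤ m) {q : A (m + 3) →* M (m + 3)}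
    (hq : ∀ b, q (bA (m + 3) b) = mq (m + 3) b) : q (xA (m + 3) (X (m + 3) (m + 2))) = 1 ∨
      q (xA (m + 3) (X (m + 3) (m + 2))) = mq (m + 3) (Br.incl (Nat.le_succ _) (Z (m + 2))) := by
  have hA := (E.isAnnular (m + 3)).map (q.comp (aq (m + 3)))
  simp only [MonoidHom.comp_apply, aq_bE, aq_xE, hq] at hA
  obtain ⟨v, hv⟩ : ∃ v, v = q (xA (m + 3) (X (m + 3) (m + 2))) := ⟨_, rfl⟩
  have hA' : IsAnnular (m + 3) (fun i => mq (m + 3) (Br.σ (m + 3) i)) v := by rw [hv]; exact hA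
  rw [← hv]
  obtain ⟨j, hj⟩ := exists_xA_z_of_commute (k := m + 2) (by omega)
    fun i hi => (hA'.comm i (by omega)).symm
  have hs := aM_swapA m
  have ht : aM (m + 2) (xA (m + 2) (X (m + 2) (m + 1))) =
      mq (m + 3) (Br.σ (m + 3) (m + 1)) ^ 2 := aM_top (Nat.succ_pos _)
  have hquad := hA'.quad (m + 1) rfl
  have hc : Commute (swapA m ^ j) (xA (m + 2) (z (m + 2) ^ j * X (m + 2) (m + 1))) := by
    obtain ⟨s, hsd⟩ : ∃ s, s = mq (m + 3) (Br.σ (m + 3) (m + 1)) := ⟨_, rfl⟩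
    simp only [← hsd] at hquad ht hs
    have h1 : aM (m + 2) (swapA m ^ j) = s⁻¹ * v * s := by
      have := conj_zpow (i := j) (a := s⁻¹) (b := aM (m + 2) (xA (m + 2) (z (m + 2))))
      rw [inv_inv] at this
      rw [map_zpow, hs, this, hj, map_zpow, map_zpow]
    have h2 : aM (m + 2) (xA (m + 2) (z (m + 2) ^ j * X (m + 2) (m + 1))) = v * (s * s) := by
      rw [map_mul, map_mul, ht, ← hj, pow_two]
    refine aM_injective (by omega) ?_
    rw [map_mul, map_mul _ (xA (m + 2) (z (m + 2) ^ j * X (m + 2) (m + 1))), h1, h2]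
    calc s⁻¹ * v * s * (v * (s * s)) = s⁻¹ * (v * s * v * s) * s := by group
      _ = s⁻¹ * (s * v * s * v) * s := by rw [hquad]
      _ = v * (s * s) * (s⁻¹ * v * s) := by group
  rcases eq_zero_or_of_commute_swapA hc with rfl | rfl
  · left; rw [hj]; simp
  · right; rw [hj, zpow_neg_one, map_inv, ← bA_Z, aM_bA]

end BraidB

namespace BraidB

open Multiplicative

variable {k r : ℕ}

theorem Br.len_incl {l : ℕ} (h : k ≤ l) (b : Br k) : Br.len l (Br.incl h b) = Br.len k b := by
  have : (Br.len l).comp (Br.incl h) = Br.len k := Br.hom_ext fun i hi => by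
    rw [MonoidHom.comp_apply, Br.incl_σ h hi, Br.len_σ (by omega), Br.len_σ hi]
  exact DFunLike.congr_fun this b

theorem expo_qz {j : ℕ} (hj : j < r) (w : F (r + 1)) :
    expo r j (qz r w) * expo (r + 1) r w = expo (r + 1) j w := by
  refine F.induction w ?_ ?_ ?_ ?_
  · simp
  · intro u v hu hv
    simp only [map_mul, ← hu, ← hv]
    exact mul_mul_mul_comm _ _ _ _
  · intro u hu
    rw [map_inv, map_inv, map_inv, map_inv, ← hu, mul_inv]
  · intro i hi
    rcases Nat.lt_succ_iff_lt_or_eq.mp hi with hi | rfl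
    · rw [qz_X hi, expo_X_ne (j := i) (i := r) (by omega), mul_one]
      rcases eq_or_ne i j with rfl | hij
      · rw [expo_X_self hi, expo_X_self (by omega)]
      · rw [expo_X_ne hij, expo_X_ne hij]
    · rw [qz_top, map_inv, expo_z hj, expo_X_self (by omega), expo_X_ne (by omega),
        inv_mul_cancel]

theorem tot_of_qz_eq_one {w : F (r + 1)} (h : qz r w = 1) :
    tot (r + 1) w = expo (r + 1) r w ^ (r + 1) := by
  rw [tot_eq_prod, Finset.prod_congr rfl (g := fun _ => expo (r + 1) r w), Finset.prod_const,
    Finset.card_range]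
  intro j hj
  rcases Nat.lt_succ_iff_lt_or_eq.mp (Finset.mem_range.mp hj) with hj | rfl
  · rw [← expo_qz hj, h, map_one, one_mul]
  · rfl

/-- The length character rules out that both projections of the image of the annular
generator are nontrivial. -/
theorem not_pr_piA_top (hr : 2 ≤ r) {φ : A (r + 1) →* A (r + 1)} {a : ℤ}
    (hφ : ∀ b, φ (bA (r + 1) b) =
      bA (r + 1) b * xA (r + 1) (z (r + 1) ^ (a * toAdd (Br.len (r + 1) b))))
    (hpr : pr (r + 1) (φ (xA (r + 1) (X (r + 1) r))) =
      mq (r + 1) (Br.incl (Nat.le_succ r) (Z r))) :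
    piA (r + 1) (φ (xA (r + 1) (X (r + 1) r))) ≠ mq (r + 1) (Br.incl (Nat.le_succ r) (Z r)) := by
  intro hpi
  obtain ⟨y, hy⟩ := exists_bA_mul_xA hpr
  rw [hy, map_mul, piA_bA, mul_eq_left] at hpi
  have hty := tot_of_qz_eq_one (qz_eq_one_of_piA hr hpi)
  have hconj : ∀ j < r + 1, chi (r + 1) (φ (xA (r + 1) (X (r + 1) j))) =
      chi (r + 1) (φ (xA (r + 1) (X (r + 1) r))) := by
    refine down_induction (k := r + 1)
      (p := fun j => chi (r + 1) (φ (xA (r + 1) (X (r + 1) j))) =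
        chi (r + 1) (φ (xA (r + 1) (X (r + 1) r)))) rfl ?_
    intro i hi h
    rw [← h, ← act_σ_succ hi, xA_act, map_mul, map_mul, map_inv, map_mul, map_mul, map_inv,
      mul_right_comm, mul_inv_cancel, one_mul]
  have h1 := map_z (f := (chi (r + 1)).comp (φ.comp (xA (r + 1)))) hconj
  have hz : φ (xA (r + 1) (z (r + 1))) =
      xA (r + 1) (z (r + 1) ^ (1 - a * ((r + 1) * r))) := by
    have h1 := congrArg φ (bA_Z (r + 1))
    rw [hφ, map_inv, bA_Z, Br.len_Z (by omega), toAdd_ofAdd, map_zpow, eq_comm,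
      inv_eq_iff_eq_inv] at h1
    rw [h1, map_zpow, mul_inv_rev, inv_inv, ← zpow_neg, ← zpow_add_one]
    congr 1; push_cast; ring
  rw [MonoidHom.comp_apply, MonoidHom.comp_apply, hz, hy, map_mul, chi_bA, chi_xA, chi_xA,
    Br.len_incl, Br.len_Z (by omega), hty, map_zpow, map_z fun j hj => tot_X hj] at h1
  obtain ⟨l, hl⟩ : ∃ l : ℤ, l = toAdd (expo (r + 1) r y) := ⟨_, rfl⟩
  have h2 := congrArg toAdd h1
  simp only [toAdd_zpow, toAdd_mul, toAdd_pow, toAdd_ofAdd, nsmul_eq_mul, smul_eq_mul, ← hl] at h2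
  push_cast at h2
  have hne : ((r : ℤ) + 1) * r ≠ 0 := mul_ne_zero (by omega) (by omega)
  have h3 : ((r : ℤ) + 1) * (l + a * r) = r := mul_left_cancel₀ hne (by linarith)
  have h4 := Int.le_of_dvd (by omega) (Dvd.intro _ h3)
  omega

theorem surjective_of_conj {G : Type*} [Group G] {φ : G →* G} {c : G}
    (h : ∀ a, φ a = c * a * c⁻¹) : Function.Surjective φ := fun a =>
  ⟨c⁻¹ * a * c, by rw [h]; group⟩

theorem surjective_of_twist {m : ℕ} (hm : 2 ≤ m) {φ : A (m + 3) →* A (m + 3)} {a : ℤ}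
    (hφ : ∀ b, φ (bA (m + 3) b) =
      bA (m + 3) b * xA (m + 3) (z (m + 3) ^ (a * toAdd (Br.len (m + 3) b)))) :
    Function.Surjective φ := by
  have hprb : ∀ b, pr (m + 3) (φ (bA (m + 3) b)) = mq (m + 3) b := fun b => by
    rw [hφ, map_mul, pr_bA, pr_xA, mul_one]
  have hpib : ∀ b, piA (m + 3) (φ (bA (m + 3) b)) = mq (m + 3) b := fun b => by
    rw [hφ, map_mul, piA_bA, map_zpow, map_zpow, piA_z, one_zpow, mul_one]
  have htop : piA (m + 3) (xA (m + 3) (X (m + 3) (m + 2))) =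
      mq (m + 3) (Br.incl (Nat.le_succ _) (Z (m + 2))) := piA_top (by omega)
  rcases top_image hm (q := (pr (m + 3)).comp φ) hprb with h1 | h1 <;>
    rw [MonoidHom.comp_apply] at h1
  · have h : (pr (m + 3)).comp φ = pr (m + 3) := A.hom_ext
      (fun i _ => by rw [MonoidHom.comp_apply, hprb, pr_bA])
      (fun _ => by rw [MonoidHom.comp_apply, pr_xA]; exact h1)
    obtain ⟨c, hc⟩ := A.exists_conj_of_pr (by omega) (DFunLike.congr_fun h)
      (by rw [hpib, mq_Z])
    exact surjective_of_conj hc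
  rcases top_image hm (q := (piA (m + 3)).comp φ) hpib with h2 | h2 <;>
    rw [MonoidHom.comp_apply] at h2
  · have h : (pr (m + 3)).comp φ = piA (m + 3) := A.hom_ext
      (fun i _ => by rw [MonoidHom.comp_apply, hprb, piA_bA])
      (fun _ => by rw [MonoidHom.comp_apply]; exact h1.trans htop.symm)
    have h' : (piA (m + 3)).comp φ = pr (m + 3) := A.hom_ext
      (fun i _ => by rw [MonoidHom.comp_apply, hpib, pr_bA])
      (fun _ => by rw [MonoidHom.comp_apply, pr_xA]; exact h2)
    have e := DFunLike.congr_fun h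
    have e' := DFunLike.congr_fun h'
    simp only [MonoidHom.comp_apply] at e e'
    obtain ⟨c, hc⟩ := A.exists_conj_of_pr (φ := φ.comp φ) (by omega)
      (fun a => by rw [MonoidHom.comp_apply, e, e'])
      (by rw [MonoidHom.comp_apply, e', hprb, mq_Z])
    exact Function.Surjective.of_comp (g := φ) (surjective_of_conj hc)
  · exact absurd h2 (not_pr_piA_top (by omega) hφ h1)

theorem conj_comp_surjective {G H : Type*} [Group G] [Group H] {φ : G →* H} (c : H)
    (h : Function.Surjective ((MulAut.conj c).toMonoidHom.comp φ)) : Function.Surjective φ :=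
  (Function.Surjective.of_comp_iff' (MulAut.conj c).bijective φ).mp h

theorem surjective_of_pr_bA (hk : 5 ≤ k) {φ : A k →* A k}
    (hφ : ∀ b, pr k (φ (bA k b)) = mq k b) : Function.Surjective φ := by
  obtain ⟨m, rfl⟩ : ∃ m, k = m + 3 := ⟨k - 3, by omega⟩
  have ho : Over (m + 3) ((piA (m + 3)).comp (φ.comp (bA (m + 3)))) := fun b => by
    rw [MonoidHom.comp_apply, MonoidHom.comp_apply, permM_piA, hφ, permM_mq]
  have hZ : piA (m + 3) (φ (bA (m + 3) (Z (m + 3)))) = 1 := ho.centralizer hk fun b =>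
    (Z_comm _ b).symm.map _
  obtain ⟨u, a, hu⟩ := A.exists_twist (by omega) (φ.comp (bA (m + 3))) hφ hZ
  refine conj_comp_surjective (xA (m + 3) u)⁻¹ (surjective_of_twist (by omega) (a := a) fun b => ?_)
  have := hu b
  rw [MonoidHom.comp_apply] at this
  rw [MonoidHom.comp_apply, this, MulEquiv.coe_toMonoidHom, MulAut.conj_apply]
  group

theorem surjective_of_perm (hk : 5 ≤ k) {φ : A k →* A k}
    (hφ : ∀ a, permM k (pr k (φ a)) = permM k (pr k a)) : Function.Surjective φ := by
  obtain ⟨H, hH⟩ : ∃ H, H = (pr k).comp (φ.comp (bA k)) := ⟨_, rfl⟩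
  have hHa : ∀ b, H b = pr k (φ (bA k b)) := fun b => by rw [hH]; rfl
  have ho : Over k H := fun b => by rw [hHa, hφ, pr_bA, permM_mq]
  have hZ : H (Z k) = 1 := ho.centralizer hk fun b => (Z_comm _ b).symm.map _
  obtain ⟨e, he⟩ : ∃ e : M k →* M k, ∀ b, e (mq k b) = H b := ⟨M.lift H hZ, M.lift_mq H hZ⟩
  have heo : OverM k e := fun x => by
    obtain ⟨b, rfl⟩ := mq_surjective k x
    rw [he, ho, permM_mq]
  obtain ⟨m, rfl⟩ : ∃ m, k = m + 1 := ⟨k - 1, by omega⟩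
  obtain ⟨g, hg⟩ := std (by omega) heo (Over.good (by omega) heo.over)
  obtain ⟨b, rfl⟩ := mq_surjective (m + 1) g
  have hc : ∀ a, pr (m + 1) (MulAut.conj (bA (m + 1) b)⁻¹ a) =
      (mq (m + 1) b)⁻¹ * pr (m + 1) a * mq (m + 1) b := fun a => by
    rw [MulAut.conj_apply, map_mul, map_mul, inv_inv, map_inv, pr_bA]
  rcases hg with hg | hg
  · refine conj_comp_surjective (bA (m + 1) b)⁻¹ (surjective_of_pr_bA hk fun b' => ?_)
    rw [MonoidHom.comp_apply, MulEquiv.coe_toMonoidHom, hc, ← hHa, ← he, hg]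
    group
  · have hs : Function.Surjective ((mirA (m + 1)).comp
        ((MulAut.conj (bA (m + 1) b)⁻¹).toMonoidHom.comp φ)) :=
      surjective_of_pr_bA hk fun b' => by
        rw [MonoidHom.comp_apply, MonoidHom.comp_apply, MulEquiv.coe_toMonoidHom,
          pr_mirA, hc, ← hHa, ← he, hg]
        have : (mq (m + 1) b)⁻¹ * (mq (m + 1) b * mirM (m + 1) (mq (m + 1) b') *
            (mq (m + 1) b)⁻¹) * mq (m + 1) b = mirM (m + 1) (mq (m + 1) b') := by group
        rw [this, mirM_mirM]
    have hm : Function.Bijective (mirA (m + 1)) :=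
      Function.Involutive.bijective mirA_mirA
    exact conj_comp_surjective _ ((Function.Surjective.of_comp_iff' hm _).mp hs)

theorem A.surjective_of_injective (hk : 5 ≤ k) {φ : A k →* A k} (hφ : Function.Injective φ) :
    Function.Surjective φ := by
  obtain ⟨m, hm, h⟩ := exists_pow_perm hk hφ
  obtain ⟨m, rfl⟩ : ∃ l, m = l + 1 := ⟨m - 1, by omega⟩
  have hpow : ∀ n, ∃ ψ : A k →* A k, ∀ a, ψ a = φ^[n] a := fun n => by
    induction n with
    | zero => exact ⟨MonoidHom.id _, fun _ => rfl⟩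
    | succ n ih =>
      obtain ⟨ψ, hψ⟩ := ih
      exact ⟨φ.comp ψ, fun a => by rw [Function.iterate_succ_apply', MonoidHom.comp_apply, hψ]⟩
  obtain ⟨ψ, hψ⟩ := hpow (m + 1)
  have hs := surjective_of_perm hk (φ := ψ) fun a => by rw [hψ, h]
  intro a
  obtain ⟨x, hx⟩ := hs a
  rw [hψ, Function.iterate_succ_apply'] at hx
  exact ⟨_, hx⟩

end BraidB

/-- `Ā = A[Bₙ]/Z(A[Bₙ])` is Hopfian and co-Hopfian for `n ≥ 5`. -/
theorem quotient_hopfian_coHopfian (n : ℕ) (hn : 5 ≤ n) :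
    (∀ φ : AbarB n →* AbarB n, Function.Surjective φ → Function.Injective φ) ∧
    (∀ φ : AbarB n →* AbarB n, Function.Injective φ → Function.Surjective φ) :=
  BraidB.hopfian_coHopfian_of (by omega) fun _ hφ => BraidB.A.surjective_of_injective hn hφ
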